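/- Let H be a connected planar graph, let ε > 0 be a real number, and let g : ℕ → ℕ be a function with g(n) = Ω(n^{1+ε}) (i.e. there exist c > 0 and N such that g(n) ≥ c · n^{1+ε} for all n ≥ N). Then there is a constant C > 0 such that for every integer k > 0 and every graph G with tw(G) < g(k) and pack_H(G) < k, we have cover_H(G) ≤ C · g(k). -/

import Mathlib

open SimpleGraph

/-- A minor model of `H` in `G`: pairwise disjoint branch sets `B v ⊆ V(G)`, each
inducing a connected (hence nonempty) subgraph of `G`, such that for every edge
`{u,v}` of `H` there is an edge of `G` between `B u` and `B v`. -/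
def IsMinorModel {β α : Type*} (H : SimpleGraph β) (G : SimpleGraph α)
    (B : β → Set α) : Prop :=
  (∀ u, (G.induce (B u)).Connected) ∧
  (Pairwise fun u v => Disjoint (B u) (B v)) ∧
  (∀ u v, H.Adj u v → ∃ a ∈ B u, ∃ b ∈ B v, G.Adj a b)

/-- `H` is a minor of `G`. -/
def IsMinor {β α : Type*} (H : SimpleGraph β) (G : SimpleGraph α) : Prop :=
  ∃ B : β → Set α, IsMinorModel H G B

/-- `G` contains `k` models of `H` whose vertex sets are pairwise disjoint
(equivalently, the disjoint union of `k` copies of `H` is a minor of `G`). -/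
def HasDisjointModels {β α : Type*} (H : SimpleGraph β) (G : SimpleGraph α) (k : ℕ) : Prop :=
  ∃ M : Fin k → β → Set α, (∀ i, IsMinorModel H G (M i)) ∧
    Pairwise fun i j => Disjoint (⋃ u, M i u) (⋃ u, M j u)

/-- `pack_H(G)`: the maximum number of pairwise disjoint models of `H` in `G`. -/
noncomputable def packNumber {β α : Type*} (H : SimpleGraph β) (G : SimpleGraph α) : ℕ :=
  sSup {k | HasDisjointModels H G k}

/-- `S` meets every model of `H` in `G`. -/
def IsHittingSet {β α : Type*} (H : SimpleGraph β) (G : SimpleGraph α) (S : Set α) : Prop :=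
  ∀ B : β → Set α, IsMinorModel H G B → ∃ a ∈ S, ∃ u, a ∈ B u

/-- `cover_H(G)`: the minimum size of a set of vertices meeting every model of `H` in `G`. -/
noncomputable def coverNumber {β α : Type*} (H : SimpleGraph β) (G : SimpleGraph α) : ℕ :=
  sInf {n | ∃ S : Set α, IsHittingSet H G S ∧ S.ncard = n}

/-- A tree/path decomposition of `G` with underlying graph `T` and bags `X`. -/
def IsTreeDecomp {α ι : Type*} (G : SimpleGraph α) (T : SimpleGraph ι) (X : ι → Set α) : Prop :=
  (∀ v, ∃ t, v ∈ X t) ∧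
  (∀ u v, G.Adj u v → ∃ t, u ∈ X t ∧ v ∈ X t) ∧
  (∀ v, (T.induce {t | v ∈ X t}).Connected)

/-- The treewidth of `G`: the minimum width of a tree decomposition of `G`. -/
noncomputable def treewidth {α : Type*} (G : SimpleGraph α) : ℕ :=
  sInf {w | ∃ (ι : Type) (T : SimpleGraph ι) (X : ι → Set α),
    T.IsTree ∧ IsTreeDecomp G T X ∧ ∀ t, (X t).ncard ≤ w + 1}

/-- The pathwidth of `G`: the minimum width of a tree decomposition whose
underlying tree is a path. -/
noncomputable def pathwidth {α : Type*} (G : SimpleGraph α) : ℕ :=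
  sInf {w | ∃ (n : ℕ) (X : Fin (n+1) → Set α),
    IsTreeDecomp G (pathGraph (n+1)) X ∧ ∀ t, (X t).ncard ≤ w + 1}

/-- The degeneracy of `G`: the maximum over all (nonempty) subgraphs of `G`
of the minimum degree. -/
noncomputable def degeneracy {α : Type*} (G : SimpleGraph α) : ℕ :=
  sSup {d | ∃ G' : G.Subgraph, G'.verts.Nonempty ∧ ∀ v ∈ G'.verts, d ≤ (G'.neighborSet v).ncard}

/-- The contraction degeneracy of `G`: the maximum over all (nonempty) minors of `G`
of the minimum degree. -/
noncomputable def contractionDegeneracy {α : Type*} (G : SimpleGraph α) : ℕ :=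
  sSup {d | ∃ (n : ℕ) (H : SimpleGraph (Fin n)), 0 < n ∧ IsMinor H G ∧
    ∀ v, d ≤ (H.neighborSet v).ncard}


/-- `X` and `Y` are externally `q`-connected within the vertex set `W` of `G`:
for all disjoint `X' ⊆ X`, `Y' ⊆ Y` with `|X'| = |Y'| ≤ q` there are `|X'|`
pairwise disjoint `X'`–`Y'` paths (inside `W`) having no internal vertices and
no edges in `G[X ∪ Y]`. -/
def ExternallyConnectedIn {α : Type*} (G : SimpleGraph α) (W X Y : Set α) (q : ℕ) : Prop :=
  ∀ X' Y' : Finset α, ↑X' ⊆ X → ↑Y' ⊆ Y → Disjoint (X' : Set α) (Y' : Set α) →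
    X'.card = Y'.card → X'.card ≤ q →
    ∃ p : (x : X') → Σ y : Y', G.Walk x.1 y.1,
      (∀ x, (p x).2.IsPath) ∧
      (∀ x, ∀ v ∈ (p x).2.support, v ∈ W) ∧
      (Pairwise fun x₁ x₂ => ∀ v, v ∈ (p x₁).2.support → v ∉ (p x₂).2.support) ∧
      (∀ x, ∀ v ∈ (p x).2.support.tail.dropLast, v ∉ X ∪ Y) ∧
      (∀ x, ∀ u v : α, s(u, v) ∈ (p x).2.edges → ¬(u ∈ X ∪ Y ∧ v ∈ X ∪ Y))

/-- `(A, B)` is a `q`-mesh of order `s` in `G`. -/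
def IsMesh {α : Type*} (G : SimpleGraph α) (A B : Set α) (q s : ℕ) : Prop :=
  A ∪ B = Set.univ ∧
  ∃ T : G.Subgraph, T.verts ⊆ A ∧ T.coe.IsTree ∧
    (∀ v ∈ T.verts, (T.neighborSet v).ncard ≤ 3) ∧
    A ∩ B ⊆ T.verts ∧
    (∀ v ∈ A ∩ B, (T.neighborSet v).ncard ≤ 2) ∧
    (∃ v ∈ A ∩ B, (T.neighborSet v).ncard = 1) ∧
    (A ∩ B).ncard = s ∧
    ExternallyConnectedIn G B (A ∩ B) (A ∩ B) q

/-- The graph `Ξ_r`, with vertices `x_i = (0,i)`, `y_i = (1,i)`, `z_i = (2,i)`. -/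
def Xi (r : ℕ) : SimpleGraph (Fin 3 × Fin r) :=
  SimpleGraph.fromRel (fun a b =>
    (a.1 = 0 ∧ b.1 = 0 ∧ (b.2 : ℕ) = (a.2 : ℕ) + 1) ∨
    (a.1 = 2 ∧ b.1 = 2 ∧ (b.2 : ℕ) = (a.2 : ℕ) + 1) ∨
    (a.1 = 1 ∧ a.2 = b.2 ∧ (b.1 = 0 ∨ b.1 = 2)))

/-- The underlying simple bipartite graph of the bipartite multigraph with
parts `α`, `β` and multiplicity function `m`. -/
def bipMulti {α β : Type*} (m : α → β → ℕ) : SimpleGraph (α ⊕ β) :=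
  SimpleGraph.fromRel (fun x y => match x, y with
    | Sum.inl v, Sum.inr u => 1 ≤ m v u
    | _, _ => False)

/-- `S` is nonempty and induces a connected subgraph of `G`, phrased through cuts. -/
def Conn {V : Type*} (G : SimpleGraph V) (S : Set V) : Prop :=
  S.Nonempty ∧ ∀ T : Set V, (S ∩ T).Nonempty →
    (∀ a ∈ S, a ∈ T → ∀ b ∈ S, G.Adj a b → b ∈ T) → S ⊆ T

section Conn

variable {V : Type*} {G : SimpleGraph V} {S T : Set V}

theorem conn_iff : (G.induce S).Connected ↔ Conn G S := by
  constructor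
  · intro h
    refine ⟨by obtain ⟨x⟩ := h.nonempty; exact ⟨x.1, x.2⟩, ?_⟩
    rintro T ⟨a, ha, haT⟩ hT b hb
    obtain ⟨w⟩ := h.preconnected ⟨a, ha⟩ ⟨b, hb⟩
    have key : ∀ (x y : S) (w : (G.induce S).Walk x y), x.1 ∈ T → y.1 ∈ T := by
      intro x y w
      induction w with
      | nil => exact id
      | cons hadj _ ih => intro hx; exact ih (hT _ (Subtype.coe_prop _) hx _ (Subtype.coe_prop _) hadj)
    exact key _ _ w haT
  · rintro ⟨⟨a, ha⟩, h⟩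
    have : Nonempty S := ⟨⟨a, ha⟩⟩
    refine ⟨fun x y => ?_⟩
    have := h {b | ∃ hb : b ∈ S, (G.induce S).Reachable x ⟨b, hb⟩} ⟨x.1, x.2, x.2, Reachable.refl _⟩
      (by
        rintro a ha ⟨_, hxa⟩ b hb hab
        exact ⟨hb, hxa.trans (SimpleGraph.Adj.reachable (by simpa using hab))⟩) y.2
    obtain ⟨_, hy⟩ := this
    exact hy

theorem Conn.nonempty (h : Conn G S) : S.Nonempty := h.1

theorem Conn.singleton (a : V) : Conn G {a} :=
  ⟨⟨a, rfl⟩, by rintro T ⟨b, hb, hbT⟩ _ c hc; cases hb; cases hc; exact hbT⟩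

theorem Conn.mono {G' : SimpleGraph V} (h : Conn G S) (hG : ∀ a ∈ S, ∀ b ∈ S, G.Adj a b → G'.Adj a b) :
    Conn G' S :=
  ⟨h.1, fun T h1 h2 => h.2 T h1 fun a ha haT b hb hab => h2 a ha haT b hb (hG a ha b hb hab)⟩

theorem Conn.mono_le {G' : SimpleGraph V} (h : Conn G S) (hG : G ≤ G') : Conn G' S :=
  h.mono fun _ _ _ _ hab => hG hab

/-- A connected set with connected sets attached to it. -/
theorem Conn.union_iUnion {ι : Type*} (hS : Conn G S) {T : ι → Set V} (hT : ∀ i, Conn G (T i))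
    (h : ∀ i, (∃ a ∈ S, a ∈ T i) ∨ ∃ a ∈ S, ∃ b ∈ T i, G.Adj a b) : Conn G (S ∪ ⋃ i, T i) := by
  refine ⟨hS.1.inl, fun U hU hcl => ?_⟩
  have hSU : (S ∩ U).Nonempty → S ⊆ U := fun h1 => hS.2 U h1
    fun a ha haU b hb hab => hcl a (Or.inl ha) haU b (Or.inl hb) hab
  have hTU : ∀ i, (T i ∩ U).Nonempty → T i ⊆ U := fun i h1 => (hT i).2 U h1
    fun a ha haU b hb hab => hcl a (Or.inr (Set.mem_iUnion_of_mem i ha)) haU b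
      (Or.inr (Set.mem_iUnion_of_mem i hb)) hab
  have hST : ∀ i, T i ⊆ U → S ⊆ U := by
    intro i hi
    apply hSU
    rcases h i with ⟨a, ha, hai⟩ | ⟨a, ha, b, hb, hab⟩
    · exact ⟨a, ha, hi hai⟩
    · exact ⟨a, ha, hcl b (Or.inr (Set.mem_iUnion_of_mem i hb)) (hi hb) a (Or.inl ha) hab.symm⟩
  have hSall : S ⊆ U := by
    obtain ⟨x, hx | hx, hxU⟩ := hU
    · exact hSU ⟨x, hx, hxU⟩
    · obtain ⟨i, hi⟩ := Set.mem_iUnion.1 hx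
      exact hST i (hTU i ⟨x, hi, hxU⟩)
  refine Set.union_subset hSall (Set.iUnion_subset fun i => hTU i ?_)
  rcases h i with ⟨a, ha, hai⟩ | ⟨a, ha, b, hb, hab⟩
  · exact ⟨a, hai, hSall ha⟩
  · exact ⟨b, hb, hcl a (Or.inl ha) (hSall ha) b (Or.inr (Set.mem_iUnion_of_mem i hb)) hab⟩

theorem Conn.union (hS : Conn G S) (hT : Conn G T) (h : ∃ a ∈ S, a ∈ T) : Conn G (S ∪ T) := by
  have := hS.union_iUnion (T := fun _ : Unit => T) (fun _ => hT) (fun _ => Or.inl h)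
  simpa [Set.iUnion_const] using this

theorem Conn.union_adj (hS : Conn G S) (hT : Conn G T) (h : ∃ a ∈ S, ∃ b ∈ T, G.Adj a b) :
    Conn G (S ∪ T) := by
  have := hS.union_iUnion (T := fun _ : Unit => T) (fun _ => hT) (fun _ => Or.inr h)
  simpa [Set.iUnion_const] using this

theorem Conn.insert_adj {a : V} (hS : Conn G S) (h : ∃ b ∈ S, G.Adj a b) : Conn G (insert a S) := by
  obtain ⟨b, hb, hab⟩ := h
  have := hS.union_adj (Conn.singleton a) ⟨b, hb, a, rfl, hab.symm⟩
  rwa [Set.union_singleton] at this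

/-- A connected set crosses every cut. -/
theorem Conn.exists_adj (hS : Conn G S) {a b : V} (ha : a ∈ S) (haT : a ∈ T) (hb : b ∈ S)
    (hbT : b ∉ T) : ∃ x ∈ S, x ∈ T ∧ ∃ y ∈ S, y ∉ T ∧ G.Adj x y := by
  by_contra! hcon
  exact hbT (hS.2 T ⟨a, ha, haT⟩ (fun x hx hxT y hy hxy => by
    by_contra hyT
    exact hcon x hx hxT y hy hyT hxy) hb)

/-- The component of `G[S]` containing `a`. -/
def compo (G : SimpleGraph V) (S : Set V) (a : V) : Set V :=
  {b | ∃ T ⊆ S, Conn G T ∧ a ∈ T ∧ b ∈ T}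

theorem compo_subset {a : V} : compo G S a ⊆ S := by
  rintro b ⟨T, hTS, -, -, hb⟩
  exact hTS hb

theorem mem_compo_self {a : V} (ha : a ∈ S) : a ∈ compo G S a :=
  ⟨{a}, by simpa using ha, Conn.singleton a, rfl, rfl⟩

theorem conn_compo {a : V} (ha : a ∈ S) : Conn G (compo G S a) := by
  refine ⟨⟨a, mem_compo_self ha⟩, fun U hU hcl => ?_⟩
  have key : ∀ T ⊆ S, Conn G T → a ∈ T → (T ∩ U).Nonempty → T ⊆ U := by
    intro T hTS hT haT hTU
    refine hT.2 U hTU fun x hx hxU y hy hxy => hcl x ⟨T, hTS, hT, haT, hx⟩ hxU y ⟨T, hTS, hT, haT, hy⟩ hxy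
  have haU : a ∈ U := by
    obtain ⟨x, ⟨T, hTS, hT, haT, hx⟩, hxU⟩ := hU
    exact key T hTS hT haT ⟨x, hx, hxU⟩ haT
  rintro b ⟨T, hTS, hT, haT, hb⟩
  exact key T hTS hT haT ⟨a, haT, haU⟩ hb

theorem Conn.subset_compo {a : V} (hT : Conn G T) (hTS : T ⊆ S) (h : ∃ b ∈ T, b ∈ compo G S a) :
    T ⊆ compo G S a := by
  obtain ⟨b, hbT, U, hU, hUc, haU, hbU⟩ := h
  intro c hc
  exact ⟨U ∪ T, Set.union_subset hU hTS, hUc.union hT ⟨b, hbU, hbT⟩, Or.inl haU, Or.inr hc⟩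

theorem mem_compo_of_adj {a b c : V} (hb : b ∈ compo G S a) (hc : c ∈ S) (hbc : G.Adj b c) :
    c ∈ compo G S a := by
  have hbS := compo_subset hb
  have h2 : Conn G ({c, b} : Set V) := (Conn.singleton b).insert_adj ⟨b, rfl, hbc.symm⟩
  exact h2.subset_compo (by rintro x (rfl | rfl) <;> assumption) ⟨b, by simp, hb⟩ (by simp)

/-- A list of vertices forming a path of `G` from `a` to `b`. -/
structure IsTrack (G : SimpleGraph V) (p : List V) (a b : V) : Prop where
  chain : p.IsChain G.Adj
  nodup : p.Nodup
  head : p.head? = some a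
  last : p.getLast? = some b

theorem conn_of_isChain {p : List V} (hp : p.IsChain G.Adj) (hne : p ≠ []) : Conn G {x | x ∈ p} := by
  induction p with
  | nil => exact absurd rfl hne
  | cons a p ih =>
    cases p with
    | nil => simpa using Conn.singleton (G := G) a
    | cons b p =>
      rw [List.isChain_cons_cons] at hp
      have h1 := (ih hp.2 (by simp)).insert_adj (a := a) ⟨b, by simp, hp.1⟩
      convert h1 using 1
      ext x; simp

theorem IsTrack.ne_nil {p : List V} {a b : V} (h : IsTrack G p a b) : p ≠ [] := by
  rintro rfl; simpa using h.head

theorem IsTrack.mem_head {p : List V} {a b : V} (h : IsTrack G p a b) : a ∈ p :=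
  List.mem_of_mem_head? h.head

theorem IsTrack.mem_last {p : List V} {a b : V} (h : IsTrack G p a b) : b ∈ p :=
  List.mem_of_mem_getLast? h.last

theorem IsTrack.conn {p : List V} {a b : V} (h : IsTrack G p a b) : Conn G {x | x ∈ p} :=
  conn_of_isChain h.chain h.ne_nil

theorem IsTrack.append_singleton {p : List V} {a b c : V} (h : IsTrack G p a b) (hbc : G.Adj b c)
    (hc : c ∉ p) : IsTrack G (p ++ [c]) a c := by
  refine ⟨?_, ?_, ?_, by simp⟩
  · rw [List.isChain_append]
    refine ⟨h.chain, by simp, ?_⟩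
    intro x hx y hy
    rw [h.last] at hx
    simp at hx hy
    subst hx; subst hy; exact hbc
  · rw [List.nodup_append]
    refine ⟨h.nodup, by simp, ?_⟩
    intro x hx y hy
    simp at hy; subst hy
    rintro rfl; exact hc hx
  · rw [List.head?_append, h.head]; rfl

theorem IsTrack.take_until {p : List V} {a b c : V} (h : IsTrack G p a b) (hc : c ∈ p) :
    ∃ q, q <+: p ∧ IsTrack G q a c := by
  obtain ⟨s, t, rfl⟩ := List.append_of_mem hc
  refine ⟨s ++ [c], ⟨t, by simp⟩, ?_, ?_, ?_, by simp⟩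
  · have := h.chain
    rw [List.append_cons] at this
    exact this.left_of_append
  · have := h.nodup
    rw [List.append_cons] at this
    exact (List.nodup_append.1 this).1
  · have := h.head
    rw [List.append_cons, List.head?_append] at this
    cases s <;> simpa using this

/-- Inside a connected set one can walk from `v` until the first visit of a target set. -/
theorem Conn.exists_track (hS : Conn G S) {v : V} (hv : v ∈ S) (hT : ∃ x ∈ S, x ∈ T) :
    ∃ p b, IsTrack G p v b ∧ (∀ x ∈ p, x ∈ S) ∧ b ∈ T ∧ ∀ x ∈ p, x ∈ T → x = b := by
  by_contra! hcon
  by_cases hvT : v ∈ T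
  · obtain ⟨x, hx, hxT, hne⟩ := hcon [v] v ⟨by simp, by simp, rfl, rfl⟩ (by simpa using hv) hvT
    simp at hx; exact hne hx
  obtain ⟨x, hxS, hxT⟩ := hT
  have := hS.2 {b | ∃ p, IsTrack G p v b ∧ (∀ x ∈ p, x ∈ S) ∧ ∀ x ∈ p, x ∉ T}
    ⟨v, hv, [v], ⟨by simp, by simp, rfl, rfl⟩, by simpa using hv, by simpa using hvT⟩
    (by
      rintro a ha ⟨p, hp, hpS, hpT⟩ b hb hab
      by_cases hbp : b ∈ p
      · obtain ⟨q, hqp, hq⟩ := hp.take_until hbp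
        exact ⟨q, hq, fun x hx => hpS x (hqp.subset hx), fun x hx => hpT x (hqp.subset hx)⟩
      · have hq := hp.append_singleton hab hbp
        refine ⟨_, hq, by simpa [or_imp, forall_and] using ⟨hpS, hb⟩, ?_⟩
        by_contra! h2
        obtain ⟨y, hy, hyT⟩ := h2
        have hyb : y = b := by
          rcases List.mem_append.1 hy with h | h
          · exact absurd hyT (hpT y h)
          · simpa using h
        subst hyb
        obtain ⟨z, hz, hzT, hzne⟩ := hcon _ _ hq (by simpa [or_imp, forall_and] using ⟨hpS, hb⟩) hyT
        rcases List.mem_append.1 hz with h | h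
        · exact hpT z h hzT
        · simp at h; exact hzne h) hxS
  obtain ⟨p, hp, -, hpT⟩ := this
  exact hpT x hp.mem_last hxT

/-- A connected set meeting two sets contains an edge or a connected piece linking them. -/
theorem Conn.connector (hS : Conn G S) {P Q : Set V} (hP : ∃ x ∈ S, x ∈ P) (hQ : ∃ x ∈ S, x ∈ Q)
    (hPQ : Disjoint P Q) :
    (∃ a ∈ S, a ∈ P ∧ ∃ b ∈ S, b ∈ Q ∧ G.Adj a b) ∨
    ∃ K ⊆ S \ (P ∪ Q), Conn G K ∧ (∃ a ∈ S, a ∈ P ∧ ∃ b ∈ K, G.Adj a b) ∧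
      ∃ a ∈ S, a ∈ Q ∧ ∃ b ∈ K, G.Adj a b := by
  by_contra! hcon
  obtain ⟨h1, h2⟩ := hcon
  obtain ⟨p, hpS, hpP⟩ := hP
  obtain ⟨q, hqS, hqQ⟩ := hQ
  have := hS.2 {b | b ∈ P ∨ ∃ K ⊆ S \ (P ∪ Q), Conn G K ∧ (∃ a ∈ S, a ∈ P ∧ ∃ b ∈ K, G.Adj a b) ∧ b ∈ K}
    ⟨p, hpS, Or.inl hpP⟩ (by
      rintro a ha haT b hb hab
      by_cases hbP : b ∈ P
      · exact Or.inl hbP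
      rcases haT with haP | ⟨K, hKS, hK, hKP, haK⟩
      · by_cases hbQ : b ∈ Q
        · exact absurd hab (h1 a ha haP b hb hbQ)
        · exact Or.inr ⟨{b}, by rintro _ rfl; exact ⟨hb, by simp [hbP, hbQ]⟩, Conn.singleton b,
            ⟨a, ha, haP, b, rfl, hab⟩, rfl⟩
      · by_cases hbQ : b ∈ Q
        · exact absurd hab.symm (h2 K hKS hK hKP b hb hbQ a haK)
        · obtain ⟨x, hx, hxP, y, hy, hxy⟩ := hKP
          exact Or.inr ⟨insert b K, Set.insert_subset ⟨hb, by simp [hbP, hbQ]⟩ hKS,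
            hK.insert_adj ⟨a, haK, hab.symm⟩, ⟨x, hx, hxP, y, Or.inr hy, hxy⟩, Or.inl rfl⟩) hqS
  rcases this with h | ⟨K, hKS, -, -, hqK⟩
  · exact Set.disjoint_left.1 hPQ h hqQ
  · exact (hKS hqK).2 (Or.inr hqQ)

end Conn

section MinorIn

variable {K V W : Type*}

/-- `B` is a model of `H` in `G` all of whose branch sets lie in `S`. -/
structure IsModelIn (H : SimpleGraph K) (G : SimpleGraph V) (S : Set V) (B : K → Set V) : Prop where
  subset : ∀ u, B u ⊆ S
  conn : ∀ u, Conn G (B u)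
  disj : ∀ u v, u ≠ v → Disjoint (B u) (B v)
  adj : ∀ u v, H.Adj u v → ∃ a ∈ B u, ∃ b ∈ B v, G.Adj a b

/-- `H` is a minor of `G[S]`. -/
def MinorIn (H : SimpleGraph K) (G : SimpleGraph V) (S : Set V) : Prop :=
  ∃ B, IsModelIn H G S B

theorem isMinorModel_iff {H : SimpleGraph K} {G : SimpleGraph V} {B : K → Set V} :
    IsMinorModel H G B ↔ IsModelIn H G Set.univ B := by
  constructor
  · rintro ⟨h1, h2, h3⟩
    exact ⟨fun _ => Set.subset_univ _, fun u => conn_iff.1 (h1 u), fun u v huv => h2 huv, h3⟩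
  · rintro ⟨-, h1, h2, h3⟩
    exact ⟨fun u => conn_iff.2 (h1 u), fun u v huv => h2 u v huv, h3⟩

theorem isMinor_iff {H : SimpleGraph K} {G : SimpleGraph V} :
    IsMinor H G ↔ MinorIn H G Set.univ :=
  exists_congr fun _ => isMinorModel_iff

theorem IsModelIn.mono {H : SimpleGraph K} {G : SimpleGraph V} {S T : Set V} {B : K → Set V}
    (h : IsModelIn H G S B) (hST : S ⊆ T) : IsModelIn H G T B :=
  ⟨fun u => (h.subset u).trans hST, h.conn, h.disj, h.adj⟩

theorem MinorIn.mono {H : SimpleGraph K} {G : SimpleGraph V} {S T : Set V}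
    (h : MinorIn H G S) (hST : S ⊆ T) : MinorIn H G T :=
  h.imp fun _ hB => hB.mono hST

theorem conn_biUnion {G : SimpleGraph V} {G' : SimpleGraph W} {S : Set V} {B : Set V}
    (hB : Conn G B) (hBS : B ⊆ S) {φ : V → Set W} (h1 : ∀ a ∈ S, Conn G' (φ a))
    (h2 : ∀ a ∈ S, ∀ b ∈ S, G.Adj a b → ∃ x ∈ φ a, ∃ y ∈ φ b, G'.Adj x y) :
    Conn G' (⋃ a ∈ B, φ a) := by
  refine ⟨?_, fun T hT hcl => ?_⟩
  · obtain ⟨a, ha⟩ := hB.1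
    obtain ⟨x, hx⟩ := (h1 a (hBS ha)).1
    exact ⟨x, Set.mem_biUnion ha hx⟩
  · have h3 : ∀ a ∈ B, (φ a ∩ T).Nonempty → φ a ⊆ T := fun a ha hne =>
      (h1 a (hBS ha)).2 T hne fun x hx hxT y hy hxy =>
        hcl x (Set.mem_biUnion ha hx) hxT y (Set.mem_biUnion ha hy) hxy
    have h4 := hB.2 {a | φ a ⊆ T} (by
      obtain ⟨x, hx, hxT⟩ := hT
      obtain ⟨a, ha, hxa⟩ := Set.mem_iUnion₂.1 hx
      exact ⟨a, ha, h3 a ha ⟨x, hxa, hxT⟩⟩) (by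
      intro a ha haT b hb hab
      obtain ⟨x, hx, y, hy, hxy⟩ := h2 a (hBS ha) b (hBS hb) hab
      exact h3 b hb ⟨y, hy, hcl x (Set.mem_biUnion ha hx) (haT hx) y (Set.mem_biUnion hb hy) hxy⟩)
    exact Set.iUnion₂_subset h4

/-- Models can be pulled through a map replacing vertices by connected sets. -/
theorem MinorIn.lift {H : SimpleGraph K} {G : SimpleGraph V} {G' : SimpleGraph W} {S : Set V}
    {S' : Set W} (h : MinorIn H G S) (φ : V → Set W) (h0 : ∀ a ∈ S, φ a ⊆ S')
    (h1 : ∀ a ∈ S, Conn G' (φ a)) (h2 : ∀ a ∈ S, ∀ b ∈ S, a ≠ b → Disjoint (φ a) (φ b))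
    (h3 : ∀ a ∈ S, ∀ b ∈ S, G.Adj a b → ∃ x ∈ φ a, ∃ y ∈ φ b, G'.Adj x y) :
    MinorIn H G' S' := by
  obtain ⟨B, hB⟩ := h
  refine ⟨fun u => ⋃ a ∈ B u, φ a, fun u => Set.iUnion₂_subset fun a ha => h0 a (hB.subset u ha),
    fun u => conn_biUnion (hB.conn u) (hB.subset u) h1 h3, ?_, ?_⟩
  · intro u v huv
    rw [Set.disjoint_left]
    intro x hx hx'
    obtain ⟨a, ha, hxa⟩ := Set.mem_iUnion₂.1 hx
    obtain ⟨b, hb, hxb⟩ := Set.mem_iUnion₂.1 hx'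
    have hab : a ≠ b := fun e => Set.disjoint_left.1 (hB.disj u v huv) ha (e ▸ hb)
    exact Set.disjoint_left.1 (h2 a (hB.subset u ha) b (hB.subset v hb) hab) hxa hxb
  · intro u v huv
    obtain ⟨a, ha, b, hb, hab⟩ := hB.adj u v huv
    obtain ⟨x, hx, y, hy, hxy⟩ := h3 a (hB.subset u ha) b (hB.subset v hb) hab
    exact ⟨x, Set.mem_biUnion ha hx, y, Set.mem_biUnion hb hy, hxy⟩

end MinorIn

section Disk

variable {V : Type*}

/-- `Dk p A E w`: the graph `E` on the vertex set `A` has a drawing in a disk, assembled step by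
step, whose outer facial walk reads the cyclic word `w` (or, if `p` holds, contains the cyclic
subword `w`). -/
inductive Dk (p : Prop) : Set V → SimpleGraph V → List V → Prop
  | single (v : V) : Dk p {v} ⊥ [v]
  | dup {A E v y} : Dk p A E (v :: y) → Dk p A E (v :: v :: y)
  | undup {A E v y} : Dk p A E (v :: v :: y) → Dk p A E (v :: y)
  | rot {A E x y} : Dk p A E (x ++ y) → Dk p A E (y ++ x)
  | join {A B E F a b x y} : Dk p A E (a :: x) → Dk p B F (b :: y) → Disjoint A B →
      Dk p (A ∪ B) (E ⊔ F ⊔ edge a b) ((a :: x ++ [a]) ++ (b :: y ++ [b]))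
  | chord {A E u g v y} : Dk p A E (u :: g ++ v :: y) → u ≠ v →
      Dk p A (E ⊔ edge u v) (u :: v :: y)
  | del {A E v y} : p → Dk p A E (v :: y) → Dk p A E y

variable {p : Prop} {A B : Set V} {E F : SimpleGraph V} {w : List V}

theorem Dk.cast {A' : Set V} {E' : SimpleGraph V} {w' : List V} (h : Dk p A E w) (hA : A = A')
    (hE : E = E') (hw : w = w') : Dk p A' E' w' := by
  subst hA hE hw; exact h

theorem Dk.weaken (h : Dk False A E w) : Dk p A E w := by
  induction h with
  | single v => exact .single v
  | dup _ ih => exact .dup ih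
  | undup _ ih => exact .undup ih
  | rot _ ih => exact .rot ih
  | join _ _ hAB ih1 ih2 => exact .join ih1 ih2 hAB
  | chord _ huv ih => exact .chord ih huv
  | del hp => exact hp.elim

theorem edge_adj_iff {a b x y : V} : (edge a b).Adj x y ↔ ((a = x ∧ b = y) ∨ (a = y ∧ b = x)) ∧ x ≠ y := by
  rw [SimpleGraph.edge_adj]
  grind

theorem Dk.mem (h : Dk p A E w) : (∀ v ∈ w, v ∈ A) ∧ ∀ a b, E.Adj a b → a ∈ A ∧ b ∈ A := by
  induction h with
  | single v => simp
  | dup _ ih => simpa using ih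
  | undup _ ih => simpa using ih
  | rot _ ih => simp only [List.mem_append] at ih ⊢; exact ⟨fun v hv => ih.1 v hv.symm, ih.2⟩
  | join _ _ hAB ih1 ih2 =>
    refine ⟨?_, ?_⟩
    · simp only [List.mem_append, List.mem_cons, Set.mem_union] at ih1 ih2 ⊢
      grind
    · intro a b hab
      simp only [SimpleGraph.sup_adj, edge_adj_iff] at hab
      simp only [Set.mem_union]
      have := ih1.1 _ List.mem_cons_self
      have := ih2.1 _ List.mem_cons_self
      grind
  | chord _ huv ih =>
    refine ⟨?_, ?_⟩
    · simp only [List.mem_append, List.mem_cons] at ih ⊢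
      grind
    · intro a b hab
      simp only [SimpleGraph.sup_adj, edge_adj_iff] at hab
      simp only [List.mem_append, List.mem_cons] at ih
      grind
  | del _ _ ih => exact ⟨fun v hv => ih.1 v (List.mem_cons_of_mem _ hv), ih.2⟩

theorem Dk.chain (h : Dk False A E w) : Cycle.Chain (fun a b => a = b ∨ E.Adj a b) (w : Cycle V) := by
  induction h with
  | single v => simp
  | dup _ ih => simp only [Cycle.chain_coe_cons] at ih ⊢; simpa using ih
  | undup _ ih => simp only [Cycle.chain_coe_cons] at ih ⊢; simpa using ih
  | rot _ ih => rwa [Cycle.coe_eq_coe.2 List.isRotated_append] at ih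
  | @join A B E F a b x y _ _ hAB ih1 ih2 =>
    have h1 : List.IsChain (fun u v => u = v ∨ (E ⊔ F ⊔ edge a b).Adj u v) (a :: (x ++ [a])) :=
      (Cycle.chain_coe_cons _ _ _ |>.1 ih1).imp fun u v h => h.imp_right fun h => Or.inl (Or.inl h)
    have h2 : List.IsChain (fun u v => u = v ∨ (E ⊔ F ⊔ edge a b).Adj u v) (b :: (y ++ [b])) :=
      (Cycle.chain_coe_cons _ _ _ |>.1 ih2).imp fun u v h => h.imp_right fun h => Or.inl (Or.inr h)
    have hab : ∀ u v, (u = a ∧ v = b) ∨ (u = b ∧ v = a) → u = v ∨ (E ⊔ F ⊔ edge a b).Adj u v := by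
      intro u v h
      by_cases huv : u = v
      · exact Or.inl huv
      · refine Or.inr (Or.inr ?_)
        rw [edge_adj_iff]; grind
    rw [List.cons_append, List.cons_append, Cycle.chain_coe_cons]
    rw [show a :: (x ++ [a] ++ (b :: y ++ [b]) ++ [a]) = (a :: (x ++ [a])) ++ ((b :: (y ++ [b])) ++ [a]) by simp]
    rw [List.isChain_append, List.isChain_append]
    refine ⟨h1, ⟨h2, by simp, ?_⟩, ?_⟩
    · intro u hu v hv
      apply hab
      simp [List.getLast?_cons, List.getLast?_append] at hu hv
      grind
    · intro u hu v hv
      apply hab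
      simp [List.getLast?_cons, List.getLast?_append] at hu hv
      grind
  | @chord A E u g v y _ huv ih =>
    rw [List.cons_append, Cycle.chain_coe_cons] at ih
    rw [Cycle.chain_coe_cons]
    have h1 := (show u :: ((g ++ v :: y) ++ [u]) = (u :: g) ++ (v :: (y ++ [u])) by simp) ▸ ih
    have h2 := (List.isChain_append.1 h1).2.1
    simp only [List.cons_append, List.isChain_cons_cons]
    refine ⟨Or.inr (Or.inr ?_), h2.imp fun u v h => h.imp_right fun h => Or.inl h⟩
    rw [edge_adj_iff]; simp [huv]
  | del hp => exact hp.elim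

theorem Dk.dupAt {x y : List V} {v : V} (h : Dk p A E (x ++ v :: y)) : Dk p A E (x ++ v :: v :: y) := by
  have h1 : Dk p A E (v :: (y ++ x)) := h.rot
  exact h1.dup.rot (x := v :: v :: y) (y := x)

theorem Dk.undupAt {x y : List V} {v : V} (h : Dk p A E (x ++ v :: v :: y)) : Dk p A E (x ++ v :: y) := by
  have h1 : Dk p A E (v :: v :: (y ++ x)) := h.rot
  exact h1.undup.rot (x := v :: y) (y := x)

theorem Dk.close {x : List V} {v : V} (h : Dk p A E (v :: x)) : Dk p A E (v :: x ++ [v]) :=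
  h.dup.rot (x := [v]) (y := v :: x)

theorem Dk.chordAt {x g y : List V} {u v : V} (h : Dk p A E (x ++ u :: g ++ v :: y)) (huv : u ≠ v) :
    Dk p A (E ⊔ edge u v) (x ++ u :: v :: y) := by
  have h1 : Dk p A E (u :: g ++ v :: (y ++ x)) := by
    have := (show Dk p A E (x ++ (u :: g ++ v :: y)) by simpa using h).rot
    simpa using this
  exact (h1.chord huv).rot (x := u :: v :: y) (y := x)

theorem Dk.reverse (h : Dk p A E w) : Dk p A E w.reverse := by
  induction h with
  | single v => exact .single v
  | @dup A E v y _ ih =>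
    have : Dk p A E (y.reverse ++ v :: []) := by simpa using ih
    simpa using this.dupAt
  | @undup A E v y _ ih =>
    have : Dk p A E (y.reverse ++ v :: v :: []) := by simpa using ih
    simpa using this.undupAt
  | rot _ ih => rw [List.reverse_append] at ih ⊢; exact ih.rot
  | @join A B E F a b x y _ _ hAB ih1 ih2 =>
    have h1 : Dk p A E (a :: x.reverse) := by
      rw [List.reverse_cons] at ih1; exact ih1.rot
    have h2 : Dk p B F (b :: y.reverse) := by
      rw [List.reverse_cons] at ih2; exact ih2.rot
    refine (h2.join h1 hAB.symm).cast (Set.union_comm _ _) ?_ (by simp)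
    rw [SimpleGraph.edge_comm, sup_comm F E]
  | @chord A E u g v y _ huv ih =>
    have h1 : Dk p A E (v :: g.reverse ++ u :: y.reverse) := by
      have : Dk p A E (y.reverse ++ (v :: g.reverse ++ [u])) := by simpa using ih
      simpa using this.rot
    have h2 := (h1.chord huv.symm).rot (x := [v, u]) (y := y.reverse)
    exact h2.cast rfl (by rw [SimpleGraph.edge_comm]) (by simp)
  | @del A E v y hp _ ih =>
    rw [List.reverse_cons] at ih
    exact .del hp ih.rot

end Disk

section Jordan

variable {V : Type*} {p : Prop} {A B : Set V} {E F : SimpleGraph V} {w : List V}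

/-- No two disjoint connected sets alternate along the word `w`. -/
def NoAlt (E : SimpleGraph V) (w : List V) : Prop :=
  ∀ S T : Set V, Conn E S → Conn E T → Disjoint S T →
    ∀ a ∈ S, ∀ b ∈ T, ∀ c ∈ S, ∀ d ∈ T, ¬ [a, b, c, d].Sublist w

theorem conn_of_sup_edge {u v : V} {S : Set V} (h : Conn (E ⊔ edge u v) S) (huv : ¬ (u ∈ S ∧ v ∈ S)) :
    Conn E S := by
  refine h.mono fun a ha b hb hab => ?_
  rcases hab with hab | hab
  · exact hab
  · rw [edge_adj_iff] at hab
    grind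

theorem mem_compo_of_sup_edge {u v : V} {S : Set V} (h : Conn (E ⊔ edge u v) S) (hu : u ∈ S)
    {a : V} (ha : a ∈ S) : a ∈ compo E S u ∨ a ∈ compo E S v := by
  refine h.2 (compo E S u ∪ compo E S v) ⟨u, hu, Or.inl (mem_compo_self hu)⟩ ?_ ha
  intro x hx hxT y hy hxy
  rcases hxy with hxy | hxy
  · exact hxT.imp (fun h => mem_compo_of_adj h hy hxy) (fun h => mem_compo_of_adj h hy hxy)
  · rw [edge_adj_iff] at hxy
    rcases hxy.1 with ⟨rfl, rfl⟩ | ⟨rfl, rfl⟩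
    · exact Or.inr (mem_compo_self hy)
    · exact Or.inl (mem_compo_self hy)

theorem NoAlt.sublist {w' : List V} (h : NoAlt E w) (hw : w'.Sublist w) : NoAlt E w' :=
  fun S T hS hT hST a ha b hb c hc d hd hsub => h S T hS hT hST a ha b hb c hc d hd (hsub.trans hw)

theorem NoAlt.dup {v : V} {y : List V} (h : NoAlt E (v :: y)) : NoAlt E (v :: v :: y) := by
  intro S T hS hT hST a ha b hb c hc d hd hsub
  refine h S T hS hT hST a ha b hb c hc d hd ?_
  have hab : a ≠ b := fun e => Set.disjoint_left.1 hST ha (e ▸ hb)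
  rcases List.sublist_cons_iff.1 hsub with h1 | ⟨r, hr, h1⟩
  · exact h1
  · obtain ⟨rfl, rfl⟩ : a = v ∧ r = [b, c, d] := by grind
    rcases List.sublist_cons_iff.1 h1 with h2 | ⟨r, hr, h2⟩
    · exact h2.cons_cons a
    · grind

theorem NoAlt.rot {x y : List V} (h : NoAlt E (x ++ y)) : NoAlt E (y ++ x) := by
  intro S T hS hT hST a ha b hb c hc d hd hsub
  obtain ⟨l1, l2, he, h1, h2⟩ := List.sublist_append_iff.1 hsub
  have h3 : (l2 ++ l1).Sublist (x ++ y) := h2.append h1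
  rcases l1 with _ | ⟨e1, _ | ⟨e2, _ | ⟨e3, _ | ⟨e4, _ | ⟨e5, l1⟩⟩⟩⟩⟩ <;> simp at he
  · subst he; exact h S T hS hT hST a ha b hb c hc d hd (by simpa using h3)
  · obtain ⟨rfl, rfl⟩ := he; exact h T S hT hS hST.symm b hb c hc d hd a ha (by simpa using h3)
  · obtain ⟨rfl, rfl, rfl⟩ := he; exact h S T hS hT hST c hc d hd a ha b hb (by simpa using h3)
  · obtain ⟨rfl, rfl, rfl, rfl⟩ := he; exact h T S hT hS hST.symm d hd a ha b hb c hc (by simpa using h3)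
  · obtain ⟨rfl, rfl, rfl, rfl, rfl⟩ := he
    exact h S T hS hT hST a ha b hb c hc d hd (by simpa using h3)

theorem NoAlt.close {v : V} {y : List V} (h : NoAlt E (v :: y)) : NoAlt E (v :: y ++ [v]) :=
  NoAlt.rot (x := [v]) h.dup

/-- Connected sets of a graph obtained by joining two graphs with one edge. -/
theorem conn_inter_of_join {a b : V} {S : Set V} (hE : ∀ x y, E.Adj x y → x ∈ A ∧ y ∈ A)
    (hF : ∀ x y, F.Adj x y → x ∈ B ∧ y ∈ B) (hAB : Disjoint A B) (hb : b ∈ B)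
    (hS : Conn (E ⊔ F ⊔ edge a b) S) (hne : (S ∩ A).Nonempty) : Conn E (S ∩ A) := by
  refine ⟨hne, fun T hT hcl => ?_⟩
  rw [Set.disjoint_left] at hAB
  have h1 := hS.2 ((T ∩ A) ∪ {x | a ∈ T ∧ x ∉ A}) (by
    obtain ⟨x, hx, hxT⟩ := hT
    exact ⟨x, hx.1, Or.inl ⟨hxT, hx.2⟩⟩) (by
    intro x hx hxT y hy hxy
    simp only [SimpleGraph.sup_adj, edge_adj_iff] at hxy
    by_cases haT : a ∈ T
    · simp only [haT, true_and, Set.mem_union, Set.mem_inter_iff, Set.mem_ofPred_eq] at hxT ⊢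
      by_cases hyA : y ∈ A
      · left
        rcases hxy with (hxy | hxy) | hxy
        · have := hE _ _ hxy
          exact ⟨hcl x ⟨hx, this.1⟩ (by tauto) y ⟨hy, hyA⟩ hxy, hyA⟩
        · exact absurd (hF _ _ hxy).2 (hAB hyA)
        · grind
      · exact Or.inr hyA
    · simp only [haT, false_and, Set.mem_union, Set.mem_inter_iff, Set.mem_ofPred_eq, or_false] at hxT ⊢
      rcases hxy with (hxy | hxy) | hxy
      · have := hE _ _ hxy
        exact ⟨hcl x ⟨hx, this.1⟩ (by tauto) y ⟨hy, this.2⟩ hxy, this.2⟩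
      · exact absurd (hF _ _ hxy).1 (hAB hxT.2)
      · grind)
  rintro x ⟨hxS, hxA⟩
  rcases h1 hxS with h | h
  · exact h.1
  · exact absurd hxA h.2

theorem mem_of_conn_join {a b : V} {S : Set V} (hE : ∀ x y, E.Adj x y → x ∈ A ∧ y ∈ A)
    (hF : ∀ x y, F.Adj x y → x ∈ B ∧ y ∈ B) (hAB : Disjoint A B)
    (hb : b ∈ B) (hS : Conn (E ⊔ F ⊔ edge a b) S) {x y : V} (hx : x ∈ S) (hxA : x ∈ A) (hy : y ∈ S)
    (hyB : y ∈ B) : a ∈ S ∧ b ∈ S := by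
  rw [Set.disjoint_left] at hAB
  obtain ⟨u, hu, huA, v, hv, hvA, huv⟩ := hS.exists_adj (T := A) hx hxA hy fun h => hAB h hyB
  simp only [SimpleGraph.sup_adj, edge_adj_iff] at huv
  grind

theorem NoAlt.join {a b : V} {x y : List V} (hx : NoAlt E (a :: x)) (hy : NoAlt F (b :: y))
    (hxA : ∀ v ∈ a :: x, v ∈ A) (hyB : ∀ v ∈ b :: y, v ∈ B)
    (hE : ∀ x y, E.Adj x y → x ∈ A ∧ y ∈ A)
    (hF : ∀ x y, F.Adj x y → x ∈ B ∧ y ∈ B) (hAB : Disjoint A B) :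
    NoAlt (E ⊔ F ⊔ edge a b) ((a :: x ++ [a]) ++ (b :: y ++ [b])) := by
  intro S T hS hT hST e1 h1 e2 h2 e3 h3 e4 h4 hsub
  have ha : a ∈ A := hxA _ List.mem_cons_self
  have hb : b ∈ B := hyB _ List.mem_cons_self
  have hxA' : ∀ v ∈ a :: x ++ [a], v ∈ A := by simp at hxA ⊢; grind
  have hyB' : ∀ v ∈ b :: y ++ [b], v ∈ B := by simp at hyB ⊢; grind
  have eqE : E ⊔ F ⊔ edge a b = F ⊔ E ⊔ edge b a := by rw [SimpleGraph.edge_comm, sup_comm E F]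
  have cA : ∀ S, Conn (E ⊔ F ⊔ edge a b) S → ∀ z ∈ S, z ∈ A → Conn E (S ∩ A) := fun S hS z hz hzA =>
    conn_inter_of_join hE hF hAB hb hS ⟨z, hz, hzA⟩
  have cB : ∀ S, Conn (E ⊔ F ⊔ edge a b) S → ∀ z ∈ S, z ∈ B → Conn F (S ∩ B) := fun S hS z hz hzA =>
    conn_inter_of_join hF hE hAB.symm ha (eqE ▸ hS) ⟨z, hz, hzA⟩
  have cr : ∀ S, Conn (E ⊔ F ⊔ edge a b) S → ∀ z ∈ S, z ∈ A → ∀ z' ∈ S, z' ∈ B → a ∈ S ∧ b ∈ S :=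
    fun S hS z hz hzA z' hz' hzB => mem_of_conn_join hE hF hAB hb hS hz hzA hz' hzB
  have dA : Disjoint (S ∩ A) (T ∩ A) := hST.mono Set.inter_subset_left Set.inter_subset_left
  have dB : Disjoint (S ∩ B) (T ∩ B) := hST.mono Set.inter_subset_left Set.inter_subset_left
  obtain ⟨l1, l2, he, hl1, hl2⟩ := List.sublist_append_iff.1 hsub
  have m1 : ∀ z ∈ l1, z ∈ A := fun z hz => hxA' z (hl1.subset hz)
  have m2 : ∀ z ∈ l2, z ∈ B := fun z hz => hyB' z (hl2.subset hz)
  rw [Set.disjoint_left] at hST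
  rcases l1 with _ | ⟨f1, _ | ⟨f2, _ | ⟨f3, _ | ⟨f4, _ | ⟨f5, l1⟩⟩⟩⟩⟩ <;> simp at he
  · subst he
    simp only [List.mem_cons, List.not_mem_nil, or_false, forall_eq_or_imp, forall_eq] at m2
    exact hy.close _ _ (cB S hS _ h1 m2.1) (cB T hT _ h2 m2.2.1) dB _ ⟨h1, m2.1⟩ _ ⟨h2, m2.2.1⟩
      _ ⟨h3, m2.2.2.1⟩ _ ⟨h4, m2.2.2.2⟩ hl2
  · obtain ⟨rfl, rfl⟩ := he
    simp only [List.mem_cons, List.not_mem_nil, or_false, forall_eq_or_imp, forall_eq] at m1 m2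
    have hbS := (cr S hS _ h1 m1 _ h3 m2.2.1).2
    refine hy.close _ _ (cB S hS _ hbS hb) (cB T hT _ h2 m2.1) dB _ ⟨hbS, hb⟩ _ ⟨h2, m2.1⟩
      _ ⟨h3, m2.2.1⟩ _ ⟨h4, m2.2.2⟩ ?_
    rcases List.sublist_cons_iff.1 hl2 with h5 | ⟨r, hr, h5⟩
    · exact h5.cons_cons b
    · grind
  · obtain ⟨rfl, rfl, rfl⟩ := he
    simp only [List.mem_cons, List.not_mem_nil, or_false, forall_eq_or_imp, forall_eq] at m1 m2
    exact hST (cr S hS _ h1 m1.1 _ h3 m2.1).1 (cr T hT _ h2 m1.2 _ h4 m2.2).1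
  · obtain ⟨rfl, rfl, rfl, rfl⟩ := he
    simp only [List.mem_cons, List.not_mem_nil, or_false, forall_eq_or_imp, forall_eq] at m1 m2
    have haT := (cr T hT _ h2 m1.2.1 _ h4 m2).1
    refine hx.close _ _ (cA S hS _ h1 m1.1) (cA T hT _ haT ha) dA _ ⟨h1, m1.1⟩ _ ⟨h2, m1.2.1⟩
      _ ⟨h3, m1.2.2⟩ _ ⟨haT, ha⟩ ?_
    obtain ⟨k1, k2, hk, hk1, hk2⟩ := List.sublist_append_iff.1 hl1
    have h5 : k2 = [] := by
      rcases List.sublist_cons_iff.1 hk2 with h5 | ⟨r, hr, h5⟩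
      · simpa using h5
      · have hr0 : r = [] := by simpa using h5
        subst hr0; subst hr
        have := congrArg List.getLast? hk
        simp at this
        subst this
        exact absurd haT (fun h => hST h3 h)
    subst h5
    rw [List.append_nil] at hk
    subst hk
    simpa using hk1.append (List.Sublist.refl [a])
  · obtain ⟨rfl, rfl, rfl, rfl, rfl⟩ := he
    simp only [List.mem_cons, List.not_mem_nil, or_false, forall_eq_or_imp, forall_eq] at m1
    exact hx.close _ _ (cA S hS _ h1 m1.1) (cA T hT _ h2 m1.2.1) dA _ ⟨h1, m1.1⟩ _ ⟨h2, m1.2.1⟩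
      _ ⟨h3, m1.2.2.1⟩ _ ⟨h4, m1.2.2.2⟩ hl1

theorem NoAlt.chord {u v : V} {g y : List V} (h : NoAlt E (u :: g ++ v :: y)) :
    NoAlt (E ⊔ edge u v) (u :: v :: y) := by
  -- the sublists used below
  have hz : ∀ z, z = u ∨ z = v → ∀ l : List V, l.Sublist y → (z :: l).Sublist (u :: g ++ v :: y) := by
    rintro z (rfl | rfl) l hl
    · exact (hl.trans (by simp)).cons_cons _
    · exact ((hl.cons_cons _).trans (List.sublist_append_right _ _))
  have drop2 : ∀ z (l y' : List V), l.Sublist (z :: y') → (∀ b ∈ l.head?, b ≠ z) → l.Sublist y' := by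
    intro z l' y' hl' hb'
    rcases List.sublist_cons_iff.1 hl' with h5 | ⟨r, rfl, h5⟩
    · exact h5
    · simp at hb'
  have drop0 : ∀ l : List V, l.Sublist (u :: v :: y) → (∀ b ∈ l.head?, b ≠ u ∧ b ≠ v) → l.Sublist y :=
    fun l hl hb => drop2 v _ _ (drop2 u _ _ hl fun b hb' => (hb b hb').1) fun b hb' => (hb b hb').2
  have drop1 : ∀ a l, (a :: l).Sublist (u :: v :: y) → (∀ b ∈ l.head?, b ≠ u ∧ b ≠ v) → l.Sublist y :=
    fun a l hl hb => drop0 l ((List.sublist_cons_self a l).trans hl) hb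
  have main : ∀ S T : Set V, Conn (E ⊔ edge u v) S → Conn E T → Disjoint S T → u ∈ S → v ∈ S →
      ∀ a ∈ S, ∀ b ∈ T, ∀ c ∈ S, ∀ d ∈ T, ¬ [b, c, d].Sublist y := by
    intro S T hS hT hST hu hv a ha b hb c hc d hd hsub
    obtain ⟨z, hz', hcz⟩ : ∃ z, (z = u ∨ z = v) ∧ c ∈ compo E S z := by
      rcases mem_compo_of_sup_edge hS hu hc with h | h
      · exact ⟨u, Or.inl rfl, h⟩
      · exact ⟨v, Or.inr rfl, h⟩
    have hzS : z ∈ S := by rcases hz' with rfl | rfl <;> assumption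
    exact h _ T (conn_compo hzS) hT (hST.mono_left compo_subset) z (mem_compo_self hzS) b hb c hcz d hd
      (hz z hz' _ hsub)
  intro S T hS hT hST a ha b hb c hc d hd hsub
  have hST' := Set.disjoint_left.1 hST
  by_cases huvS : u ∈ S ∧ v ∈ S
  · have hT' : Conn E T := conn_of_sup_edge hT fun h => hST' huvS.1 h.1
    refine main S T hS hT' hST huvS.1 huvS.2 a ha b hb c hc d hd (drop1 a _ hsub ?_)
    simp only [List.head?_cons, Option.mem_def, Option.some.injEq, forall_eq']
    constructor <;> rintro rfl
    exacts [hST' huvS.1 hb, hST' huvS.2 hb]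
  have hS' : Conn E S := conn_of_sup_edge hS huvS
  by_cases huvT : u ∈ T ∧ v ∈ T
  · refine main T S hT hS' hST.symm huvT.1 huvT.2 b hb a ha b hb c hc ?_
    have h1 : [a, b, c].Sublist (u :: v :: y) := (by simp : [a, b, c].Sublist [a, b, c, d]).trans hsub
    refine drop0 _ h1 ?_
    simp only [List.head?_cons, Option.mem_def, Option.some.injEq, forall_eq']
    constructor <;> rintro rfl
    exacts [hST' ha huvT.1, hST' ha huvT.2]
  · have hT' := conn_of_sup_edge hT huvT
    exact h S T hS' hT' hST a ha b hb c hc d hd (hsub.trans (by simp))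

theorem Dk.noAlt (h : Dk p A E w) : NoAlt E w := by
  induction h with
  | single v =>
    intro S T hS hT hST a ha b hb c hc d hd hsub
    have := hsub.length_le
    simp at this
  | dup _ ih => exact ih.dup
  | undup _ ih => exact ih.sublist (by simp)
  | rot _ ih => exact ih.rot
  | join h1 h2 hAB ih1 ih2 => exact ih1.join ih2 h1.mem.1 h2.mem.1 h1.mem.2 h2.mem.2 hAB
  | chord _ _ ih => exact ih.chord
  | del _ _ ih => exact ih.sublist (by simp)

end Jordan

section Glue

variable {V : Type*} {p : Prop} {A B : Set V} {E F : SimpleGraph V} {w : List V}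

/-- Two drawings sharing a vertex that is visible in both are put side by side. -/
theorem Dk.glue {c : V} {α : List V} (h1 : Dk False A E (c :: α)) (h2 : Dk False B F w) :
    A ∩ B = {c} → ∀ x y, w = x ++ c :: y →
      Dk False (A ∪ B) (E ⊔ F) (x ++ (c :: α ++ c :: y)) := by
  induction h2 with
  | single v =>
    intro hAB x y hw
    obtain ⟨rfl, rfl, rfl⟩ : x = [] ∧ y = [] ∧ v = c := by
      cases x <;> simp at hw; exact ⟨rfl, hw.2, hw.1⟩
    refine h1.close.cast ?_ (by simp) (by simp)
    have := h1.mem.1 v (by simp)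
    ext z; simp; rintro rfl; exact this
  | @dup B F v z _ ih =>
    intro hAB x y hw
    rcases x with _ | ⟨x1, _ | ⟨x2, x⟩⟩
    · simp at hw; obtain ⟨rfl, rfl⟩ := hw
      have := (ih hAB [] z rfl).dupAt (x := v :: α)
      simpa using this
    · simp at hw; obtain ⟨rfl, rfl, rfl⟩ := hw
      have := (ih hAB [] z rfl).dup
      simpa using this
    · simp at hw; obtain ⟨rfl, rfl, rfl⟩ := hw
      exact (ih hAB (v :: x) y rfl).dup
  | @undup B F v z _ ih =>
    intro hAB x y hw
    rcases x with _ | ⟨x1, x⟩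
    · simp at hw; obtain ⟨rfl, rfl⟩ := hw
      have := (ih hAB [] _ rfl).undupAt (x := v :: α)
      simpa using this
    · simp at hw; obtain ⟨rfl, rfl⟩ := hw
      exact (ih hAB (v :: v :: x) y rfl).undup
  | @rot B F z1 z2 _ ih =>
    intro hAB x y hw
    rcases List.append_eq_append_iff.1 hw with ⟨m, rfl, rfl⟩ | ⟨m, rfl, hm⟩
    · have := (ih hAB m (y ++ z2) (by simp))
      have := Dk.rot (x := m ++ (c :: α ++ c :: y)) (y := z2) (by simpa using this)
      simpa using this
    · rcases m with _ | ⟨m0, m⟩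
      · simp at hm; subst hm
        have := (ih hAB [] (y ++ x) (by simp))
        have := Dk.rot (x := (c :: α ++ c :: y)) (y := x) (by simpa using this)
        simpa using this
      · simp at hm; obtain ⟨rfl, rfl⟩ := hm
        have := (ih hAB (z1 ++ x) m (by simp))
        have := Dk.rot (x := z1) (y := x ++ (c :: α ++ c :: m)) (by simpa using this)
        simpa using this
  | @join A' B' E' F' a b x' y' d1 d2 hd ih1 ih2 =>
    intro hAB x y hw
    have key : ∀ (D : Set V) (L : SimpleGraph V) (a : V) (x' : List V),
        (∀ x y, a :: x' = x ++ c :: y → Dk False (A ∪ D) (E ⊔ L) (x ++ (c :: α ++ c :: y))) →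
        ∀ l r, a :: x' ++ [a] = l ++ c :: r →
          ∃ x'', Dk False (A ∪ D) (E ⊔ L) (a :: x'') ∧ a :: x'' ++ [a] = l ++ (c :: α ++ c :: r) := by
      intro D L a x' ih l r hlr
      rcases l with _ | ⟨l0, l⟩
      · simp at hlr
        obtain ⟨rfl, rfl⟩ := hlr
        exact ⟨α ++ a :: x', ih [] x' rfl, by simp⟩
      · simp at hlr
        obtain ⟨rfl, hlr⟩ := hlr
        rcases List.eq_nil_or_concat r with rfl | ⟨r', z, rfl⟩
        · have := List.append_inj' hlr rfl
          simp at this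
          obtain ⟨rfl, rfl⟩ := this
          refine ⟨x' ++ a :: α, ?_, by simp⟩
          exact Dk.rot (x := a :: α) (y := a :: x') (ih [] x' rfl)
        · rw [List.concat_eq_append, ← List.cons_append, ← List.append_assoc] at hlr
          have := List.append_inj' hlr rfl
          simp at this
          obtain ⟨rfl, rfl⟩ := this
          exact ⟨l ++ (c :: α ++ c :: r'), ih (a :: l) r' (by simp), by simp⟩
    have hc : c ∈ A ∩ (A' ∪ B') := by rw [hAB]; rfl
    have hsub : ∀ z ∈ A, z ∈ A' ∨ z ∈ B' → z = c := fun z hz hz' => by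
      have : z ∈ A ∩ (A' ∪ B') := ⟨hz, hz'⟩
      rwa [hAB] at this
    have hd' := Set.disjoint_left.1 hd
    have cA' : ∀ z ∈ a :: x' ++ [a], z ∈ A' := by
      have := d1.mem.1; simp at this ⊢; grind
    have cB' : ∀ z ∈ b :: y' ++ [b], z ∈ B' := by
      have := d2.mem.1; simp at this ⊢; grind
    have first : ∀ r, a :: x' ++ [a] = x ++ c :: r → y = r ++ (b :: y' ++ [b]) →
        Dk False (A ∪ (A' ∪ B')) (E ⊔ (E' ⊔ F' ⊔ edge a b)) (x ++ (c :: α ++ c :: y)) := by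
      intro r hr hy
      have hcA : c ∈ A' := cA' c (by rw [hr]; simp)
      have hcB : c ∉ B' := hd' hcA
      obtain ⟨x'', h1, h2⟩ := key A' E' a x' (ih1 (by
        ext z; simp only [Set.mem_inter_iff, Set.mem_singleton_iff]
        exact ⟨fun h => hsub z h.1 (Or.inl h.2), by rintro rfl; exact ⟨hc.1, hcA⟩⟩)) x r hr
      refine (h1.join d2 ?_).cast (Set.union_assoc _ _ _) (by simp only [sup_assoc]) ?_
      · rw [Set.disjoint_left]
        rintro z (hz | hz) hzB
        · exact hcB (hsub z hz (Or.inr hzB) ▸ hzB)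
        · exact hd' hz hzB
      · rw [h2, hy]; simp
    rcases List.append_eq_append_iff.1 hw with ⟨m, rfl, hm⟩ | ⟨m, hm, hm'⟩
    · have hcB : c ∈ B' := cB' c (by rw [hm]; simp)
      have hcA : c ∉ A' := fun h => hd' h hcB
      obtain ⟨x'', h1, h2⟩ := key B' F' b y' (ih2 (by
        ext z; simp only [Set.mem_inter_iff, Set.mem_singleton_iff]
        exact ⟨fun h => hsub z h.1 (Or.inr h.2), by rintro rfl; exact ⟨hc.1, hcB⟩⟩)) m y hm
      refine (d1.join h1 ?_).cast ?_ ?_ ?_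
      · rw [Set.disjoint_left]
        rintro z hzA (hz | hz)
        · exact hcA (hsub z hz (Or.inl hzA) ▸ hzA)
        · exact hd' hzA hz
      · rw [Set.union_left_comm]
      · rw [sup_left_comm E' E F', sup_assoc]
      · rw [h2]; simp
    · rcases m with _ | ⟨m0, m⟩
      · simp only [List.nil_append] at hm'
        simp only [List.append_nil] at hm
        have hcB : c ∈ B' := cB' c (by rw [← hm']; simp)
        have hcA : c ∉ A' := fun h => hd' h hcB
        obtain ⟨x'', h1, h2⟩ := key B' F' b y' (ih2 (by
          ext z; simp only [Set.mem_inter_iff, Set.mem_singleton_iff]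
          exact ⟨fun h => hsub z h.1 (Or.inr h.2), by rintro rfl; exact ⟨hc.1, hcB⟩⟩)) [] y hm'.symm
        refine (d1.join h1 ?_).cast ?_ ?_ ?_
        · rw [Set.disjoint_left]
          rintro z hzA (hz | hz)
          · exact hcA (hsub z hz (Or.inl hzA) ▸ hzA)
          · exact hd' hzA hz
        · rw [Set.union_left_comm]
        · rw [sup_left_comm E' E F', sup_assoc]
        · rw [h2, hm]; simp
      · rw [List.cons_append] at hm'
        injection hm' with e1 e2
        subst e1
        exact first m hm e2
  | @chord B F u g v z _ huv ih =>
    intro hAB x y hw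
    have eq : E ⊔ (F ⊔ edge u v) = E ⊔ F ⊔ edge u v := (sup_assoc _ _ _).symm
    rw [eq]
    rcases x with _ | ⟨x1, _ | ⟨x2, x⟩⟩
    · simp at hw; obtain ⟨rfl, rfl⟩ := hw
      have := (ih hAB [] _ rfl)
      have := Dk.chordAt (x := u :: α) (u := u) (g := g) (v := v) (y := z) (by simpa using this) huv
      simpa using this
    · simp at hw; obtain ⟨rfl, rfl, rfl⟩ := hw
      have := (ih hAB (u :: g) _ rfl)
      have := Dk.chord (u := u) (g := g) (v := v) (y := α ++ v :: z) (by simpa using this) huv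
      simpa using this
    · simp at hw; obtain ⟨rfl, rfl, rfl⟩ := hw
      have := ih hAB (u :: g ++ v :: x) y (by simp)
      have := Dk.chord (u := u) (g := g) (v := v) (y := x ++ (c :: α ++ c :: y)) (by simpa using this) huv
      simpa using this
  | del hp => exact hp.elim

/-- The star with centre `z` and leaves `Y`. -/
def starOn (z : V) (Y : Set V) : SimpleGraph V :=
  SimpleGraph.fromRel fun a b => a = z ∧ b ∈ Y

theorem starOn_adj {z a b : V} {Y : Set V} :
    (starOn z Y).Adj a b ↔ a ≠ b ∧ (a = z ∧ b ∈ Y ∨ b = z ∧ a ∈ Y) := by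
  simp [starOn, SimpleGraph.fromRel_adj]

theorem Dk.attach_aux {z : V} (Q : List V) : ∀ (g R : List V) (E : SimpleGraph V) (Y : Set V),
    Dk p A E (z :: g ++ Q ++ R) → (∀ v ∈ Y, v ∈ Q) → z ∉ Q →
      ∃ g', Dk p A (E ⊔ starOn z Y) (z :: g' ++ R) := by
  induction Q with
  | nil =>
    intro g R E Y h hY _
    refine ⟨g, h.cast rfl ?_ (by simp)⟩
    ext a b
    simp only [SimpleGraph.sup_adj, starOn_adj]
    have : ∀ v, v ∉ Y := fun v hv => by simpa using hY v hv
    simp [this]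
  | cons q Q ih =>
    intro g R E Y h hY hz
    simp only [List.mem_cons, not_or] at hz
    by_cases hq : q ∈ Y
    · have h1 : Dk p A (E ⊔ edge z q) (z :: [q] ++ Q ++ R) :=
        Dk.chord (g := g) (y := Q ++ R) (by simpa using h) hz.1
      obtain ⟨g', h2⟩ := ih [q] R _ {v | v ∈ Y ∧ v ∈ Q} h1 (fun v hv => hv.2) hz.2
      refine ⟨g', h2.cast rfl ?_ rfl⟩
      ext a b
      simp only [SimpleGraph.sup_adj, starOn_adj, edge_adj_iff, Set.mem_ofPred_eq]
      have : ∀ v ∈ Y, v = q ∨ v ∈ Q := fun v hv => by simpa using hY v hv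
      grind
    · refine ih (g ++ [q]) R E Y (by simpa using h) (fun v hv => ?_) hz.2
      rcases List.mem_cons.1 (hY v hv) with rfl | h
      · exact absurd hv hq
      · exact h

/-- A new vertex is joined to vertices visible in a segment of the outer word. -/
theorem Dk.attach {z : V} {Y : Set V} (Q : List V) : ∀ (P : List V), Dk p A E (P ++ Q) →
    z ∉ A → Y ⊆ A → (∀ v ∈ Y, v ∈ Q) → Y.Nonempty →
    ∃ w, Dk p (insert z A) (E ⊔ starOn z Y) w ∧ z ∈ w ∧ ∀ a ∈ P, a ∈ w := by
  induction Q with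
  | nil =>
    rintro P - - - hY ⟨v, hv⟩
    simpa using hY v hv
  | cons q Q ih =>
    intro P h hz hYA hY hne
    by_cases hq : q ∈ Y
    · have hqz : z ≠ q := fun e => hz (e ▸ hYA hq)
      have h1 : Dk p A E (q :: (Q ++ P)) := h.rot
      have h2 := h1.join (Dk.single z) (by simpa using hz)
      have h3 := Dk.rot (x := q :: (Q ++ P) ++ [q] ++ [z]) (y := [z]) (by simpa using h2)
      obtain ⟨g', h4⟩ := Dk.attach_aux (z := z) Q [q] (P ++ [q, z]) _ {v | v ∈ Y ∧ v ∈ Q}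
        (by simpa using h3) (fun v hv => hv.2) (fun h' => hz (h.mem.1 z (by simp [h'])))
      refine ⟨_, h4.cast (by simp) ?_ rfl, by simp, by simp +contextual⟩
      ext a b
      simp only [SimpleGraph.sup_adj, starOn_adj, edge_adj_iff, Set.mem_ofPred_eq]
      have : ∀ v ∈ Y, v = q ∨ v ∈ Q := fun v hv => by simpa using hY v hv
      grind
    · obtain ⟨w, h1, h2, h3⟩ := ih (P ++ [q]) (by simpa using h) hz hYA (fun v hv => by
        rcases List.mem_cons.1 (hY v hv) with rfl | h
        · exact absurd hv hq
        · exact h) hne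
      exact ⟨w, h1, h2, fun a ha => h3 a (by simp [ha])⟩

/-- The edges of `G` inside `J`. -/
def gon (G : SimpleGraph V) (J : Set V) : SimpleGraph V where
  Adj a b := a ∈ J ∧ b ∈ J ∧ G.Adj a b
  symm := ⟨fun _ _ h => ⟨h.2.1, h.1, h.2.2.symm⟩⟩
  loopless := ⟨fun _ h => G.loopless.irrefl _ h.2.2⟩

theorem gon_adj {G : SimpleGraph V} {J : Set V} {a b : V} :
    (gon G J).Adj a b ↔ a ∈ J ∧ b ∈ J ∧ G.Adj a b := Iff.rfl

theorem gon_le {G : SimpleGraph V} {J : Set V} : gon G J ≤ G := fun _ _ h => h.2.2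

theorem Conn.gon {G : SimpleGraph V} {J S : Set V} (h : Conn G S) (hS : S ⊆ J) : Conn (gon G J) S :=
  h.mono fun _ ha _ hb hab => ⟨hS ha, hS hb, hab⟩

theorem Dk.attach_gon {G : SimpleGraph V} {J : Set V} {z : V} {P Q : List V}
    (h : Dk p J (_root_.gon G J) (P ++ Q)) (hz : z ∉ J) (hQ : ∀ a ∈ J, G.Adj z a → a ∈ Q)
    (hne : ∃ a ∈ J, G.Adj z a) :
    ∃ w, Dk p (insert z J) (_root_.gon G (insert z J)) w ∧ z ∈ w ∧ ∀ a ∈ P, a ∈ w := by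
  obtain ⟨w, h1, h2, h3⟩ := h.attach (z := z) (Y := {a | a ∈ J ∧ G.Adj z a}) Q P hz (fun a ha => ha.1)
    (fun a ha => hQ a ha.1 ha.2) (by obtain ⟨a, ha⟩ := hne; exact ⟨a, ha⟩)
  refine ⟨w, h1.cast rfl ?_ rfl, h2, h3⟩
  ext a b
  simp only [SimpleGraph.sup_adj, starOn_adj, gon_adj, Set.mem_ofPred_eq, Set.mem_insert_iff]
  constructor
  · rintro (h | ⟨-, ⟨rfl, h, h'⟩ | ⟨rfl, h, h'⟩⟩)
    · tauto
    · tauto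
    · exact ⟨Or.inr h, Or.inl rfl, h'.symm⟩
  · rintro ⟨rfl | ha, rfl | hb, hab⟩
    · exact absurd hab (G.loopless.irrefl _)
    · exact Or.inr ⟨hab.ne, Or.inl ⟨rfl, hb, hab⟩⟩
    · exact Or.inr ⟨hab.ne, Or.inr ⟨rfl, ha, hab.symm⟩⟩
    · exact Or.inl ⟨ha, hb, hab⟩

theorem Dk.glue_gon {G : SimpleGraph V} {c : V} {α x y : List V} (h1 : Dk False A (_root_.gon G A) (c :: α))
    (h2 : Dk False B (_root_.gon G B) (x ++ c :: y)) (hAB : A ∩ B = {c})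
    (hG : ∀ a ∈ A, ∀ b ∈ B, G.Adj a b → a = c ∨ b = c) :
    Dk False (A ∪ B) (_root_.gon G (A ∪ B)) (x ++ (c :: α ++ c :: y)) := by
  refine (h1.glue h2 hAB x y rfl).cast rfl ?_ rfl
  have hc : c ∈ A ∩ B := by rw [hAB]; rfl
  ext a b
  simp only [SimpleGraph.sup_adj, gon_adj, Set.mem_union]
  constructor
  · tauto
  · rintro ⟨ha | ha, hb | hb, hab⟩
    · tauto
    · rcases hG a ha b hb hab with rfl | rfl
      · exact Or.inr ⟨hc.2, hb, hab⟩
      · exact Or.inl ⟨ha, hc.1, hab⟩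
    · rcases hG b hb a ha hab.symm with rfl | rfl
      · exact Or.inr ⟨ha, hc.2, hab⟩
      · exact Or.inl ⟨hc.1, hb, hab⟩
    · tauto

end Glue

section Rooted

variable {V : Type*} {G : SimpleGraph V} {J X Y : Set V}

/-- Adjacency of the graph `G` with two extra adjacent vertices, one joined to `X`, one to `Y`. -/
def rootAdj (G : SimpleGraph V) (X Y : Set V) : V ⊕ Bool → V ⊕ Bool → Prop
  | .inl a, .inl b => G.Adj a b
  | .inl a, .inr false => a ∈ X
  | .inl a, .inr true => a ∈ Y
  | .inr false, .inl a => a ∈ X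
  | .inr true, .inl a => a ∈ Y
  | .inr i, .inr j => i ≠ j

/-- `G` with two extra adjacent vertices, one joined to `X`, one to `Y`. -/
def rooted (G : SimpleGraph V) (X Y : Set V) : SimpleGraph (V ⊕ Bool) where
  Adj := rootAdj G X Y
  symm := ⟨by rintro (a | _ | _) (b | _ | _) h <;> simp_all [rootAdj, G.adj_comm]⟩
  loopless := ⟨by rintro (a | _ | _) h <;> simp_all [rootAdj]⟩

/-- The vertices of `rooted` lying over `J`. -/
def rootSet (J : Set V) : Set (V ⊕ Bool) := {x | ∀ a, x = .inl a → a ∈ J}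

/-- The rooted graph over `J` has a Kuratowski minor. -/
def Obs (G : SimpleGraph V) (J X Y : Set V) : Prop :=
  MinorIn (completeGraph (Fin 5)) (rooted G X Y) (rootSet J) ∨
    MinorIn (completeBipartiteGraph (Fin 3) (Fin 3)) (rooted G X Y) (rootSet J)

@[simp] theorem rooted_ll {a b : V} : (rooted G X Y).Adj (.inl a) (.inl b) ↔ G.Adj a b := Iff.rfl
@[simp] theorem rooted_lf {a : V} : (rooted G X Y).Adj (.inl a) (.inr false) ↔ a ∈ X := Iff.rfl
@[simp] theorem rooted_lt {a : V} : (rooted G X Y).Adj (.inl a) (.inr true) ↔ a ∈ Y := Iff.rfl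
@[simp] theorem rooted_fl {a : V} : (rooted G X Y).Adj (.inr false) (.inl a) ↔ a ∈ X := Iff.rfl
@[simp] theorem rooted_tl {a : V} : (rooted G X Y).Adj (.inr true) (.inl a) ↔ a ∈ Y := Iff.rfl
@[simp] theorem rooted_rr {i j : Bool} : (rooted G X Y).Adj (.inr i) (.inr j) ↔ i ≠ j := by
  cases i <;> cases j <;> rfl

@[simp] theorem inl_mem_rootSet {a : V} : Sum.inl a ∈ rootSet J ↔ a ∈ J := by simp [rootSet]
@[simp] theorem inr_mem_rootSet {i : Bool} : Sum.inr i ∈ rootSet J := by simp [rootSet]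

theorem Conn.inl {S : Set V} (h : Conn G S) : Conn (rooted G X Y) (Sum.inl '' S) := by
  have := conn_biUnion (G' := rooted G X Y) h subset_rfl (φ := fun a => {Sum.inl a})
    (fun a _ => Conn.singleton _) (fun a _ b _ hab => by simpa using hab)
  convert this using 1
  ext x; simp [eq_comm]

theorem image_inl_subset {S : Set V} (h : S ⊆ J) : Sum.inl '' S ⊆ rootSet J := by
  rintro _ ⟨a, ha, rfl⟩; simpa using h ha

/-- Contracting a connected part into a vertex transfers its labels to that vertex. -/
def lab (A B : Set V) (c : V) (X : Set V) : Set V := {a | a ∈ A ∧ (a ∈ X ∨ a = c ∧ ∃ b ∈ B, b ∈ X)}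

theorem obs_of_lab {A B : Set V} {c : V} (hAB : A ∩ B = {c}) (hB : Conn G B)
    (h : Obs G A (lab A B c X) (lab A B c Y)) : Obs G (A ∪ B) X Y := by
  have hc : c ∈ A ∩ B := by rw [hAB]; rfl
  have key : ∀ {K : Type} {H : SimpleGraph K},
      MinorIn H (rooted G (lab A B c X) (lab A B c Y)) (rootSet A) → MinorIn H (rooted G X Y) (rootSet (A ∪ B)) := by
    intro K H hm
    have hsub : ∀ z ∈ A, z ∈ B → z = c := fun z hz hz' => by
      have : z ∈ A ∩ B := ⟨hz, hz'⟩
      rwa [hAB] at this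
    refine hm.lift (fun x => Sum.elim (fun a => Sum.inl '' {b | b = a ∨ (a = c ∧ b ∈ B)}) (fun i => {Sum.inr i}) x)
      ?_ ?_ ?_ ?_
    · rintro (a | i) ha
      · rintro _ ⟨b, hb, rfl⟩
        simp at ha hb ⊢
        rcases hb with rfl | ⟨-, hb⟩ <;> tauto
      · simp
    · rintro (a | i) ha
      · refine Conn.inl ?_
        by_cases hac : a = c
        · convert hB using 1
          ext b; simp only [Set.mem_ofPred_eq]; subst hac
          constructor
          · rintro (rfl | h); exacts [hc.2, h.2]
          · intro h; exact Or.inr ⟨rfl, h⟩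
        · convert Conn.singleton (G := G) a using 1
          ext b; simp [hac]
      · exact Conn.singleton _
    · rintro (a | i) ha (b | j) hb hab
      · simp only [Sum.elim_inl]
        rw [Set.disjoint_image_iff Sum.inl_injective, Set.disjoint_left]
        simp at ha hb hab
        simp only [Set.mem_ofPred_eq]
        grind
      · simp
      · simp
      · simpa using hab
    · rintro (a | _ | _) ha (b | _ | _) hb hab <;> simp [lab] at ha hb hab ⊢ <;> grind
  exact h.imp key key

theorem obs_of_remove {z : V} (hzJ : z ∈ J) (hz : z ∈ X ∪ Y)
    (h : Obs G (J \ {z}) ((X ∪ Y) \ {z}) {a | a ∈ J ∧ G.Adj z a}) : Obs G J X Y := by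
  have key : ∀ {K : Type} {H : SimpleGraph K},
      MinorIn H (rooted G ((X ∪ Y) \ {z}) {a | a ∈ J ∧ G.Adj z a}) (rootSet (J \ {z})) →
        MinorIn H (rooted G X Y) (rootSet J) := by
    intro K H hm
    refine hm.lift (fun x => Sum.elim (fun a => {Sum.inl a})
      (fun i => if i then {Sum.inl z} else {Sum.inr false, Sum.inr true}) x) ?_ ?_ ?_ ?_
    · rintro (a | _ | _) ha
      · simp at ha ⊢; exact ha.1
      · simp [Set.insert_subset_iff]
      · simpa using hzJ
    · rintro (a | _ | _) ha
      · exact Conn.singleton _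
      · exact (Conn.singleton _).insert_adj ⟨Sum.inr true, rfl, by simp⟩
      · exact Conn.singleton _
    · rintro (a | _ | _) ha (b | _ | _) hb hab <;> simp at ha hb hab ⊢ <;> grind
    · rintro (a | _ | _) ha (b | _ | _) hb hab <;> simp at ha hb hab hz ⊢ <;> grind [G.adj_comm]
  exact h.imp key key

theorem rooted_adj_inl {S : Set V} {T : Set V} (h : ∃ a ∈ S, ∃ b ∈ T, G.Adj a b) :
    ∃ a ∈ (Sum.inl '' S : Set (V ⊕ Bool)), ∃ b ∈ (Sum.inl '' T : Set (V ⊕ Bool)), (rooted G X Y).Adj a b := by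
  obtain ⟨a, ha, b, hb, hab⟩ := h
  exact ⟨_, ⟨a, ha, rfl⟩, _, ⟨b, hb, rfl⟩, hab⟩

theorem minorIn_K33 {W : Type*} {G : SimpleGraph W} {S : Set W} (P Q : Fin 3 → Set W) (hP : ∀ i, P i ⊆ S)
    (hQ : ∀ i, Q i ⊆ S) (cP : ∀ i, Conn G (P i)) (cQ : ∀ i, Conn G (Q i))
    (dP : ∀ i j, i < j → Disjoint (P i) (P j)) (dQ : ∀ i j, i < j → Disjoint (Q i) (Q j))
    (dPQ : ∀ i j, Disjoint (P i) (Q j)) (h : ∀ i j, ∃ a ∈ P i, ∃ b ∈ Q j, G.Adj a b) :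
    MinorIn (completeBipartiteGraph (Fin 3) (Fin 3)) G S := by
  refine ⟨Sum.elim P Q, ?_, ?_, ?_, ?_⟩
  · rintro (i | i); exacts [hP i, hQ i]
  · rintro (i | i); exacts [cP i, cQ i]
  · rintro (i | i) (j | j) hij
    · rcases lt_or_gt_of_ne (fun e => hij (congrArg Sum.inl e) : i ≠ j) with h | h
      exacts [dP i j h, (dP j i h).symm]
    · exact dPQ i j
    · exact (dPQ j i).symm
    · rcases lt_or_gt_of_ne (fun e => hij (congrArg Sum.inr e) : i ≠ j) with h | h
      exacts [dQ i j h, (dQ j i h).symm]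
  · rintro (i | i) (j | j) hij
    · simp at hij
    · exact h i j
    · obtain ⟨a, ha, b, hb, hab⟩ := h j i
      exact ⟨b, hb, a, ha, hab.symm⟩
    · simp at hij

theorem minorIn_K5 {W : Type*} {G : SimpleGraph W} {S : Set W} (P : Fin 5 → Set W) (hP : ∀ i, P i ⊆ S)
    (cP : ∀ i, Conn G (P i)) (dP : ∀ i j, i < j → Disjoint (P i) (P j))
    (h : ∀ i j, i < j → ∃ a ∈ P i, ∃ b ∈ P j, G.Adj a b) :
    MinorIn (completeGraph (Fin 5)) G S := by
  refine ⟨P, hP, cP, ?_, ?_⟩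
  · intro i j hij
    rcases lt_or_gt_of_ne hij with h | h
    exacts [dP i j h, (dP j i h).symm]
  · intro i j hij
    rcases lt_or_gt_of_ne hij.ne with h' | h'
    · exact h i j h'
    · obtain ⟨a, ha, b, hb, hab⟩ := h j i h'
      exact ⟨b, hb, a, ha, hab.symm⟩

theorem obs_cut {c : V} (hc : c ∈ J) (D : Fin 3 → Set V) (hD : ∀ i, D i ⊆ J) (cD : ∀ i, Conn G (D i))
    (hcD : ∀ i, c ∉ D i) (dD : ∀ i j, i < j → Disjoint (D i) (D j)) (hadj : ∀ i, ∃ b ∈ D i, G.Adj c b)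
    (hX : ∀ i, ∃ b ∈ D i, b ∈ X) (hY : ∀ i, ∃ b ∈ D i, b ∈ Y) : Obs G J X Y := by
  refine Or.inr (minorIn_K33 ![{.inr false}, {.inr true}, {.inl c}] (fun i => Sum.inl '' D i) ?_ ?_ ?_ ?_ ?_ ?_ ?_ ?_)
  · intro i; fin_cases i <;> simp [hc]
  · intro i; exact image_inl_subset (hD i)
  · intro i; fin_cases i <;> exact Conn.singleton _
  · intro i; exact (cD i).inl
  · intro i j hij; fin_cases i <;> fin_cases j <;> simp at hij ⊢
  · intro i j hij; rw [Set.disjoint_image_iff Sum.inl_injective]; exact dD i j hij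
  · intro i j; fin_cases i <;> simp [hcD]
  · intro i j
    obtain ⟨x, hx, hx'⟩ := hX j
    obtain ⟨y, hy, hy'⟩ := hY j
    obtain ⟨b, hb, hb'⟩ := hadj j
    fin_cases i
    · exact ⟨_, rfl, _, ⟨x, hx, rfl⟩, hx'⟩
    · exact ⟨_, rfl, _, ⟨y, hy, rfl⟩, hy'⟩
    · exact ⟨_, rfl, _, ⟨b, hb, rfl⟩, hb'⟩

theorem obs_alt {A B C D : Set V} (hA : A ⊆ J) (hB : B ⊆ J) (hC : C ⊆ J) (hD : D ⊆ J) (cA : Conn G A)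
    (cB : Conn G B) (cC : Conn G C) (cD : Conn G D) (dAB : Disjoint A B) (dAC : Disjoint A C)
    (dAD : Disjoint A D) (dBC : Disjoint B C) (dBD : Disjoint B D) (dCD : Disjoint C D)
    (aAB : ∃ a ∈ A, ∃ b ∈ B, G.Adj a b) (aBC : ∃ a ∈ B, ∃ b ∈ C, G.Adj a b)
    (aCD : ∃ a ∈ C, ∃ b ∈ D, G.Adj a b) (aDA : ∃ a ∈ D, ∃ b ∈ A, G.Adj a b)
    (hAX : ∃ a ∈ A, a ∈ X) (hBY : ∃ a ∈ B, a ∈ Y) (hCX : ∃ a ∈ C, a ∈ X) (hDY : ∃ a ∈ D, a ∈ Y) :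
    Obs G J X Y := by
  have sym : ∀ {S T : Set V}, (∃ a ∈ S, ∃ b ∈ T, G.Adj a b) → ∃ a ∈ T, ∃ b ∈ S, G.Adj a b := by
    rintro S T ⟨a, ha, b, hb, hab⟩; exact ⟨b, hb, a, ha, hab.symm⟩
  refine Or.inr (minorIn_K33 ![{.inr false}, Sum.inl '' B, Sum.inl '' D] ![{.inr true}, Sum.inl '' A, Sum.inl '' C]
    ?_ ?_ ?_ ?_ ?_ ?_ ?_ ?_)
  · intro i; fin_cases i
    · simp
    · exact image_inl_subset hB
    · exact image_inl_subset hD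
  · intro i; fin_cases i
    · simp
    · exact image_inl_subset hA
    · exact image_inl_subset hC
  · intro i; fin_cases i; exacts [Conn.singleton _, cB.inl, cD.inl]
  · intro i; fin_cases i; exacts [Conn.singleton _, cA.inl, cC.inl]
  · intro i j hij; fin_cases i <;> fin_cases j <;> simp [Set.disjoint_image_iff Sum.inl_injective] at hij ⊢
    exact dBD
  · intro i j hij; fin_cases i <;> fin_cases j <;> simp [Set.disjoint_image_iff Sum.inl_injective] at hij ⊢
    exact dAC
  · intro i j; fin_cases i <;> fin_cases j <;> simp [Set.disjoint_image_iff Sum.inl_injective]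
    exacts [dAB.symm, dBC, dAD.symm, dCD.symm]
  · intro i j
    obtain ⟨x, hx, hx'⟩ := hAX
    obtain ⟨y, hy, hy'⟩ := hBY
    obtain ⟨x2, hx2, hx2'⟩ := hCX
    obtain ⟨y2, hy2, hy2'⟩ := hDY
    fin_cases i <;> fin_cases j
    · exact ⟨_, rfl, _, rfl, by simp⟩
    · exact ⟨_, rfl, _, ⟨x, hx, rfl⟩, hx'⟩
    · exact ⟨_, rfl, _, ⟨x2, hx2, rfl⟩, hx2'⟩
    · exact ⟨_, ⟨y, hy, rfl⟩, _, rfl, hy'⟩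
    · exact rooted_adj_inl (sym aAB)
    · exact rooted_adj_inl aBC
    · exact ⟨_, ⟨y2, hy2, rfl⟩, _, rfl, hy2'⟩
    · exact rooted_adj_inl aDA
    · exact rooted_adj_inl (sym aCD)

theorem obs_tri {A : Fin 3 → Set V} (hA : ∀ i, A i ⊆ J) (cA : ∀ i, Conn G (A i))
    (dA : ∀ i j, i < j → Disjoint (A i) (A j)) (aA : ∀ i j, i < j → ∃ a ∈ A i, ∃ b ∈ A j, G.Adj a b)
    (hX : ∀ i, ∃ a ∈ A i, a ∈ X) (hY : ∀ i, ∃ a ∈ A i, a ∈ Y) :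
    Obs G J X Y := by
  refine Or.inl (minorIn_K5 ![{.inr false}, {.inr true}, Sum.inl '' A 0, Sum.inl '' A 1, Sum.inl '' A 2]
    ?_ ?_ ?_ ?_)
  · intro i; fin_cases i
    · simp
    · simp
    · exact image_inl_subset (hA 0)
    · exact image_inl_subset (hA 1)
    · exact image_inl_subset (hA 2)
  · intro i; fin_cases i
    exacts [Conn.singleton _, Conn.singleton _, (cA 0).inl, (cA 1).inl, (cA 2).inl]
  · intro i j hij
    fin_cases i <;> fin_cases j <;> simp [Set.disjoint_image_iff Sum.inl_injective] at hij ⊢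
    exacts [dA 0 1 (by decide), dA 0 2 (by decide), dA 1 2 (by decide)]
  · have fX : ∀ i, ∃ a ∈ ({.inr false} : Set (V ⊕ Bool)), ∃ b ∈ (Sum.inl '' A i : Set (V ⊕ Bool)), (rooted G X Y).Adj a b := by
      intro i
      obtain ⟨x, hx, hx'⟩ := hX i
      exact ⟨_, rfl, _, ⟨x, hx, rfl⟩, hx'⟩
    have fY : ∀ i, ∃ a ∈ ({.inr true} : Set (V ⊕ Bool)), ∃ b ∈ (Sum.inl '' A i : Set (V ⊕ Bool)), (rooted G X Y).Adj a b := by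
      intro i
      obtain ⟨x, hx, hx'⟩ := hY i
      exact ⟨_, rfl, _, ⟨x, hx, rfl⟩, hx'⟩
    intro i j hij
    fin_cases i <;> fin_cases j <;> first | (exfalso; revert hij; decide) | skip
    · exact ⟨_, rfl, _, rfl, by simp⟩
    · exact fX 0
    · exact fX 1
    · exact fX 2
    · exact fY 0
    · exact fY 1
    · exact fY 2
    · exact rooted_adj_inl (aA 0 1 (by decide))
    · exact rooted_adj_inl (aA 0 2 (by decide))
    · exact rooted_adj_inl (aA 1 2 (by decide))

end Rooted

section Pattern

theorem isChain_of_append {V : Type*} {R : V → V → Prop} {l L : List V} (h : L.IsChain R)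
    (hl : ∃ s t, s ++ l ++ t = L) : l.IsChain R := by
  obtain ⟨s, t, rfl⟩ := hl
  exact (List.isChain_append.1 (List.isChain_append.1 h).1).2.1

variable {V : Type*} {G : SimpleGraph V} {J X Y : Set V}

theorem Obs.symm (h : Obs G J X Y) : Obs G J Y X := by
  have key : ∀ {K : Type} {H : SimpleGraph K},
      MinorIn H (rooted G X Y) (rootSet J) → MinorIn H (rooted G Y X) (rootSet J) := by
    intro K H hm
    refine hm.lift (fun x => {Sum.map id not x}) ?_ (fun _ _ => Conn.singleton _) ?_ ?_
    · rintro (a | i) ha <;> simp_all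
    · rintro (a | _ | _) ha (b | _ | _) hb hab <;> simp at hab ⊢
      exact hab
    · rintro (a | _ | _) ha (b | _ | _) hb hab <;> simp_all
  exact h.imp key key

theorem List.exists_first {α : Type*} (p : α → Prop) {l : List α} (h : ∃ a ∈ l, p a) :
    ∃ s a t, l = s ++ a :: t ∧ p a ∧ ∀ b ∈ s, ¬ p b := by
  induction l with
  | nil => simp at h
  | cons c l ih =>
    by_cases hc : p c
    · exact ⟨[], c, l, rfl, hc, by simp⟩
    · obtain ⟨s, a, t, rfl, ha, hs⟩ := ih (by simpa [hc] using h)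
      exact ⟨c :: s, a, t, rfl, ha, by simpa [hc] using hs⟩

theorem List.exists_last {α : Type*} (p : α → Prop) {l : List α} (h : ∃ a ∈ l, p a) :
    ∃ s a t, l = s ++ a :: t ∧ p a ∧ ∀ b ∈ t, ¬ p b := by
  obtain ⟨s, a, t, hl, ha, hs⟩ := List.exists_first p (l := l.reverse) (by simpa using h)
  refine ⟨t.reverse, a, s.reverse, ?_, ha, by simpa using hs⟩
  rw [← List.reverse_inj, hl]; simp

theorem Dk.isChain {a : V} {t : List V} (h : Dk False J (gon G J) (a :: t)) (hnd : (a :: t).Nodup)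
    (ht : t ≠ []) : (a :: t ++ [a]).IsChain G.Adj := by
  have h1 := h.chain
  rw [Cycle.chain_coe_cons] at h1
  obtain ⟨t', b, rfl⟩ : ∃ t' b, t = t' ++ [b] := ⟨_, _, (List.dropLast_append_getLast ht).symm⟩
  have hl : (a :: (t' ++ [b])).getLast? = some b := by rw [← List.cons_append, List.getLast?_concat]
  have h2 : (a :: (t' ++ [b])).IsChain G.Adj ∧ G.Adj b a := by
    rw [← List.cons_append, List.isChain_append, hl] at h1
    simp at h1
    constructor
    · have h3 := h1.1
      rw [List.isChain_iff_getElem] at h3 ⊢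
      intro i hi
      have := h3 i hi
      rcases this with h4 | h4
      · have := (List.Nodup.getElem_inj_iff hnd).1 h4
        omega
      · exact gon_le h4
    · rcases h1.2 with h4 | h4
      · simp at hnd; grind
      · exact gon_le h4
  rw [List.isChain_append]
  refine ⟨h2.1, by simp, ?_⟩
  rw [hl]
  simpa using h2.2

theorem List.IsChain.adj_of_append {l₁ l₂ : List V} (h : (l₁ ++ l₂).IsChain G.Adj) (h₁ : l₁ ≠ []) (h₂ : l₂ ≠ []) :
    ∃ a ∈ {x | x ∈ l₁}, ∃ b ∈ {x | x ∈ l₂}, G.Adj a b := by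
  rw [List.isChain_append] at h
  refine ⟨l₁.getLast h₁, List.getLast_mem h₁, l₂.head h₂, List.head_mem h₂, ?_⟩
  exact h.2.2 _ (List.getLast_mem_getLast? h₁) _ (List.head_mem_head? h₂)

theorem Dk.obs_alt {a b c d : V} {u1 u2 u3 u4 : List V}
    (h : Dk False J (gon G J) (a :: u1 ++ b :: u2 ++ c :: u3 ++ d :: u4))
    (hnd : (a :: u1 ++ b :: u2 ++ c :: u3 ++ d :: u4).Nodup) (ha : a ∈ X) (hb : b ∈ Y) (hc : c ∈ X)
    (hd : d ∈ Y) : Obs G J X Y := by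
  have hch := Dk.isChain (a := a) (t := u1 ++ b :: u2 ++ c :: u3 ++ d :: u4) (by simpa using h)
    (by simpa using hnd) (by simp)
  have hm := h.mem.1
  have c4 : (d :: u4 ++ [a]).IsChain G.Adj := isChain_of_append hch ⟨a :: u1 ++ b :: u2 ++ c :: u3, [], by simp⟩
  have c34 : (c :: u3 ++ d :: u4).IsChain G.Adj := isChain_of_append hch ⟨a :: u1 ++ b :: u2, [a], by simp⟩
  have c23 : (b :: u2 ++ c :: u3).IsChain G.Adj := isChain_of_append hch ⟨a :: u1, d :: u4 ++ [a], by simp⟩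
  have c12 : (a :: u1 ++ b :: u2).IsChain G.Adj := isChain_of_append hch ⟨[], c :: u3 ++ d :: u4 ++ [a], by simp⟩
  have dis : ∀ {l1 l2 : List V}, (∀ x ∈ l1, x ∈ l2 → False) → Disjoint {x | x ∈ l1} {x | x ∈ l2} :=
    fun h => Set.disjoint_left.2 h
  have hnd' := hnd
  simp only [List.nodup_append', List.disjoint_left] at hnd
  obtain ⟨x, hx, y, hy, hxy⟩ := c4.adj_of_append (by simp) (by simp)
  refine _root_.obs_alt (A := {x | x ∈ a :: u1}) (B := {x | x ∈ b :: u2}) (C := {x | x ∈ c :: u3})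
    (D := {x | x ∈ d :: u4}) ?_ ?_ ?_ ?_ ?_ ?_ ?_ ?_ ?_ ?_ ?_ ?_ ?_ ?_ (c12.adj_of_append (by simp) (by simp))
    (c23.adj_of_append (by simp) (by simp)) (c34.adj_of_append (by simp) (by simp))
    ⟨x, hx, a, by simp, by simp at hy; exact hy ▸ hxy⟩ ⟨a, by simp, ha⟩ ⟨b, by simp, hb⟩ ⟨c, by simp, hc⟩ ⟨d, by simp, hd⟩
  · intro x hx; exact hm x (by simp only [List.mem_append]; exact Or.inl (Or.inl (Or.inl hx)))
  · intro x hx; exact hm x (by simp only [List.mem_append]; exact Or.inl (Or.inl (Or.inr hx)))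
  · intro x hx; exact hm x (by simp only [List.mem_append]; exact Or.inl (Or.inr hx))
  · intro x hx; exact hm x (by simp only [List.mem_append]; exact Or.inr hx)
  · exact conn_of_isChain (isChain_of_append c12 ⟨[], b :: u2, by simp⟩) (by simp)
  · exact conn_of_isChain (isChain_of_append c23 ⟨[], c :: u3, by simp⟩) (by simp)
  · exact conn_of_isChain (isChain_of_append c34 ⟨[], d :: u4, by simp⟩) (by simp)
  · exact conn_of_isChain (isChain_of_append c4 ⟨[], [a], by simp⟩) (by simp)
  all_goals
    apply dis
    intro x h1 h2
    simp only [List.mem_append] at hnd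
    grind

theorem Dk.obs_tri {a b c : V} {u1 u2 u3 : List V} (h : Dk False J (gon G J) (a :: u1 ++ b :: u2 ++ c :: u3))
    (hnd : (a :: u1 ++ b :: u2 ++ c :: u3).Nodup) (ha : a ∈ X ∩ Y) (hb : b ∈ X ∩ Y) (hc : c ∈ X ∩ Y) :
    Obs G J X Y := by
  have hch := Dk.isChain (a := a) (t := u1 ++ b :: u2 ++ c :: u3) (by simpa using h)
    (by simpa using hnd) (by simp)
  have hm := h.mem.1
  have c31 : (c :: u3 ++ [a]).IsChain G.Adj := isChain_of_append hch ⟨a :: u1 ++ b :: u2, [], by simp⟩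
  have c23 : (b :: u2 ++ c :: u3).IsChain G.Adj := isChain_of_append hch ⟨a :: u1, [a], by simp⟩
  have c12 : (a :: u1 ++ b :: u2).IsChain G.Adj := isChain_of_append hch ⟨[], c :: u3 ++ [a], by simp⟩
  have dis : ∀ {l1 l2 : List V}, (∀ x ∈ l1, x ∈ l2 → False) → Disjoint {x | x ∈ l1} {x | x ∈ l2} :=
    fun h => Set.disjoint_left.2 h
  simp only [List.nodup_append', List.disjoint_left] at hnd
  obtain ⟨x, hx, y, hy, hxy⟩ := c31.adj_of_append (by simp) (by simp)
  simp at hy; subst hy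
  refine _root_.obs_tri (A := ![{x | x ∈ y :: u1}, {x | x ∈ b :: u2}, {x | x ∈ c :: u3}]) ?_ ?_ ?_ ?_ ?_ ?_
  · intro i x hx
    apply hm
    simp only [List.mem_append]
    fin_cases i
    exacts [Or.inl (Or.inl hx), Or.inl (Or.inr hx), Or.inr hx]
  · intro i; fin_cases i
    · exact conn_of_isChain (isChain_of_append c12 ⟨[], b :: u2, by simp⟩) (by simp)
    · exact conn_of_isChain (isChain_of_append c23 ⟨[], c :: u3, by simp⟩) (by simp)
    · exact conn_of_isChain (isChain_of_append c31 ⟨[], [y], by simp⟩) (by simp)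
  · intro i j hij
    simp only [List.mem_append] at hnd
    fin_cases i <;> fin_cases j <;> first | (exfalso; revert hij; decide) | skip
    all_goals
      apply dis
      intro x h1 h2
      grind
  · intro i j hij
    fin_cases i <;> fin_cases j <;> first | (exfalso; revert hij; decide) | skip
    · exact c12.adj_of_append (by simp) (by simp)
    · exact ⟨y, by simp, x, hx, hxy.symm⟩
    · exact c23.adj_of_append (by simp) (by simp)
  · intro i; fin_cases i
    exacts [⟨y, by simp, ha.1⟩, ⟨b, by simp, hb.1⟩, ⟨c, by simp, hc.1⟩]
  · intro i; fin_cases i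
    exacts [⟨y, by simp, ha.2⟩, ⟨b, by simp, hb.2⟩, ⟨c, by simp, hc.2⟩]

/-- The disk drawing of `J` shows `X` in one segment and `Y` in the complementary segment. -/
def Splits (G : SimpleGraph V) (J X Y : Set V) : Prop :=
  ∃ P Q, Dk False J (gon G J) (P ++ Q) ∧ (∀ x ∈ X, x ∈ P) ∧ ∀ y ∈ Y, y ∈ Q

theorem Splits.symm (h : Splits G J X Y) : Splits G J Y X := by
  obtain ⟨P, Q, h, hP, hQ⟩ := h
  exact ⟨Q, P, h.rot, hQ, hP⟩

theorem Dk.splits_of_private {w : List V} (h : Dk False J (gon G J) w) (hnd : w.Nodup) (hX : ∀ x ∈ X, x ∈ w)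
    (hY : ∀ y ∈ Y, y ∈ w) (hobs : ¬ Obs G J X Y) (hx : ∃ x ∈ X, x ∉ Y) : Splits G J X Y := by
  obtain ⟨x, hxX, hxY⟩ := hx
  obtain ⟨u, v, rfl⟩ := List.append_of_mem (hX x hxX)
  have h1 : Dk False J (gon G J) (x :: (v ++ u)) := h.rot (x := u) (y := x :: v)
  have hnd1 : (x :: (v ++ u)).Nodup := by rw [List.nodup_middle, List.nodup_cons] at hnd; simpa [and_comm, List.nodup_append_comm] using hnd
  replace hX : ∀ z ∈ X, z ∈ x :: (v ++ u) := fun z hz => by have := hX z hz; simp at this ⊢; tauto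
  replace hY : ∀ z ∈ Y, z ∈ v ++ u := fun z hz => by
    have := hY z hz; simp at this ⊢
    rcases this with h | rfl | h
    exacts [Or.inr h, absurd hz hxY, Or.inl h]
  generalize v ++ u = t at *
  by_cases hYt : ∃ y ∈ t, y ∈ Y
  · obtain ⟨p, y, r, rfl, hy, hp⟩ := List.exists_first _ hYt
    by_cases hYr : ∃ y ∈ r, y ∈ Y
    · obtain ⟨m, y', s, rfl, hy', hs⟩ := List.exists_last _ hYr
      by_cases hm : ∃ x' ∈ m, x' ∈ X
      · obtain ⟨x', hx', hx'X⟩ := hm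
        obtain ⟨m1, m2, rfl⟩ := List.append_of_mem hx'
        exact absurd (Dk.obs_alt (a := x) (u1 := p) (b := y) (u2 := m1) (c := x') (u3 := m2) (d := y') (u4 := s)
          (by simpa using h1) (by simpa using hnd1) hxX hy hx'X hy') hobs
      · push Not at hm
        refine ⟨y' :: s ++ (x :: p ++ [y]), y :: m ++ [y'], ?_, ?_, ?_⟩
        · have := Dk.rot (x := x :: p ++ y :: m) (y := y' :: s) (by simpa using h1)
          have := (Dk.dupAt (x := y' :: s ++ x :: p) (v := y) (y := m) (by simpa using this)).close
          simpa using this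
        · intro z hz; have := hX z hz; have := hm z; simp at *; grind
        · intro z hz; have := hY z hz; have := hp z; have := hs z; simp at *; grind
    · push Not at hYr
      refine ⟨y :: r ++ x :: p, [y], ?_, ?_, ?_⟩
      · exact Dk.close (Dk.rot (x := x :: p) (y := y :: r) (by simpa using h1))
      · intro z hz; have := hX z hz; simp at *; tauto
      · intro z hz; have := hY z hz; have := hp z; have := hYr z; simp at *; grind
  · push Not at hYt
    exact ⟨_, [], by simpa using h1, hX, fun z hz => absurd hz (hYt z (hY z hz))⟩

theorem Dk.splits {w : List V} (h : Dk False J (gon G J) w) (hnd : w.Nodup) (hX : ∀ x ∈ X, x ∈ w)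
    (hY : ∀ y ∈ Y, y ∈ w) (hobs : ¬ Obs G J X Y) : Splits G J X Y := by
  by_cases h1 : ∃ x ∈ X, x ∉ Y
  · exact h.splits_of_private hnd hX hY hobs h1
  by_cases h2 : ∃ y ∈ Y, y ∉ X
  · exact (h.splits_of_private hnd hY hX (fun h => hobs h.symm) h2).symm
  push Not at h1 h2
  obtain rfl : X = Y := Set.Subset.antisymm h1 h2
  by_cases hw : ∃ x ∈ w, x ∈ X
  · obtain ⟨u, x, v, rfl, hx, hu⟩ := List.exists_first _ hw
    by_cases hv : ∃ x ∈ v, x ∈ X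
    · obtain ⟨p, x', s, rfl, hx', hp⟩ := List.exists_first _ hv
      by_cases hs : ∃ x ∈ s, x ∈ X
      · obtain ⟨s1, x'', s2, rfl, hx'', -⟩ := List.exists_first _ hs
        refine absurd (Dk.obs_tri (a := x) (u1 := p) (b := x') (u2 := s1) (c := x'') (u3 := s2 ++ u) ?_ ?_
          ⟨hx, hx⟩ ⟨hx', hx'⟩ ⟨hx'', hx''⟩) hobs
        · have := h.rot; simpa using this
        · have := (List.nodup_append_comm).1 hnd; simpa using this
      · push Not at hs
        refine ⟨x :: p ++ [x'], x' :: (s ++ u) ++ [x], ?_, ?_, ?_⟩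
        · have := h.rot
          have := (Dk.dupAt (x := x :: p) (v := x') (y := s ++ u) (by simpa using this)).close
          simpa using this
        all_goals intro z hz; have := hX z hz; have := hu z; have := hp z; have := hs z; simp at *; grind
    · push Not at hv
      refine ⟨x :: (v ++ u), [x], ?_, ?_, ?_⟩
      · exact Dk.close (Dk.rot (x := u) (y := x :: v) h)
      all_goals intro z hz; have := hX z hz; have := hu z; have := hv z; simp at *; grind
  · push Not at hw
    exact ⟨w, [], by simpa using h, hX, fun z hz => absurd hz (hw z (hX z hz))⟩

end Pattern

section Split

variable {V : Type*} {G : SimpleGraph V} {J X Y A B D : Set V} {c : V}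

theorem List.exists_dup {α : Type*} {l : List α} (h : ¬ l.Nodup) : ∃ u v m n, l = u ++ v :: m ++ v :: n := by
  induction l with
  | nil => simp at h
  | cons a l ih =>
    rw [List.nodup_cons, not_and_or, not_not] at h
    rcases h with h | h
    · obtain ⟨m, n, rfl⟩ := List.append_of_mem h
      exact ⟨[], a, m, n, rfl⟩
    · obtain ⟨u, v, m, n, rfl⟩ := ih h
      exact ⟨a :: u, v, m, n, rfl⟩

theorem Dk.cut_word {E : SimpleGraph V} {v : V} {m n : List V} (h : Dk False J E (v :: m ++ v :: n))
    (hJ : Conn E (J \ {v}) ∨ J = {v}) : (∀ b ∈ m, b = v) ∨ ∀ b ∈ n, b = v := by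
  by_contra! hcon
  obtain ⟨⟨b, hb, hbv⟩, d, hd, hdv⟩ := hcon
  have hm := h.mem.1
  rcases hJ with hJ | rfl
  · refine h.noAlt {v} (J \ {v}) (Conn.singleton v) hJ (by simp) v rfl b ⟨hm b (by simp [hb]), hbv⟩ v rfl d
      ⟨hm d (by simp [hd]), hdv⟩ ?_
    have h1 : [b].Sublist m := by simpa using hb
    have h2 : [d].Sublist n := by simpa using hd
    exact (h1.cons_cons v).append (h2.cons_cons v)
  · exact hbv (hm b (by simp [hb]))

theorem Dk.undup_all {E : SimpleGraph V} {p : Prop} {v : V} {m n : List V} (h : Dk p J E (v :: m ++ v :: n))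
    (hm : ∀ b ∈ m, b = v) : Dk p J E (v :: n) := by
  induction m with
  | nil => exact h.undup
  | cons b m ih =>
    obtain rfl := hm b (by simp)
    exact ih h.undup (fun x hx => hm x (by simp [hx]))

theorem Dk.exists_nodup {E : SimpleGraph V} (k : ℕ) : ∀ {w : List V}, w.length = k → Dk False J E w →
    (∀ v ∈ J, Conn E (J \ {v}) ∨ J = {v}) → ∃ w', Dk False J E w' ∧ w'.Nodup ∧ ∀ a ∈ w, a ∈ w' := by
  induction k using Nat.strong_induction_on with
  | _ k ih =>
    intro w hk h hJ
    by_cases hnd : w.Nodup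
    · exact ⟨w, h, hnd, fun _ h => h⟩
    obtain ⟨u, v, m, n, rfl⟩ := List.exists_dup hnd
    have hv : v ∈ J := h.mem.1 v (by simp)
    have h1 : Dk False J E (v :: m ++ v :: (n ++ u)) := by
      have := Dk.rot (x := u) (y := v :: m ++ v :: n) (by simpa using h)
      simpa using this
    rcases h1.cut_word (hJ v hv) with h2 | h2
    · obtain ⟨w', a, b, d⟩ := ih _ (by subst hk; simp; omega) rfl (h1.undup_all h2) hJ
      refine ⟨w', a, b, fun x hx => ?_⟩
      by_cases hxv : x = v
      · subst hxv; exact d x (by simp)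
      · refine d x ?_; have := h2 x; simp at hx ⊢; tauto
    · obtain ⟨w', a, b, d⟩ := ih _ (by subst hk; simp; omega) rfl (h1.rot.undup_all h2) hJ
      refine ⟨w', a, b, fun x hx => ?_⟩
      by_cases hxv : x = v
      · subst hxv; exact d x (by simp)
      · refine d x ?_; have := h2 x; simp at this hx ⊢; tauto

theorem Dk.contig {E : SimpleGraph V} {P Q : List V} (h : Dk False J E (P ++ Q)) (hP : c ∈ P) (hQ : c ∈ Q)
    (hJ : Conn E (J \ {c})) : ∃ P' Q', Dk False J E (c :: P' ++ Q') ∧ (∀ x ∈ P, x = c ∨ x ∈ P') ∧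
      ∀ x ∈ Q, x = c ∨ x ∈ Q' := by
  obtain ⟨p1, p2, rfl⟩ := List.append_of_mem hP
  obtain ⟨q1, q2, rfl⟩ := List.append_of_mem hQ
  have h1 : Dk False J E (c :: (p2 ++ q1) ++ c :: (q2 ++ p1)) := by
    have := Dk.rot (x := p1) (y := c :: p2 ++ (q1 ++ c :: q2)) (by simpa using h)
    simpa using this
  rcases h1.cut_word (Or.inl hJ) with h2 | h2
  · have h3 := (h1.undup_all h2).reverse
    refine ⟨p1.reverse, q2.reverse, ?_, ?_, ?_⟩
    · have := Dk.rot (x := (q2 ++ p1).reverse) (y := [c]) (by simpa using h3)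
      simpa using this
    all_goals intro x hx; have := h2 x; simp at this hx ⊢; tauto
  · refine ⟨p2, q1, by simpa using h1.rot.undup_all h2, ?_, ?_⟩
    all_goals intro x hx; have := h2 x; simp at this hx ⊢; tauto

theorem Conn.diff (hJ : Conn G J) (hc : c ∈ J) (hcD : c ∉ D) (hcl : ∀ a ∈ D, ∀ b ∈ J, G.Adj a b → b ∈ D ∨ b = c) :
    Conn G (J \ D) := by
  refine ⟨⟨c, hc, hcD⟩, fun T hT hTcl => ?_⟩
  obtain ⟨x, hx, hxT⟩ := hT
  by_cases hcT : c ∈ T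
  · have := hJ.2 (T ∪ D) ⟨x, hx.1, Or.inl hxT⟩ (fun a ha haT b hb hab => by
      by_cases hbD : b ∈ D
      · exact Or.inr hbD
      · by_cases haD : a ∈ D
        · rcases hcl a haD b hb hab with h | rfl
          exacts [Or.inr h, Or.inl hcT]
        · exact Or.inl (hTcl a ⟨ha, haD⟩ (haT.resolve_right haD) b ⟨hb, hbD⟩ hab))
    exact fun y hy => (this hy.1).resolve_right hy.2
  · have := hJ.2 (T \ D) ⟨x, hx.1, hxT, hx.2⟩ (fun a ha haT b hb hab => by
      by_cases hbD : b ∈ D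
      · rcases hcl b hbD a ha hab.symm with h | rfl
        exacts [absurd h haT.2, absurd haT.1 hcT]
      · exact ⟨hTcl a ⟨ha, haT.2⟩ haT.1 b ⟨hb, hbD⟩ hab, hbD⟩)
    exact fun y hy => (this hy.1).1

/-- Every part of `J` cut off by one vertex contains a label. -/
def Att (G : SimpleGraph V) (J Z : Set V) : Prop :=
  ∀ c ∈ J, ∀ D ⊆ J, D.Nonempty → c ∉ D → insert c D ≠ J →
    (∀ a ∈ D, ∀ b ∈ J, G.Adj a b → b ∈ D ∨ b = c) → ∃ z ∈ D, z ∈ Z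

theorem Att.lab (h : Att G (A ∪ B) (X ∪ Y)) (hAB : A ∩ B = {c})
    (hG : ∀ a ∈ A, ∀ b ∈ B, G.Adj a b → a = c ∨ b = c) : Att G A (lab A B c X ∪ lab A B c Y) := by
  have hc : c ∈ A ∩ B := by rw [hAB]; rfl
  have hsub : ∀ z ∈ A, z ∈ B → z = c := fun z hz hz' => by
    have : z ∈ A ∩ B := ⟨hz, hz'⟩
    rwa [hAB] at this
  intro c' hc' D hD hne hc'D hDA hcl
  by_cases hcD : c ∈ D
  · obtain ⟨z, hz, hzXY⟩ := h c' (Or.inl hc') (D ∪ B) (Set.union_subset_union_left _ hD) ⟨c, Or.inl hcD⟩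
      (by rintro (h | h); exacts [hc'D h, hc'D (hsub c' hc' h ▸ hcD)])
      (by
        intro e; apply hDA
        refine Set.Subset.antisymm (Set.insert_subset hc' hD) fun x hx => ?_
        have : x ∈ insert c' (D ∪ B) := e ▸ Or.inl hx
        rcases this with rfl | h | h
        exacts [Or.inl rfl, Or.inr h, Or.inr (hsub x hx h ▸ hcD)])
      (by
        rintro a (ha | ha) b (hb | hb) hab
        · exact (hcl a ha b hb hab).imp_left Or.inl
        · exact Or.inl (Or.inr hb)
        · rcases hG b hb a ha hab.symm with rfl | rfl
          · exact Or.inl (Or.inr hc.2)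
          · exact (hcl a hcD b hb hab).imp_left Or.inl
        · exact Or.inl (Or.inr hb))
    rcases hz with hz | hz
    · exact ⟨z, hz, hzXY.imp (fun h => ⟨hD hz, Or.inl h⟩) (fun h => ⟨hD hz, Or.inl h⟩)⟩
    · exact ⟨c, hcD, hzXY.imp (fun h => ⟨hc.1, Or.inr ⟨rfl, z, hz, h⟩⟩) (fun h => ⟨hc.1, Or.inr ⟨rfl, z, hz, h⟩⟩)⟩
  · obtain ⟨z, hz, hzXY⟩ := h c' (Or.inl hc') D (hD.trans Set.subset_union_left) hne hc'D
      (fun e => hDA (Set.Subset.antisymm (Set.insert_subset hc' hD) (e ▸ Set.subset_union_left)))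
      (by
        rintro a ha b (hb | hb) hab
        · exact hcl a ha b hb hab
        · rcases hG a (hD ha) b hb hab with rfl | rfl
          · exact absurd ha hcD
          · exact hcl a ha b hc.1 hab)
    exact ⟨z, hz, hzXY.imp (fun h => ⟨hD hz, Or.inl h⟩) (fun h => ⟨hD hz, Or.inl h⟩)⟩

theorem Conn.adj_cut (hJ : Conn G J) (hc : c ∈ J) (hDJ : D ⊆ J) (hne : D.Nonempty) (hcD : c ∉ D)
    (hcl : ∀ a ∈ D, ∀ b ∈ J, G.Adj a b → b ∈ D ∨ b = c) : ∃ b ∈ D, G.Adj c b := by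
  obtain ⟨a, ha⟩ := hne
  obtain ⟨x, -, hx, y, hy, hyD, hxy⟩ := hJ.exists_adj (hDJ ha) ha hc hcD
  rcases hcl x hx y hy hxy with h | rfl
  exacts [absurd h hyD, ⟨x, hx, hxy.symm⟩]

theorem compo_closed {a : V} : ∀ x ∈ compo G (J \ {c}) a, ∀ b ∈ J, G.Adj x b → b ∈ compo G (J \ {c}) a ∨ b = c := by
  intro x hx b hb hxb
  by_cases hbc : b = c
  · exact Or.inr hbc
  · exact Or.inl (mem_compo_of_adj hx ⟨hb, hbc⟩ hxb)

theorem lab_nonempty (hc : c ∈ A) (hXY : ((A ∪ B) ∩ (X ∪ Y)).Nonempty) :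
    (lab A B c X ∪ lab A B c Y).Nonempty := by
  obtain ⟨z, hz | hz, hz'⟩ := hXY
  · exact ⟨z, hz'.imp (fun h => ⟨hz, Or.inl h⟩) (fun h => ⟨hz, Or.inl h⟩)⟩
  · exact ⟨c, hz'.imp (fun h => ⟨hc, Or.inr ⟨rfl, z, hz, h⟩⟩) (fun h => ⟨hc, Or.inr ⟨rfl, z, hz, h⟩⟩)⟩

/-- One part attached at a cut vertex carries labels of one kind only. -/
theorem splits_pure (hAB : A ∩ B = {c}) (hG : ∀ a ∈ A, ∀ b ∈ B, G.Adj a b → a = c ∨ b = c) (hX : X ⊆ A ∪ B)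
    (hY : Y ⊆ A ∪ B) (hBX : ∀ x ∈ X, x ∈ B → x = c) (hBY : ∃ y ∈ B, y ∈ Y)
    (hAl : ∃ z ∈ A, z ∈ X ∪ Y) (sA : Splits G A (lab A B c X) (lab A B c Y))
    (sB : Splits G B (lab B A c X) (lab B A c Y)) : Splits G (A ∪ B) X Y := by
  have hc : c ∈ A ∩ B := by rw [hAB]; rfl
  obtain ⟨P, Q, h1, hP, hQ⟩ := sA
  obtain ⟨P', Q', h2, hP', hQ'⟩ := sB
  have hcB : c ∈ P' ++ Q' := by
    obtain ⟨z, hz, hz'⟩ := hAl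
    rw [List.mem_append]
    exact hz'.imp (fun h => hP' c ⟨hc.2, Or.inr ⟨rfl, z, hz, h⟩⟩) (fun h => hQ' c ⟨hc.2, Or.inr ⟨rfl, z, hz, h⟩⟩)
  have hcQ : c ∈ Q := by
    obtain ⟨z, hz, hz'⟩ := hBY
    exact hQ c ⟨hc.1, Or.inr ⟨rfl, z, hz, hz'⟩⟩
  have hYB : ∀ y ∈ Y, y ∈ B → y ∈ P' ++ Q' := fun y hy hyB => List.mem_append_right _ (hQ' y ⟨hyB, Or.inl hy⟩)
  obtain ⟨x, y, hxy⟩ := List.append_of_mem hcB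
  rw [hxy] at h2 hYB
  obtain ⟨Q1, Q2, rfl⟩ := List.append_of_mem hcQ
  have h3 := Dk.glue_gon (x := P ++ Q1) (c := c) (y := Q2) (Dk.rot h2) (by simpa using h1)
    (by rw [Set.inter_comm]; exact hAB) (fun a ha b hb hab => (hG b hb a ha hab.symm).symm)
  refine ⟨P, Q1 ++ (c :: (y ++ x) ++ c :: Q2), by rw [Set.union_comm]; simpa using h3, ?_, ?_⟩
  · intro z hz
    refine hP z ⟨?_, Or.inl hz⟩
    rcases hX hz with h | h
    exacts [h, hBX z hz h ▸ hc.1]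
  · intro z hz
    rcases hY hz with h | h
    · have := hQ z ⟨h, Or.inl hz⟩
      simp at this ⊢; tauto
    · have := hYB z hz h
      simp at this ⊢; tauto

theorem splits_mixed (hAB : A ∩ B = {c}) (hG : ∀ a ∈ A, ∀ b ∈ B, G.Adj a b → a = c ∨ b = c) (hX : X ⊆ A ∪ B)
    (hY : Y ⊆ A ∪ B) (hA : Conn G (A \ {c})) (hB : Conn G (B \ {c}))
    (hAX : ∃ y ∈ A, y ∈ X) (hAY : ∃ y ∈ A, y ∈ Y) (hBX : ∃ y ∈ B, y ∈ X) (hBY : ∃ y ∈ B, y ∈ Y)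
    (sA : Splits G A (lab A B c X) (lab A B c Y))
    (sB : Splits G B (lab B A c X) (lab B A c Y)) : Splits G (A ∪ B) X Y := by
  have hc : c ∈ A ∩ B := by rw [hAB]; rfl
  obtain ⟨P, Q, h1, hP, hQ⟩ := sA
  obtain ⟨P', Q', h2, hP', hQ'⟩ := sB
  obtain ⟨q1, p1, h3, hq1, hp1⟩ := Dk.contig h1.rot (c := c)
    (by obtain ⟨z, hz, hz'⟩ := hBY; exact hQ c ⟨hc.1, Or.inr ⟨rfl, z, hz, hz'⟩⟩)
    (by obtain ⟨z, hz, hz'⟩ := hBX; exact hP c ⟨hc.1, Or.inr ⟨rfl, z, hz, hz'⟩⟩) (hA.gon Set.sdiff_subset)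
  obtain ⟨p2, q2, h4, hp2, hq2⟩ := Dk.contig h2 (c := c)
    (by obtain ⟨z, hz, hz'⟩ := hAX; exact hP' c ⟨hc.2, Or.inr ⟨rfl, z, hz, hz'⟩⟩)
    (by obtain ⟨z, hz, hz'⟩ := hAY; exact hQ' c ⟨hc.2, Or.inr ⟨rfl, z, hz, hz'⟩⟩) (hB.gon Set.sdiff_subset)
  have h5 := Dk.glue_gon (x := []) (c := c) (y := p2 ++ q2) (α := q1 ++ p1) (by simpa using h3) (by simpa using h4) hAB hG
  refine ⟨p1 ++ c :: p2, q2 ++ c :: q1, ?_, ?_, ?_⟩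
  · have := Dk.rot (x := c :: q1) (y := p1 ++ c :: (p2 ++ q2)) (by simpa using h5)
    simpa using this
  · intro z hz
    rcases hX hz with h | h
    · have := hp1 z (hP z ⟨h, Or.inl hz⟩)
      simp; tauto
    · have := hp2 z (hP' z ⟨h, Or.inl hz⟩)
      simp; tauto
  · intro z hz
    rcases hY hz with h | h
    · have := hq1 z (hQ z ⟨h, Or.inl hz⟩)
      simp; tauto
    · have := hq2 z (hQ' z ⟨h, Or.inl hz⟩)
      simp; tauto

theorem splits_of_not_obs [Finite V] (n : ℕ) : ∀ {J X Y : Set V}, J.ncard = n → Conn G J → X ⊆ J → Y ⊆ J →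
    (X ∪ Y).Nonempty → Att G J (X ∪ Y) → ¬ Obs G J X Y → Splits G J X Y := by
  induction n using Nat.strong_induction_on with
  | _ n ih =>
    intro J X Y hn hJ hX hY hne hatt hobs
    by_cases hcut : ∃ c ∈ J, J ≠ {c} ∧ ¬ Conn G (J \ {c})
    · obtain ⟨c, hc, hJc, hncon⟩ := hcut
      obtain ⟨a, haJ, hac⟩ : ∃ a ∈ J, a ≠ c := by
        by_contra! h
        exact hJc (Set.Subset.antisymm (fun x hx => h x hx) (by simpa using hc))
      -- the pieces hanging off `c`
      have split : ∀ a ∈ J, a ≠ c → ∃ A B, J = A ∪ B ∧ A ∩ B = {c} ∧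
          (∀ a ∈ A, ∀ b ∈ B, G.Adj a b → a = c ∨ b = c) ∧ B \ {c} = compo G (J \ {c}) a ∧
          A = J \ compo G (J \ {c}) a ∧ (∃ z ∈ A, z ≠ c ∧ z ∈ X ∪ Y) ∧ (∃ z ∈ B, z ≠ c ∧ z ∈ X ∪ Y) ∧
          (∀ X Y, X ∪ Y ⊆ J → (X ∪ Y).Nonempty → Att G J (X ∪ Y) → ¬ Obs G J X Y →
            Splits G A (lab A B c X) (lab A B c Y) ∧ Splits G B (lab B A c X) (lab B A c Y)) := by
        intro a ha hac
        set D := compo G (J \ {c}) a with hD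
        have hDJ : D ⊆ J \ {c} := compo_subset
        have hcl : ∀ x ∈ D, ∀ b ∈ J, G.Adj x b → b ∈ D ∨ b = c := compo_closed
        have haD : a ∈ D := mem_compo_self ⟨ha, hac⟩
        have hcD : c ∉ D := fun h => (hDJ h).2 rfl
        have hDne : ∃ z ∈ J, z ≠ c ∧ z ∉ D := by
          by_contra! h
          apply hncon
          rw [← show D = J \ {c} from Set.Subset.antisymm hDJ fun z hz => h z hz.1 hz.2]
          exact conn_compo ⟨ha, hac⟩
        obtain ⟨z, hzJ, hzc, hzD⟩ := hDne
        have cA : Conn G (J \ D) := hJ.diff hc hcD hcl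
        have hcl' : ∀ x ∈ J \ insert c D, ∀ b ∈ J, G.Adj x b → b ∈ J \ insert c D ∨ b = c := by
          rintro x ⟨hx, hx'⟩ b hb hxb
          simp only [Set.mem_insert_iff, not_or] at hx'
          by_cases hbc : b = c
          · exact Or.inr hbc
          · refine Or.inl ⟨hb, ?_⟩
            rintro (h | h)
            · exact hbc h
            · exact (hcl b h x hx hxb.symm).elim hx'.2 hx'.1
        have cB : Conn G (insert c D) := by
          have := hJ.diff hc (D := J \ insert c D) (by simp) hcl'
          rwa [Set.sdiff_sdiff_cancel_left (Set.insert_subset hc (hDJ.trans Set.sdiff_subset))] at this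
        have hAB : (J \ D) ∩ insert c D = {c} := by
          ext x; simp only [Set.mem_inter_iff, Set.mem_sdiff, Set.mem_insert_iff, Set.mem_singleton_iff]
          constructor
          · tauto
          · rintro rfl; exact ⟨⟨hc, hcD⟩, Or.inl rfl⟩
        have hun : J = (J \ D) ∪ insert c D := by
          ext x; simp only [Set.mem_union, Set.mem_sdiff, Set.mem_insert_iff]
          constructor
          · tauto
          · rintro (h | rfl | h); exacts [h.1, hc, (hDJ h).1]
        have hG : ∀ a ∈ J \ D, ∀ b ∈ insert c D, G.Adj a b → a = c ∨ b = c := by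
          rintro a ⟨ha, haD⟩ b (rfl | hb) hab
          · exact Or.inr rfl
          · exact (hcl b hb a ha hab.symm).elim (fun h => absurd h haD) Or.inl
        refine ⟨J \ D, insert c D, hun, hAB, hG, by simp [hcD], rfl, ?_, ?_, ?_⟩
        · obtain ⟨y, hy, hy'⟩ := hatt c hc (J \ insert c D) Set.sdiff_subset ⟨z, hzJ, by simp [hzc, hzD]⟩ (by simp)
            (fun e => by
              have : a ∈ insert c (J \ insert c D) := by rw [e]; exact ha
              simp [hac, haD] at this) hcl'
          have := hy.2
          simp only [Set.mem_insert_iff, not_or] at this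
          exact ⟨y, ⟨hy.1, this.2⟩, this.1, hy'⟩
        · obtain ⟨y, hy, hy'⟩ := hatt c hc D (hDJ.trans Set.sdiff_subset) ⟨a, haD⟩ hcD
            (fun e => by
              have : z ∈ insert c D := by rw [e]; exact hzJ
              simp [hzc, hzD] at this) hcl
          exact ⟨y, Or.inr hy, (hDJ hy).2, hy'⟩
        · intro X Y hXY hne hatt hobs
          have hc1 : c ∈ J \ D := ⟨hc, hcD⟩
          constructor
          · refine ih _ ?_ rfl cA (fun x hx => hx.1) (fun x hx => hx.1) (lab_nonempty hc1 ?_) (Att.lab ?_ hAB hG)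
              (fun h => hobs ?_)
            · rw [← hn]
              exact Set.ncard_lt_ncard ⟨Set.sdiff_subset, fun h => (h haJ).2 (by
                exact absurd (h ha).2 (by simpa using haD))⟩ (Set.toFinite _)
            · rw [← hun, Set.inter_eq_self_of_subset_right hXY]; exact hne
            · rwa [← hun]
            · rw [hun]; exact obs_of_lab hAB cB h
          · have hun' : J = insert c D ∪ (J \ D) := by rw [Set.union_comm]; exact hun
            have hAB' : insert c D ∩ (J \ D) = {c} := by rw [Set.inter_comm]; exact hAB
            refine ih _ ?_ rfl cB (fun x hx => hx.1) (fun x hx => hx.1) (lab_nonempty (Set.mem_insert _ _) ?_)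
              (Att.lab ?_ hAB' (fun a ha b hb hab => (hG b hb a ha hab.symm).symm))
              (fun h => hobs ?_)
            · rw [← hn]
              refine Set.ncard_lt_ncard ⟨Set.insert_subset hc (hDJ.trans Set.sdiff_subset), fun h => ?_⟩ (Set.toFinite _)
              exact (h hzJ).elim hzc hzD
            · rw [← hun', Set.inter_eq_self_of_subset_right hXY]; exact hne
            · rwa [← hun']
            · rw [hun']; exact obs_of_lab hAB' cA h
      have pure : ∀ X' Y', X' ⊆ J → Y' ⊆ J → (X' ∪ Y' = X ∪ Y) → ¬ Obs G J X' Y' → (∃ a ∈ J, a ≠ c ∧ ∀ x ∈ compo G (J \ {c}) a, x ∉ X') →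
          Splits G J X' Y' := by
        rintro X' Y' hX hY hXY hobs ⟨a, ha, hac, hx⟩
        obtain ⟨A, B, hun, hAB, hG, hB, hA, ⟨z, hz, hzc, hz'⟩, ⟨z2, hz2, hz2c, hz2'⟩, hs⟩ := split a ha hac
        rw [← hXY] at hne hatt hz' hz2'
        obtain ⟨s1, s2⟩ := hs X' Y' (Set.union_subset hX hY) hne hatt hobs
        rw [hun] at hX hY ⊢
        have hB' : ∀ x ∈ B, x ≠ c → x ∉ X' := fun x hx' hxc => hx x (by rw [← hB]; exact ⟨hx', hxc⟩)
        exact splits_pure hAB hG hX hY (fun x hx hxB => by_contra fun h => hB' x hxB h hx)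
          ⟨z2, hz2, hz2'.resolve_left (hB' z2 hz2 hz2c)⟩ ⟨z, hz, hz'⟩ s1 s2
      by_cases hpX : ∃ a ∈ J, a ≠ c ∧ ∀ x ∈ compo G (J \ {c}) a, x ∉ X
      · exact pure X Y hX hY rfl hobs hpX
      by_cases hpY : ∃ a ∈ J, a ≠ c ∧ ∀ x ∈ compo G (J \ {c}) a, x ∉ Y
      · exact (pure Y X hY hX (Set.union_comm _ _) (fun h => hobs h.symm) hpY).symm
      push Not at hpX hpY
      obtain ⟨A, B, hun, hAB, hG, hB, hA, ⟨a2, ha2A, ha2c, -⟩, -, hs⟩ := split a haJ hac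
      have ha2 : a2 ∈ J \ compo G (J \ {c}) a := hA ▸ ha2A
      have dis : ∀ a b, b ∈ J → b ≠ c → b ∉ compo G (J \ {c}) a → Disjoint (compo G (J \ {c}) a) (compo G (J \ {c}) b) := by
        intro a b hb hbc hab
        rw [Set.disjoint_left]
        intro x hx hx'
        exact hab ((conn_compo (a := b) (show b ∈ J \ {c} from ⟨hb, hbc⟩)).subset_compo compo_subset ⟨x, hx', hx⟩ (mem_compo_self ⟨hb, hbc⟩))
      by_cases h3 : ∃ a3 ∈ J, a3 ≠ c ∧ a3 ∉ compo G (J \ {c}) a ∧ a3 ∉ compo G (J \ {c}) a2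
      · exfalso
        obtain ⟨a3, ha3, ha3c, h31, h32⟩ := h3
        have hmem : ∀ i, ![a, a2, a3] i ∈ J ∧ ![a, a2, a3] i ≠ c := by
          intro i; fin_cases i; exacts [⟨haJ, hac⟩, ⟨ha2.1, ha2c⟩, ⟨ha3, ha3c⟩]
        refine hobs (obs_cut hc (fun i => compo G (J \ {c}) (![a, a2, a3] i)) ?_ ?_ ?_ ?_ ?_ ?_ ?_)
        · exact fun i => compo_subset.trans Set.sdiff_subset
        · exact fun i => conn_compo (hmem i)
        · exact fun i h => (compo_subset h).2 rfl
        · intro i j hij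
          fin_cases i <;> fin_cases j <;> first | (exfalso; revert hij; decide) | skip
          exacts [dis _ _ ha2.1 ha2c ha2.2, dis _ _ ha3 ha3c h31, dis _ _ ha3 ha3c h32]
        · exact fun i => hJ.adj_cut hc (compo_subset.trans Set.sdiff_subset) ⟨_, mem_compo_self (hmem i)⟩
            (fun h => (compo_subset h).2 rfl) compo_closed
        · exact fun i => hpX _ (hmem i).1 (hmem i).2
        · exact fun i => hpY _ (hmem i).1 (hmem i).2
      · push Not at h3
        obtain ⟨s1, s2⟩ := hs X Y (Set.union_subset hX hY) hne hatt hobs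
        have hA' : A \ {c} = compo G (J \ {c}) a2 := by
          rw [hA]; ext x; constructor
          · rintro ⟨⟨hx, hx'⟩, hxc⟩
            exact h3 x hx hxc hx'
          · intro hx
            refine ⟨⟨(compo_subset hx).1, fun h => ?_⟩, (compo_subset hx).2⟩
            exact Set.disjoint_left.1 (dis a a2 ha2.1 ha2c ha2.2) h hx
        obtain ⟨x1, hx1, hx1'⟩ := hpX a haJ hac
        obtain ⟨y1, hy1, hy1'⟩ := hpY a haJ hac
        obtain ⟨x2, hx2, hx2'⟩ := hpX a2 ha2.1 ha2c
        obtain ⟨y2, hy2, hy2'⟩ := hpY a2 ha2.1 ha2c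
        have c1 := conn_compo (G := G) (S := J \ {c}) (a := a) ⟨haJ, hac⟩
        have c2 := conn_compo (G := G) (S := J \ {c}) (a := a2) ⟨ha2.1, ha2c⟩
        rw [← hB] at hx1 hy1 c1
        rw [← hA'] at hx2 hy2 c2
        rw [hun] at hX hY ⊢
        exact splits_mixed hAB hG hX hY c2 c1 ⟨x2, hx2.1, hx2'⟩ ⟨y2, hy2.1, hy2'⟩ ⟨x1, hx1.1, hx1'⟩
          ⟨y1, hy1.1, hy1'⟩ s1 s2
    · push Not at hcut
      obtain ⟨z, hz⟩ := hne
      have hzJ : z ∈ J := hz.elim (fun h => hX h) (fun h => hY h)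
      by_cases hJz : J = {z}
      · subst hJz
        refine ⟨[z], [z], (Dk.single z).dup.cast rfl ?_ rfl, fun x hx => by simpa using hX hx, fun x hx => by simpa using hY hx⟩
        ext a b
        simp only [gon_adj, SimpleGraph.bot_adj, Set.mem_singleton_iff, false_iff]
        rintro ⟨rfl, rfl, h⟩
        exact G.loopless.irrefl _ h
      have hcon : ∀ v ∈ J, Conn G (J \ {v}) ∨ J = {v} := fun v hv => by
        by_cases h : J = {v}
        exacts [Or.inr h, Or.inl (hcut v hv h)]
      have hJz' := hcut z hzJ hJz
      have hnb : ∃ a ∈ J \ {z}, G.Adj z a :=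
        hJ.adj_cut hzJ Set.sdiff_subset hJz'.1 (by simp) (fun a _ b hb _ => by
          by_cases h : b = z
          exacts [Or.inr h, Or.inl ⟨hb, h⟩])
      have hS : Splits G (J \ {z}) ((X ∪ Y) \ {z}) {a | a ∈ J ∧ G.Adj z a} := by
        refine ih _ ?_ rfl hJz' (Set.sdiff_subset_sdiff_left (Set.union_subset hX hY))
          (fun a ha => ⟨ha.1, ha.2.ne'⟩) ?_ ?_ (fun h => hobs (obs_of_remove hzJ hz h))
        · rw [← hn]
          exact Set.ncard_lt_ncard ⟨Set.sdiff_subset, fun h => (h hzJ).2 rfl⟩ (Set.toFinite _)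
        · obtain ⟨a, ha, hza⟩ := hnb
          exact ⟨a, Or.inr ⟨ha.1, hza⟩⟩
        · intro c hc D hD hDne hcD hDJ hcl
          have hJc : J ≠ {c} := fun h => hc.2 (by rw [h] at hzJ; exact hzJ.symm)
          obtain ⟨a, ha⟩ := hDne
          have hDc : ∀ x ∈ D, x ∈ J \ {c} := fun x hx => ⟨(hD hx).1, fun h => hcD (h ▸ hx)⟩
          obtain ⟨x, -, hx, y, hy, hyD, hxy⟩ := (hcut c hc.1 hJc).exists_adj (hDc a ha) ha (b := z)
            ⟨hzJ, fun h => hc.2 h.symm⟩ (fun h => (hD h).2 rfl)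
          by_cases hyz : y = z
          · subst hyz
            exact ⟨x, hx, Or.inr ⟨(hD hx).1, hxy.symm⟩⟩
          · rcases hcl x hx y ⟨hy.1, hyz⟩ hxy with h | h
            exacts [absurd h hyD, absurd h hy.2]
      obtain ⟨P, Q, h, hP, hQ⟩ := hS
      obtain ⟨w, h1, hzw, hPw⟩ := h.attach_gon (z := z) (by simp) (fun a ha hza => hQ a ⟨ha.1, hza⟩) hnb
      rw [Set.insert_sdiff_singleton, Set.insert_eq_of_mem hzJ] at h1
      obtain ⟨w', h2, hnd, hw'⟩ := Dk.exists_nodup _ rfl h1 (fun v hv => (hcon v hv).imp_left fun h => h.gon Set.sdiff_subset)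
      have hall : ∀ x ∈ X ∪ Y, x ∈ w' := fun x hx => hw' x (by
        by_cases hxz : x = z
        · exact hxz ▸ hzw
        · exact hPw x (hP x ⟨hx, hxz⟩))
      exact h2.splits hnd (fun x hx => hall x (Or.inl hx)) (fun x hx => hall x (Or.inr hx)) hobs

end Split

section Draw

variable {V K : Type*} {G E F : SimpleGraph V} {A B J S : Set V} {c : V} {w : List V}

theorem Dk.subst {p : Prop} (h1 : Dk p A E w) (h2 : Dk p B F [c]) (hc : c ∈ A) (hAB : A ∩ B = {c}) :
    Dk p (A ∪ B) (E ⊔ F) w := by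
  induction h1 with
  | single v =>
    obtain rfl : c = v := hc
    exact h2.cast (Set.union_eq_self_of_subset_left (by simpa using h2.mem.1 c (by simp))).symm (by simp) rfl
  | dup _ ih => exact (ih hc hAB).dup
  | undup _ ih => exact (ih hc hAB).undup
  | rot _ ih => exact (ih hc hAB).rot
  | del hp _ ih => exact .del hp (ih hc hAB)
  | @chord A E u g v z _ huv ih =>
    exact ((ih hc hAB).chord huv).cast rfl (by rw [sup_right_comm]) rfl
  | @join A' B' E' F' a b x y d1 d2 hd ih1 ih2 =>
    have hcB : c ∈ B := h2.mem.1 c (by simp)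
    have hsub : ∀ z, (z ∈ A' ∨ z ∈ B') → z ∈ B → z = c := fun z hz hz' => by
      have : z ∈ (A' ∪ B') ∩ B := ⟨hz, hz'⟩
      rwa [hAB] at this
    have hd' := Set.disjoint_left.1 hd
    rcases hc with hc | hc
    · refine ((ih1 hc ?_).join d2 ?_).cast (Set.union_right_comm _ _ _) ?_ rfl
      · ext z; simp only [Set.mem_inter_iff, Set.mem_singleton_iff]
        exact ⟨fun h => hsub z (Or.inl h.1) h.2, by rintro rfl; exact ⟨hc, hcB⟩⟩
      · rw [Set.disjoint_left]
        rintro z (hz | hz) hzB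
        · exact hd' hz hzB
        · obtain rfl := hsub z (Or.inr hzB) hz
          exact hd' hc hzB
      · rw [sup_right_comm E' F, sup_right_comm (E' ⊔ F') F]
    · refine (d1.join (ih2 hc ?_) ?_).cast (Set.union_assoc _ _ _).symm ?_ rfl
      · ext z; simp only [Set.mem_inter_iff, Set.mem_singleton_iff]
        exact ⟨fun h => hsub z (Or.inr h.1) h.2, by rintro rfl; exact ⟨hc, hcB⟩⟩
      · rw [Set.disjoint_left]
        rintro z hzA (hz | hz)
        · exact hd' hzA hz
        · obtain rfl := hsub z (Or.inl hzA) hz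
          exact hd' hzA hc
      · rw [← sup_assoc E' F', sup_right_comm]

theorem gon_union (hAB : c ∈ A ∩ B) (hG : ∀ a ∈ A, ∀ b ∈ B, G.Adj a b → a = c ∨ b = c) :
    gon G A ⊔ gon G B = gon G (A ∪ B) := by
  ext a b
  simp only [SimpleGraph.sup_adj, gon_adj, Set.mem_union]
  constructor
  · tauto
  · rintro ⟨ha | ha, hb | hb, hab⟩
    · tauto
    · rcases hG a ha b hb hab with rfl | rfl
      · exact Or.inr ⟨hAB.2, hb, hab⟩
      · exact Or.inl ⟨ha, hAB.1, hab⟩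
    · rcases hG b hb a ha hab.symm with rfl | rfl
      · exact Or.inr ⟨ha, hAB.2, hab⟩
      · exact Or.inl ⟨hAB.1, hb, hab⟩
    · tauto

theorem MinorIn.remove_pendant {H : SimpleGraph K} {r y : V} (hr : ∀ b, G.Adj r b → b = y) (hry : r ≠ y)
    (hK : ∀ k, ∃ k1 k2, k1 ≠ k2 ∧ H.Adj k k1 ∧ H.Adj k k2) (h : MinorIn H G S) : MinorIn H G (S \ {r}) := by
  obtain ⟨B, hB⟩ := h
  have hyB : ∀ k, r ∈ B k → y ∈ B k := by
    intro k hk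
    by_contra hy
    obtain ⟨k1, k2, hne, h1, h2⟩ := hK k
    have hBk : B k ⊆ {r} := (hB.conn k).2 {r} ⟨r, hk, rfl⟩ (by
      rintro a - rfl b hb hab
      exact absurd (hr b hab ▸ hb) hy)
    obtain ⟨a, ha, b, hb, hab⟩ := hB.adj _ _ h1
    obtain ⟨a', ha', b', hb', hab'⟩ := hB.adj _ _ h2
    obtain rfl := hBk ha
    obtain rfl := hBk ha'
    obtain rfl := hr _ hab
    obtain rfl := hr _ hab'
    exact Set.disjoint_left.1 (hB.disj _ _ hne) hb hb'
  refine ⟨fun k => B k \ {r}, fun k => Set.sdiff_subset_sdiff_left (hB.subset k), fun k => ?_, ?_, ?_⟩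
  · by_cases hk : r ∈ B k
    · refine ⟨⟨y, hyB k hk, hry.symm⟩, fun T hT hcl => ?_⟩
      obtain ⟨x, hx, hxT⟩ := hT
      by_cases hyT : y ∈ T
      · have := (hB.conn k).2 (insert r T) ⟨r, hk, Or.inl rfl⟩ (by
          rintro a ha (rfl | haT) b hb hab
          · obtain rfl := hr b hab
            exact Or.inr hyT
          · by_cases hbr : b = r
            · exact Or.inl hbr
            · by_cases har : a = r
              · subst har; obtain rfl := hr b hab; exact Or.inr hyT
              · exact Or.inr (hcl a ⟨ha, har⟩ haT b ⟨hb, hbr⟩ hab))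
        exact fun z hz => (this hz.1).resolve_left hz.2
      · have := (hB.conn k).2 (T \ {r}) ⟨x, hx.1, hxT, hx.2⟩ (by
          rintro a ha ⟨haT, har⟩ b hb hab
          by_cases hbr : b = r
          · subst hbr
            obtain rfl := hr a hab.symm
            exact absurd haT hyT
          · exact ⟨hcl a ⟨ha, har⟩ haT b ⟨hb, hbr⟩ hab, hbr⟩)
        exact fun z hz => (this hz.1).1
    · rw [Set.sdiff_singleton_eq_self hk]; exact hB.conn k
  · intro i j hij
    exact (hB.disj _ _ hij).mono Set.sdiff_subset Set.sdiff_subset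
  · intro i j hij
    obtain ⟨a, ha, b, hb, hab⟩ := hB.adj i j hij
    refine ⟨a, ⟨ha, ?_⟩, b, ⟨hb, ?_⟩, hab⟩
    · rintro rfl
      obtain rfl := hr b hab
      exact Set.disjoint_left.1 (hB.disj _ _ hij.ne) (hyB i ha) hb
    · rintro rfl
      obtain rfl := hr a hab.symm
      exact Set.disjoint_left.1 (hB.disj _ _ hij.ne) ha (hyB j hb)

/-- `G[J]` has a Kuratowski minor. -/
def Kur (G : SimpleGraph V) (J : Set V) : Prop :=
  MinorIn (completeGraph (Fin 5)) G J ∨ MinorIn (completeBipartiteGraph (Fin 3) (Fin 3)) G J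

theorem Kur.mono {J' : Set V} (h : Kur G J) (hJ : J ⊆ J') : Kur G J' :=
  Or.imp (fun h => h.mono hJ) (fun h => h.mono hJ) h

theorem kur_of_obs (hc : c ∈ J) (h : Obs G (J \ {c}) ∅ {a | a ∈ J ∧ G.Adj c a}) : Kur G J := by
  have key : ∀ {K : Type} {H : SimpleGraph K}, (∀ k, ∃ k1 k2, k1 ≠ k2 ∧ H.Adj k k1 ∧ H.Adj k k2) →
      MinorIn H (rooted G ∅ {a | a ∈ J ∧ G.Adj c a}) (rootSet (J \ {c})) → MinorIn H G J := by
    intro K H hK hm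
    refine (hm.remove_pendant (r := .inr false) (y := .inr true) ?_ (by simp) hK).lift
      (fun x => Sum.elim (fun a => {a}) (fun _ => {c}) x) ?_ ?_ ?_ ?_
    · rintro (a | _ | _) h <;> simp at h ⊢
    · rintro (a | _ | _) ⟨ha, ha'⟩ <;> simp at ha ha' ⊢
      exacts [ha.1, hc]
    · rintro (a | _ | _) - <;> exact Conn.singleton _
    · rintro (a | _ | _) ⟨ha, ha'⟩ (b | _ | _) ⟨hb, hb'⟩ hab <;> simp at ha ha' hb hb' hab ⊢ <;> grind
    · rintro (a | _ | _) ⟨ha, ha'⟩ (b | _ | _) ⟨hb, hb'⟩ hab <;> simp at ha ha' hb hb' hab ⊢ <;> grind [G.adj_comm]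
  refine Or.imp (key ?_) (key ?_) h
  · simp only [completeGraph, SimpleGraph.top_adj]; decide
  · rintro (i | i)
    exacts [⟨.inr 0, .inr 1, by simp, by simp, by simp⟩, ⟨.inl 0, .inl 1, by simp, by simp, by simp⟩]

theorem exists_compo_not_mem (hJ : c ∈ J) {c' : V} (hc' : c' ∈ J) (hJc : J ≠ {c'}) (hcut : ¬ Conn G (J \ {c'})) :
    ∃ a ∈ J, a ≠ c' ∧ c ∉ compo G (J \ {c'}) a ∧ ∃ z ∈ J, z ≠ c' ∧ z ∉ compo G (J \ {c'}) a := by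
  have h1 : ∀ a ∈ J, a ≠ c' → ∃ z ∈ J, z ≠ c' ∧ z ∉ compo G (J \ {c'}) a := by
    intro a ha hac
    by_contra! h
    apply hcut
    rw [← show compo G (J \ {c'}) a = J \ {c'} from Set.Subset.antisymm compo_subset fun z hz => h z hz.1 hz.2]
    exact conn_compo ⟨ha, hac⟩
  have h2 : ∃ a ∈ J, a ≠ c' ∧ c ∉ compo G (J \ {c'}) a := by
    by_cases hcc : c = c'
    · subst hcc
      obtain ⟨a, haJ, hac⟩ : ∃ a ∈ J, a ≠ c := by
        by_contra! h
        exact hJc (Set.Subset.antisymm (fun x hx => h x hx) (by simpa using hJ))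
      exact ⟨a, haJ, hac, fun h => (compo_subset h).2 rfl⟩
    · obtain ⟨z, hz, hzc, hz'⟩ := h1 c hJ hcc
      refine ⟨z, hz, hzc, fun h => hz' ?_⟩
      exact (conn_compo (a := z) (show z ∈ J \ {c'} from ⟨hz, hzc⟩)).subset_compo compo_subset
        ⟨c, h, mem_compo_self ⟨hJ, hcc⟩⟩ (mem_compo_self ⟨hz, hzc⟩)
  obtain ⟨a, ha, hac, h3⟩ := h2
  exact ⟨a, ha, hac, h3, h1 a ha hac⟩

theorem Dk.del_all {p : Prop} (hp : p) {l r : List V} (h : Dk p A E (l ++ r)) : Dk p A E r := by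
  induction l with
  | nil => exact h
  | cons a l ih => exact ih (.del hp h)

theorem dk_of_not_kur [Finite V] (n : ℕ) : ∀ {J : Set V} {c : V}, J.ncard = n → Conn G J → c ∈ J → ¬ Kur G J →
    Dk True J (gon G J) [c] := by
  induction n using Nat.strong_induction_on with
  | _ n ih =>
    intro J c hn hJ hc hK
    by_cases hJc : J = {c}
    · subst hJc
      refine (Dk.single c).cast rfl ?_ rfl
      ext a b
      simp only [gon_adj, SimpleGraph.bot_adj, Set.mem_singleton_iff, false_iff]
      rintro ⟨rfl, rfl, h⟩
      exact G.loopless.irrefl _ h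
    by_cases hcut : ∃ c' ∈ J, J ≠ {c'} ∧ ¬ Conn G (J \ {c'})
    · obtain ⟨c', hc', hJc', hnc⟩ := hcut
      obtain ⟨a, ha, hac, hca, z, hz, hzc, hza⟩ := exists_compo_not_mem hc hc' hJc' hnc
      set D := compo G (J \ {c'}) a with hD
      have hDJ : D ⊆ J \ {c'} := compo_subset
      have hcl : ∀ x ∈ D, ∀ b ∈ J, G.Adj x b → b ∈ D ∨ b = c' := compo_closed
      have haD : a ∈ D := mem_compo_self ⟨ha, hac⟩
      have hcD : c' ∉ D := fun h => (hDJ h).2 rfl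
      have hJA : J \ D ⊆ J := Set.sdiff_subset
      have hJB : insert c' D ⊆ J := Set.insert_subset hc' (hDJ.trans Set.sdiff_subset)
      have cB : Conn G (insert c' D) :=
        (conn_compo (a := a) (show a ∈ J \ {c'} from ⟨ha, hac⟩)).insert_adj (hJ.adj_cut hc' (hDJ.trans Set.sdiff_subset) ⟨a, haD⟩ hcD hcl)
      have h1 := ih (J \ D).ncard (by
        rw [← hn]
        exact Set.ncard_lt_ncard ⟨hJA, fun h => (h ha).2 haD⟩ (Set.toFinite _)) rfl (hJ.diff hc' hcD hcl)
        ⟨hc, hca⟩ (fun h => hK (h.mono hJA))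
      have h2 := ih (insert c' D).ncard (by
        rw [← hn]
        exact Set.ncard_lt_ncard ⟨hJB, fun h => (h hz).elim hzc hza⟩ (Set.toFinite _)) rfl cB
        (Set.mem_insert _ _) (fun h => hK (h.mono hJB))
      have hAB : (J \ D) ∩ insert c' D = {c'} := by
        ext x; simp only [Set.mem_inter_iff, Set.mem_sdiff, Set.mem_insert_iff, Set.mem_singleton_iff]
        constructor
        · tauto
        · rintro rfl; exact ⟨⟨hc', hcD⟩, Or.inl rfl⟩
      have hun : (J \ D) ∪ insert c' D = J := by
        ext x; simp only [Set.mem_union, Set.mem_sdiff]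
        constructor
        · rintro (h | h); exacts [h.1, hJB h]
        · intro h; by_cases hx : x ∈ D
          exacts [Or.inr (Or.inr hx), Or.inl ⟨h, hx⟩]
      refine (h1.subst h2 ⟨hc', hcD⟩ hAB).cast hun ?_ rfl
      rw [gon_union (c := c') (show c' ∈ (J \ D) ∩ insert c' D from ⟨⟨hc', hcD⟩, Or.inl rfl⟩), hun]
      rintro a ⟨ha, haD⟩ b (rfl | hb) hab
      · exact Or.inr rfl
      · exact (hcl b hb a ha hab.symm).elim (fun h => absurd h haD) Or.inl
    · push Not at hcut
      have hJz' := hcut c hc hJc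
      have hnb : ∃ a ∈ J \ {c}, G.Adj c a :=
        hJ.adj_cut hc Set.sdiff_subset hJz'.1 (by simp) (fun a _ b hb _ => by
          by_cases h : b = c
          exacts [Or.inr h, Or.inl ⟨hb, h⟩])
      have hS : Splits G (J \ {c}) ∅ {a | a ∈ J ∧ G.Adj c a} := by
        refine splits_of_not_obs _ rfl hJz' (Set.empty_subset _) (fun a ha => ⟨ha.1, ha.2.ne'⟩) ?_ ?_
          (fun h => hK (kur_of_obs hc h))
        · obtain ⟨a, ha, hza⟩ := hnb
          exact ⟨a, Or.inr ⟨ha.1, hza⟩⟩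
        · intro d hd D hD hDne hdD hDJ hcl
          have hJd : J ≠ {d} := fun h => hd.2 (by rw [h] at hc; exact hc.symm)
          obtain ⟨a, ha⟩ := hDne
          have hDc : ∀ x ∈ D, x ∈ J \ {d} := fun x hx => ⟨(hD hx).1, fun h => hdD (h ▸ hx)⟩
          obtain ⟨x, -, hx, y, hy, hyD, hxy⟩ := (hcut d hd.1 hJd).exists_adj (hDc a ha) ha (b := c)
            ⟨hc, fun h => hd.2 h.symm⟩ (fun h => (hD h).2 rfl)
          by_cases hyz : y = c
          · subst hyz
            exact ⟨x, hx, Or.inr ⟨(hD hx).1, hxy.symm⟩⟩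
          · rcases hcl x hx y ⟨hy.1, hyz⟩ hxy with h | h
            exacts [absurd h hyD, absurd h hy.2]
      obtain ⟨P, Q, h, hP, hQ⟩ := hS
      obtain ⟨w, h1, hzw, -⟩ := h.attach_gon (z := c) (by simp) (fun a ha hza => hQ a ⟨ha.1, hza⟩) hnb
      rw [Set.insert_sdiff_singleton, Set.insert_eq_of_mem hc] at h1
      obtain ⟨u, v, rfl⟩ := List.append_of_mem hzw
      have h2 : Dk True J (gon G J) ((v ++ u) ++ [c]) := by
        have := Dk.rot (x := u ++ [c]) (y := v) (by simpa using h1.weaken (p := True))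
        simpa using this
      exact h2.del_all trivial

end Draw

theorem Conn.hang {V : Type*} {G : SimpleGraph V} {S S' : Set V} (hS : Conn G S) (hSS : S ⊆ S')
    (h : ∀ a ∈ S', a ∉ S → ∃ b ∈ S, G.Adj b a) : Conn G S' := by
  have := hS.union_iUnion (T := fun a : (S' \ S : Set V) => {a.1}) (fun _ => Conn.singleton _) (fun a => by
    obtain ⟨b, hb, hba⟩ := h a.1 a.2.1 a.2.2
    exact Or.inr ⟨b, hb, a.1, rfl, hba⟩)
  convert this
  ext x
  simp only [Set.mem_union, Set.mem_iUnion, Set.mem_singleton_iff]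
  constructor
  · intro hx
    by_cases hxS : x ∈ S
    exacts [Or.inl hxS, Or.inr ⟨⟨x, hx, hxS⟩, rfl⟩]
  · rintro (hx | ⟨y, rfl⟩)
    exacts [hSS hx, y.2.1]

theorem Conn.image {V W : Type*} {G : SimpleGraph V} {G' : SimpleGraph W} {S : Set V} (hS : Conn G S) (f : V → W)
    (hf : ∀ a ∈ S, ∀ b ∈ S, G.Adj a b → G'.Adj (f a) (f b)) : Conn G' (f '' S) := by
  have := conn_biUnion (G' := G') hS subset_rfl (φ := fun a => {f a}) (fun _ _ => Conn.singleton _)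
    (fun a ha b hb hab => ⟨f a, rfl, f b, rfl, hf a ha b hb hab⟩)
  convert this using 1
  ext x; simp [eq_comm]

/-- The infinite grid. -/
def gr : SimpleGraph (ℕ × ℕ) where
  Adj p q := (p.1 = q.1 ∧ (p.2 + 1 = q.2 ∨ q.2 + 1 = p.2)) ∨ (p.2 = q.2 ∧ (p.1 + 1 = q.1 ∨ q.1 + 1 = p.1))
  symm := ⟨fun p q h => by grind⟩
  loopless := ⟨fun p h => by grind⟩

theorem gr_adj {p q : ℕ × ℕ} : gr.Adj p q ↔
    (p.1 = q.1 ∧ (p.2 + 1 = q.2 ∨ q.2 + 1 = p.2)) ∨ (p.2 = q.2 ∧ (p.1 + 1 = q.1 ∨ q.1 + 1 = p.1)) := Iff.rfl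

theorem conn_row (a c : ℕ) (n : ℕ) : Conn gr {p | p.2 = c ∧ a ≤ p.1 ∧ p.1 ≤ a + n} := by
  induction n with
  | zero => convert Conn.singleton (G := gr) (a, c) using 1; ext p; simp [Prod.ext_iff]; omega
  | succ n ih =>
    convert ih.insert_adj (a := (a + n + 1, c)) ⟨(a + n, c), by simp, by simp [gr_adj]⟩ using 1
    ext p; simp [Prod.ext_iff]; omega

theorem conn_col (a c : ℕ) (n : ℕ) : Conn gr {p | p.1 = c ∧ a ≤ p.2 ∧ p.2 ≤ a + n} := by
  induction n with
  | zero => convert Conn.singleton (G := gr) (c, a) using 1; ext p; simp [Prod.ext_iff]; omega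
  | succ n ih =>
    convert ih.insert_adj (a := (c, a + n + 1)) ⟨(c, a + n), by simp, by simp [gr_adj]⟩ using 1
    ext p; simp [Prod.ext_iff]; omega

section Sem

variable {V : Type*} {A B : Set V} {E F : SimpleGraph V} {w : List V}

/-- A model of `E` in an `N × N` grid whose bottom row reads `w` at the positions `ps`. -/
structure GridModel (A : Set V) (E : SimpleGraph V) (w : List V) (φ : V → Set (ℕ × ℕ)) (N : ℕ) (ps : List ℕ) :
    Prop where
  sub : ∀ v p, p ∈ φ v → v ∈ A ∧ p.1 < N ∧ p.2 < N
  conn : ∀ v ∈ A, Conn gr (φ v)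
  disj : ∀ u v p, p ∈ φ u → p ∈ φ v → u = v
  adj : ∀ u v, E.Adj u v → ∃ a ∈ φ u, ∃ b ∈ φ v, gr.Adj a b
  sorted : ps.Pairwise (· ≤ ·)
  read : List.Forall₂ (fun i v => (i, 0) ∈ φ v) ps w

/-- There is a grid model reading `w`. -/
def Drawn (A : Set V) (E : SimpleGraph V) (w : List V) : Prop :=
  ∃ φ N ps, GridModel A E w φ N ps

theorem Drawn.single (v : V) : Drawn {v} ⊥ [v] := by
  classical
  refine ⟨fun u => if u = v then {(0, 0)} else ∅, 1, [0], ?_, ?_, ?_, ?_, by simp, by simp⟩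
  · intro u p hp; split_ifs at hp with h
    · obtain rfl : p = (0, 0) := hp
      simp [h]
    · exact absurd hp (by simp)
  · rintro u rfl; simpa using Conn.singleton _
  · intro u u' p hp hp'; split_ifs at hp hp' with h h' <;> simp_all
  · intro u u' h; exact absurd h (by simp)

theorem Drawn.dup {v : V} {y : List V} (h : Drawn A E (v :: y)) : Drawn A E (v :: v :: y) := by
  obtain ⟨φ, N, ps, h1, h2, h3, h4, h5, h6⟩ := h
  cases h6 with
  | @cons i _ ps _ hi h =>
    refine ⟨φ, N, i :: i :: ps, h1, h2, h3, h4, ?_, .cons hi (.cons hi h)⟩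
    rw [List.pairwise_cons] at h5 ⊢
    exact ⟨fun a ha => by rcases List.mem_cons.1 ha with rfl | ha; exacts [le_rfl, h5.1 a ha], List.pairwise_cons.2 h5⟩

theorem Drawn.del {v : V} {y : List V} (h : Drawn A E (v :: y)) : Drawn A E y := by
  obtain ⟨φ, N, ps, h1, h2, h3, h4, h5, h6⟩ := h
  cases h6 with
  | @cons i _ ps _ hi h => exact ⟨φ, N, ps, h1, h2, h3, h4, (List.pairwise_cons.1 h5).2, h⟩

theorem Drawn.del_middle {u : V} {g r : List V} (h : Drawn A E (u :: (g ++ r))) : Drawn A E (u :: r) := by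
  induction g with
  | nil => exact h
  | cons a g ih =>
    apply ih
    obtain ⟨φ, N, ps, h1, h2, h3, h4, h5, h6⟩ := h
    cases h6 with
    | @cons i _ ps _ hi h =>
      cases h with
      | @cons j _ ps _ hj h =>
        refine ⟨φ, N, i :: ps, h1, h2, h3, h4, ?_, .cons hi h⟩
        simp only [List.pairwise_cons, List.mem_cons] at h5 ⊢
        exact ⟨fun b hb => h5.1 b (Or.inr hb), h5.2.2⟩

theorem List.Forall₂.split {α β : Type*} {R : α → β → Prop} {y : List β} : ∀ {l : List α} {x : List β},
    List.Forall₂ R l (x ++ y) → ∃ l1 l2, l = l1 ++ l2 ∧ List.Forall₂ R l1 x ∧ List.Forall₂ R l2 y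
  | l, [], h => ⟨[], l, rfl, .nil, h⟩
  | _, _ :: _, .cons h1 h2 => by
    obtain ⟨l1, l2, rfl, h3, h4⟩ := List.Forall₂.split h2
    exact ⟨_ :: l1, l2, rfl, .cons h1 h3, h4⟩

theorem List.Forall₂.imp_mem {α β : Type*} {R R' : α → β → Prop} {l : List α} {y : List β}
    (h : List.Forall₂ R l y) (hR : ∀ a ∈ l, ∀ b, R a b → R' a b) : List.Forall₂ R' l y := by
  induction h with
  | nil => exact .nil
  | cons h1 _ ih => exact .cons (hR _ (by simp) _ h1) (ih fun a ha => hR a (by simp [ha]))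

theorem Drawn.edge {u v : V} {x y : List V} (h : Drawn A E (x ++ u :: v :: y)) (huv : u ≠ v) :
    Drawn A (E ⊔ SimpleGraph.edge u v) (x ++ u :: v :: y) := by
  obtain ⟨φ, N, ps, h1, h2, h3, h4, h5, h6⟩ := h
  obtain ⟨px, qx, rfl, h7, h8⟩ := h6.split
  cases h8 with
  | @cons i _ _ _ hi h8 =>
  cases h8 with
  | @cons j _ py _ hj h8 =>
  simp only [List.pairwise_append, List.pairwise_cons, List.mem_cons] at h5
  have hij : i < j := lt_of_le_of_ne (h5.2.1.1 j (Or.inl rfl)) (fun e => huv (h3 _ _ (i, 0) hi (e ▸ hj)))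
  have huA := (h1 _ _ hi).1
  set φ' : V → Set (ℕ × ℕ) := fun z =>
    {p | (∃ q ∈ φ z, p = (q.1, q.2 + 1)) ∨ (p.2 = 0 ∧ ((p.1 < i ∨ j ≤ p.1) ∧ (p.1, 0) ∈ φ z ∨ i ≤ p.1 ∧ p.1 < j ∧ z = u))}
    with hφ'
  have hread : ∀ a z, (a ≤ i ∨ j ≤ a) → (a, 0) ∈ φ z → (a, 0) ∈ φ' z := by
    intro a z ha haz
    rcases lt_or_ge a i with h | h
    · exact Or.inr ⟨rfl, Or.inl ⟨Or.inl h, haz⟩⟩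
    rcases lt_or_ge a j with h' | h'
    · obtain rfl : a = i := by omega
      exact Or.inr ⟨rfl, Or.inr ⟨le_rfl, h', h3 _ _ _ haz hi⟩⟩
    · exact Or.inr ⟨rfl, Or.inl ⟨Or.inr h', haz⟩⟩
  have hsh : ∀ z, Conn gr (φ z) → Conn gr ((fun q : ℕ × ℕ => (q.1, q.2 + 1)) '' φ z) := fun z hz =>
    hz.image _ (fun a _ b _ h => by simp only [gr_adj] at h ⊢; omega)
  refine ⟨φ', N + 1, px ++ i :: j :: py, ?_, ?_, ?_, ?_, ?_, ?_⟩
  · rintro z p (⟨q, hq, rfl⟩ | ⟨hp, ⟨-, h⟩ | ⟨ha, hb, rfl⟩⟩)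
    · have := h1 _ _ hq; exact ⟨this.1, by simp; omega, by simp; omega⟩
    · have := h1 _ _ h; exact ⟨this.1, by simp at this; omega, by omega⟩
    · have := (h1 _ _ hj).2; exact ⟨huA, by simp at this; omega, by omega⟩
  · intro z hz
    by_cases hzu : z = u
    · subst hzu
      have hc := (hsh z (h2 z hz)).union_adj (conn_row i 0 (j - 1 - i))
        ⟨(i, 1), ⟨(i, 0), hi, rfl⟩, (i, 0), by simp, by simp [gr_adj]⟩
      refine hc.hang ?_ ?_
      · rintro p (⟨q, hq, rfl⟩ | ⟨hp, ha, hb⟩)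
        exacts [Or.inl ⟨q, hq, rfl⟩, Or.inr ⟨hp, Or.inr ⟨ha, by omega, rfl⟩⟩]
      · rintro p (⟨q, hq, rfl⟩ | ⟨hp, ⟨-, h⟩ | ⟨ha, hb, -⟩⟩) hp'
        · exact absurd (Or.inl ⟨q, hq, rfl⟩) hp'
        · exact ⟨(p.1, 1), Or.inl ⟨_, h, rfl⟩, by simp [gr_adj, hp]⟩
        · exact absurd (Or.inr ⟨hp, ha, by omega⟩) hp'
    · refine (hsh z (h2 z hz)).hang ?_ ?_
      · rintro p ⟨q, hq, rfl⟩; exact Or.inl ⟨q, hq, rfl⟩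
      · rintro p (⟨q, hq, rfl⟩ | ⟨hp, ⟨-, h⟩ | ⟨ha, hb, h⟩⟩) hp'
        · exact absurd ⟨q, hq, rfl⟩ hp'
        · exact ⟨(p.1, 1), ⟨_, h, rfl⟩, by simp [gr_adj, hp]⟩
        · exact absurd h hzu
  · rintro z z' p (⟨q, hq, rfl⟩ | ⟨hp, ⟨hr, h⟩ | ⟨ha, hb, rfl⟩⟩) (⟨q', hq', he⟩ | ⟨hp', ⟨hr', h'⟩ | ⟨ha', hb', rfl⟩⟩)
    all_goals try first | rfl | (exfalso; omega) | (exfalso; rw [he] at hp; simp at hp)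
    · have : q = q' := by ext <;> simp_all
      exact h3 _ _ _ hq (this ▸ hq')
    · exact h3 _ _ _ h h'
  · intro a b hab
    rw [SimpleGraph.sup_adj, edge_adj_iff] at hab
    have key : ∃ p ∈ φ' u, ∃ q ∈ φ' v, gr.Adj p q :=
      ⟨(j - 1, 0), Or.inr ⟨rfl, Or.inr ⟨by simp; omega, by simp; omega, rfl⟩⟩, (j, 0),
        hread j v (Or.inr le_rfl) hj, by simp [gr_adj]; omega⟩
    rcases hab with hab | hab
    · obtain ⟨p, hp, q, hq, hpq⟩ := h4 a b hab
      exact ⟨(p.1, p.2 + 1), Or.inl ⟨p, hp, rfl⟩, (q.1, q.2 + 1), Or.inl ⟨q, hq, rfl⟩, by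
        simp only [gr_adj] at hpq ⊢; omega⟩
    · obtain ⟨p, hp, q, hq, hpq⟩ := key
      rcases hab with ⟨⟨rfl, rfl⟩ | ⟨rfl, rfl⟩, -⟩
      exacts [⟨p, hp, q, hq, hpq⟩, ⟨q, hq, p, hp, hpq.symm⟩]
  · simp only [List.pairwise_append, List.pairwise_cons, List.mem_cons]; exact h5
  · refine h6.imp_mem (fun a ha z => hread a z ?_)
    rcases List.mem_append.1 ha with ha | ha
    · exact Or.inl (h5.2.2 a ha i (Or.inl rfl))
    · simp only [List.mem_cons] at ha
      rcases ha with rfl | rfl | ha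
      exacts [Or.inl le_rfl, Or.inr le_rfl, Or.inr (h5.2.1.2.1 a ha)]

theorem conn_frame (i N : ℕ) : Conn gr ({p | p.2 = 0 ∧ p.1 ≤ i} ∪ {p | p.1 = 0 ∧ p.2 ≤ N} ∪
    {p | p.2 = N ∧ p.1 ≤ N} ∪ {p | p.1 = N ∧ p.2 ≤ N}) := by
  have h1 := conn_row 0 0 i
  have h2 := conn_col 0 0 N
  have h3 := conn_row 0 N N
  have h4 := conn_col 0 N N
  simp only [zero_add, Nat.zero_le, true_and] at h1 h2 h3 h4
  exact ((h1.union h2 ⟨(0, 0), by simp⟩).union h3 ⟨(0, N), by simp⟩).union h4 ⟨(N, N), by simp⟩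

theorem Drawn.rot_one {a : V} {x : List V} (h : Drawn A E (a :: x)) : Drawn A E (x ++ [a]) := by
  obtain ⟨φ, N, ps, h1, h2, h3, h4, h5, h6⟩ := h
  cases h6 with
  | @cons i _ ps _ hi h6 =>
  rw [List.pairwise_cons] at h5
  have haA := (h1 _ _ hi).1
  have hiN := (h1 _ _ hi).2.1
  set fr : Set (ℕ × ℕ) := {p | p.2 = 0 ∧ p.1 ≤ i + 1} ∪ {p | p.1 = 0 ∧ p.2 ≤ N + 1} ∪
    {p | p.2 = N + 1 ∧ p.1 ≤ N + 1} ∪ {p | p.1 = N + 1 ∧ p.2 ≤ N + 1} with hfr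
  have hfm : ∀ p, p ∈ fr ↔ (p.2 = 0 ∧ p.1 ≤ i + 1) ∨ (p.1 = 0 ∧ p.2 ≤ N + 1) ∨
      (p.2 = N + 1 ∧ p.1 ≤ N + 1) ∨ (p.1 = N + 1 ∧ p.2 ≤ N + 1) := by
    intro p; simp only [hfr, Set.mem_union, Set.mem_ofPred_eq]; tauto
  set φ' : V → Set (ℕ × ℕ) := fun z =>
    {p | (∃ q ∈ φ z, p = (q.1 + 1, q.2 + 1)) ∨ (∃ c, i < c ∧ (c, 0) ∈ φ z ∧ p = (c + 1, 0)) ∨ (p ∈ fr ∧ z = a)}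
    with hφ'
  have hsh : ∀ z, Conn gr (φ z) → Conn gr ((fun q : ℕ × ℕ => (q.1 + 1, q.2 + 1)) '' φ z) := fun z hz =>
    hz.image _ (fun a _ b _ h => by simp only [gr_adj] at h ⊢; omega)
  refine ⟨φ', N + 2, ps.map (· + 1) ++ [N + 1], ?_, ?_, ?_, ?_, ?_, ?_⟩
  · rintro z p (⟨q, hq, rfl⟩ | ⟨c, -, hc, rfl⟩ | ⟨hp, rfl⟩)
    · have := h1 _ _ hq; exact ⟨this.1, by simp; omega, by simp; omega⟩
    · have := h1 _ _ hc; exact ⟨this.1, by simp at this ⊢; omega, by simp⟩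
    · rw [hfm] at hp; exact ⟨haA, by omega, by omega⟩
  · intro z hz
    by_cases hza : z = a
    · subst hza
      have hc := (hsh z (h2 z hz)).union_adj (conn_frame (i + 1) (N + 1))
        ⟨(i + 1, 1), ⟨(i, 0), hi, rfl⟩, (i + 1, 0), (hfm _).2 (by simp), by simp [gr_adj]⟩
      refine hc.hang ?_ ?_
      · rintro p (⟨q, hq, rfl⟩ | hp)
        exacts [Or.inl ⟨q, hq, rfl⟩, Or.inr (Or.inr ⟨hp, rfl⟩)]
      · rintro p (⟨q, hq, rfl⟩ | ⟨c, -, hc, rfl⟩ | ⟨hp, -⟩) hp'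
        · exact absurd (Or.inl ⟨q, hq, rfl⟩) hp'
        · exact ⟨(c + 1, 1), Or.inl ⟨_, hc, rfl⟩, by simp [gr_adj]⟩
        · exact absurd (Or.inr hp) hp'
    · refine (hsh z (h2 z hz)).hang ?_ ?_
      · rintro p ⟨q, hq, rfl⟩; exact Or.inl ⟨q, hq, rfl⟩
      · rintro p (⟨q, hq, rfl⟩ | ⟨c, -, hc, rfl⟩ | ⟨hp, h⟩) hp'
        · exact absurd ⟨q, hq, rfl⟩ hp'
        · exact ⟨(c + 1, 1), ⟨_, hc, rfl⟩, by simp [gr_adj]⟩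
        · exact absurd h hza
  · have e1 : ∀ z q, q ∈ φ z → (q.1 + 1, q.2 + 1) ∉ fr := fun z q hq h => by
      rw [hfm] at h; have := (h1 _ _ hq).2; simp at h; omega
    have e2 : ∀ z c, i < c → (c, 0) ∈ φ z → (c + 1, 0) ∉ fr := fun z c hic hc h => by
      rw [hfm] at h; have := (h1 _ _ hc).2; simp at h this; omega
    rintro z z' p (⟨q, hq, rfl⟩ | ⟨c, hic, hc, rfl⟩ | ⟨hp, rfl⟩) (⟨q', hq', he⟩ | ⟨c', hic', hc', he⟩ | ⟨hp', rfl⟩)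
    · have : q = q' := by ext <;> simp_all
      exact h3 _ _ _ hq (this ▸ hq')
    · simp at he
    · exact absurd hp' (e1 _ _ hq)
    · simp at he
    · obtain rfl : c = c' := by simpa using he
      exact h3 _ _ _ hc hc'
    · exact absurd hp' (e2 _ _ hic hc)
    · exact absurd (he ▸ hp) (e1 _ _ hq')
    · exact absurd (he ▸ hp) (e2 _ _ hic' hc')
    · rfl
  · intro u v huv
    obtain ⟨p, hp, q, hq, hpq⟩ := h4 u v huv
    exact ⟨(p.1 + 1, p.2 + 1), Or.inl ⟨p, hp, rfl⟩, (q.1 + 1, q.2 + 1), Or.inl ⟨q, hq, rfl⟩, by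
      simp only [gr_adj] at hpq ⊢; omega⟩
  · have hlt : ∀ (l : List ℕ) (y : List V), List.Forall₂ (fun i v => (i, 0) ∈ φ v) l y → ∀ b ∈ l, b < N := by
      intro l y h
      induction h with
      | nil => simp
      | cons h _ ih => intro b hb; rcases List.mem_cons.1 hb with rfl | hb; exacts [(h1 _ _ h).2.1, ih b hb]
    rw [List.pairwise_append]
    refine ⟨List.pairwise_map.2 (h5.2.imp fun h => by omega), by simp, ?_⟩
    intro b hb c hc
    obtain ⟨d, hd, rfl⟩ := List.mem_map.1 hb
    obtain rfl : c = N + 1 := by simpa using hc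
    have := hlt _ _ h6 d hd
    omega
  · refine List.rel_append (List.forall₂_map_left_iff.2 (h6.imp_mem fun b hb z hz => ?_)) (.cons ?_ .nil)
    · rcases (h5.1 b hb).lt_or_eq with h | rfl
      · exact Or.inr (Or.inl ⟨b, h, hz, rfl⟩)
      · exact Or.inr (Or.inr ⟨(hfm _).2 (by simp), h3 _ _ _ hz hi⟩)
    · exact Or.inr (Or.inr ⟨(hfm _).2 (by simp), rfl⟩)

theorem Drawn.rot {x y : List V} (h : Drawn A E (x ++ y)) : Drawn A E (y ++ x) := by
  induction x generalizing y with
  | nil => simpa using h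
  | cons a x ih =>
    have := ih (y := y ++ [a]) (by simpa using Drawn.rot_one (x := x ++ y) (by simpa using h))
    simpa using this

theorem Drawn.union {x y : List V} (h : Drawn A E x) (h' : Drawn B F y) (hAB : Disjoint A B) :
    Drawn (A ∪ B) (E ⊔ F) (x ++ y) := by
  obtain ⟨φ, N, ps, h1, h2, h3, h4, h5, h6⟩ := h
  obtain ⟨ψ, M, qs, k1, k2, k3, k4, k5, k6⟩ := h'
  rw [Set.disjoint_left] at hAB
  have hsh : ∀ z, Conn gr (ψ z) → Conn gr ((fun q : ℕ × ℕ => (q.1 + N, q.2)) '' ψ z) := fun z hz =>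
    hz.image _ (fun a _ b _ h => by simp only [gr_adj] at h ⊢; omega)
  refine ⟨fun z => φ z ∪ (fun q : ℕ × ℕ => (q.1 + N, q.2)) '' ψ z, N + M, ps ++ qs.map (· + N), ?_, ?_, ?_, ?_, ?_, ?_⟩
  · rintro z p (hp | ⟨q, hq, rfl⟩)
    · have := h1 _ _ hp; exact ⟨Or.inl this.1, by omega, by omega⟩
    · have := k1 _ _ hq; exact ⟨Or.inr this.1, by simp; omega, by simp; omega⟩
  · rintro z (hz | hz)
    · rw [show ψ z = ∅ from Set.eq_empty_of_forall_notMem fun q hq => hAB hz (k1 _ _ hq).1]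
      simpa using h2 z hz
    · rw [show φ z = ∅ from Set.eq_empty_of_forall_notMem fun q hq => hAB (h1 _ _ hq).1 hz]
      simpa using hsh z (k2 z hz)
  · rintro z z' p (hp | ⟨q, hq, rfl⟩) (hp' | ⟨q', hq', he⟩)
    · exact h3 _ _ _ hp hp'
    · have := (h1 _ _ hp).2; rw [← he] at this; simp at this
    · have := (h1 _ _ hp').2; simp at this
    · have : q = q' := by simp at he; ext <;> omega
      exact k3 _ _ _ hq (this ▸ hq')
  · rintro u v (huv | huv)
    · obtain ⟨p, hp, q, hq, hpq⟩ := h4 u v huv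
      exact ⟨p, Or.inl hp, q, Or.inl hq, hpq⟩
    · obtain ⟨p, hp, q, hq, hpq⟩ := k4 u v huv
      exact ⟨_, Or.inr ⟨p, hp, rfl⟩, _, Or.inr ⟨q, hq, rfl⟩, by simp only [gr_adj] at hpq ⊢; omega⟩
  · have hlt : ∀ (l : List ℕ) (y : List V), List.Forall₂ (fun i v => (i, 0) ∈ φ v) l y → ∀ b ∈ l, b < N := by
      intro l y h
      induction h with
      | nil => simp
      | cons h _ ih => intro b hb; rcases List.mem_cons.1 hb with rfl | hb; exacts [(h1 _ _ h).2.1, ih b hb]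
    rw [List.pairwise_append]
    refine ⟨h5, List.pairwise_map.2 (k5.imp fun h => by omega), ?_⟩
    intro b hb c hc
    obtain ⟨d, hd, rfl⟩ := List.mem_map.1 hc
    have := hlt _ _ h6 b hb
    omega
  · refine List.rel_append (h6.imp_mem fun b _ z hz => Or.inl hz) (List.forall₂_map_left_iff.2 (k6.imp_mem fun b _ z hz => ?_))
    exact Or.inr ⟨_, hz, rfl⟩

theorem Dk.drawn {p : Prop} (h : Dk p A E w) : Drawn A E w := by
  induction h with
  | single v => exact .single v
  | dup _ ih => exact ih.dup
  | undup _ ih => exact ih.del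
  | rot _ ih => exact ih.rot
  | del _ _ ih => exact ih.del
  | chord _ huv ih =>
    have := Drawn.edge (x := []) (Drawn.del_middle (by simpa using ih)) huv
    simpa using this
  | @join A B E F a b x y d1 d2 hAB ih1 ih2 =>
    have e1 := ih1.dup.rot_one
    have e2 := ih2.dup.rot_one
    have h3 := e1.union e2 hAB
    have hab : a ≠ b := fun e => Set.disjoint_left.1 hAB (d1.mem.1 a (by simp)) (e ▸ d2.mem.1 b (by simp))
    have h4 := Drawn.edge (x := a :: x) (u := a) (v := b) (y := y ++ [b]) (by simpa using h3) hab
    simpa using h4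

/-- Wagner's theorem combined with grid embeddings: a connected graph without a Kuratowski minor is
a minor of a grid. -/
theorem exists_grid_minor {K : Type*} [Finite K] {H : SimpleGraph K} (hH : H.Connected)
    (h5 : ¬ IsMinor (completeGraph (Fin 5)) H) (h33 : ¬ IsMinor (completeBipartiteGraph (Fin 3) (Fin 3)) H) :
    ∃ N, MinorIn H gr {p | p.1 < N ∧ p.2 < N} := by
  obtain ⟨c⟩ := hH.nonempty
  have hc : Conn H Set.univ := conn_iff.1 ((SimpleGraph.induceUnivIso H).connected_iff.2 hH)
  obtain ⟨φ, N, ps, h1, h2, h3, h4, -, -⟩ := (dk_of_not_kur _ rfl hc (Set.mem_univ c) (by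
    rintro (h | h); exacts [h5 (isMinor_iff.2 h), h33 (isMinor_iff.2 h)])).drawn
  refine ⟨N, φ, fun u p hp => (h1 u p hp).2, fun u => h2 u trivial, ?_, ?_⟩
  · intro u v huv
    rw [Set.disjoint_left]
    exact fun p hp hp' => huv (h3 u v p hp hp')
  · intro u v huv
    exact h4 u v (by simp [gon_adj, huv])

end Sem

section Menger

variable {V : Type*} {G Γ : SimpleGraph V} {A B S X : Set V}

/-- `S` meets every connected set meeting both `A` and `B`. -/
def Separates (G : SimpleGraph V) (A B S : Set V) : Prop :=
  ∀ T, Conn G T → (T ∩ A).Nonempty → (T ∩ B).Nonempty → (T ∩ S).Nonempty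

/-- Every separator of `A` and `B` has at least `q` vertices. -/
def Linked (G : SimpleGraph V) (A B : Set V) (q : ℕ) : Prop :=
  ∀ S, Separates G A B S → q ≤ S.ncard

theorem Separates.symm (h : Separates G A B S) : Separates G B A S := fun T h1 h2 h3 => h T h1 h3 h2

theorem Linked.symm {q : ℕ} (h : Linked G A B q) : Linked G B A q := fun S hS => h S hS.symm

/-- Disjoint connected sets linking `A` and `B`. -/
def HasLinkage (G : SimpleGraph V) (A B : Set V) (q : ℕ) : Prop :=
  ∃ t : Fin q → Set V, (∀ i, Conn G (t i) ∧ (t i ∩ A).Nonempty ∧ (t i ∩ B).Nonempty) ∧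
    ∀ i j, i ≠ j → Disjoint (t i) (t j)

/-- `v` can be reached from `A` without using `S`. -/
def Reach (G : SimpleGraph V) (A S : Set V) (v : V) : Prop :=
  ∃ T, Conn G T ∧ (T ∩ A).Nonempty ∧ Disjoint T S ∧ v ∈ T

theorem Separates.not_reach (h : Separates G A B S) {v : V} (ha : Reach G A S v) (hb : Reach G B S v) : False := by
  obtain ⟨T, h1, h2, h3, h4⟩ := ha
  obtain ⟨T', h1', h2', h3', h4'⟩ := hb
  obtain ⟨z, hz, hzS⟩ := h _ (h1.union h1' ⟨v, h4, h4'⟩) (h2.mono (Set.inter_subset_inter_left _ Set.subset_union_left))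
    (h2'.mono (Set.inter_subset_inter_left _ Set.subset_union_right))
  exact hz.elim (fun h => Set.disjoint_left.1 h3 h hzS) (fun h => Set.disjoint_left.1 h3' h hzS)

theorem IsTrack.take_until_lt {p : List V} {a b c : V} (h : IsTrack G p a b) (hc : c ∈ p) (hcb : c ≠ b) :
    ∃ q, q <+: p ∧ IsTrack G q a c ∧ b ∉ q := by
  obtain ⟨q, ⟨r, rfl⟩, hq⟩ := h.take_until hc
  refine ⟨q, ⟨r, rfl⟩, hq, fun hb => ?_⟩
  cases r with
  | nil =>
    have := h.last
    rw [List.append_nil, hq.last] at this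
    exact hcb (by simpa using this)
  | cons x r =>
    have h1 := h.last
    rw [List.getLast?_append_of_ne_nil _ (by simp)] at h1
    exact (List.nodup_append.1 h.nodup).2.2 b hb b (List.mem_of_mem_getLast? h1) rfl

theorem exists_arm {T : Set V} (hT : Conn G T) (hA : (T ∩ A).Nonempty) (hX : (T ∩ X).Nonempty) (hSX : S ⊆ X) :
    ∃ P ⊆ T, ∃ b ∈ P, Conn G P ∧ (P ∩ A).Nonempty ∧ b ∈ X ∧ (∀ z ∈ P, z ∈ X → z = b) ∧
      ∀ v ∈ P, v ∉ S → Reach G A S v := by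
  obtain ⟨a, haT, haA⟩ := hA
  obtain ⟨p, b, hp, hpT, hbX, hb⟩ := hT.exists_track haT hX
  refine ⟨{x | x ∈ p}, hpT, b, hp.mem_last, hp.conn, ⟨a, hp.mem_head, haA⟩, hbX, hb, fun v hv hvS => ?_⟩
  by_cases hvb : v = b
  · subst hvb
    exact ⟨_, hp.conn, ⟨a, hp.mem_head, haA⟩, Set.disjoint_left.2 fun z hz hzS => hvS (hb z hz (hSX hzS) ▸ hzS), hv⟩
  · obtain ⟨q, hqp, hq, hbq⟩ := hp.take_until_lt hv hvb
    exact ⟨_, hq.conn, ⟨a, hq.mem_head, haA⟩, Set.disjoint_left.2 fun z hz hzS =>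
      hbq (hb z (hqp.subset hz) (hSX hzS) ▸ hz), hq.mem_last⟩

theorem exists_arms {q : ℕ} (h : HasLinkage G A X q) (hSX : S ⊆ X) :
    ∃ (P : Fin q → Set V) (b : Fin q → V), (∀ i, Conn G (P i)) ∧ (∀ i, (P i ∩ A).Nonempty) ∧ (∀ i, b i ∈ P i) ∧
      (∀ i, b i ∈ X) ∧ (∀ i, ∀ z ∈ P i, z ∈ X → z = b i) ∧ (∀ i, ∀ v ∈ P i, v ∉ S → Reach G A S v) ∧
      ∀ i j, i ≠ j → Disjoint (P i) (P j) := by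
  obtain ⟨t, ht, hd⟩ := h
  choose P hP b hb h1 h2 h3 h4 h5 using fun i => exists_arm (ht i).1 (ht i).2.1 (ht i).2.2 hSX
  exact ⟨P, b, h1, h2, hb, h3, h4, h5, fun i j hij => (hd i j hij).mono (hP i) (hP j)⟩

variable {x y : V}

theorem adj_delete_iff {u v : V} : (Γ.deleteEdges {s(x, y)}).Adj u v ↔
    Γ.Adj u v ∧ ¬ (u = x ∧ v = y ∨ u = y ∧ v = x) := by
  simp [SimpleGraph.deleteEdges_adj]

theorem Conn.delete {T : Set V} {a : V} (hT : Conn Γ T) (ha : a ∈ T)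
    (hx : x ∉ compo (Γ.deleteEdges {s(x, y)}) T a) (hy : y ∉ compo (Γ.deleteEdges {s(x, y)}) T a) :
    Conn (Γ.deleteEdges {s(x, y)}) T ∧ T ⊆ compo (Γ.deleteEdges {s(x, y)}) T a := by
  have h1 : T ⊆ compo (Γ.deleteEdges {s(x, y)}) T a := hT.2 _ ⟨a, ha, mem_compo_self ha⟩ (by
    intro u _ huD v hv huv
    refine mem_compo_of_adj huD hv (adj_delete_iff.2 ⟨huv, ?_⟩)
    rintro (⟨rfl, -⟩ | ⟨rfl, -⟩)
    exacts [hx huD, hy huD])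
  exact ⟨by rw [Set.Subset.antisymm h1 compo_subset]; exact conn_compo ha, h1⟩

theorem Linked.half {q : ℕ} (h : Linked Γ A B q) (hS : Separates (Γ.deleteEdges {s(x, y)}) A B S)
    (hy : ¬ Reach (Γ.deleteEdges {s(x, y)}) A S y) : Linked (Γ.deleteEdges {s(x, y)}) A (insert x S) q := by
  intro R hR
  refine h R fun T hT hTA hTB => ?_
  by_contra hTR
  obtain ⟨a, haT, haA⟩ := hTA
  set D := compo (Γ.deleteEdges {s(x, y)}) T a with hD
  have haD : a ∈ D := mem_compo_self haT
  have hDS : ¬ (D ∩ insert x S).Nonempty := fun h' => by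
    obtain ⟨z, hz, hzR⟩ := hR D (conn_compo haT) ⟨a, haD, haA⟩ h'
    exact hTR ⟨z, compo_subset hz, hzR⟩
  have hxD : x ∉ D := fun h' => hDS ⟨x, h', Or.inl rfl⟩
  have hyD : y ∉ D := fun h' => hy ⟨D, conn_compo haT, ⟨a, haD, haA⟩,
    Set.disjoint_left.2 fun z hz hzS => hDS ⟨z, hz, Or.inr hzS⟩, h'⟩
  obtain ⟨h1, h2⟩ := hT.delete haT hxD hyD
  obtain ⟨z, hz, hzS⟩ := hS T h1 ⟨a, haT, haA⟩ hTB
  exact hDS ⟨z, h2 hz, Or.inr hzS⟩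

theorem Linked.half_swap {q : ℕ} (h : Linked Γ A B q) (hS : Separates (Γ.deleteEdges {s(x, y)}) A B S)
    (hx : ¬ Reach (Γ.deleteEdges {s(x, y)}) A S x) : Linked (Γ.deleteEdges {s(x, y)}) A (insert y S) q := by
  rw [Sym2.eq_swap] at hS hx ⊢
  exact h.half hS hx

theorem HasLinkage.symm {q : ℕ} (h : HasLinkage Γ A B q) : HasLinkage Γ B A q := by
  obtain ⟨t, ht, hd⟩ := h
  exact ⟨t, fun i => ⟨(ht i).1, (ht i).2.2, (ht i).2.1⟩, hd⟩

theorem exists_index [Finite V] {q : ℕ} {b : Fin q → V} (hb : ∀ i, b i ∈ X) (hinj : Function.Injective b)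
    (hX : X.ncard ≤ q) {z : V} (hz : z ∈ X) : ∃ i, b i = z := by
  have hb' : Function.Injective (fun i => (⟨b i, hb i⟩ : X)) := fun i j hij => hinj (by simpa using hij)
  have := hb'.bijective_of_nat_card_le (by rw [Nat.card_coe_set_eq]; simpa using hX)
  obtain ⟨i, hi⟩ := this.2 ⟨z, hz⟩
  exact ⟨i, by simpa using hi⟩

theorem HasLinkage.join [Finite V] {q : ℕ} (hxy : Γ.Adj x y) (hS : Separates (Γ.deleteEdges {s(x, y)}) A B S)
    (hy : y ∉ S) (hq : S.ncard < q)
    (h1 : HasLinkage (Γ.deleteEdges {s(x, y)}) A (insert x S) q)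
    (h2 : HasLinkage (Γ.deleteEdges {s(x, y)}) B (insert y S) q) : HasLinkage Γ A B q := by
  obtain ⟨P, b, p1, p2, p3, p4, p5, p6, p7⟩ := exists_arms h1 (Set.subset_insert x S)
  obtain ⟨Q, c, q1, q2, q3, q4, q5, q6, q7⟩ := exists_arms h2 (Set.subset_insert y S)
  have hcinj : Function.Injective c := fun i j hij => by
    by_contra hne
    exact Set.disjoint_left.1 (q7 i j hne) (q3 i) (hij ▸ q3 j)
  have hbinj : Function.Injective b := fun i j hij => by
    by_contra hne
    exact Set.disjoint_left.1 (p7 i j hne) (p3 i) (hij ▸ p3 j)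
  have hcard : (insert y S).ncard ≤ q := (Set.ncard_insert_le y S).trans hq
  have hle : Γ.deleteEdges {s(x, y)} ≤ Γ := SimpleGraph.deleteEdges_le _
  have hj : ∀ i, ∃ k, (b i = x ∧ c k = y) ∨ (b i ≠ x ∧ c k = b i) := by
    intro i
    by_cases hbx : b i = x
    · obtain ⟨k, hk⟩ := exists_index q4 hcinj hcard (Set.mem_insert y S)
      exact ⟨k, Or.inl ⟨hbx, hk⟩⟩
    · obtain ⟨k, hk⟩ := exists_index q4 hcinj hcard (z := b i) (Or.inr ((p4 i).resolve_left hbx))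
      exact ⟨k, Or.inr ⟨hbx, hk⟩⟩
  choose j hj using hj
  have hPQ : ∀ i k, i ≠ k → Disjoint (P i) (Q (j k)) := by
    intro i k hik
    rw [Set.disjoint_left]
    intro v hvP hvQ
    have hvS : v ∈ S := by
      by_contra hvS
      exact hS.not_reach (p6 i v hvP hvS) (q6 _ v hvQ hvS)
    have e1 := p5 i v hvP (Or.inr hvS)
    have e2 := q5 _ v hvQ (Or.inr hvS)
    rcases hj k with ⟨-, h⟩ | ⟨-, h⟩
    · rw [h] at e2; exact hy (e2 ▸ hvS)
    · exact hik (hbinj (by rw [← e1, e2, h]))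
  refine ⟨fun i => P i ∪ Q (j i), fun i => ⟨?_, ?_, ?_⟩, fun i k hik => ?_⟩
  · rcases hj i with ⟨h, h'⟩ | ⟨h, h'⟩
    · exact ((p1 i).mono_le hle).union_adj ((q1 _).mono_le hle) ⟨b i, p3 i, c (j i), q3 _, by rw [h, h']; exact hxy⟩
    · exact ((p1 i).mono_le hle).union ((q1 _).mono_le hle) ⟨b i, p3 i, h' ▸ q3 _⟩
  · exact (p2 i).mono (Set.inter_subset_inter_left _ Set.subset_union_left)
  · exact (q2 _).mono (Set.inter_subset_inter_left _ Set.subset_union_right)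
  · have hjik : j i ≠ j k := by
      intro e
      apply hik
      apply hbinj
      rcases hj i with ⟨h, h'⟩ | ⟨h, h'⟩ <;> rcases hj k with ⟨g, g'⟩ | ⟨g, g'⟩
      · rw [h, g]
      · rw [e, g'] at h'; exact absurd (h' ▸ (p4 k).resolve_left g) hy
      · rw [e, g'] at h'; exact absurd (h' ▸ (p4 i).resolve_left h) hy
      · rw [← h', ← g', e]
    rw [Set.disjoint_union_left, Set.disjoint_union_right, Set.disjoint_union_right]
    exact ⟨⟨p7 i k hik, hPQ i k hik⟩, (hPQ k i hik.symm).symm, q7 _ _ hjik⟩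

theorem HasLinkage.mono_le {q : ℕ} (h : HasLinkage G A B q) (hG : G ≤ Γ) : HasLinkage Γ A B q := by
  obtain ⟨t, ht, hd⟩ := h
  exact ⟨t, fun i => ⟨(ht i).1.mono_le hG, (ht i).2⟩, hd⟩

theorem Linked.hasLinkage_of_subset [Finite V] {q : ℕ} (h : q ≤ (A ∩ B).ncard) : HasLinkage Γ A B q := by
  obtain ⟨f⟩ : Nonempty (Fin q ↪ (A ∩ B : Set V)) := by
    have := Fintype.ofFinite (A ∩ B : Set V)
    rw [Function.Embedding.nonempty_iff_card_le]
    rw [← Nat.card_coe_set_eq, Nat.card_eq_fintype_card] at h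
    simpa using h
  refine ⟨fun i => {(f i).1}, fun i => ⟨Conn.singleton _, ⟨_, rfl, (f i).2.1⟩, ⟨_, rfl, (f i).2.2⟩⟩, fun i j hij => ?_⟩
  simp only [Set.disjoint_singleton]
  exact fun e => hij (f.injective (Subtype.ext e))

/-- Menger's theorem. -/
theorem Linked.hasLinkage [Finite V] (n : ℕ) : ∀ {Γ : SimpleGraph V} {A B : Set V} {q : ℕ}, Γ.edgeSet.ncard = n →
    Linked Γ A B q → HasLinkage Γ A B q := by
  induction n using Nat.strong_induction_on with
  | _ n ih =>
    intro Γ A B q hn h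
    by_cases hE : ∃ x y, Γ.Adj x y
    swap
    · push Not at hE
      refine hasLinkage_of_subset (h _ ?_)
      rintro T hT ⟨a, haT, haA⟩ ⟨b, hbT, hbB⟩
      have : T ⊆ {a} := hT.2 {a} ⟨a, haT, rfl⟩ fun u _ _ v _ huv => absurd huv (hE u v)
      obtain rfl : b = a := this hbT
      exact ⟨b, haT, haA, hbB⟩
    obtain ⟨x, y, hxy⟩ := hE
    set Γ' := Γ.deleteEdges {s(x, y)} with hΓ'
    have hle : Γ' ≤ Γ := SimpleGraph.deleteEdges_le _
    have hlt : Γ'.edgeSet.ncard < n := by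
      rw [← hn]
      refine Set.ncard_lt_ncard ⟨SimpleGraph.edgeSet_mono hle, fun hh => ?_⟩ (Set.toFinite _)
      have : Γ'.Adj x y := hh (show s(x, y) ∈ Γ.edgeSet from hxy)
      exact (adj_delete_iff.1 this).2 (Or.inl ⟨rfl, rfl⟩)
    by_cases hL : Linked Γ' A B q
    · exact (ih _ hlt rfl hL).mono_le hle
    unfold Linked at hL
    push Not at hL
    obtain ⟨S, hS, hSq⟩ := hL
    have hy : y ∉ S := fun hx => by
      refine absurd (h S fun T hT hTA hTB => ?_) (not_le.2 hSq)
      by_contra hTS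
      have hxT : y ∉ T := fun hh => hTS ⟨y, hh, hx⟩
      exact hTS (hS T (hT.mono fun a ha b hb hab => adj_delete_iff.2 ⟨hab, by
        rintro (⟨-, rfl⟩ | ⟨rfl, -⟩)
        exacts [hxT hb, hxT ha]⟩) hTA hTB)
    have hT : ∃ T, Conn Γ T ∧ (T ∩ A).Nonempty ∧ (T ∩ B).Nonempty ∧ Disjoint T S := by
      by_contra! hcon
      refine absurd (h S fun T hT hTA hTB => ?_) (not_le.2 hSq)
      exact Set.not_disjoint_iff_nonempty_inter.1 (hcon T hT hTA hTB)
    obtain ⟨T, hT, hTA, hTB, hTS⟩ := hT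
    have hside : ∀ C, (T ∩ C).Nonempty → Reach Γ' C S x ∨ Reach Γ' C S y := by
      rintro C ⟨a, haT, haC⟩
      by_contra! hcon
      have hr : ∀ z ∈ compo Γ' T a, Reach Γ' C S z := fun z hz =>
        ⟨_, conn_compo haT, ⟨a, mem_compo_self haT, haC⟩, hTS.mono_left compo_subset, hz⟩
      obtain ⟨h1, h2⟩ := hT.delete haT (fun hh => hcon.1 (hr x hh)) (fun hh => hcon.2 (hr y hh))
      obtain ⟨z, hz, hzS⟩ := hS T h1 hTA hTB
      exact Set.disjoint_left.1 hTS hz hzS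
    have hA := hside A hTA
    have hB := hside B hTB
    have e1 : ¬ (Reach Γ' A S x ∧ Reach Γ' B S x) := fun h => hS.not_reach h.1 h.2
    have e2 : ¬ (Reach Γ' A S y ∧ Reach Γ' B S y) := fun h => hS.not_reach h.1 h.2
    have key : (¬ Reach Γ' A S y ∧ ¬ Reach Γ' B S x) ∨ (¬ Reach Γ' A S x ∧ ¬ Reach Γ' B S y) := by tauto
    rcases key with ⟨ha, hb⟩ | ⟨ha, hb⟩
    · exact HasLinkage.join hxy hS hy hSq (ih _ hlt rfl (h.half hS ha)) (ih _ hlt rfl (h.symm.half_swap hS.symm hb))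
    · exact (HasLinkage.join hxy hS.symm hy hSq (ih _ hlt rfl (h.symm.half hS.symm hb))
        (ih _ hlt rfl (h.half_swap hS ha))).symm

/-- Disjoint paths linking `A` and `B`. -/
theorem Linked.exists_tracks [Finite V] {q : ℕ} (h : Linked Γ A B q) :
    ∃ t : Fin q → List V, (∀ i, ∃ a ∈ A, ∃ b ∈ B, IsTrack Γ (t i) a b) ∧ ∀ i j, i ≠ j → ∀ v ∈ t i, v ∉ t j := by
  obtain ⟨t, ht, hd⟩ := h.hasLinkage _ rfl
  have : ∀ i, ∃ p : List V, (∃ a ∈ A, ∃ b ∈ B, IsTrack Γ p a b) ∧ ∀ v ∈ p, v ∈ t i := by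
    intro i
    obtain ⟨h1, ⟨a, ha, haA⟩, ⟨b, hb, hbB⟩⟩ := ht i
    obtain ⟨p, c, hp, hpt, hc, -⟩ := h1.exists_track ha ⟨b, hb, hbB⟩
    exact ⟨p, ⟨a, haA, c, hc, hp⟩, hpt⟩
  choose p hp hpt using this
  exact ⟨p, hp, fun i j hij v hv hv' => Set.disjoint_left.1 (hd i j hij) (hpt i v hv) (hpt j v hv')⟩

end Menger

section Slicing

variable {V ι : Type*} {G Γ : SimpleGraph V} {A B S : Set V} {U : ι → Set V} {q w ℓ : ℕ} {x y : V}

theorem conn_segment {t : List V} {a b : ℕ} (hab : a ≤ b) (hb : b < t.length)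
    (h : ∀ k, a ≤ k → k < b → ∀ x y, t[k]? = some x → t[k + 1]? = some y → G.Adj x y) :
    Conn G {x | ∃ k, a ≤ k ∧ k ≤ b ∧ t[k]? = some x} := by
  induction b, hab using Nat.le_induction with
  | base =>
    convert Conn.singleton (G := G) t[a] using 1
    ext x
    constructor
    · rintro ⟨k, h1, h2, h3⟩
      obtain rfl : k = a := by omega
      rw [List.getElem?_eq_getElem hb] at h3
      simpa using h3.symm
    · rintro rfl
      exact ⟨a, le_rfl, le_rfl, List.getElem?_eq_getElem hb⟩
  | succ b hab ih =>
    have hb' : b < t.length := by omega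
    have h1 := (ih hb' fun k h1 h2 => h k h1 (by omega)).insert_adj (a := t[b + 1])
      ⟨t[b], ⟨b, hab, le_rfl, List.getElem?_eq_getElem hb'⟩,
        (h b hab (by omega) _ _ (List.getElem?_eq_getElem hb') (List.getElem?_eq_getElem hb)).symm⟩
    convert h1 using 1
    ext x
    simp only [Set.mem_ofPred_eq, Set.mem_insert_iff]
    constructor
    · rintro ⟨k, h1, h2, h3⟩
      rcases Nat.lt_or_ge k (b + 1) with h | h
      · exact Or.inr ⟨k, h1, by omega, h3⟩
      · obtain rfl : k = b + 1 := by omega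
        rw [List.getElem?_eq_getElem hb] at h3
        exact Or.inl (by simpa using h3.symm)
    · rintro (rfl | ⟨k, h1, h2, h3⟩)
      · exact ⟨b + 1, by omega, le_rfl, List.getElem?_eq_getElem hb⟩
      · exact ⟨k, h1, by omega, h3⟩

theorem List.IsChain.adj_getElem? {t : List V} (h : t.IsChain G.Adj) {k : ℕ} (hx : t[k]? = some x)
    (hy : t[k + 1]? = some y) : G.Adj x y := by
  obtain ⟨h1, rfl⟩ := List.getElem?_eq_some_iff.1 hx
  obtain ⟨h2, rfl⟩ := List.getElem?_eq_some_iff.1 hy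
  exact List.isChain_iff_getElem.1 h k h2

theorem List.Nodup.getElem?_inj' {t : List V} (h : t.Nodup) {a b : ℕ} (ha : t[a]? = some x) (hb : t[b]? = some x) :
    a = b := by
  obtain ⟨h1, h3⟩ := List.getElem?_eq_some_iff.1 ha
  obtain ⟨h2, h4⟩ := List.getElem?_eq_some_iff.1 hb
  exact (h.getElem_inj_iff).1 (h3.trans h4.symm)

theorem List.lt_of_getElem? {t : List V} {a : ℕ} (ha : t[a]? = some x) : a < t.length :=
  (List.getElem?_eq_some_iff.1 ha).1

/-- Disjoint tracks from `A` to `B`. -/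
structure IsLinkage (G : SimpleGraph V) (A B : Set V) (t : Fin q → List V) : Prop where
  track : ∀ i, ∃ a ∈ A, ∃ b ∈ B, IsTrack G (t i) a b
  disj : ∀ i j, i ≠ j → ∀ v ∈ t i, v ∉ t j

/-- A path-of-sets structure: `w` disjoint tracks crossed in order by `ℓ` disjoint connected sets. -/
structure IsPoS (G : SimpleGraph V) (w ℓ : ℕ) (t : Fin w → List V) (c : Fin ℓ → Set V) : Prop where
  chain : ∀ i, (t i).IsChain G.Adj
  nodup : ∀ i, (t i).Nodup
  disj : ∀ i j, i ≠ j → ∀ v ∈ t i, v ∉ t j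
  conn : ∀ j, Conn G (c j)
  cdisj : ∀ j j', j ≠ j' → Disjoint (c j) (c j')
  meet : ∀ i j, ∃ x ∈ t i, x ∈ c j
  ordered : ∀ (i : Fin w) (j j' : Fin ℓ), j < j' → ∀ (a b : ℕ) (x y : V), (t i)[a]? = some x → x ∈ c j → (t i)[b]? = some y → y ∈ c j' → a < b

/-- A separator of `Γ` minus the edge of the track `t i₀` at position `p`. -/
structure IsMarker (Γ : SimpleGraph V) (A B : Set V) (t : Fin q → List V) (i₀ : Fin q) (p : ℕ) (x y : V) (S : Set V) :
    Prop where
  left : (t i₀)[p]? = some x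
  right : (t i₀)[p + 1]? = some y
  sep : Separates (Γ.deleteEdges {s(x, y)}) A B S
  card : S.ncard < q
  miss : ∀ v ∈ t i₀, v ∉ S
  unique : ∀ i, ∀ u ∈ t i, ∀ v ∈ t i, u ∈ S → v ∈ S → u = v

theorem exists_marker [Finite V] {t : Fin q → List V} (ht : IsLinkage Γ A B t) {i₀ : Fin q} {p : ℕ}
    (hx : (t i₀)[p]? = some x) (hy : (t i₀)[p + 1]? = some y) (hL : ¬ Linked (Γ.deleteEdges {s(x, y)}) A B q) :
    ∃ S, IsMarker Γ A B t i₀ p x y S := by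
  unfold Linked at hL
  push Not at hL
  obtain ⟨S, hS, hSq⟩ := hL
  have hz : ∀ k, k ≠ i₀ → ∃ z ∈ t k, z ∈ S := by
    intro k hk
    obtain ⟨a, ha, b, hb, h⟩ := ht.track k
    obtain ⟨z, hz, hzS⟩ := hS {x | x ∈ t k} (h.conn.mono fun u hu v hv huv => adj_delete_iff.2 ⟨huv, by
      rintro (⟨rfl, -⟩ | ⟨rfl, -⟩)
      exacts [ht.disj _ _ hk _ hu (List.mem_of_getElem? hx), ht.disj _ _ hk _ hu (List.mem_of_getElem? hy)]⟩)
      ⟨a, h.mem_head, ha⟩ ⟨b, h.mem_last, hb⟩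
    exact ⟨z, hz, hzS⟩
  have : Nonempty V := ⟨x⟩
  choose! z hz hzS using hz
  have key : ∀ v ∈ S, ∃ k, k ≠ i₀ ∧ v = z k := by
    intro v hv
    by_contra! hcon
    have hinj : Function.Injective (Function.update z i₀ v) := by
      intro j k hjk
      by_contra hne
      by_cases hj : j = i₀
      · subst hj
        rw [Function.update_self, Function.update_of_ne (Ne.symm hne)] at hjk
        exact hcon k (Ne.symm hne) hjk
      · by_cases hk : k = i₀
        · subst hk
          rw [Function.update_self, Function.update_of_ne hj] at hjk
          exact hcon j hj hjk.symm
        · rw [Function.update_of_ne hj, Function.update_of_ne hk] at hjk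
          exact ht.disj _ _ hne _ (hz j hj) (hjk ▸ hz k hk)
    have := Set.ncard_le_ncard (s := Set.range (Function.update z i₀ v)) (t := S) (by
      rintro _ ⟨k, rfl⟩
      by_cases hk : k = i₀
      · subst hk; rwa [Function.update_self]
      · rw [Function.update_of_ne hk]; exact hzS k hk) (Set.toFinite _)
    rw [← Nat.card_coe_set_eq, Nat.card_range_of_injective hinj, Nat.card_fin] at this
    omega
  have hmiss : ∀ v ∈ t i₀, v ∉ S := by
    intro v hv hvS
    obtain ⟨k, hk, rfl⟩ := key v hvS
    exact ht.disj _ _ hk _ (hz k hk) hv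
  refine ⟨S, hx, hy, hS, hSq, hmiss, fun i u hu v hv huS hvS => ?_⟩
  have h1 : ∀ u ∈ t i, u ∈ S → u = z i := by
    intro u hu huS
    obtain ⟨k, hk, rfl⟩ := key u huS
    by_cases hki : k = i
    · rw [hki]
    · exact absurd hu (ht.disj _ _ hki _ (hz k hk))
  rw [h1 u hu huS, h1 v hv hvS]

theorem Reach.of_conn {T : Set V} {u v : V} (h : Reach G A S u) (hT : Conn G T) (hTS : Disjoint T S) (hu : u ∈ T)
    (hv : v ∈ T) : Reach G A S v := by
  obtain ⟨T', h1, h2, h3, h4⟩ := h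
  exact ⟨T' ∪ T, h1.union hT ⟨u, h4, hu⟩, h2.mono (Set.inter_subset_inter_left _ Set.subset_union_left),
    Set.disjoint_union_left.2 ⟨h3, hTS⟩, Or.inr hv⟩

theorem IsTrack.zero {t : List V} {a b : V} (h : IsTrack G t a b) : t[0]? = some a := by
  rw [← List.head?_eq_getElem?]; exact h.head

theorem IsTrack.last_pos {t : List V} {a b : V} (h : IsTrack G t a b) : t[t.length - 1]? = some b := by
  rw [← List.getLast?_eq_getElem?]; exact h.last

section
variable {t : Fin q → List V} {i₀ : Fin q} {p : ℕ}

theorem IsMarker.segment (hm : IsMarker Γ A B t i₀ p x y S) (ht : IsLinkage Γ A B t) {i : Fin q} {a b : ℕ}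
    (hab : a ≤ b) (hb : b < (t i).length) (hi : i = i₀ → b ≤ p ∨ p < a) :
    Conn (Γ.deleteEdges {s(x, y)}) {x | ∃ k, a ≤ k ∧ k ≤ b ∧ (t i)[k]? = some x} := by
  obtain ⟨_, _, _, _, hti⟩ := ht.track i
  refine conn_segment hab hb fun k h1 h2 u v hu hv => adj_delete_iff.2 ⟨hti.chain.adj_getElem? hu hv, ?_⟩
  by_cases hii : i = i₀
  · subst hii
    rintro (⟨rfl, rfl⟩ | ⟨rfl, rfl⟩)
    · have := hti.nodup.getElem?_inj' hu hm.left
      have := hi rfl; omega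
    · have h3 := hti.nodup.getElem?_inj' hu hm.right
      have h4 := hti.nodup.getElem?_inj' hv hm.left
      omega
  · rintro (⟨rfl, rfl⟩ | ⟨rfl, rfl⟩)
    · exact ht.disj _ _ hii _ (List.mem_of_getElem? hu) (List.mem_of_getElem? hm.left)
    · exact ht.disj _ _ hii _ (List.mem_of_getElem? hu) (List.mem_of_getElem? hm.right)

theorem IsMarker.reach_left (hm : IsMarker Γ A B t i₀ p x y S) (ht : IsLinkage Γ A B t) {i : Fin q} {a : ℕ} {v : V}
    (ha : (t i)[a]? = some v) (hi : i = i₀ → a ≤ p) (hS : ∀ k ≤ a, ∀ z, (t i)[k]? = some z → z ∉ S) :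
    Reach (Γ.deleteEdges {s(x, y)}) A S v := by
  obtain ⟨c, hc, _, _, hti⟩ := ht.track i
  refine ⟨_, hm.segment ht (Nat.zero_le a) (List.lt_of_getElem? ha) (fun h => Or.inl (hi h)),
    ⟨c, ⟨0, le_rfl, Nat.zero_le _, hti.zero⟩, hc⟩, ?_, ⟨a, Nat.zero_le _, le_rfl, ha⟩⟩
  rw [Set.disjoint_left]
  rintro z ⟨k, -, hk, hkz⟩
  exact hS k hk z hkz

theorem IsMarker.reach_right (hm : IsMarker Γ A B t i₀ p x y S) (ht : IsLinkage Γ A B t) {i : Fin q} {a : ℕ} {v : V}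
    (ha : (t i)[a]? = some v) (hi : i = i₀ → p < a) (hS : ∀ k, a ≤ k → ∀ z, (t i)[k]? = some z → z ∉ S) :
    Reach (Γ.deleteEdges {s(x, y)}) B S v := by
  obtain ⟨_, _, c, hc, hti⟩ := ht.track i
  have := List.lt_of_getElem? ha
  refine ⟨_, hm.segment ht (a := a) (b := (t i).length - 1) (by omega) (by omega) (fun h => Or.inr (hi h)),
    ⟨c, ⟨_, by omega, le_rfl, hti.last_pos⟩, hc⟩, ?_, ⟨a, le_rfl, by omega, ha⟩⟩
  rw [Set.disjoint_left]
  rintro z ⟨k, hk, -, hkz⟩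
  exact hS k hk z hkz

/-- A marker separates sets crossing its track before it from those crossing after it. -/
theorem IsMarker.lt (hm : IsMarker Γ A B t i₀ p x y S) (ht : IsLinkage Γ A B t) {C C' : Set V}
    (hC : Conn (Γ.deleteEdges {s(x, y)}) C) (hC' : Conn (Γ.deleteEdges {s(x, y)}) C')
    (hCS : Disjoint C S) (hCS' : Disjoint C' S) {a₀ b₀ : ℕ} {u₀ v₀ : V} (ha₀ : (t i₀)[a₀]? = some u₀) (hap : a₀ ≤ p)
    (hu₀ : u₀ ∈ C) (hb₀ : (t i₀)[b₀]? = some v₀) (hbp : p < b₀) (hv₀ : v₀ ∈ C') {i : Fin q} {a b : ℕ} {u v : V}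
    (ha : (t i)[a]? = some u) (hu : u ∈ C) (hb : (t i)[b]? = some v) (hv : v ∈ C') : a < b := by
  have hmiss : ∀ k z, (t i₀)[k]? = some z → z ∉ S := fun k z hz => hm.miss z (List.mem_of_getElem? hz)
  have rA : Reach (Γ.deleteEdges {s(x, y)}) A S u :=
    (hm.reach_left ht ha₀ (fun _ => hap) (fun k _ => hmiss k)).of_conn hC hCS hu₀ hu
  have rB : Reach (Γ.deleteEdges {s(x, y)}) B S v :=
    (hm.reach_right ht hb₀ (fun _ => hbp) (fun k _ => hmiss k)).of_conn hC' hCS' hv₀ hv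
  have nB : ¬ Reach (Γ.deleteEdges {s(x, y)}) B S u := fun h => hm.sep.not_reach rA h
  have nA : ¬ Reach (Γ.deleteEdges {s(x, y)}) A S v := fun h => hm.sep.not_reach h rB
  by_contra! hba
  by_cases hii : i = i₀
  · subst hii
    by_cases hbp' : b ≤ p
    · exact nA (hm.reach_left ht hb (fun _ => hbp') (fun k _ => hmiss k))
    · exact nB (hm.reach_right ht ha (fun _ => by omega) (fun k _ => hmiss k))
  · have hl : ∃ k ≤ b, ∃ z, (t i)[k]? = some z ∧ z ∈ S := by
      by_contra! h
      exact nA (hm.reach_left ht hb (fun e => absurd e hii) h)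
    have hr : ∃ k, a ≤ k ∧ ∃ z, (t i)[k]? = some z ∧ z ∈ S := by
      by_contra! h
      exact nB (hm.reach_right ht ha (fun e => absurd e hii) h)
    obtain ⟨k, hk, z, hz, hzS⟩ := hl
    obtain ⟨k', hk', z', hz', hzS'⟩ := hr
    obtain rfl := hm.unique i z (List.mem_of_getElem? hz) z' (List.mem_of_getElem? hz') hzS hzS'
    obtain ⟨_, _, _, _, hti⟩ := ht.track i
    obtain rfl := hti.nodup.getElem?_inj' hz hz'
    obtain rfl : k = b := by omega
    obtain rfl : k = a := by omega
    rw [ha] at hb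
    obtain rfl : u = v := by simpa using hb
    exact nA rA
end

theorem exists_minimal_linked [Finite V] (h : Linked G A B q) {In : SimpleGraph V} (hIn : In ≤ G) :
    ∃ Γ ≤ G, In ≤ Γ ∧ Linked Γ A B q ∧ ∀ x y, Γ.Adj x y → ¬ In.Adj x y → ¬ Linked (Γ.deleteEdges {s(x, y)}) A B q := by
  obtain ⟨Γ, h1, h2⟩ := (Set.toFinite {Γ : SimpleGraph V | Γ ≤ G ∧ In ≤ Γ ∧ Linked Γ A B q}).exists_minimal ⟨G, le_rfl, hIn, h⟩
  refine ⟨Γ, h1.1, h1.2.1, h1.2.2, fun x y hxy hn hL => ?_⟩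
  have := h2 (y := Γ.deleteEdges {s(x, y)}) ⟨(SimpleGraph.deleteEdges_le _).trans h1.1, ?_, hL⟩ (SimpleGraph.deleteEdges_le _)
  · exact (adj_delete_iff.1 (this hxy)).2 (Or.inl ⟨rfl, rfl⟩)
  · intro u v huv
    refine adj_delete_iff.2 ⟨h1.2.1 huv, ?_⟩
    rintro (⟨rfl, rfl⟩ | ⟨rfl, rfl⟩)
    exacts [hn huv, hn huv.symm]

theorem exists_pos_of_markers [Finite V] {t : Fin q → List V} (ht : IsLinkage Γ A B t) {i₀ : Fin q} {C S : ℕ → Set V}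
    {pos : ℕ → ℕ} {v x y : ℕ → V} {N b : ℕ} (hb : ℓ * q < b) (hN : (ℓ + 1) * b ≤ N)
    (hC : ∀ m < N, Conn Γ (C m)) (hdisj : ∀ m < N, ∀ m' < N, m ≠ m' → Disjoint (C m) (C m'))
    (hpos : ∀ m < N, ∀ m' < m, pos m' < pos m) (hv : ∀ m < N, (t i₀)[pos m]? = some (v m)) (hvC : ∀ m < N, v m ∈ C m)
    (hM : ∀ m < N, 0 < m → IsMarker Γ A B t i₀ (pos m - 1) (x m) (y m) (S m))
    (hCM : ∀ m < N, 0 < m → ∀ m' < N, Conn (Γ.deleteEdges {s(x m, y m)}) (C m'))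
    {T : Finset (Fin q)} (hT : w ≤ T.card) (hTC : ∀ m < N, ∀ i ∈ T, ∃ z ∈ t i, z ∈ C m) :
    ∃ t c, IsPoS Γ w ℓ t c := by
  have hlt : ∀ j : Fin ℓ, ∀ r < b, j * b + r < N := by
    intro j r hr
    have : (j + 1) * b ≤ ℓ * b := Nat.mul_le_mul_right _ j.2
    nlinarith
  have hblock : ∀ j : Fin ℓ, ∃ r < b, ∀ k : Fin ℓ, Disjoint (C (j * b + r)) (S ((k + 1) * b)) := by
    intro j
    by_contra! hcon
    have : ∀ r : Fin b, ∃ z, z ∈ C (j * b + r) ∧ ∃ k : Fin ℓ, z ∈ S ((k + 1) * b) := by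
      intro r
      obtain ⟨k, hk⟩ := hcon r r.2
      obtain ⟨z, hz⟩ := Set.not_disjoint_iff.1 hk
      exact ⟨z, hz.1, k, hz.2⟩
    choose z hz hzS using this
    have hinj : Function.Injective z := by
      intro r r' h
      by_contra hne
      exact Set.disjoint_left.1 (hdisj _ (hlt j r r.2) _ (hlt j r' r'.2)
        (fun h => hne (Fin.ext (by omega)))) (hz r) (h ▸ hz r')
    have h1 := Set.ncard_le_ncard (s := Set.range z) (t := ⋃ k : Fin ℓ, S ((k + 1) * b)) (by
      rintro _ ⟨r, rfl⟩; exact Set.mem_iUnion.2 (hzS r)) (Set.toFinite _)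
    rw [← Nat.card_coe_set_eq, Nat.card_range_of_injective hinj, Nat.card_fin] at h1
    have h2 : (⋃ k : Fin ℓ, S ((k + 1) * b)).ncard ≤ ∑ k : Fin ℓ, (S ((k + 1) * b)).ncard :=
      Set.ncard_iUnion_le_of_fintype _
    have h3 : ∑ k : Fin ℓ, (S ((k + 1) * b)).ncard ≤ ∑ k : Fin ℓ, q := by
      refine Finset.sum_le_sum fun k _ => (hM _ ?_ (Nat.mul_pos (Nat.succ_pos _) (by omega))).card.le
      have := hlt k 0 (by omega)
      have h4 : (k.1 + 1) * b ≤ ℓ * b := Nat.mul_le_mul_right _ k.2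
      nlinarith
    rw [Finset.sum_const, Finset.card_univ, Fintype.card_fin, smul_eq_mul] at h3
    omega
  choose r hr hrS using hblock
  refine ⟨fun i => t (T.orderEmbOfCardLe hT i), fun j => C (j * b + r j), ?_⟩
  have hsep : ∀ j j' : Fin ℓ, j < j' → j * b + r j < (j + 1) * b ∧ (j + 1) * b ≤ j' * b + r j' := by
    intro j j' hjj
    have h4 : (j.1 + 1) * b ≤ j' * b := Nat.mul_le_mul_right _ hjj
    have := hr j
    constructor <;> nlinarith
  constructor
  · intro i; obtain ⟨_, _, _, _, h⟩ := ht.track (T.orderEmbOfCardLe hT i); exact h.chain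
  · intro i; obtain ⟨_, _, _, _, h⟩ := ht.track (T.orderEmbOfCardLe hT i); exact h.nodup
  · exact fun i j hij => ht.disj _ _ ((T.orderEmbOfCardLe hT).injective.ne hij)
  · exact fun j => hC _ (hlt j _ (hr j))
  · intro j j' hjj
    refine hdisj _ (hlt j _ (hr j)) _ (hlt j' _ (hr j')) ?_
    rcases lt_or_gt_of_ne hjj with h | h
    · have := hsep _ _ h; omega
    · have := hsep _ _ h; omega
  · exact fun i j => hTC _ (hlt j _ (hr j)) _ (T.orderEmbOfCardLe_mem hT i)
  · intro i j j' hjj a b' u u' ha hu hb' hu'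
    obtain ⟨h1, h2⟩ := hsep j j' hjj
    have hmN : (j.1 + 1) * b < N := h2.trans_lt (hlt j' _ (hr j'))
    have hm0 : 0 < (j.1 + 1) * b := by omega
    have h3 := hpos _ hmN 0 hm0
    have h4 := hpos _ hmN _ h1
    have h5 : pos ((j.1 + 1) * b) ≤ pos (j' * b + r j') := by
      rcases h2.eq_or_lt with h | h
      · rw [h]
      · exact (hpos _ (hlt j' _ (hr j')) _ h).le
    exact (hM _ hmN hm0).lt ht (hCM _ hmN hm0 _ (hlt j _ (hr j))) (hCM _ hmN hm0 _ (hlt j' _ (hr j')))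
      (hrS j j) (hrS j' j) (hv _ (hlt j _ (hr j))) (by omega) (hvC _ (hlt j _ (hr j))) (hv _ (hlt j' _ (hr j')))
      (by omega) (hvC _ (hlt j' _ (hr j'))) ha hu hb' hu'

theorem exists_linkage_of_not_pos [Finite V] [Finite ι] (hU : ∀ i, Conn G (U i))
    (hd : ∀ i j, i ≠ j → Disjoint (U i) (U j)) (hw : 1 ≤ w) (hL : Linked G A B q) (hP : ∀ t c, ¬ IsPoS G w ℓ t c) :
    ∃ t : Fin q → List V, IsLinkage G A B t ∧
      {i | w ≤ {j : Fin q | ∃ x ∈ t j, x ∈ U i}.ncard}.ncard ≤ 2 ^ q * ((ℓ + 1) * (ℓ * q + 1)) := by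
  classical
  let In : SimpleGraph V := ⟨fun x y => G.Adj x y ∧ ∃ i, x ∈ U i ∧ y ∈ U i,
    ⟨fun x y h => ⟨h.1.symm, by obtain ⟨i, h1, h2⟩ := h.2; exact ⟨i, h2, h1⟩⟩⟩, ⟨fun x h => G.loopless.irrefl x h.1⟩⟩
  obtain ⟨Γ, hΓ, hIn, hΓL, hmin⟩ := exists_minimal_linked hL (In := In) fun x y h => h.1
  obtain ⟨t, htr, htd⟩ := hΓL.exists_tracks
  have ht : IsLinkage Γ A B t := ⟨htr, htd⟩
  refine ⟨t, ⟨fun i => ?_, htd⟩, ?_⟩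
  · obtain ⟨a, ha, b, hb, h⟩ := htr i
    exact ⟨a, ha, b, hb, h.chain.imp fun _ _ h => hΓ h, h.nodup, h.head, h.last⟩
  have hUIn : ∀ i, Conn In (U i) := fun i => (hU i).mono fun a ha b hb hab => ⟨hab, i, ha, hb⟩
  by_contra! hcon
  have := Fintype.ofFinite ι
  let τ : ι → Finset (Fin q) := fun i => {j | ∃ x ∈ t j, x ∈ U i}
  have hτ : ∀ i, {j : Fin q | ∃ x ∈ t j, x ∈ U i}.ncard = (τ i).card := by
    intro i
    rw [← Set.ncard_coe_finset]; simp [τ]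
  obtain ⟨T, -, hT⟩ := Finset.exists_lt_card_fiber_of_mul_lt_card_of_maps_to (s := {i | w ≤ (τ i).card})
    (t := Finset.univ) (f := τ) (n := (ℓ + 1) * (ℓ * q + 1)) (by simp) (by
      rw [Finset.card_univ, Fintype.card_finset, Fintype.card_fin]
      refine hcon.trans_eq ?_
      rw [← Set.ncard_coe_finset]; simp [hτ])
  set E : Finset ι := {i ∈ ({i | w ≤ (τ i).card} : Finset ι) | τ i = T} with hE
  have hEm : ∀ i, i ∈ E → w ≤ T.card ∧ τ i = T := by
    intro i hi
    simp only [hE, Finset.mem_filter] at hi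
    exact ⟨hi.2 ▸ hi.1.2, hi.2⟩
  have hEne : E.Nonempty := Finset.card_pos.1 (by omega)
  obtain ⟨i₁, hi₁⟩ := hEne
  have hTw := (hEm i₁ hi₁).1
  obtain ⟨i₀, hi₀⟩ : T.Nonempty := Finset.card_pos.1 (by omega)
  have hvis : ∀ i ∈ E, ∀ j ∈ T, ∃ x ∈ t j, x ∈ U i := by
    intro i hi j hj
    rw [← (hEm i hi).2] at hj
    simpa [τ] using hj
  have hfirst : ∀ i, ∃ (k : ℕ) (z : V), i ∈ E → (t i₀)[k]? = some z ∧ z ∈ U i ∧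
      ∀ k' < k, ∀ z' : V, (t i₀)[k']? = some z' → z' ∉ U i := by
    intro i
    by_cases hi : i ∈ E
    · have hex : ∃ k : ℕ, ∃ z : V, (t i₀)[k]? = some z ∧ z ∈ U i := by
        obtain ⟨x, hx, hxU⟩ := hvis i hi i₀ hi₀
        obtain ⟨k, hk⟩ := List.getElem?_of_mem hx
        exact ⟨k, x, hk, hxU⟩
      obtain ⟨z, h1, h2⟩ := Nat.find_spec hex
      exact ⟨Nat.find hex, z, fun _ => ⟨h1, h2, fun k' hk' z' hz' hzU => Nat.find_min hex hk' ⟨z', hz', hzU⟩⟩⟩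
    · obtain ⟨x, -⟩ := hvis i₁ hi₁ i₀ hi₀
      exact ⟨0, x, fun h => absurd h hi⟩
  choose f z hf using hfirst
  have hUeq : ∀ {i j x}, x ∈ U i → x ∈ U j → i = j := by
    intro i j x h1 h2
    by_contra hne
    exact Set.disjoint_left.1 (hd i j hne) h1 h2
  have hfinj : Set.InjOn f E := by
    intro i hi j hj hij
    have h1 := (hf i hi).1
    have h2 := (hf j hj).1
    rw [hij, h2] at h1
    have h3 : z j = z i := by simpa using h1
    exact hUeq (hf i hi).2.1 (h3 ▸ (hf j hj).2.1)
  have hcard : (E.image f).card = E.card := Finset.card_image_of_injOn hfinj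
  have hg : ∀ m, ∃ i, ∀ h : m < E.card, i ∈ E ∧ f i = (E.image f).orderEmbOfFin hcard ⟨m, h⟩ := by
    intro m
    by_cases h : m < E.card
    · obtain ⟨i, hi, hi'⟩ := Finset.mem_image.1 (Finset.orderEmbOfFin_mem (E.image f) hcard ⟨m, h⟩)
      exact ⟨i, fun _ => ⟨hi, hi'⟩⟩
    · exact ⟨i₁, fun h' => absurd h' h⟩
  choose g hg using hg
  have hmono : ∀ m < E.card, ∀ m' < m, f (g m') < f (g m) := by
    intro m hm m' hm'
    rw [(hg m hm).2, (hg m' (hm'.trans hm)).2]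
    exact ((E.image f).orderEmbOfFin hcard).strictMono hm'
  have hmark : ∀ m, ∃ x y S, m < E.card → 0 < m → IsMarker Γ A B t i₀ (f (g m) - 1) x y S ∧ ¬ In.Adj x y := by
    intro m
    by_cases h : m < E.card ∧ 0 < m
    · have h0 := hmono m h.1 0 h.2
      obtain ⟨h1, h2, h3⟩ := hf (g m) (hg m h.1).1
      have hlt := List.lt_of_getElem? h1
      have hx : (t i₀)[f (g m) - 1]? = some (t i₀)[f (g m) - 1] := List.getElem?_eq_getElem (by omega)
      have hy : (t i₀)[f (g m) - 1 + 1]? = some (z (g m)) := by rwa [Nat.sub_add_cancel (by omega)]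
      have hn : ¬ In.Adj (t i₀)[f (g m) - 1] (z (g m)) := by
        rintro ⟨-, i, h4, h5⟩
        obtain rfl := hUeq h5 h2
        exact h3 _ (by omega) _ hx h4
      obtain ⟨_, _, _, _, hti⟩ := htr i₀
      obtain ⟨S, hS⟩ := exists_marker ht hx hy (hmin _ _ (hti.chain.adj_getElem? hx hy) hn)
      exact ⟨_, _, S, fun _ _ => ⟨hS, hn⟩⟩
    · obtain ⟨x, -⟩ := hvis i₁ hi₁ i₀ hi₀
      exact ⟨x, x, ∅, fun h1 h2 => absurd ⟨h1, h2⟩ h⟩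
  choose x y S hmark using hmark
  obtain ⟨t', c, h⟩ := exists_pos_of_markers ht (i₀ := i₀) (C := fun m => U (g m)) (S := S) (pos := fun m => f (g m))
    (v := fun m => z (g m)) (x := x) (y := y) (N := E.card) (b := ℓ * q + 1) (ℓ := ℓ) (w := w) (by omega) hT.le
    (fun m _ => (hUIn _).mono_le hIn) (fun m hm m' hm' hne => hd _ _ fun h => by
      rcases lt_or_gt_of_ne hne with h1 | h1
      · exact (hmono m' hm' m h1).ne (by rw [h])
      · exact (hmono m hm m' h1).ne (by rw [h])) hmono
    (fun m hm => (hf _ (hg m hm).1).1) (fun m hm => (hf _ (hg m hm).1).2.1) (fun m hm h0 => (hmark m hm h0).1)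
    (fun m hm h0 m' hm' => (hUIn _).mono fun a ha b hb hab => adj_delete_iff.2 ⟨hIn hab, by
      rintro (⟨rfl, rfl⟩ | ⟨rfl, rfl⟩)
      · exact (hmark m hm h0).2 hab
      · exact (hmark m hm h0).2 hab.symm⟩) hTw (fun m hm i hi => hvis _ (hg m hm).1 i hi)
  exact hP t' c ⟨fun i => (h.chain i).imp fun _ _ h => hΓ h, h.nodup, h.disj, fun j => (h.conn j).mono_le hΓ, h.cdisj,
    h.meet, h.ordered⟩

end Slicing

section Bramble

variable {V : Type*} {G : SimpleGraph V} {𝒞 : Set (Set V)} {I : Set V} {k M a b : ℕ}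

/-- No fewer than `k` vertices meet all members of `𝒞` meeting `I`. -/
def Attached (𝒞 : Set (Set V)) (I : Set V) (k : ℕ) : Prop :=
  ∀ S : Set V, S.ncard < k → ∃ C ∈ 𝒞, Disjoint C S ∧ (C ∩ I).Nonempty

theorem Attached.linked {J : Set V} (h𝒞 : ∀ C ∈ 𝒞, Conn G C) (hi : ∀ C ∈ 𝒞, ∀ C' ∈ 𝒞, (C ∩ C').Nonempty)
    (hI : Attached 𝒞 I k) (hJ : Attached 𝒞 J k) : Linked G I J k := by
  intro S hS
  by_contra! hk
  obtain ⟨C, hC, hCS, c, hc, hcI⟩ := hI S hk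
  obtain ⟨C', hC', hCS', c', hc', hcJ⟩ := hJ S hk
  obtain ⟨z, hz, hz'⟩ := hi C hC C' hC'
  obtain ⟨x, hx, hxS⟩ := hS (C ∪ C') ((h𝒞 C hC).union (h𝒞 C' hC') ⟨z, hz, hz'⟩) ⟨c, Or.inl hc, hcI⟩ ⟨c', Or.inr hc', hcJ⟩
  rcases hx with hx | hx
  · exact Set.disjoint_left.1 hCS hx hxS
  · exact Set.disjoint_left.1 hCS' hx hxS

theorem exists_meeting_list [Finite V] (h𝒞 : ∀ C ∈ 𝒞, Conn G C) (hi : ∀ C ∈ 𝒞, ∀ C' ∈ 𝒞, (C ∩ C').Nonempty) :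
    ∃ l : List V, l.IsChain G.Adj ∧ l.Nodup ∧ ∀ C ∈ 𝒞, (C ∩ {x | x ∈ l}).Nonempty := by
  by_contra! hcon
  have := Fintype.ofFinite V
  have key : ∀ n, ∃ l : List V, n ≤ l.length ∧ ∃ a b, IsTrack G l a b ∧ ∃ C ∈ 𝒞, b ∈ C ∧ ∀ x ∈ l, x ∈ C → x = b := by
    intro n
    induction n with
    | zero =>
      obtain ⟨C, hC, -⟩ := hcon [] (by simp) (by simp)
      obtain ⟨v, hv⟩ := (h𝒞 C hC).nonempty
      exact ⟨[v], Nat.zero_le _, v, v, ⟨by simp, by simp, rfl, rfl⟩, C, hC, hv, by simp⟩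
    | succ n ih =>
      obtain ⟨l, hln, a, b, hl, C, hC, hbC, hb⟩ := ih
      obtain ⟨C', hC', hd⟩ := hcon l hl.chain hl.nodup
      have hd' : ∀ x ∈ l, x ∉ C' := fun x hx hxC => by
        have : x ∈ C' ∩ {x | x ∈ l} := ⟨hxC, hx⟩
        rw [hd] at this; exact this
      obtain ⟨p, c, hp, hpC, hcC', hc⟩ := (h𝒞 C hC).exists_track hbC (hi C hC C' hC')
      obtain ⟨s, rfl⟩ : ∃ s, p = b :: s := by
        cases p with
        | nil => exact absurd rfl hp.ne_nil
        | cons x s => exact ⟨s, by simpa using hp.head⟩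
      have hs : s ≠ [] := by
        rintro rfl
        have : b = c := by simpa using hp.last
        exact hd' b hl.mem_last (this ▸ hcC')
      have hbs : b ∉ s := (List.nodup_cons.1 hp.nodup).1
      refine ⟨l ++ s, ?_, a, c, ⟨?_, ?_, ?_, ?_⟩, C', hC', hcC', ?_⟩
      · have := List.length_pos_iff.2 hs
        simp; omega
      · refine List.isChain_append.2 ⟨hl.chain, (List.isChain_cons.1 hp.chain).2, ?_⟩
        intro x hx y hy
        rw [hl.last] at hx
        obtain rfl : b = x := by simpa using hx
        exact (List.isChain_cons.1 hp.chain).1 y hy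
      · refine List.nodup_append.2 ⟨hl.nodup, (List.nodup_cons.1 hp.nodup).2, ?_⟩
        rintro x hx y hy rfl
        exact hbs (hb x hx (hpC x (List.mem_cons_of_mem _ hy)) ▸ hy)
      · have := hl.head
        cases l with
        | nil => simp at this
        | cons x l => simpa using this
      · have := hp.last
        rw [List.getLast?_cons] at this
        rw [List.getLast?_append]
        obtain ⟨y, hy⟩ : ∃ y, s.getLast? = some y := ⟨_, List.getLast?_eq_some_getLast hs⟩
        rw [hy] at this ⊢
        simpa using this
      · intro x hx hxC
        rcases List.mem_append.1 hx with h | h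
        · exact absurd hxC (hd' x h)
        · exact hc x (List.mem_cons_of_mem _ h) hxC
  obtain ⟨l, hl, _, _, ht, -⟩ := key (Fintype.card V + 1)
  have := ht.nodup.length_le_card
  omega

theorem Attached.split [Finite V] {l : List V} (h : Attached 𝒞 {x | x ∈ l} (a + k)) :
    ∃ l₁ l₂, l = l₁ ++ l₂ ∧ Attached 𝒞 {x | x ∈ l₁} k ∧ Attached 𝒞 {x | x ∈ l₂} a := by
  classical
  have hex : ∃ n, Attached 𝒞 {x | x ∈ l.take n} k :=
    ⟨l.length, by rw [List.take_length]; exact fun S hS => h S (by omega)⟩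
  refine ⟨l.take (Nat.find hex), l.drop (Nat.find hex), (List.take_append_drop _ _).symm, Nat.find_spec hex, ?_⟩
  have hS : ∃ S : Set V, S.ncard ≤ k ∧ ∀ C ∈ 𝒞, Disjoint C S → ∀ x ∈ C, x ∉ l.take (Nat.find hex) := by
    rcases hn : Nat.find hex with _ | n
    · exact ⟨∅, by simp, by simp⟩
    · have h1 := Nat.find_min hex (m := n) (by omega)
      unfold Attached at h1
      push Not at h1
      obtain ⟨S, hSk, hS⟩ := h1
      refine ⟨S ∪ {x | x ∈ l[n]?}, ?_, fun C hC hd x hx hxl => ?_⟩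
      · refine (Set.ncard_union_le _ _).trans ?_
        have : {x | x ∈ l[n]?}.ncard ≤ 1 := by
          rw [Set.ncard_le_one (Set.toFinite _)]
          intro x hx y hy
          simp only [Set.mem_ofPred_eq, Option.mem_def] at hx hy
          rw [hx] at hy; simpa using hy
        omega
      · rw [List.take_add_one, List.mem_append] at hxl
        rw [Set.disjoint_union_right] at hd
        rcases hxl with h2 | h2
        · have : x ∈ C ∩ {x | x ∈ l.take n} := ⟨hx, h2⟩
          rw [hS C hC hd.1] at this; exact this
        · exact Set.disjoint_left.1 hd.2 hx (by simpa using h2)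
  obtain ⟨S, hSk, hS⟩ := hS
  intro S' hS'
  obtain ⟨C, hC, hCd, x, hx, hxl⟩ := h (S ∪ S') ((Set.ncard_union_le _ _).trans_lt (by omega))
  rw [Set.disjoint_union_right] at hCd
  refine ⟨C, hC, hCd.2, x, hx, ?_⟩
  have hxl' : x ∈ l := hxl
  rw [← List.take_append_drop (Nat.find hex) l, List.mem_append] at hxl'
  exact hxl'.resolve_left (hS C hC hCd.1 x hx)

theorem Attached.exists_segments [Finite V] (hk : 0 < k) {l : List V} (hl : l.IsChain G.Adj) (hn : l.Nodup)
    (h : Attached 𝒞 {x | x ∈ l} (M * k)) : ∃ P : Fin M → Set V, (∀ i, Conn G (P i)) ∧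
      (∀ i j, i ≠ j → Disjoint (P i) (P j)) ∧ (∀ i, Attached 𝒞 (P i) k) ∧ ∀ i, P i ⊆ {x | x ∈ l} := by
  induction M generalizing l with
  | zero => exact ⟨fun i => i.elim0, fun i => i.elim0, fun i => i.elim0, fun i => i.elim0, fun i => i.elim0⟩
  | succ M ih =>
    rw [Nat.succ_mul] at h
    obtain ⟨l₁, l₂, rfl, h1, h2⟩ := h.split
    obtain ⟨P, p1, p2, p3, p4⟩ := ih hl.right_of_append (List.nodup_append.1 hn).2.1 h2
    have hne : l₁ ≠ [] := by
      rintro rfl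
      obtain ⟨C, -, -, x, -, hx⟩ := h1 ∅ (by simpa using hk)
      simp at hx
    have hdis : ∀ i, Disjoint {x | x ∈ l₁} (P i) := fun i => Set.disjoint_left.2 fun x hx hxP =>
      (List.nodup_append.1 hn).2.2 x hx x (p4 i hxP) rfl
    refine ⟨Fin.cons {x | x ∈ l₁} P, ?_, ?_, ?_, ?_⟩
    · exact Fin.cases (conn_of_isChain hl.left_of_append hne) p1
    · refine Fin.cases (Fin.cases (fun h => absurd rfl h) fun j _ => hdis j)
        fun i => Fin.cases (fun _ => (hdis i).symm) fun j hij => p2 i j fun h => hij (h ▸ rfl)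
    · exact Fin.cases h1 p3
    · refine Fin.cases (fun x hx => ?_) fun i x hx => ?_
      · exact List.mem_append_left _ hx
      · exact List.mem_append_right _ (p4 i hx)

/-- A bramble of large order yields many pairwise highly linked disjoint connected sets. -/
theorem exists_linked_sets [Finite V] (h𝒞 : ∀ C ∈ 𝒞, Conn G C) (hi : ∀ C ∈ 𝒞, ∀ C' ∈ 𝒞, (C ∩ C').Nonempty)
    (hk : 0 < k) (h : ∀ S : Set V, S.ncard < M * k → ∃ C ∈ 𝒞, Disjoint C S) :
    ∃ P : Fin M → Set V, (∀ i, Conn G (P i)) ∧ (∀ i j, i ≠ j → Disjoint (P i) (P j)) ∧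
      ∀ i j, Linked G (P i) (P j) k := by
  obtain ⟨l, hl, hn, hm⟩ := exists_meeting_list h𝒞 hi
  obtain ⟨P, p1, p2, p3, -⟩ := Attached.exists_segments (𝒞 := 𝒞) (M := M) hk hl hn fun S hS => by
    obtain ⟨C, hC, hCS⟩ := h S hS
    exact ⟨C, hC, hCS, hm C hC⟩
  exact ⟨P, p1, p2, fun i j => (p3 i).linked h𝒞 hi (p3 j)⟩

end Bramble

section Route

variable {V ι : Type*} {G Γ : SimpleGraph V} {A B S Z : Set V} {P : ι → Set V} {q w ℓ k : ℕ}

/-- Delete the edges touching `Z`. -/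
def off (G : SimpleGraph V) (Z : Set V) : SimpleGraph V where
  Adj x y := G.Adj x y ∧ x ∉ Z ∧ y ∉ Z
  symm := ⟨fun _ _ h => ⟨h.1.symm, h.2.2, h.2.1⟩⟩
  loopless := ⟨fun _ h => G.loopless.irrefl _ h.1⟩

theorem off_le : off G Z ≤ G := fun _ _ h => h.1

theorem Conn.off (h : Conn G S) (hd : Disjoint S Z) : Conn (off G Z) S :=
  h.mono fun _ ha _ hb hab => ⟨hab, Set.disjoint_left.1 hd ha, Set.disjoint_left.1 hd hb⟩

theorem Conn.disjoint_of_off {b : V} (h : Conn (_root_.off G Z) S) (hb : b ∈ S) (hbZ : b ∉ Z) : Disjoint S Z := by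
  refine Set.disjoint_left.2 fun x hx => ?_
  exact h.2 Zᶜ ⟨b, hb, hbZ⟩ (fun _ _ _ _ _ hab => hab.2.2) hx

theorem IsPoS.mono_le {t : Fin w → List V} {c : Fin ℓ → Set V} (h : IsPoS Γ w ℓ t c) (hG : Γ ≤ G) : IsPoS G w ℓ t c :=
  ⟨fun i => (h.chain i).imp fun _ _ h => hG h, h.nodup, h.disj, fun j => (h.conn j).mono_le hG, h.cdisj,
    h.meet, h.ordered⟩

theorem IsLinkage.linked [Finite V] {t : Fin q → List V} (h : IsLinkage G A B t) {J : Finset (Fin q)}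
    (hJ : ∀ i ∈ J, Conn Γ {x | x ∈ t i}) : Linked Γ A B J.card := by
  intro S hS
  have : ∀ i : J, ∃ z ∈ t i, z ∈ S := by
    rintro ⟨i, hi⟩
    obtain ⟨a, ha, b, hb, ht⟩ := h.track i
    exact hS _ (hJ i hi) ⟨a, ht.mem_head, ha⟩ ⟨b, ht.mem_last, hb⟩
  choose z hz hzS using this
  have hinj : Function.Injective z := by
    intro i j hij
    by_contra hne
    exact h.disj i j (fun e => hne (Subtype.ext e)) _ (hz i) (hij ▸ hz j)
  have h1 := Set.ncard_le_ncard (s := Set.range z) (t := S) (by rintro _ ⟨i, rfl⟩; exact hzS i) (Set.toFinite _)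
  rwa [← Nat.card_coe_set_eq, Nat.card_range_of_injective hinj, Nat.card_eq_fintype_card, Fintype.card_coe] at h1

theorem Linked.mono (h : Linked G A B k) (hq : q ≤ k) : Linked G A B q := fun S hS => hq.trans (h S hS)

/-- Bound on the number of sets met often in the slicing lemma. -/
def sliceBound (ℓ q : ℕ) : ℕ := 2 ^ q * ((ℓ + 1) * (ℓ * q + 1))

def routeBound (w ℓ : ℕ) : ℕ → ℕ
  | 0 => 1
  | n + 1 => routeBound w ℓ n + w + n * sliceBound ℓ (routeBound w ℓ n + w) + 1

theorem exists_route [Finite V] (hw : 1 ≤ w) (hP : ∀ i j, i ≠ j → Disjoint (P i) (P j)) (D : Finset (ι × ι)) :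
    ∀ {G : SimpleGraph V}, (∀ t c, ¬ IsPoS G w ℓ t c) → (∀ e ∈ D, e.1 ≠ e.2) →
    (∀ e ∈ D, ∀ a ∈ P e.1, ∀ b ∈ P e.2, ¬ G.Adj a b) →
    (∀ e ∈ D, Linked (off G (⋃ l : {l // l ≠ e.1 ∧ l ≠ e.2}, P l)) (P e.1) (P e.2) (routeBound w ℓ D.card)) →
    ∃ K : ι × ι → Set V, (∀ e ∈ D, Conn G (K e) ∧ (∀ l, Disjoint (K e) (P l)) ∧
      (∃ a ∈ P e.1, ∃ b ∈ K e, G.Adj a b) ∧ ∃ a ∈ P e.2, ∃ b ∈ K e, G.Adj a b) ∧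
      ∀ e ∈ D, ∀ e' ∈ D, e ≠ e' → Disjoint (K e) (K e') := by
  classical
  induction D using Finset.induction_on with
  | empty => exact fun _ _ _ _ => ⟨fun _ => ∅, by simp, by simp⟩
  | insert e D he ih =>
    intro G hpos hne hna hL
    rw [Finset.card_insert_of_notMem he] at hL
    have heD := Finset.mem_insert_self e D
    obtain ⟨t, htr, htd⟩ := (hL e heD).exists_tracks
    have hcon : ∀ i : Fin (routeBound w ℓ (D.card + 1)), ∃ K ⊆ {x | x ∈ t i}, Conn G K ∧ (∀ l, Disjoint K (P l)) ∧
        (∃ a ∈ P e.1, ∃ b ∈ K, G.Adj a b) ∧ ∃ a ∈ P e.2, ∃ b ∈ K, G.Adj a b := by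
      intro i
      obtain ⟨a, ha, b, hb, hti⟩ := htr i
      rcases hti.conn.connector ⟨a, hti.mem_head, ha⟩ ⟨b, hti.mem_last, hb⟩ (hP _ _ (hne e heD)) with h | h
      · obtain ⟨a, -, ha, b, -, hb, hab⟩ := h
        exact absurd hab.1 (hna e heD a ha b hb)
      · obtain ⟨K, hK, hKc, ⟨a, -, ha, x, hx, hax⟩, ⟨b, -, hb, y, hy, hby⟩⟩ := h
        refine ⟨K, fun z hz => (hK hz).1, hKc.mono_le off_le, fun l => ?_, ⟨a, ha, x, hx, hax.1⟩, ⟨b, hb, y, hy, hby.1⟩⟩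
        have h1 := (Set.disjoint_union_right.1 (Set.disjoint_of_subset_left hK Set.disjoint_sdiff_left))
        by_cases hl1 : l = e.1
        · exact hl1 ▸ h1.1
        by_cases hl2 : l = e.2
        · exact hl2 ▸ h1.2
        exact (hKc.disjoint_of_off hx hax.2.2).mono_right
          (Set.subset_iUnion (fun l : {l // l ≠ e.1 ∧ l ≠ e.2} => P l) ⟨l, hl1, hl2⟩)
    choose K hKt hK hKP hK1 hK2 using hcon
    have hKd : ∀ i j, i ≠ j → Disjoint (K i) (K j) := fun i j hij =>
      Set.disjoint_left.2 fun x hx hx' => htd i j hij x (hKt i hx) (hKt j hx')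
    set q := routeBound w ℓ D.card + w with hq
    have hslice : ∀ e' ∈ D, ∃ t : Fin q → List V,
        IsLinkage (off G (⋃ l : {l // l ≠ e'.1 ∧ l ≠ e'.2}, P l)) (P e'.1) (P e'.2) t ∧
        {i | w ≤ {j : Fin q | ∃ x ∈ t j, x ∈ K i}.ncard}.ncard ≤ sliceBound ℓ q := by
      intro e' he'
      refine exists_linkage_of_not_pos (fun i => (hK i).off ?_) hKd hw
        ((hL e' (Finset.mem_insert_of_mem he')).mono ?_) fun t c h => hpos t c (h.mono_le off_le)
      · exact Set.disjoint_iUnion_right.2 fun l => hKP i l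
      · rw [routeBound]; omega
    have hgood : ∃ i, ∀ e' ∈ D, ∃ t : Fin q → List V,
        IsLinkage (off G (⋃ l : {l // l ≠ e'.1 ∧ l ≠ e'.2}, P l)) (P e'.1) (P e'.2) t ∧
        {j : Fin q | ∃ x ∈ t j, x ∈ K i}.ncard < w := by
      choose! s hs hsn using hslice
      by_contra! hcon
      have h1 : (Set.univ : Set (Fin (routeBound w ℓ (D.card + 1)))) ⊆
          ⋃ e' : D, {i | w ≤ {j : Fin q | ∃ x ∈ s e' j, x ∈ K i}.ncard} := by
        intro i _
        obtain ⟨e', he', h⟩ := hcon i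
        exact Set.mem_iUnion.2 ⟨⟨e', he'⟩, h _ (hs e' he')⟩
      have h2 := (Set.ncard_le_ncard h1 (Set.toFinite _)).trans (Set.ncard_iUnion_le_of_fintype _)
      have h3 : ∑ e' : D, {i | w ≤ {j : Fin q | ∃ x ∈ s e' j, x ∈ K i}.ncard}.ncard ≤ ∑ e' : D, sliceBound ℓ q :=
        Finset.sum_le_sum fun e' _ => hsn e' e'.2
      rw [Finset.sum_const, Finset.card_univ, Fintype.card_coe, smul_eq_mul] at h3
      have h5 : routeBound w ℓ (D.card + 1) = q + D.card * sliceBound ℓ q + 1 := rfl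
      rw [Set.ncard_univ, Nat.card_fin] at h2
      omega
    obtain ⟨i, hi⟩ := hgood
    obtain ⟨K', hK', hK'd⟩ := ih (G := off G (K i)) (fun t c h => hpos t c (h.mono_le off_le))
      (fun e he => hne e (Finset.mem_insert_of_mem he))
      (fun e he a ha b hb hab => hna e (Finset.mem_insert_of_mem he) a ha b hb hab.1) fun e' he' => by
        obtain ⟨s, hs, hsn⟩ := hi e' he'
        have hJ : routeBound w ℓ D.card ≤ ({j | ¬ ∃ x ∈ s j, x ∈ K i} : Finset (Fin q)).card := by
          have h1 := Finset.card_filter_add_card_filter_not (s := (Finset.univ : Finset (Fin q)))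
            (fun j => ∃ x ∈ s j, x ∈ K i)
          rw [Finset.card_univ, Fintype.card_fin] at h1
          rw [← Set.ncard_coe_finset] at h1
          simp only [Finset.coe_filter, Finset.mem_univ, true_and] at h1
          omega
        refine (hs.linked fun j hj => ?_).mono hJ
        obtain ⟨_, _, _, _, hsj⟩ := hs.track j
        refine hsj.conn.mono fun a ha b hb hab => ⟨⟨hab.1, fun h => ?_, fun h => ?_⟩, hab.2⟩
        · exact (Finset.mem_filter.1 hj).2 ⟨a, ha, h⟩
        · exact (Finset.mem_filter.1 hj).2 ⟨b, hb, h⟩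
    have hKK' : ∀ e' ∈ D, Disjoint (K' e') (K i) := by
      intro e' he'
      obtain ⟨h1, -, ⟨a, ha, b, hb, hab⟩, -⟩ := hK' e' he'
      exact h1.disjoint_of_off hb hab.2.2
    have hne' : ∀ e' ∈ D, e' ≠ e := fun e' he' h => he (h ▸ he')
    refine ⟨Function.update K' e (K i), ?_, ?_⟩
    · intro e' he'
      rcases Finset.mem_insert.1 he' with rfl | he'
      · rw [Function.update_self]
        exact ⟨hK i, hKP i, hK1 i, hK2 i⟩
      · rw [Function.update_of_ne (hne' e' he')]
        obtain ⟨h1, h2, ⟨a, ha, b, hb, hab⟩, ⟨a', ha', b', hb', hab'⟩⟩ := hK' e' he'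
        exact ⟨h1.mono_le off_le, h2, ⟨a, ha, b, hb, hab.1⟩, ⟨a', ha', b', hb', hab'.1⟩⟩
    · intro e₁ h₁ e₂ h₂ h12
      rcases Finset.mem_insert.1 h₁ with rfl | g₁ <;> rcases Finset.mem_insert.1 h₂ with rfl | g₂
      · exact absurd rfl h12
      · rw [Function.update_self, Function.update_of_ne (hne' _ g₂)]
        exact (hKK' _ g₂).symm
      · rw [Function.update_self, Function.update_of_ne (hne' _ g₁)]
        exact hKK' _ g₁
      · rw [Function.update_of_ne (hne' _ g₁), Function.update_of_ne (hne' _ g₂)]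
        exact hK'd _ g₁ _ g₂ h12

end Route

section Select

theorem exists_transversal {m R n : ℕ} {Bad : Fin m × Fin R → Fin m × Fin R → Set (Fin m × Fin R)}
    (hB : ∀ p q, (Bad p q).ncard ≤ n) (hR : m * (m * m) * n < R) :
    ∃ φ : Fin m → Fin R, ∀ a b c, a ≠ c → b ≠ c → (c, φ c) ∉ Bad (a, φ a) (b, φ b) := by
  classical
  let F : Fin m × Fin m × Fin m → Finset (Fin m → Fin R) := fun x =>
    {φ | x.1 ≠ x.2.2 ∧ x.2.1 ≠ x.2.2 ∧ (x.2.2, φ x.2.2) ∈ Bad (x.1, φ x.1) (x.2.1, φ x.2.1)}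
  have hF : ∀ x, (F x).card * R ≤ n * Fintype.card (Fin m → Fin R) := by
    intro x
    have h1 := Finset.card_le_mul_card_image (s := F x ×ˢ (Finset.univ : Finset (Fin R)))
      (f := fun y => Function.update y.1 x.2.2 y.2) n ?_
    · rw [Finset.card_product, Finset.card_univ, Fintype.card_fin] at h1
      exact h1.trans (Nat.mul_le_mul_left _ (Finset.card_le_univ _))
    · intro ψ _
      refine le_trans ?_ (hB (x.1, ψ x.1) (x.2.1, ψ x.2.1))
      rw [← Set.ncard_coe_finset]
      refine Set.ncard_le_ncard_of_injOn (fun y => (x.2.2, y.1 x.2.2)) ?_ ?_ (Set.toFinite _)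
      · rintro ⟨φ, r⟩ h
        simp only [Finset.coe_filter, Finset.mem_product, F, Finset.mem_filter, Finset.mem_univ, true_and, and_true,
          Set.mem_ofPred_eq] at h
        obtain ⟨⟨h1, h2, h3⟩, rfl⟩ := h
        simpa [Function.update_of_ne h1, Function.update_of_ne h2] using h3
      · rintro ⟨φ, r⟩ h ⟨φ', r'⟩ h' heq
        simp only [Finset.coe_filter, Set.mem_ofPred_eq] at h h'
        simp only [Prod.mk.injEq, true_and] at heq
        have h3 := h.2.trans h'.2.symm
        simp only [Prod.mk.injEq]
        constructor
        · funext i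
          by_cases hi : i = x.2.2
          · rw [hi, heq]
          · simpa [Function.update_of_ne hi] using congrFun h3 i
        · simpa using congrFun h3 x.2.2
  by_contra! hcon
  have h1 : (Finset.univ : Finset (Fin m → Fin R)) ⊆ Finset.univ.biUnion F := by
    intro φ _
    obtain ⟨a, b, c, h1, h2, h3⟩ := hcon φ
    exact Finset.mem_biUnion.2 ⟨(a, b, c), Finset.mem_univ _, by simp only [F, Finset.mem_filter]; exact ⟨Finset.mem_univ _, h1, h2, h3⟩⟩
  have h2 := (Finset.card_le_card h1).trans Finset.card_biUnion_le
  rw [Finset.card_univ] at h2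
  have h3 := Nat.mul_le_mul_right R h2
  rw [Finset.sum_mul] at h3
  have h4 := h3.trans (Finset.sum_le_sum fun x _ => hF x)
  rw [Finset.sum_const, Finset.card_univ, Fintype.card_prod, Fintype.card_prod, Fintype.card_fin, smul_eq_mul] at h4
  have : 0 < Fintype.card (Fin m → Fin R) := by
    have : Nonempty (Fin R) := ⟨⟨0, by omega⟩⟩
    exact Fintype.card_pos
  nlinarith

variable {V : Type*} {G : SimpleGraph V} {w ℓ m : ℕ}

/-- The connectivity needed to find a clique minor of order `m`. -/
def cliqueLink (w ℓ m : ℕ) : ℕ := routeBound w ℓ (m * m) + m * w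

/-- The number of linked sets, per branch set, needed to find a clique minor of order `m`. -/
def cliqueWidth (w ℓ m : ℕ) : ℕ := m * (m * m) * sliceBound ℓ (cliqueLink w ℓ m) + 1

theorem routeBound_mono : Monotone (routeBound w ℓ) :=
  monotone_nat_of_le_succ fun n => by rw [routeBound]; omega

theorem minorIn_top_of_linked [Finite V] (hw : 1 ≤ w) (hpos : ∀ t c, ¬ IsPoS G w ℓ t c)
    {P : Fin m × Fin (cliqueWidth w ℓ m) → Set V} (hP : ∀ i, Conn G (P i)) (hd : ∀ i j, i ≠ j → Disjoint (P i) (P j))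
    (hL : ∀ i j, Linked G (P i) (P j) (cliqueLink w ℓ m)) : MinorIn (⊤ : SimpleGraph (Fin m)) G Set.univ := by
  classical
  choose t ht hbad using fun i j => exists_linkage_of_not_pos hP hd hw (hL i j) hpos
  obtain ⟨φ, hφ⟩ := exists_transversal hbad (R := cliqueWidth w ℓ m) (by rw [cliqueWidth, sliceBound]; omega)
  let Q : Fin m → Set V := fun a => P (a, φ a)
  have hQd : ∀ a b, a ≠ b → Disjoint (Q a) (Q b) := fun a b hab => hd _ _ fun h => hab (congrArg Prod.fst h)
  let D : Finset (Fin m × Fin m) := {e | e.1 < e.2 ∧ ∀ a ∈ Q e.1, ∀ b ∈ Q e.2, ¬ G.Adj a b}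
  have hD : ∀ {e}, e ∈ D ↔ e.1 < e.2 ∧ ∀ a ∈ Q e.1, ∀ b ∈ Q e.2, ¬ G.Adj a b := by simp [D]
  obtain ⟨K, hK, hKd⟩ := exists_route hw hQd D hpos (fun e he => (hD.1 he).1.ne) (fun e he => (hD.1 he).2) (by
    rintro ⟨a, b⟩ he
    have hab := (hD.1 he).1
    set s := t (a, φ a) (b, φ b)
    let J : Finset (Fin (cliqueLink w ℓ m)) := {j | ∀ l, l ≠ a → l ≠ b → ∀ x ∈ s j, x ∉ Q l}
    have hJ : routeBound w ℓ (m * m) ≤ J.card := by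
      have h1 : (Finset.univ : Finset (Fin (cliqueLink w ℓ m))) ⊆ J ∪ Finset.univ.biUnion fun l : Fin m =>
          {j | l ≠ a ∧ l ≠ b ∧ ∃ x ∈ s j, x ∈ Q l} := by
        intro j _
        by_cases hj : j ∈ J
        · exact Finset.mem_union_left _ hj
        · simp only [J, Finset.mem_filter, Finset.mem_univ, true_and] at hj
          push Not at hj
          obtain ⟨l, h1, h2, h3⟩ := hj
          exact Finset.mem_union_right _ (Finset.mem_biUnion.2 ⟨l, Finset.mem_univ _, by simpa using ⟨h1, h2, h3⟩⟩)
      have h2 := (Finset.card_le_card h1).trans (Finset.card_union_le _ _)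
      have h3 : (Finset.univ.biUnion fun l : Fin m =>
          ({j | l ≠ a ∧ l ≠ b ∧ ∃ x ∈ s j, x ∈ Q l} : Finset (Fin (cliqueLink w ℓ m)))).card ≤ ∑ l : Fin m, w := by
        refine Finset.card_biUnion_le.trans (Finset.sum_le_sum fun l _ => ?_)
        by_cases h : l ≠ a ∧ l ≠ b
        · have h4 := hφ a b l h.1.symm h.2.symm
          simp only [Set.mem_ofPred_eq, not_le] at h4
          refine le_trans (le_of_eq ?_) h4.le
          rw [← Set.ncard_coe_finset]
          congr 1
          ext j
          simp [h.1, h.2, s, Q]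
        · rw [Finset.card_eq_zero.2]
          · exact Nat.zero_le _
          · rw [Finset.filter_eq_empty_iff]
            exact fun j _ h' => h ⟨h'.1, h'.2.1⟩
      rw [Finset.sum_const, Finset.card_univ, Fintype.card_fin, smul_eq_mul] at h3
      rw [Finset.card_univ, Fintype.card_fin] at h2
      have h4 : cliqueLink w ℓ m = routeBound w ℓ (m * m) + m * w := rfl
      omega
    refine Linked.mono ((ht (a, φ a) (b, φ b)).linked (J := J) fun j hj => ?_) (le_trans (routeBound_mono ?_) hJ)
    · obtain ⟨_, _, _, _, hsj⟩ := (ht (a, φ a) (b, φ b)).track j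
      refine hsj.conn.off (Set.disjoint_iUnion_right.2 fun l => Set.disjoint_left.2 fun x hx => ?_)
      exact (Finset.mem_filter.1 hj).2 l l.2.1 l.2.2 x hx
    · exact (Finset.card_le_univ D).trans (by simp))
  let B : Fin m → Set V := fun a => Q a ∪ ⋃ e : {e // e ∈ D ∧ e.1 = a}, K e
  have hadj : ∀ a b, a < b → ∃ x ∈ B a, ∃ y ∈ B b, G.Adj x y := by
    intro a b hab
    by_cases he : (a, b) ∈ D
    · obtain ⟨-, -, -, ⟨y, hy, x, hx, hxy⟩⟩ := hK _ he
      exact ⟨x, Or.inr (Set.mem_iUnion.2 ⟨⟨(a, b), he, rfl⟩, hx⟩), y, Or.inl hy, hxy.symm⟩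
    · rw [hD] at he
      push Not at he
      obtain ⟨x, hx, y, hy, hxy⟩ := he hab
      exact ⟨x, Or.inl hx, y, Or.inl hy, hxy⟩
  refine ⟨B, fun _ => Set.subset_univ _, fun a => ?_, fun a b hab => ?_, fun a b hab => ?_⟩
  · refine (hP _).union_iUnion (fun e => (hK e e.2.1).1) fun e => Or.inr ?_
    obtain ⟨-, -, h, -⟩ := hK e e.2.1
    rwa [e.2.2] at h
  · refine Set.disjoint_union_left.2 ⟨Set.disjoint_union_right.2 ⟨hQd a b hab, ?_⟩,
      Set.disjoint_union_right.2 ⟨?_, ?_⟩⟩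
    · exact Set.disjoint_iUnion_right.2 fun e => ((hK e e.2.1).2.1 a).symm
    · exact Set.disjoint_iUnion_left.2 fun e => (hK e e.2.1).2.1 b
    · refine Set.disjoint_iUnion_left.2 fun e => Set.disjoint_iUnion_right.2 fun e' => ?_
      exact hKd e e.2.1 e' e'.2.1 fun h => hab (by rw [← e.2.2, ← e'.2.2, h])
  · rcases lt_or_gt_of_ne hab with h | h
    · exact hadj a b h
    · obtain ⟨x, hx, y, hy, hxy⟩ := hadj b a h
      exact ⟨y, hy, x, hx, hxy.symm⟩

end Select

section Layers

/-- The cartesian product of `L` with an infinite path. -/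
def layers {K : Type*} (L : SimpleGraph K) : SimpleGraph (K × ℕ) where
  Adj x y := (L.Adj x.1 y.1 ∧ x.2 = y.2) ∨ (x.1 = y.1 ∧ (x.2 + 1 = y.2 ∨ y.2 + 1 = x.2))
  symm := ⟨fun _ _ h => by
    rcases h with ⟨h1, h2⟩ | ⟨h1, h2⟩
    exacts [Or.inl ⟨h1.symm, h2.symm⟩, Or.inr ⟨h1.symm, h2.symm⟩]⟩
  loopless := ⟨fun x h => by
    rcases h with ⟨h1, -⟩ | ⟨-, h2⟩
    exacts [L.loopless.irrefl _ h1, by omega]⟩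

variable {V : Type*} {G : SimpleGraph V} {w ℓ : ℕ} {t : Fin w → List V} {c : Set V}

/-- Inside `c` one can leave the track `t i` and reach the track `t i'` without using other tracks. -/
def Bridge (G : SimpleGraph V) (t : Fin w → List V) (c : Set V) (i i' : Fin w) : Prop :=
  ∃ K ⊆ c, Conn G K ∧ (∃ a ∈ K, a ∈ t i ∧ ∀ x ∈ K, ∀ l, x ∈ t l → x = a) ∧ ∃ k ∈ K, ∃ b ∈ c, b ∈ t i' ∧ G.Adj k b

def slotGraph (G : SimpleGraph V) (t : Fin w → List V) (c : Set V) : SimpleGraph (Fin w) where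
  Adj i i' := i ≠ i' ∧ Bridge G t c i i' ∧ Bridge G t c i' i
  symm := ⟨fun _ _ h => ⟨h.1.symm, h.2.2, h.2.1⟩⟩
  loopless := ⟨fun _ h => h.1 rfl⟩

theorem conn_slotGraph (hw : 1 ≤ w) (hc : Conn G c) (hd : ∀ i j, i ≠ j → ∀ v ∈ t i, v ∉ t j)
    (hm : ∀ i, ∃ x ∈ t i, x ∈ c) : Conn (slotGraph G t c) Set.univ := by
  refine ⟨⟨⟨0, hw⟩, trivial⟩, ?_⟩
  rintro T ⟨i₁, -, hi₁⟩ hcl i₂ -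
  by_contra hi₂
  obtain ⟨x₁, hx₁, hxc₁⟩ := hm i₁
  obtain ⟨x₂, hx₂, hxc₂⟩ := hm i₂
  have key : ∀ i ∈ T, ∀ i' ∉ T, Bridge G t c i i' → Bridge G t c i' i → False := fun i hi i' hi' h1 h2 =>
    hi' (hcl i trivial hi i' trivial ⟨fun h => hi' (h ▸ hi), h1, h2⟩)
  rcases hc.connector (P := {x | ∃ i ∈ T, x ∈ t i}) (Q := {x | ∃ i ∉ T, x ∈ t i}) ⟨x₁, hxc₁, i₁, hi₁, hx₁⟩
    ⟨x₂, hxc₂, i₂, hi₂, hx₂⟩ (Set.disjoint_left.2 (by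
      rintro x ⟨i, hi, hx⟩ ⟨i', hi', hx'⟩
      exact hd i i' (fun h => hi' (h ▸ hi)) x hx hx')) with h | h
  · obtain ⟨a, hac, ⟨i, hi, ha⟩, b, hbc, ⟨i', hi', hb⟩, hab⟩ := h
    have hs : ∀ x i a, a ∈ t i → x ∈ ({a} : Set V) → ∀ l, x ∈ t l → x = a := fun x i a _ hx _ _ => hx
    exact key i hi i' hi' ⟨{a}, by simpa using hac, .singleton a, ⟨a, rfl, ha, fun x hx _ _ => hx⟩, a, rfl, b, hbc, hb, hab⟩
      ⟨{b}, by simpa using hbc, .singleton b, ⟨b, rfl, hb, fun x hx _ _ => hx⟩, b, rfl, a, hac, ha, hab.symm⟩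
  · obtain ⟨K, hKc, hK, ⟨a, hac, ⟨i, hi, ha⟩, k, hk, hak⟩, ⟨b, hbc, ⟨i', hi', hb⟩, k', hk', hbk⟩⟩ := h
    have hoff : ∀ x ∈ K, ∀ l, x ∉ t l := by
      intro x hx l hl
      by_cases hlT : l ∈ T
      · exact (hKc hx).2 (Or.inl ⟨l, hlT, hl⟩)
      · exact (hKc hx).2 (Or.inr ⟨l, hlT, hl⟩)
    refine key i hi i' hi' ⟨insert a K, Set.insert_subset hac fun x hx => (hKc hx).1, hK.insert_adj ⟨k, hk, hak⟩,
      ⟨a, Or.inl rfl, ha, ?_⟩, k', Or.inr hk', b, hbc, hb, hbk.symm⟩ ⟨insert b K, Set.insert_subset hbc fun x hx => (hKc hx).1,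
      hK.insert_adj ⟨k', hk', hbk⟩, ⟨b, Or.inl rfl, hb, ?_⟩, k, Or.inr hk, a, hac, ha, hak.symm⟩
    all_goals
      rintro x (rfl | hx) l hl
      · rfl
      · exact absurd hl (hoff x hx l)

theorem IsPoS.minorIn {K : Type*} {H : SimpleGraph K} {M : ℕ} {L : SimpleGraph (Fin w)}
    {c : Fin (M * (w * w) + 1) → Set V} (h : IsPoS G w (M * (w * w) + 1) t c)
    (hL : ∀ j i i', L.Adj i i' → Bridge G t (c j) i i') (hH : MinorIn H (layers L) {x | x.2 < M}) :
    MinorIn H G Set.univ := by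
  obtain ⟨cc, hcc⟩ : ∃ cc : ℕ → Set V, ∀ j (hj : j < M * (w * w) + 1), cc j = c ⟨j, hj⟩ :=
    ⟨fun j => if hj : j < M * (w * w) + 1 then c ⟨j, hj⟩ else ∅, fun j hj => by simp [hj]⟩
  have hord : ∀ i : Fin w, ∀ j j' : ℕ, j < j' → j' < M * (w * w) + 1 → ∀ (a b : ℕ) (x y : V), (t i)[a]? = some x →
      x ∈ cc j → (t i)[b]? = some y → y ∈ cc j' → a < b := by
    intro i j j' hjj hj' a b x y ha hx hb hy
    rw [hcc j (hjj.trans hj')] at hx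
    rw [hcc j' hj'] at hy
    exact h.ordered i _ _ (by simpa using hjj) a b x y ha hx hb hy
  have hcd : ∀ j j' : ℕ, j < M * (w * w) + 1 → j' < M * (w * w) + 1 → j ≠ j' → Disjoint (cc j) (cc j') := by
    intro j j' hj hj' hne
    rw [hcc j hj, hcc j' hj']
    exact h.cdisj _ _ (by simpa using hne)
  have hslot : ∀ p < M, ∀ e < w * w, p * (w * w) + e < (p + 1) * (w * w) := by intros; nlinarith
  have hslot' : ∀ p ≤ M, p * (w * w) < M * (w * w) + 1 := fun p hp => Nat.lt_succ_of_le (Nat.mul_le_mul_right _ hp)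
  have hf : ∀ (i : Fin w) (p : ℕ), ∃ k : ℕ, p ≤ M → (∃ z, (t i)[k]? = some z ∧ z ∈ cc (p * (w * w))) ∧
      ∀ k' z', (t i)[k']? = some z' → z' ∈ cc (p * (w * w)) → k ≤ k' := by
    classical
    intro i p
    by_cases hp : p ≤ M
    · have hex : ∃ k : ℕ, ∃ z, (t i)[k]? = some z ∧ z ∈ cc (p * (w * w)) := by
        obtain ⟨x, hx, hxc⟩ := h.meet i ⟨p * (w * w), hslot' p hp⟩
        obtain ⟨k, hk⟩ := List.getElem?_of_mem hx
        exact ⟨k, x, hk, by rwa [hcc _ (hslot' p hp)]⟩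
      exact ⟨Nat.find hex, fun _ => ⟨Nat.find_spec hex, fun k' z' h1 h2 => Nat.find_min' hex ⟨z', h1, h2⟩⟩⟩
    · exact ⟨0, fun h => absurd h hp⟩
  choose f hf using hf
  have hvisit : ∀ i : Fin w, ∀ p < M, ∀ e < w * w, ∀ (a : ℕ) (x : V), (t i)[a]? = some x → x ∈ cc (p * (w * w) + e) →
      f i p ≤ a ∧ a < f i (p + 1) := by
    intro i p hp e he a x ha hx
    obtain ⟨⟨z, hz, hzc⟩, h1⟩ := hf i p hp.le
    obtain ⟨⟨z', hz', hzc'⟩, -⟩ := hf i (p + 1) hp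
    refine ⟨?_, hord i _ _ (hslot p hp e he) (hslot' _ hp) _ _ _ _ ha hx hz' hzc'⟩
    rcases Nat.eq_zero_or_pos e with rfl | he0
    · exact h1 _ _ ha hx
    · exact (hord i _ _ (by omega) ((hslot p hp e he).trans (hslot' (p + 1) hp)) _ _ _ _ hz hzc ha hx).le
  have hw0 : ∀ i : Fin w, 0 < w * w := fun i => Nat.mul_pos (by have := i.2; omega) (by have := i.2; omega)
  have hflt : ∀ i : Fin w, ∀ p < M, f i p < f i (p + 1) := by
    intro i p hp
    obtain ⟨⟨z, hz, hzc⟩, -⟩ := hf i p hp.le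
    exact (hvisit i p hp 0 (hw0 i) _ z hz (by simpa using hzc)).2
  have hfle : ∀ i : Fin w, ∀ p p', p ≤ p' → p' ≤ M → f i p ≤ f i p' := by
    intro i p p' hpp
    induction p', hpp using Nat.le_induction with
    | base => exact fun _ => le_rfl
    | succ p' _ ih => exact fun hp' => (ih (by omega)).trans (hflt i p' (by omega)).le
  let enc : Fin w → Fin w → ℕ := fun i i' => i * w + i'
  have henc : ∀ i i', enc i i' < w * w := by
    intro i i'
    have h1 : (i.1 + 1) * w ≤ w * w := Nat.mul_le_mul_right _ i.2
    have := i'.2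
    simp only [enc]; nlinarith
  let slot : ℕ → Fin w → Fin w → ℕ := fun p i i' => p * (w * w) + enc i i'
  have hslt : ∀ p < M, ∀ i i', slot p i i' < M * (w * w) + 1 := fun p hp i i' =>
    (hslot p hp _ (henc i i')).trans (hslot' (p + 1) hp)
  have hsinj : ∀ p p' i i' j j', slot p i i' = slot p' j j' → p = p' ∧ i = j ∧ i' = j' := by
    intro p p' i i' j j' heq
    have h1 : p = p' := by
      have := congrArg (· / (w * w)) heq
      simpa [slot, Nat.add_div_of_dvd_right (Dvd.intro_left p rfl), Nat.add_div_of_dvd_right (Dvd.intro_left p' rfl),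
        Nat.div_eq_of_lt (henc _ _), hw0 i] using this
    subst h1
    have h2 : i.1 * w + i'.1 = j.1 * w + j'.1 := by simpa [slot, enc] using heq
    have h3 : i = j := by
      have := congrArg (· / w) h2
      have hw : 0 < w := by have := i.2; omega
      exact Fin.ext (by simpa [Nat.add_div_of_dvd_right (Dvd.intro_left _ rfl), Nat.div_eq_of_lt i'.2,
        Nat.div_eq_of_lt j'.2, hw] using this)
    subst h3
    exact ⟨rfl, rfl, Fin.ext (by omega)⟩
  have hK : ∀ p i i', ∃ K : Set V, p < M → L.Adj i i' → K ⊆ cc (slot p i i') ∧ Conn G K ∧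
      (∃ a ∈ K, a ∈ t i ∧ ∀ x ∈ K, ∀ l, x ∈ t l → x = a) ∧ ∃ k ∈ K, ∃ b ∈ cc (slot p i i'), b ∈ t i' ∧ G.Adj k b := by
    intro p i i'
    by_cases hp : p < M ∧ L.Adj i i'
    · obtain ⟨K, h1, h2⟩ := hL ⟨slot p i i', hslt p hp.1 i i'⟩ i i' hp.2
      exact ⟨K, fun _ _ => by rw [hcc _ (hslt p hp.1 i i')]; exact ⟨h1, h2⟩⟩
    · exact ⟨∅, fun h1 h2 => absurd ⟨h1, h2⟩ hp⟩
  choose X hX using hK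
  let Blk : Fin w → ℕ → Set V := fun i p => {x | ∃ k, f i p ≤ k ∧ k ≤ f i (p + 1) - 1 ∧ (t i)[k]? = some x}
  have hblk_of : ∀ i, ∀ p < M, ∀ e < w * w, ∀ x ∈ t i, x ∈ cc (p * (w * w) + e) → x ∈ Blk i p := by
    intro i p hp e he x hx hxc
    obtain ⟨k, hk⟩ := List.getElem?_of_mem hx
    have := hvisit i p hp e he k x hk hxc
    exact ⟨k, this.1, by omega, hk⟩
  have hblk_mem : ∀ {i p x}, x ∈ Blk i p → x ∈ t i := by
    rintro i p x ⟨k, -, -, hk⟩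
    exact List.mem_of_getElem? hk
  have htd : ∀ {i j x}, x ∈ t i → x ∈ t j → i = j := by
    intro i j x h1 h2
    by_contra hne
    exact h.disj i j hne x h1 h2
  have hblk_uniq : ∀ {i j p p' x}, p < M → p' < M → x ∈ Blk i p → x ∈ Blk j p' → i = j ∧ p = p' := by
    intro i j p p' x hp hp' hx hx'
    obtain rfl := htd (hblk_mem hx) (hblk_mem hx')
    refine ⟨rfl, ?_⟩
    obtain ⟨k, h1, h2, h3⟩ := hx
    obtain ⟨k', h1', h2', h3'⟩ := hx'
    obtain rfl := (h.nodup i).getElem?_inj' h3 h3'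
    have := hflt i p hp
    have := hflt i p' hp'
    rcases lt_trichotomy p p' with h4 | h4 | h4
    · have := hfle i (p + 1) p' h4 hp'.le; omega
    · exact h4
    · have := hfle i (p' + 1) p h4 hp.le; omega
  have hXB : ∀ {p i i' x l}, p < M → L.Adj i i' → x ∈ X p i i' → x ∈ t l → x ∈ Blk i p := by
    intro p i i' x l hp hii hx hxl
    obtain ⟨h1, -, ⟨a, ha, hat, hu⟩, -⟩ := hX p i i' hp hii
    obtain rfl := hu x hx l hxl
    exact hblk_of i p hp _ (henc i i') x hat (h1 ha)
  have hadj : ∀ i, ∀ p, p + 1 < M → ∃ x ∈ Blk i p, ∃ y ∈ Blk i (p + 1), G.Adj x y := by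
    intro i p hp
    have h1 := hflt i p (by omega)
    have h2 := hflt i (p + 1) hp
    obtain ⟨⟨z, hz, -⟩, -⟩ := hf i (p + 1) hp.le
    have hlt := List.lt_of_getElem? hz
    have hy : (t i)[f i (p + 1) - 1]? = some (t i)[f i (p + 1) - 1] := List.getElem?_eq_getElem (by omega)
    refine ⟨_, ⟨f i (p + 1) - 1, by omega, le_rfl, hy⟩, z, ⟨f i (p + 1), le_rfl, by omega, hz⟩, ?_⟩
    exact (h.chain i).adj_getElem? hy (by rwa [Nat.sub_add_cancel (by omega)])
  refine hH.lift (fun x => Blk x.1 x.2 ∪ ⋃ i' : {i' // L.Adj x.1 i'}, X x.2 x.1 i') (fun _ _ => Set.subset_univ _) ?_ ?_ ?_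
  · rintro ⟨i, p⟩ (hp : p < M)
    refine Conn.union_iUnion ?_ (fun i' => (hX p i i' hp i'.2).2.1) fun i' => Or.inl ?_
    · obtain ⟨⟨z, hz, -⟩, -⟩ := hf i (p + 1) hp
      have := List.lt_of_getElem? hz
      have := hflt i p hp
      exact conn_segment (show f i p ≤ f i (p + 1) - 1 by omega) (show f i (p + 1) - 1 < (t i).length by omega) fun k _ _ x y hx hy => (h.chain i).adj_getElem? hx hy
    · obtain ⟨-, -, ⟨a, ha, hat, -⟩, -⟩ := hX p i i' hp i'.2
      exact ⟨a, hXB hp i'.2 ha hat, ha⟩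
  · rintro ⟨i, p⟩ (hp : p < M) ⟨j, p'⟩ (hp' : p' < M) hne
    rw [Set.disjoint_left]
    intro x hx hx'
    have huq : x ∈ Blk i p → x ∈ Blk j p' → False := fun h1 h2 => by
      obtain ⟨rfl, rfl⟩ := hblk_uniq hp hp' h1 h2
      exact hne rfl
    rcases hx with hx | hx <;> rcases hx' with hx' | hx'
    · exact huq hx hx'
    · obtain ⟨i', hx'⟩ := Set.mem_iUnion.1 hx'
      exact huq hx (hXB hp' i'.2 hx' (hblk_mem hx))
    · obtain ⟨i', hx⟩ := Set.mem_iUnion.1 hx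
      exact huq (hXB hp i'.2 hx (hblk_mem hx')) hx'
    · obtain ⟨i', hx⟩ := Set.mem_iUnion.1 hx
      obtain ⟨j', hx'⟩ := Set.mem_iUnion.1 hx'
      have h1 := (hX p i i' hp i'.2).1 hx
      have h2 := (hX p' j j' hp' j'.2).1 hx'
      by_cases hs : slot p i i' = slot p' j j'
      · obtain ⟨rfl, rfl, -⟩ := hsinj _ _ _ _ _ _ hs
        exact hne rfl
      · exact Set.disjoint_left.1 (hcd _ _ (hslt p hp i i') (hslt p' hp' j j') hs) h1 h2
  · rintro ⟨i, p⟩ (hp : p < M) ⟨j, p'⟩ (hp' : p' < M) (⟨h1, h2⟩ | ⟨h1, h2⟩)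
    · simp only at h1 h2
      subst h2
      obtain ⟨-, -, -, k, hk, b, hb, hbj, hkb⟩ := hX p i j hp h1
      exact ⟨k, Or.inr (Set.mem_iUnion.2 ⟨⟨j, h1⟩, hk⟩), b, Or.inl (hblk_of j p hp _ (henc i j) b hbj hb), hkb⟩
    · simp only at h1 h2
      subst h1
      rcases h2 with rfl | rfl
      · obtain ⟨x, hx, y, hy, hxy⟩ := hadj i p hp'
        exact ⟨x, Or.inl hx, y, Or.inl hy, hxy⟩
      · obtain ⟨x, hx, y, hy, hxy⟩ := hadj i p' hp
        exact ⟨y, Or.inl hy, x, Or.inl hx, hxy.symm⟩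

end Layers

section LayersMinor

variable {K : Type*} {H : SimpleGraph K} {w r m M : ℕ} {L : SimpleGraph (Fin w)}

theorem exists_path_or_star (hL : Conn L Set.univ) (hw : (m + 1) ^ r < w) :
    (∃ h, m ≤ (L.neighborSet h).ncard) ∨ ∃ u : ℕ → Fin w, (∀ a < r, ∀ b < r, u a = u b → a = b) ∧
      ∀ a, a + 1 < r → L.Adj (u a) (u (a + 1)) := by
  by_contra! hcon
  obtain ⟨hdeg, hpath⟩ := hcon
  let v : Fin w := ⟨0, by omega⟩
  have hD : ∀ n, ∃ D : Set (Fin w), D.ncard ≤ (m + 1) ^ n ∧ ∀ p b, IsTrack L p v b → p.length ≤ n + 1 → b ∈ D := by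
    intro n
    induction n with
    | zero =>
      refine ⟨{v}, by simp, fun p b hp hn => ?_⟩
      match p, hp.head, hp.last with
      | [x], h1, h2 =>
        simp only [List.head?_cons, Option.some.injEq, List.getLast?_singleton] at h1 h2
        exact h2 ▸ h1
      | x :: y :: p, _, _ => simp at hn
    | succ n ih =>
      obtain ⟨D, hD, hp⟩ := ih
      refine ⟨⋃ x ∈ D, insert x (L.neighborSet x), ?_, fun p b hpb hn => ?_⟩
      · classical
        have h1 : ∀ x, (insert x (L.neighborSet x)).ncard ≤ m + 1 := fun x =>
          (Set.ncard_insert_le _ _).trans (by have := hdeg x; omega)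
        have h2 : (⋃ x ∈ D, insert x (L.neighborSet x)) =
            ((D.toFinset.biUnion fun x => (insert x (L.neighborSet x)).toFinset : Finset (Fin w)) : Set (Fin w)) := by
          ext; simp
        rw [h2, Set.ncard_coe_finset, pow_succ]
        refine (Finset.card_biUnion_le_card_mul _ _ (m + 1) fun x _ => ?_).trans ?_
        · rw [← Set.ncard_eq_toFinset_card']
          exact h1 x
        · rw [← Set.ncard_eq_toFinset_card']
          exact Nat.mul_le_mul_right _ hD
      · rcases List.eq_nil_or_concat p with rfl | ⟨p', z, rfl⟩
        · exact absurd rfl hpb.ne_nil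
        have hz : z = b := by simpa using hpb.last
        subst hz
        rcases List.eq_nil_or_concat p' with rfl | ⟨p'', y, rfl⟩
        · exact Set.mem_biUnion (hp _ _ hpb (by simp)) (Set.mem_insert _ _)
        have h1 := hpb.chain
        have h2 := hpb.head
        have h3 := hpb.nodup
        simp only [List.concat_eq_append, List.append_assoc] at h1 h2 h3 hn
        have hy : IsTrack L (p'' ++ [y]) v y := by
          refine ⟨?_, ?_, ?_, by simp⟩
          · rw [← List.append_assoc] at h1
            exact (List.isChain_append.1 h1).1
          · rw [← List.append_assoc] at h3
            exact (List.nodup_append.1 h3).1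
          · cases p'' with
            | nil => simpa using h2
            | cons => simpa using h2
        refine Set.mem_biUnion (hp _ _ hy (by simp at hn ⊢; omega)) (Set.mem_insert_of_mem _ ?_)
        rw [← List.append_assoc] at h1
        exact (List.isChain_append.1 h1).2.2 y (by simp) z (by simp)
  obtain ⟨D, hD, hp⟩ := hD r
  have h1 : D = Set.univ := by
    refine Set.eq_univ_of_forall fun b => ?_
    obtain ⟨p, b', hpb, -, rfl, -⟩ := hL.exists_track (T := {b}) (Set.mem_univ v) ⟨b, trivial, rfl⟩
    refine hp p _ hpb ?_
    by_contra! hlen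
    obtain ⟨a, ha, hna⟩ := hpath (fun a => p.getD a v) (fun a ha b hb hab => by
      rw [List.getD_eq_getElem _ _ (by omega), List.getD_eq_getElem _ _ (by omega)] at hab
      exact (hpb.nodup.getElem_inj_iff).1 hab)
    rw [List.getD_eq_getElem _ _ (by omega), List.getD_eq_getElem _ _ (by omega)] at hna
    exact hna (List.isChain_iff_getElem.1 hpb.chain a (by omega))
  rw [h1, Set.ncard_univ, Nat.card_fin] at hD
  omega

theorem minorIn_layers_of_path {N : ℕ} {u : ℕ → Fin w} (hu : ∀ a < N, ∀ b < N, u a = u b → a = b)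
    (hadj : ∀ a, a + 1 < N → L.Adj (u a) (u (a + 1))) (hNM : N ≤ M) (hH : MinorIn H gr {p | p.1 < N ∧ p.2 < N}) :
    MinorIn H (layers L) {x | x.2 < M} := by
  refine hH.lift (fun p => {(u p.1, p.2)}) ?_ (fun _ _ => .singleton _) ?_ ?_
  · rintro ⟨a, b⟩ ⟨-, hb⟩ _ rfl
    exact lt_of_lt_of_le hb hNM
  · rintro ⟨a, b⟩ ⟨ha, -⟩ ⟨a', b'⟩ ⟨ha', -⟩ hne
    rw [Set.disjoint_singleton]
    intro h
    simp only [Prod.mk.injEq] at h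
    exact hne (Prod.ext (hu a ha a' ha' h.1) h.2)
  · rintro ⟨a, b⟩ ⟨ha, hb⟩ ⟨a', b'⟩ ⟨ha', hb'⟩ hab
    refine ⟨_, rfl, _, rfl, ?_⟩
    simp only [gr_adj] at hab ha ha' hb hb'
    rcases hab with ⟨rfl, h⟩ | ⟨rfl, h⟩
    · exact Or.inr ⟨rfl, h⟩
    · refine Or.inl ⟨?_, rfl⟩
      rcases h with h | h
      · subst h
        exact hadj _ ha'
      · subst h
        exact (hadj _ ha).symm

theorem minorIn_layers_of_star [Finite K] {h : Fin w} (hh : Nat.card K ≤ (L.neighborSet h).ncard)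
    (hM : Nat.card K * Nat.card K < M) : MinorIn H (layers L) {x | x.2 < M} := by
  have := Fintype.ofFinite K
  obtain ⟨l⟩ : Nonempty (K ↪ L.neighborSet h) := by
    have := Fintype.ofFinite (L.neighborSet h)
    refine Function.Embedding.nonempty_of_card_le ?_
    rwa [← Nat.card_eq_fintype_card, ← Nat.card_eq_fintype_card, Nat.card_coe_set_eq]
  obtain ⟨e⟩ : Nonempty (K × K ↪ Fin M) := by
    refine Function.Embedding.nonempty_of_card_le ?_
    rw [Fintype.card_prod, Fintype.card_fin, ← Nat.card_eq_fintype_card]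
    exact hM.le
  have hl : ∀ a, L.Adj h (l a) := fun a => (l a).2
  have hne : ∀ a, (l a : Fin w) ≠ h := fun a => (hl a).ne'
  refine ⟨fun a => {x | x.1 = l a ∧ x.2 < M} ∪ ⋃ b, {(h, (e (a, b) : ℕ))}, ?_, ?_, ?_, ?_⟩
  · rintro a x (hx | hx)
    · exact hx.2
    · obtain ⟨b, rfl⟩ := Set.mem_iUnion.1 hx
      exact (e (a, b)).2
  · intro a
    refine Conn.union_iUnion ?_ (fun _ => .singleton _) fun b => Or.inr ?_
    · refine ⟨⟨(l a, 0), rfl, by omega⟩, ?_⟩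
      rintro T ⟨⟨i, p⟩, ⟨rfl, hp⟩, hpT⟩ hcl ⟨j, p'⟩ ⟨h1, hp'⟩
      simp only at h1 hp hp'
      subst h1
      have step : ∀ n, n + 1 < M → (((l a : Fin w), n) ∈ T ↔ ((l a : Fin w), n + 1) ∈ T) := fun n hn =>
        ⟨fun h => hcl _ ⟨rfl, by simp only; omega⟩ h _ ⟨rfl, hn⟩ (Or.inr ⟨rfl, Or.inl rfl⟩),
          fun h => hcl _ ⟨rfl, hn⟩ h _ ⟨rfl, by simp only; omega⟩ (Or.inr ⟨rfl, Or.inr rfl⟩)⟩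
      have all : ∀ n < M, (((l a : Fin w), 0) ∈ T ↔ ((l a : Fin w), n) ∈ T) := by
        intro n
        induction n with
        | zero => simp
        | succ n ih => exact fun hn => (ih (by omega)).trans (step n hn)
      exact (all p' hp').1 ((all p hp).2 hpT)
    · exact ⟨(l a, e (a, b)), ⟨rfl, (e (a, b)).2⟩, _, rfl, Or.inl ⟨(hl a).symm, rfl⟩⟩
  · intro a b hab
    rw [Set.disjoint_left]
    rintro x (hx | hx) (hx' | hx')
    · exact hab (l.injective (Subtype.ext (hx.1.symm.trans hx'.1)))
    · obtain ⟨c, rfl⟩ := Set.mem_iUnion.1 hx'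
      exact hne a hx.1.symm
    · obtain ⟨c, rfl⟩ := Set.mem_iUnion.1 hx
      exact hne b hx'.1.symm
    · obtain ⟨c, rfl⟩ := Set.mem_iUnion.1 hx
      obtain ⟨c', h2⟩ := Set.mem_iUnion.1 hx'
      have h3 : (e (a, c) : ℕ) = e (b, c') := congrArg Prod.snd h2
      exact hab (congrArg Prod.fst (e.injective (Fin.ext h3)))
  · intro a b _
    exact ⟨(h, e (a, b)), Or.inr (Set.mem_iUnion.2 ⟨b, rfl⟩), (l b, e (a, b)), Or.inl ⟨rfl, (e (a, b)).2⟩,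
      Or.inl ⟨hl b, rfl⟩⟩

/-- Large path-of-sets structures contain every minor of a grid. -/
theorem exists_pos_bound [Finite K] {N : ℕ} (hH : MinorIn H gr {p | p.1 < N ∧ p.2 < N}) :
    ∃ w ℓ, 1 ≤ w ∧ ∀ {V : Type*} {G : SimpleGraph V} {t : Fin w → List V} {c : Fin ℓ → Set V},
      IsPoS G w ℓ t c → MinorIn H G Set.univ := by
  classical
  set w := (Nat.card K + 1) ^ N + 1 with hw
  set M := Nat.card K * Nat.card K + 1 + N with hM
  have := Fintype.ofFinite (SimpleGraph (Fin w))
  refine ⟨w, Fintype.card (SimpleGraph (Fin w)) * (M * (w * w) + 1), by omega, fun {V G t c} h => ?_⟩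
  obtain ⟨L, -, hL⟩ := Finset.exists_le_card_fiber_of_mul_le_card_of_maps_to (s := Finset.univ)
    (t := (Finset.univ : Finset (SimpleGraph (Fin w)))) (f := fun j => slotGraph G t (c j)) (n := M * (w * w) + 1)
    (by simp) Finset.univ_nonempty (by simp [Finset.card_univ])
  let e := Finset.orderEmbOfCardLe _ hL
  have he : ∀ j, slotGraph G t (c (e j)) = L := fun j => (Finset.mem_filter.1 (Finset.orderEmbOfCardLe_mem _ hL j)).2
  have h' : IsPoS G w (M * (w * w) + 1) t (fun j => c (e j)) :=
    ⟨h.chain, h.nodup, h.disj, fun j => h.conn _, fun j j' hj => h.cdisj _ _ (e.injective.ne hj), fun i j => h.meet i _,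
      fun i j j' hj => h.ordered i _ _ (e.strictMono hj)⟩
  have hLc : Conn L Set.univ := by
    rw [← he 0]
    exact conn_slotGraph (by omega) (h'.conn 0) h.disj fun i => h'.meet i 0
  refine h'.minorIn (L := L) (fun j i i' hii => ?_) ?_
  · rw [← he j] at hii
    exact hii.2.1
  · rcases exists_path_or_star (m := Nat.card K) (r := N) hLc (by omega) with ⟨x, hx⟩ | ⟨u, h1, h2⟩
    · exact minorIn_layers_of_star hx (by omega)
    · exact minorIn_layers_of_path h1 h2 (by omega) hH

end LayersMinor

section Sep

variable {K : Type*} {H : SimpleGraph K}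

theorem MinorIn.of_top [Finite K] {V : Type*} {G : SimpleGraph V} {S : Set V}
    (h : MinorIn (⊤ : SimpleGraph (Fin (Nat.card K))) G S) : MinorIn H G S := by
  obtain ⟨B, hB⟩ := h
  let e := Finite.equivFin K
  exact ⟨fun a => B (e a), fun u => hB.subset _, fun u => hB.conn _, fun u v huv => hB.disj _ _ (e.injective.ne huv),
    fun u v huv => hB.adj _ _ (e.injective.ne huv.ne)⟩

theorem Conn.image_val {V : Type*} {G : SimpleGraph V} {X : Set V} {C : Set X} (h : Conn (G.induce X) C) :
    Conn G (Subtype.val '' C) := by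
  refine ⟨h.nonempty.image _, ?_⟩
  rintro T ⟨_, ⟨a, ha, rfl⟩, haT⟩ hcl _ ⟨b, hb, rfl⟩
  exact h.2 (Subtype.val ⁻¹' T) ⟨a, ha, haT⟩
    (fun x hx hxT y hy hxy => hcl _ ⟨x, hx, rfl⟩ hxT _ ⟨y, hy, rfl⟩ hxy) hb

theorem Conn.preimage_val {V : Type*} {G : SimpleGraph V} {X C : Set V} (h : Conn G C) (hCX : C ⊆ X) :
    Conn (G.induce X) (Subtype.val ⁻¹' C) := by
  obtain ⟨a, ha⟩ := h.nonempty
  refine ⟨⟨⟨a, hCX ha⟩, ha⟩, ?_⟩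
  rintro T ⟨b, hb, hbT⟩ hcl ⟨c, hcX⟩ hc
  obtain ⟨_, h1⟩ := h.2 {x | ∃ hx : x ∈ X, (⟨x, hx⟩ : X) ∈ T} ⟨b, hb, b.2, hbT⟩
    (fun x hx ⟨hxX, hxT⟩ y hy hxy => ⟨hCX hy, hcl ⟨x, hxX⟩ hx hxT ⟨y, hCX hy⟩ hy hxy⟩) hc
  exact h1

theorem MinorIn.image_val {V : Type*} {G : SimpleGraph V} {X : Set V} {C : Set X} (h : MinorIn H (G.induce X) C) :
    MinorIn H G (Subtype.val '' C) :=
  h.lift (fun a => {a.1}) (fun a ha => by rintro _ rfl; exact ⟨a, ha, rfl⟩) (fun _ _ => .singleton _)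
    (fun a _ b _ hab => by simpa using fun h => hab (Subtype.ext h)) fun a _ b _ hab => ⟨_, rfl, _, rfl, hab⟩

theorem exists_balanced_aux [Finite K] {N : ℕ} (hH : MinorIn H gr {p | p.1 < N ∧ p.2 < N}) :
    ∃ w : ℕ, ∀ {V : Type*} [Finite V] {G : SimpleGraph V} (_ : ¬ MinorIn H G Set.univ) (W : Set V),
      ∃ S : Set V, S.ncard ≤ w ∧ ∀ C, Conn G C → Disjoint C S → 2 * (C ∩ W).ncard ≤ W.ncard := by
  obtain ⟨w, ℓ, hw, hpos⟩ := exists_pos_bound hH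
  set m := Nat.card K
  refine ⟨m * cliqueWidth w ℓ m * (cliqueLink w ℓ m + 1), fun {V _ G} hG W => ?_⟩
  by_contra! hcon
  refine hG (MinorIn.of_top ?_)
  let 𝒞 : Set (Set V) := {C | Conn G C ∧ W.ncard < 2 * (C ∩ W).ncard}
  have hi : ∀ C ∈ 𝒞, ∀ C' ∈ 𝒞, (C ∩ C').Nonempty := by
    rintro C ⟨-, hC⟩ C' ⟨-, hC'⟩
    by_contra hne
    rw [Set.not_nonempty_iff_eq_empty, ← Set.disjoint_iff_inter_eq_empty] at hne
    have h1 := Set.ncard_union_eq (hne.mono (Set.inter_subset_left (t := W)) (Set.inter_subset_left (t := W)))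
      (Set.toFinite _) (Set.toFinite _)
    have h2 : (C ∩ W ∪ C' ∩ W).ncard ≤ W.ncard :=
      Set.ncard_le_ncard (Set.union_subset Set.inter_subset_right Set.inter_subset_right) (Set.toFinite _)
    omega
  obtain ⟨P, p1, p2, p3⟩ := exists_linked_sets (𝒞 := 𝒞) (G := G) (M := m * cliqueWidth w ℓ m)
    (k := cliqueLink w ℓ m + 1) (fun C hC => hC.1) hi (by omega) fun S hS => by
      obtain ⟨C, h1, h2, h3⟩ := hcon S hS.le
      exact ⟨C, ⟨h1, h3⟩, h2⟩
  exact minorIn_top_of_linked hw (fun t c h => hG (hpos h)) (P := fun x => P (finProdFinEquiv x)) (fun _ => p1 _)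
    (fun i j hij => p2 _ _ (finProdFinEquiv.injective.ne hij)) fun i j => (p3 _ _).mono (Nat.le_succ _)

/-- Constant-size balanced separations in graphs without a fixed planar minor. -/
theorem exists_balanced [Finite K] {N : ℕ} (hH : MinorIn H gr {p | p.1 < N ∧ p.2 < N}) :
    ∃ w : ℕ, ∀ {V : Type*} [Finite V] {G : SimpleGraph V} {Y : Set V} (_ : ¬ MinorIn H G Y) (W : Set V) (_ : W ⊆ Y),
      ∃ S A₁ A₂ : Set V, S.ncard ≤ w ∧ S ∪ (A₁ ∪ A₂) = Y ∧ Disjoint S A₁ ∧ Disjoint S A₂ ∧ Disjoint A₁ A₂ ∧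
        (∀ a ∈ A₁, ∀ b ∈ A₂, ¬ G.Adj a b) ∧ 3 * (A₁ ∩ W).ncard ≤ 2 * W.ncard ∧ 3 * (A₂ ∩ W).ncard ≤ 2 * W.ncard := by
  obtain ⟨w, h⟩ := exists_balanced_aux hH
  refine ⟨w, fun {V _ G Y} hY W hWY => ?_⟩
  obtain ⟨S', hS', hb'⟩ := h (G := G.induce Y) (fun h => hY (h.image_val.mono (by simp))) (Subtype.val ⁻¹' W)
  set S : Set V := Subtype.val '' S' with hS
  have hSY : S ⊆ Y := by simp [S]
  have hb : ∀ C ⊆ Y \ S, Conn G C → 2 * (C ∩ W).ncard ≤ W.ncard := by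
    intro C hC hCc
    have h1 := hb' _ (hCc.preimage_val (hC.trans Set.sdiff_subset))
      (Set.disjoint_left.2 fun x hx hxS => (hC hx).2 ⟨x, hxS, rfl⟩)
    rw [← Set.ncard_image_of_injective _ Subtype.val_injective,
      ← Set.ncard_image_of_injective _ Subtype.val_injective, ← Set.preimage_inter] at h1
    simp only [Subtype.image_preimage_coe] at h1
    rwa [Set.inter_eq_right.2 hWY, Set.inter_eq_right.2 (Set.inter_subset_right.trans hWY)] at h1
  -- a closed part of `Y \ S` with as many elements of `W` as possible, subject to the balance condition
  let 𝒜 : Set (Set V) := {A | A ⊆ Y \ S ∧ (∀ a ∈ A, ∀ b ∈ Y \ S, G.Adj a b → b ∈ A) ∧ 3 * (A ∩ W).ncard ≤ 2 * W.ncard}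
  obtain ⟨A, ⟨hA1, hA2, hA3⟩, hmax⟩ := Set.exists_max_image 𝒜 (fun A => (A ∩ W).ncard) (Set.toFinite _)
    ⟨∅, by simp [𝒜]⟩
  have key : ∀ B, B ∈ 𝒜 → W.ncard ≤ 3 * (B ∩ W).ncard →
      ∃ S A₁ A₂ : Set V, S.ncard ≤ w ∧ S ∪ (A₁ ∪ A₂) = Y ∧ Disjoint S A₁ ∧ Disjoint S A₂ ∧ Disjoint A₁ A₂ ∧
        (∀ a ∈ A₁, ∀ b ∈ A₂, ¬ G.Adj a b) ∧ 3 * (A₁ ∩ W).ncard ≤ 2 * W.ncard ∧ 3 * (A₂ ∩ W).ncard ≤ 2 * W.ncard := by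
    rintro B ⟨hB1, hB2, hB3⟩ hB4
    refine ⟨S, B, (Y \ S) \ B, ?_, ?_, ?_, ?_, Set.disjoint_sdiff_right, fun a ha b hb hab => hb.2 (hB2 a ha b hb.1 hab),
      hB3, ?_⟩
    · rwa [hS, Set.ncard_image_of_injective _ Subtype.val_injective]
    · rw [Set.union_sdiff_cancel hB1, Set.union_sdiff_cancel hSY]
    · exact Set.disjoint_sdiff_right.mono_right hB1
    · exact Set.disjoint_sdiff_right.mono_right Set.sdiff_subset
    · have h1 := Set.ncard_union_eq (s := B ∩ W) (t := ((Y \ S) \ B) ∩ W)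
        (Set.disjoint_sdiff_right.mono Set.inter_subset_left Set.inter_subset_left) (Set.toFinite _) (Set.toFinite _)
      have h2 : (B ∩ W ∪ ((Y \ S) \ B) ∩ W).ncard ≤ W.ncard :=
        Set.ncard_le_ncard (Set.union_subset Set.inter_subset_right Set.inter_subset_right) (Set.toFinite _)
      omega
  by_cases hbig : W.ncard ≤ 3 * (A ∩ W).ncard
  · exact key A ⟨hA1, hA2, hA3⟩ hbig
  by_cases hall : (Y \ S) ∩ W ⊆ A
  · refine ⟨S, A, (Y \ S) \ A, ?_, ?_, ?_, ?_, Set.disjoint_sdiff_right, fun a ha b hb hab => hb.2 (hA2 a ha b hb.1 hab),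
      hA3, ?_⟩
    · rwa [hS, Set.ncard_image_of_injective _ Subtype.val_injective]
    · rw [Set.union_sdiff_cancel hA1, Set.union_sdiff_cancel hSY]
    · exact Set.disjoint_sdiff_right.mono_right hA1
    · exact Set.disjoint_sdiff_right.mono_right Set.sdiff_subset
    · have : (Y \ S) \ A ∩ W = ∅ := by
        ext x; simp only [Set.mem_inter_iff, Set.mem_sdiff, Set.mem_empty_iff_false, iff_false]
        rintro ⟨⟨h1, h2⟩, h3⟩
        exact h2 (hall ⟨h1, h3⟩)
      simp [this]
  · obtain ⟨x, ⟨hxY, hxW⟩, hxA⟩ := Set.not_subset.1 hall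
    set C := compo G (Y \ S) x
    have hC : Conn G C := conn_compo hxY
    have hCcl : ∀ a ∈ C, ∀ b ∈ Y \ S, G.Adj a b → b ∈ C := fun a ha b hb hab => mem_compo_of_adj ha hb hab
    have hCsub : C ⊆ Y \ S := compo_subset
    have hC2 := hb C hCsub hC
    have h1 : ¬ (C ∪ A) ∈ 𝒜 := by
      intro h
      have h2 := hmax _ h
      have h3 : A ∩ W ⊂ (C ∪ A) ∩ W := by
        refine ⟨Set.inter_subset_inter_left _ Set.subset_union_right, fun h => hxA (h ⟨Or.inl (mem_compo_self hxY), hxW⟩).1⟩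
      have := Set.ncard_lt_ncard h3 (Set.toFinite _)
      omega
    refine key C ⟨hCsub, hCcl, by omega⟩ ?_
    by_contra! hlt
    refine h1 ⟨Set.union_subset hCsub hA1, ?_, ?_⟩
    · rintro a (ha | ha) b hb hab
      exacts [Or.inl (hCcl a ha b hb hab), Or.inr (hA2 a ha b hb hab)]
    · rw [Set.union_inter_distrib_right]
      have := Set.ncard_union_le (C ∩ W) (A ∩ W)
      omega

end Sep

section Attach

variable {V : Type*} {K : Type*} {H : SimpleGraph K} {G : SimpleGraph V} {w s : ℕ} {Z C : Set V}

/-- The vertices of `Z` with a neighbour in `C`. -/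
def att (G : SimpleGraph V) (Z C : Set V) : Set V := {z | z ∈ Z ∧ ∃ a ∈ C, G.Adj a z}

/-- The `H`-minor-free parts of `G` have balanced separations of order at most `w`. -/
def HasSep (H : SimpleGraph K) (G : SimpleGraph V) (w : ℕ) : Prop :=
  ∀ Y, ¬ MinorIn H G Y → ∀ W ⊆ Y,
    ∃ S A₁ A₂ : Set V, S.ncard ≤ w ∧ S ∪ (A₁ ∪ A₂) = Y ∧ Disjoint S A₁ ∧ Disjoint S A₂ ∧ Disjoint A₁ A₂ ∧
      (∀ a ∈ A₁, ∀ b ∈ A₂, ¬ G.Adj a b) ∧ 3 * (A₁ ∩ W).ncard ≤ 2 * W.ncard ∧ 3 * (A₂ ∩ W).ncard ≤ 2 * W.ncard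

theorem att_refine {Y S A₁ A₂ Z₁ Z₂ B : Set V} (hY : S ∪ (A₁ ∪ A₂) = Y) (hB : B ⊆ Y)
    (hadj : ∀ a ∈ A₁, ∀ b ∈ A₂, ¬ G.Adj a b) (hZ₁ : Z₁ ⊆ A₁ ∪ S) (hZ₂ : Z₂ ⊆ A₂ ∪ S) (hC : C ⊆ A₁) :
    att G (S ∪ (Z₁ ∪ Z₂) ∪ B) C ⊆ att G (Z₁ ∪ (A₁ ∩ B ∪ S)) C := by
  rintro x ⟨hx, a, ha, hax⟩
  refine ⟨?_, a, ha, hax⟩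
  have hxA := hadj a (hC ha) x
  have hB' := @hB x
  have hZ₁' := @hZ₁ x
  have hZ₂' := @hZ₂ x
  rw [← hY] at hB'
  simp only [Set.mem_union, Set.mem_inter_iff] at *
  tauto

theorem HasSep.refine [Finite V] (hsep : HasSep H G w) (hw : 1 ≤ w) (hs : 6 * w ≤ s) : ∀ n : ℕ, ∀ Y B : Set V,
    B.ncard ≤ n → ¬ MinorIn H G Y → B ⊆ Y → ∃ Z' ⊆ Y,
      (∀ C, Conn G C → C ⊆ Y \ (Z' ∪ B) → (att G (Z' ∪ B) C).ncard ≤ s) ∧ (B.ncard ≤ s → Z' = ∅) ∧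
      (s < B.ncard → s * Z'.ncard + 3 * (w * s) ≤ 6 * (w * B.ncard)) := by
  intro n
  induction n with
  | zero =>
    intro Y B hB _ _
    refine ⟨∅, Set.empty_subset _, fun C _ _ => ?_, fun _ => rfl, fun h => by omega⟩
    exact (Set.ncard_le_ncard (fun x hx => by simpa using hx.1) (Set.toFinite _)).trans (hB.trans (Nat.zero_le _))
  | succ n ih =>
    intro Y B hBn hY hBY
    by_cases hBs : B.ncard ≤ s
    · refine ⟨∅, Set.empty_subset _, fun C _ _ => ?_, fun _ => rfl, fun h => by omega⟩
      exact (Set.ncard_le_ncard (fun x hx => by simpa using hx.1) (Set.toFinite _)).trans hBs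
    obtain ⟨S, A₁, A₂, hS, hSA, hS1, hS2, h12, hadj, hA1, hA2⟩ := hsep Y hY B hBY
    have hsum : (A₁ ∩ B).ncard + (A₂ ∩ B).ncard ≤ B.ncard := by
      rw [← Set.ncard_union_eq (h12.mono Set.inter_subset_left Set.inter_subset_left) (Set.toFinite _) (Set.toFinite _)]
      exact Set.ncard_le_ncard (Set.union_subset Set.inter_subset_right Set.inter_subset_right) (Set.toFinite _)
    have hB1 := (Set.ncard_union_le (A₁ ∩ B) S).trans (Nat.add_le_add_left hS _)
    have hB2 := (Set.ncard_union_le (A₂ ∩ B) S).trans (Nat.add_le_add_left hS _)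
    obtain ⟨Z₁, hZ₁, c1, d1, e1⟩ := ih (A₁ ∪ S) (A₁ ∩ B ∪ S) (by omega)
      (fun h => hY (h.mono (by rw [← hSA]; grind))) (Set.union_subset_union_left _ Set.inter_subset_left)
    obtain ⟨Z₂, hZ₂, c2, d2, e2⟩ := ih (A₂ ∪ S) (A₂ ∩ B ∪ S) (by omega)
      (fun h => hY (h.mono (by rw [← hSA]; grind))) (Set.union_subset_union_left _ Set.inter_subset_left)
    refine ⟨S ∪ (Z₁ ∪ Z₂), ?_, ?_, fun h => absurd h hBs, fun _ => ?_⟩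
    · rw [← hSA]
      grind
    · intro C hC hCY
      have hCA : C ⊆ A₁ ∨ C ⊆ A₂ := by
        have hCA : C ⊆ A₁ ∪ A₂ := fun x hx => by
          have := hCY hx
          rw [← hSA] at this
          grind
        obtain ⟨x, hx⟩ := hC.nonempty
        rcases hCA hx with h | h
        · exact Or.inl (hC.2 A₁ ⟨x, hx, h⟩ fun a _ ha b hb hab => (hCA hb).resolve_right fun h => hadj a ha b h hab)
        · exact Or.inr (hC.2 A₂ ⟨x, hx, h⟩ fun a _ ha b hb hab => (hCA hb).resolve_left fun h => hadj b h a ha hab.symm)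
      rcases hCA with h | h
      · refine (Set.ncard_le_ncard (att_refine hSA hBY hadj hZ₁ hZ₂ h) (Set.toFinite _)).trans (c1 C hC ?_)
        refine fun x hx => ⟨Or.inl (h hx), ?_⟩
        rintro (h1 | h1 | h1)
        exacts [(hCY hx).2 (Or.inl (Or.inr (Or.inl h1))), (hCY hx).2 (Or.inr h1.2), (hCY hx).2 (Or.inl (Or.inl h1))]
      · have h0 := att_refine (C := C) (Z₁ := Z₂) (Z₂ := Z₁) ((congrArg (S ∪ ·) (Set.union_comm A₂ A₁)).trans hSA) hBY
          (fun a ha b hb hab => hadj b hb a ha hab.symm) hZ₂ hZ₁ h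
        rw [Set.union_comm Z₂ Z₁] at h0
        refine (Set.ncard_le_ncard h0 (Set.toFinite _)).trans (c2 C hC ?_)
        refine fun x hx => ⟨Or.inl (h hx), ?_⟩
        rintro (h1 | h1 | h1)
        exacts [(hCY hx).2 (Or.inl (Or.inr (Or.inr h1))), (hCY hx).2 (Or.inr h1.2), (hCY hx).2 (Or.inl (Or.inl h1))]
    · have hc : (S ∪ (Z₁ ∪ Z₂)).ncard ≤ w + (Z₁.ncard + Z₂.ncard) :=
        (Set.ncard_union_le _ _).trans (Nat.add_le_add hS (Set.ncard_union_le _ _))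
      have h0 : s * (S ∪ (Z₁ ∪ Z₂)).ncard ≤ w * s + (s * Z₁.ncard + s * Z₂.ncard) := by
        calc _ ≤ s * (w + (Z₁.ncard + Z₂.ncard)) := Nat.mul_le_mul_left _ hc
          _ = _ := by ring
      have hww : 6 * (w * w) ≤ w * s := by nlinarith
      have hwb : w * s ≤ w * B.ncard := Nat.mul_le_mul_left _ (by omega)
      have f1 : w * (A₁ ∩ B ∪ S).ncard ≤ w * (A₁ ∩ B).ncard + w * w := by rw [← mul_add]; exact Nat.mul_le_mul_left _ hB1
      have f2 : w * (A₂ ∩ B ∪ S).ncard ≤ w * (A₂ ∩ B).ncard + w * w := by rw [← mul_add]; exact Nat.mul_le_mul_left _ hB2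
      have g0 : w * (A₁ ∩ B).ncard + w * (A₂ ∩ B).ncard ≤ w * B.ncard := by rw [← mul_add]; exact Nat.mul_le_mul_left _ hsum
      have g1 : 3 * (w * (A₁ ∩ B).ncard) ≤ 2 * (w * B.ncard) := by nlinarith
      have g2 : 3 * (w * (A₂ ∩ B).ncard) ≤ 2 * (w * B.ncard) := by nlinarith
      have k1 : s * Z₁.ncard = 0 ∨ s * Z₁.ncard + 3 * (w * s) ≤ 6 * (w * (A₁ ∩ B ∪ S).ncard) := by
        rcases Nat.lt_or_ge s (A₁ ∩ B ∪ S).ncard with h | h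
        exacts [Or.inr (e1 h), Or.inl (by simp [d1 h])]
      have k2 : s * Z₂.ncard = 0 ∨ s * Z₂.ncard + 3 * (w * s) ≤ 6 * (w * (A₂ ∩ B ∪ S).ncard) := by
        rcases Nat.lt_or_ge s (A₂ ∩ B ∪ S).ncard with h | h
        exacts [Or.inr (e2 h), Or.inl (by simp [d2 h])]
      omega

end Attach

section Nice

variable {V : Type*} {K : Type*} {H : SimpleGraph K} {G : SimpleGraph V} {w s q : ℕ} {Z Z₀ X C : Set V}

theorem IsModelIn.conn_iUnion {S : Set V} {B : K → Set V} (hH : Conn H Set.univ) (h : IsModelIn H G S B) :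
    Conn G (⋃ u, B u) := by
  have := conn_biUnion (G := H) (G' := G) hH (Set.subset_univ _) (φ := B) (fun a _ => h.conn a) fun a _ b _ => h.adj a b
  simpa using this

/-- Removing `S` isolates some model of `H` from all models that avoid `S`. -/
def Isolates (H : SimpleGraph K) (G : SimpleGraph V) (S : Set V) : Prop :=
  ∃ B, IsModelIn H G Set.univ B ∧ ∀ B', IsModelIn H G Sᶜ B' → Disjoint (⋃ u, B u) (⋃ u, B' u)

theorem not_minorIn_of_small (hH : Conn H Set.univ) (hZ : ¬ MinorIn H G Zᶜ)
    (hq : ∀ S : Set V, S.ncard ≤ q → ¬ Isolates H G S) (hX : Disjoint X Z)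
    (hN : ∀ a ∈ X, ∀ b ∉ Z, G.Adj a b → b ∈ X) (hc : (Z₀ ∪ att G Z X).ncard ≤ q) : ¬ MinorIn H G (Z₀ ∪ X) := by
  rintro ⟨B, hB⟩
  refine hq _ hc ⟨B, hB.mono (Set.subset_univ _), fun B' hB' => ?_⟩
  by_contra hd
  obtain ⟨x, hx, hx'⟩ := Set.not_disjoint_iff.1 hd
  have hS : ∀ x ∈ ⋃ u, B' u, x ∉ Z₀ ∪ att G Z X := fun x hx => Set.iUnion_subset hB'.subset hx
  have hxX : x ∈ X := (Set.iUnion_subset hB.subset hx).resolve_left fun h => hS x hx' (Or.inl h)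
  have hsub : (⋃ u, B' u) ⊆ X := by
    refine (hB'.conn_iUnion hH).2 X ⟨x, hx', hxX⟩ fun a _ haX b hb hab => ?_
    by_cases hbZ : b ∈ Z
    · exact absurd (Or.inr ⟨hbZ, a, haX, hab⟩) (hS b hb)
    · exact hN a haX b hbZ hab
  exact hZ ⟨B', fun u => (Set.subset_iUnion B' u).trans (hsub.trans (Set.disjoint_left.1 hX)), hB'.conn, hB'.disj, hB'.adj⟩

/-- A hitting set all of whose complementary components attach to at most `s` of its vertices. -/
def IsNice (H : SimpleGraph K) (G : SimpleGraph V) (s : ℕ) (Z : Set V) : Prop :=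
  ¬ MinorIn H G Zᶜ ∧ ∀ C, Conn G C → Disjoint C Z → (att G Z C).ncard ≤ s

/-- The union of the components of `G - Z` adjacent to `Z₀`. -/
def touched (G : SimpleGraph V) (Z Z₀ : Set V) : Set V :=
  {x | ∃ C, Conn G C ∧ Disjoint C Z ∧ x ∈ C ∧ ∃ c ∈ C, ∃ z ∈ Z₀, G.Adj c z}

theorem disjoint_touched : Disjoint (touched G Z Z₀) Z :=
  Set.disjoint_left.2 fun _ ⟨_, _, h, hx, _⟩ => Set.disjoint_left.1 h hx

theorem mem_touched_of_adj {a b : V} (ha : a ∈ touched G Z Z₀) (hb : b ∉ Z) (hab : G.Adj a b) : b ∈ touched G Z Z₀ := by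
  obtain ⟨C, hC, hCZ, haC, c, hc, h⟩ := ha
  exact ⟨insert b C, hC.insert_adj ⟨a, haC, hab.symm⟩, Set.disjoint_insert_left.2 ⟨hb, hCZ⟩, Set.mem_insert _ _, c,
    Set.mem_insert_of_mem _ hc, h⟩

theorem mem_touched {z b : V} (hz : z ∈ Z₀) (hb : b ∉ Z) (hzb : G.Adj z b) : b ∈ touched G Z Z₀ :=
  ⟨{b}, .singleton b, Set.disjoint_singleton_left.2 hb, rfl, b, rfl, z, hz, hzb.symm⟩

/-- `Z₀`, its neighbours in `Z`, and the attachments of the components adjacent to `Z₀`. -/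
def hull (G : SimpleGraph V) (Z Z₀ : Set V) : Set V := Z₀ ∪ (att G Z Z₀ ∪ att G Z (touched G Z Z₀))

theorem lt_ncard_hull [Finite V] (hH : Conn H Set.univ) (hsep : HasSep H G w) (hw : 1 ≤ w) (hs : 6 * w ≤ s)
    (hq : ∀ S : Set V, S.ncard ≤ q → ¬ Isolates H G S) (hZ : IsNice H G s Z)
    (hmin : ∀ Z', IsNice H G s Z' → Z.ncard ≤ Z'.ncard) (hZ₀ : Z₀ ⊆ Z) (hne : Z₀.Nonempty)
    (hD : (hull G Z Z₀).ncard ≤ q) :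
    s < (hull G Z Z₀).ncard ∧ s * Z₀.ncard ≤ 6 * (w * (hull G Z Z₀).ncard) := by
  set D := hull G Z Z₀ with hDdef
  set X := touched G Z Z₀
  have hDZ : D ⊆ Z := Set.union_subset hZ₀ (Set.union_subset (fun _ h => h.1) fun _ h => h.1)
  have hY : ¬ MinorIn H G (D ∪ X) :=
    not_minorIn_of_small hH hZ.1 hq disjoint_touched (fun a ha b hb hab => mem_touched_of_adj ha hb hab)
      (by rwa [Set.union_eq_left.2 (show att G Z X ⊆ D from fun x hx => Or.inr (Or.inr hx))])
  obtain ⟨Z', hZ'Y, hc, h0, h1⟩ := hsep.refine hw hs _ (D ∪ X) (D \ Z₀) le_rfl hY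
    (Set.sdiff_subset.trans Set.subset_union_left)
  have hcl : ∀ a ∈ Z₀ ∪ X, ∀ b ∉ Z \ Z₀ ∪ Z', G.Adj a b → b ∈ Z₀ ∪ X := by
    rintro a ha b hb hab
    by_cases hbZ : b ∈ Z
    · exact Or.inl (by_contra fun h => hb (Or.inl ⟨hbZ, h⟩))
    · rcases ha with ha | ha
      exacts [Or.inr (mem_touched ha hbZ hab), Or.inr (mem_touched_of_adj ha hbZ hab)]
  have hcl' : ∀ U, Conn G U → Disjoint U (Z \ Z₀ ∪ Z') → U ⊆ Z₀ ∪ X ∨ Disjoint U (Z₀ ∪ X) := by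
    intro U hU hUd
    refine or_iff_not_imp_right.2 fun h => hU.2 _ (Set.not_disjoint_iff_nonempty_inter.1 h)
      fun a _ ha b hb hab => hcl a ha b (Set.disjoint_left.1 hUd hb) hab
  have hnew : IsNice H G s (Z \ Z₀ ∪ Z') := by
    constructor
    · rintro ⟨B, hB⟩
      have hBd : Disjoint (⋃ u, B u) (Z \ Z₀ ∪ Z') := Set.disjoint_left.2 (Set.iUnion_subset hB.subset)
      rcases hcl' _ (hB.conn_iUnion hH) hBd with h | h
      · exact hY ⟨B, fun u => (Set.subset_iUnion B u).trans (h.trans (Set.union_subset_union_left _ Set.subset_union_left)),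
          hB.conn, hB.disj, hB.adj⟩
      · refine hZ.1 ⟨B, fun u x hx hxZ => ?_, hB.conn, hB.disj, hB.adj⟩
        have hxB := Set.mem_iUnion_of_mem u hx
        exact Set.disjoint_left.1 hBd hxB (Or.inl ⟨hxZ, fun h' => Set.disjoint_left.1 h hxB (Or.inl h')⟩)
    · intro C hC hCd
      rcases hcl' C hC hCd with h | h
      · refine (Set.ncard_le_ncard ?_ (Set.toFinite _)).trans (hc C hC fun x hx => ⟨?_, ?_⟩)
        · rintro x ⟨hx | hx, a, ha, hax⟩
          · refine ⟨Or.inr ⟨?_, hx.2⟩, a, ha, hax⟩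
            rcases h ha with h' | h'
            exacts [Or.inr (Or.inl ⟨hx.1, a, h', hax⟩), Or.inr (Or.inr ⟨hx.1, a, h', hax⟩)]
          · exact ⟨Or.inl hx, a, ha, hax⟩
        · exact (h hx).imp_left Or.inl
        · rintro (h' | h')
          · exact Set.disjoint_left.1 hCd hx (Or.inr h')
          · exact Set.disjoint_left.1 hCd hx (Or.inl ⟨hDZ h'.1, h'.2⟩)
      · have hCZ : Disjoint C Z := Set.disjoint_left.2 fun x hx hxZ =>
          Set.disjoint_left.1 hCd hx (Or.inl ⟨hxZ, fun h' => Set.disjoint_left.1 h hx (Or.inl h')⟩)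
        refine (Set.ncard_le_ncard ?_ (Set.toFinite _)).trans (hZ.2 C hC hCZ)
        rintro x ⟨hx | hx, a, ha, hax⟩
        · exact ⟨hx.1, a, ha, hax⟩
        · rcases hZ'Y hx with h' | h'
          · exact ⟨hDZ h', a, ha, hax⟩
          · exact absurd (Or.inr (mem_touched_of_adj h' (Set.disjoint_left.1 hCZ ha) hax.symm)) (Set.disjoint_left.1 h ha)
  have h2 := hmin _ hnew
  have h3 := Set.ncard_union_le (Z \ Z₀) Z'
  have h4 := Set.ncard_sdiff_add_ncard_of_subset hZ₀ (Set.toFinite _)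
  have h5 : Z₀.ncard ≤ Z'.ncard := by omega
  have h6 : 0 < Z₀.ncard := (Set.ncard_pos (Set.toFinite _)).2 hne
  have h7 : (D \ Z₀).ncard ≤ D.ncard := Set.ncard_le_ncard Set.sdiff_subset (Set.toFinite _)
  have h8 : s < (D \ Z₀).ncard := by
    by_contra! h
    rw [h0 h, Set.ncard_empty] at h5
    omega
  refine ⟨h8.trans_le h7, ?_⟩
  have h9 := h1 h8
  have h10 : w * (D \ Z₀).ncard ≤ w * D.ncard := Nat.mul_le_mul_left _ h7
  have h11 : s * Z₀.ncard ≤ s * Z'.ncard := Nat.mul_le_mul_left _ h5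
  omega

end Nice

section SmallMinor

variable {ι : Type*} {Q : SimpleGraph ι} {U : Set ι}

/-- The number of ordered pairs of adjacent vertices of `U`. -/
noncomputable def dg (Q : SimpleGraph ι) (U : Set ι) : ℕ := {p : ι × ι | p.1 ∈ U ∧ p.2 ∈ U ∧ Q.Adj p.1 p.2}.ncard

/-- The number of ordered pairs of adjacent vertices of `U` that touch `X`. -/
noncomputable def dgTouch (Q : SimpleGraph ι) (U X : Set ι) : ℕ :=
  {p : ι × ι | p.1 ∈ U ∧ p.2 ∈ U ∧ Q.Adj p.1 p.2 ∧ (p.1 ∈ X ∨ p.2 ∈ X)}.ncard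

theorem dg_le [Finite ι] (X : Set ι) : dg Q U ≤ dg Q (U \ X) + dgTouch Q U X := by
  refine (Set.ncard_le_ncard (fun p hp => ?_) (Set.toFinite _)).trans (Set.ncard_union_le _ _)
  by_cases h : p.1 ∈ X ∨ p.2 ∈ X
  · exact Or.inr ⟨hp.1, hp.2.1, hp.2.2, h⟩
  · exact Or.inl ⟨⟨hp.1, fun h' => h (Or.inl h')⟩, ⟨hp.2.1, fun h' => h (Or.inr h')⟩, hp.2.2⟩

/-- A dense graph has a dense part in which every set touches many edges. -/
theorem exists_dense_part [Finite ι] {D : ℕ} (hU : U.Nonempty) (h : D * U.ncard ≤ dg Q U) :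
    ∃ S ⊆ U, S.Nonempty ∧ ∀ X ⊆ S, D * X.ncard ≤ dgTouch Q S X := by
  obtain ⟨S, ⟨h1, h2, h3⟩, hmin⟩ := Set.exists_min_image {S : Set ι | S ⊆ U ∧ S.Nonempty ∧ D * S.ncard ≤ dg Q S}
    Set.ncard (Set.toFinite _) ⟨U, subset_rfl, hU, h⟩
  refine ⟨S, h1, h2, fun X hX => ?_⟩
  have h4 := dg_le (Q := Q) (U := S) X
  have h5 := Set.ncard_sdiff_add_ncard_of_subset hX (Set.toFinite _)
  by_cases hXe : X.Nonempty
  · have h6 : 0 < X.ncard := (Set.ncard_pos (Set.toFinite _)).2 hXe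
    have h7 : dg Q (S \ X) ≤ D * (S \ X).ncard := by
      by_contra! hlt
      have hne : (S \ X).Nonempty := by
        by_contra hne
        rw [Set.not_nonempty_iff_eq_empty] at hne
        simp [hne, dg] at hlt
      have := hmin _ ⟨Set.sdiff_subset.trans h1, hne, hlt.le⟩
      omega
    rw [← h5, mul_add] at h3
    omega
  · rw [Set.not_nonempty_iff_eq_empty] at hXe
    simp [hXe]

/-- The balls around the edge `a b` inside `S`. -/
def eball (Q : SimpleGraph ι) (S : Set ι) (a b : ι) : ℕ → Set ι
  | 0 => {a, b}
  | i + 1 => eball Q S a b i ∪ {v | v ∈ S ∧ ∃ u ∈ eball Q S a b i, Q.Adj u v}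

variable {S : Set ι} {a b : ι}

theorem eball_subset_succ (i : ℕ) : eball Q S a b i ⊆ eball Q S a b (i + 1) := Set.subset_union_left

theorem eball_mono : Monotone (eball Q S a b) := monotone_nat_of_le_succ eball_subset_succ

theorem eball_subset (ha : a ∈ S) (hb : b ∈ S) (i : ℕ) : eball Q S a b i ⊆ S := by
  induction i with
  | zero => exact Set.insert_subset ha (Set.singleton_subset_iff.2 hb)
  | succ i ih => exact Set.union_subset ih fun _ h => h.1

theorem mem_eball_succ {i : ℕ} {u v : ι} (hu : u ∈ eball Q S a b i) (hv : v ∈ S) (h : Q.Adj u v) :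
    v ∈ eball Q S a b (i + 1) := Or.inr ⟨hv, u, hu, h⟩

theorem conn_pair (hab : Q.Adj a b) : Conn Q {a, b} := (Conn.singleton b).insert_adj ⟨b, rfl, hab⟩

theorem exists_root_path [Finite ι] (hab : Q.Adj a b) (i : ℕ) : ∀ v ∈ eball Q S a b (i + 1), ∃ P ⊆ eball Q S a b i,
    Conn Q P ∧ a ∈ P ∧ P.ncard ≤ i + 2 ∧ ∃ u ∈ P, Q.Adj u v := by
  induction i with
  | zero =>
    rintro v ((rfl | rfl) | ⟨-, u, hu, huv⟩)
    · exact ⟨_, subset_rfl, conn_pair hab, Or.inl rfl, Set.ncard_insert_le _ _ |>.trans (by simp), b, Or.inr rfl, hab.symm⟩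
    · exact ⟨_, subset_rfl, conn_pair hab, Or.inl rfl, Set.ncard_insert_le _ _ |>.trans (by simp), a, Or.inl rfl, hab⟩
    · exact ⟨_, subset_rfl, conn_pair hab, Or.inl rfl, Set.ncard_insert_le _ _ |>.trans (by simp), u, hu, huv⟩
  | succ i ih =>
    rintro v (hv | ⟨-, u, hu, huv⟩)
    · obtain ⟨P, h1, h2, h3, h4, h5⟩ := ih v hv
      exact ⟨P, h1.trans (eball_subset_succ i), h2, h3, by omega, h5⟩
    · obtain ⟨P, h1, h2, h3, h4, x, hx, hxu⟩ := ih u hu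
      exact ⟨insert u P, Set.insert_subset hu (h1.trans (eball_subset_succ i)), h2.insert_adj ⟨x, hx, hxu.symm⟩,
        Set.mem_insert_of_mem _ h3, (Set.ncard_insert_le _ _).trans (by omega), u, Set.mem_insert _ _, huv⟩

/-- The edges of `S` touching `L`, and no vertex of `X`. -/
def hostGraph (Q : SimpleGraph ι) (L X : Set ι) : SimpleGraph ι where
  Adj u v := Q.Adj u v ∧ u ∉ X ∧ v ∉ X ∧ (u ∈ L ∨ v ∈ L)
  symm := ⟨fun _ _ h => ⟨h.1.symm, h.2.2.1, h.2.1, h.2.2.2.symm⟩⟩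
  loopless := ⟨fun _ h => Q.loopless.irrefl _ h.1⟩

theorem Conn.exists_mem_of_hostGraph {L X B : Set ι} (h : Conn (hostGraph Q L X) B) (h2 : 2 ≤ B.ncard) : ∃ v ∈ B, v ∈ L := by
  obtain ⟨x, hx⟩ := h.nonempty
  by_contra! hcon
  have h3 : B ⊆ {x} := h.2 {x} ⟨x, hx, rfl⟩ fun a ha hax b hb hab =>
    absurd hab.2.2.2 (by rintro (h | h); exacts [hcon _ ha h, hcon _ hb h])
  have := Set.ncard_le_ncard h3 (Set.toFinite _)
  rw [Set.ncard_singleton] at this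
  omega

theorem exists_slow_ball [Finite ι] (ha : a ∈ S) (hb : b ∈ S) (hab : a ≠ b) :
    ∃ i ≤ Nat.log 2 S.ncard, (eball Q S a b (i + 1)).ncard ≤ 2 * (eball Q S a b i).ncard := by
  by_contra! h
  have key : ∀ i ≤ Nat.log 2 S.ncard + 1, 2 ^ i ≤ (eball Q S a b i).ncard := by
    intro i
    induction i with
    | zero =>
      intro _
      rw [eball, Set.ncard_pair hab]
      norm_num
    | succ i ih =>
      intro hi
      have h1 := ih (by omega)
      have h2 := h i (by omega)
      rw [pow_succ]
      omega
  have h1 := (key _ le_rfl).trans (Set.ncard_le_ncard (eball_subset ha hb _) (Set.toFinite _))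
  have h2 := Nat.lt_pow_succ_log_self (b := 2) (by norm_num) S.ncard
  omega

theorem dgTouch_pair_le [Finite ι] :
    dgTouch Q S {a, b} ≤ 4 * (eball Q S a b 1).ncard := by
  set B := eball Q S a b 1
  have h1 : {p : ι × ι | p.1 ∈ S ∧ p.2 ∈ S ∧ Q.Adj p.1 p.2 ∧ (p.1 ∈ ({a, b} : Set ι) ∨ p.2 ∈ ({a, b} : Set ι))} ⊆
      ({a, b} ×ˢ B) ∪ (B ×ˢ {a, b}) := by
    rintro ⟨u, v⟩ ⟨hu, hv, huv, h | h⟩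
    · exact Or.inl ⟨h, mem_eball_succ (i := 0) h hv huv⟩
    · exact Or.inr ⟨mem_eball_succ (i := 0) h hu huv.symm, h⟩
  have h2 : ({a, b} : Set ι).ncard ≤ 2 := (Set.ncard_insert_le _ _).trans (by simp)
  have h3 := (Set.ncard_le_ncard h1 (Set.toFinite _)).trans (Set.ncard_union_le _ _)
  rw [Set.ncard_prod, Set.ncard_prod] at h3
  have h4 : ({a, b} : Set ι).ncard * B.ncard ≤ 2 * B.ncard := Nat.mul_le_mul_right _ h2
  rw [mul_comm B.ncard] at h3
  exact h3.trans (by omega)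

/-- A density that forces small minors on `h` vertices. -/
def denseBound : ℕ → ℕ
  | 0 => 1
  | h + 1 => 4 * denseBound h + 9

theorem exists_dense_host [Finite ι] {τ : ℕ} (ha : a ∈ S) (hb : b ∈ S)
    (hX : ∀ X ⊆ S, (4 * τ + 9) * X.ncard ≤ dgTouch Q S X) {i : ℕ}
    (hi : (eball Q S a b (i + 1)).ncard ≤ 2 * (eball Q S a b i).ncard) :
    ∃ j < i, τ * (eball Q S a b (j + 2) \ eball Q S a b j).ncard <
      dg (hostGraph Q (eball Q S a b (j + 1)) (eball Q S a b j)) (eball Q S a b (j + 2) \ eball Q S a b j) := by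
  by_contra! hcon
  set E := eball Q S a b with hE
  have key : ∀ j ≤ i, dgTouch Q S (E j) ≤ 4 * (E 1).ncard + τ * ((E (j + 1)).ncard + (E j).ncard) := by
    intro j
    induction j with
    | zero => exact fun _ => dgTouch_pair_le.trans (Nat.le_add_right _ _)
    | succ j ih =>
      intro hj
      have h1 := ih (by omega)
      have h2 := hcon j (by omega)
      have h3 : dgTouch Q S (E (j + 1)) ≤ dgTouch Q S (E j) + dg (hostGraph Q (E (j + 1)) (E j)) (E (j + 2) \ E j) := by
        refine (Set.ncard_le_ncard (fun p hp => ?_) (Set.toFinite _)).trans (Set.ncard_union_le _ _)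
        obtain ⟨hu, hv, huv, h⟩ := hp
        by_cases hj : p.1 ∈ E j ∨ p.2 ∈ E j
        · exact Or.inl ⟨hu, hv, huv, hj⟩
        · rw [not_or] at hj
          refine Or.inr ⟨⟨?_, hj.1⟩, ⟨?_, hj.2⟩, huv, hj.1, hj.2, h⟩
          · rcases h with h | h
            exacts [eball_subset_succ _ h, mem_eball_succ h hu huv.symm]
          · rcases h with h | h
            exacts [mem_eball_succ h hv huv, eball_subset_succ _ h]
      have h4 := Set.ncard_sdiff_add_ncard_of_subset (eball_mono (Q := Q) (S := S) (a := a) (b := b) (show j ≤ j + 2 by omega))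
        (Set.toFinite _)
      simp only [← hE] at h4
      have h5 : τ * (E (j + 2) \ E j).ncard + τ * (E j).ncard = τ * (E (j + 2)).ncard := by rw [← mul_add, h4]
      rw [mul_add] at h1 ⊢
      show _ ≤ _ + (τ * (E (j + 2)).ncard + _)
      omega
  have h1 := key i le_rfl
  have h2 := hX _ (eball_subset (Q := Q) ha hb i)
  have h3 : (E 1).ncard ≤ (E (i + 1)).ncard := Set.ncard_le_ncard (eball_mono (by omega)) (Set.toFinite _)
  have h4 : 0 < (E i).ncard := (Set.ncard_pos (Set.toFinite _)).2 ⟨a, eball_mono (Nat.zero_le i) (Or.inl rfl)⟩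
  simp only [← hE] at h2
  have h5 : τ * (E (i + 1)).ncard ≤ τ * (2 * (E i).ncard) := Nat.mul_le_mul_left _ hi
  nlinarith

theorem exists_small_top [Finite ι] (h : ℕ) : ∀ (Q : SimpleGraph ι) (U : Set ι), U.Nonempty → denseBound h * U.ncard ≤ dg Q U →
    ∃ B : Fin h → Set ι, IsModelIn ⊤ Q U B ∧ (∀ i, 2 ≤ (B i).ncard) ∧
      (⋃ i, B i).ncard ≤ h * h * (Nat.log 2 U.ncard + 3) := by
  induction h with
  | zero => exact fun Q U _ _ => ⟨fun i => i.elim0, ⟨fun i => i.elim0, fun i => i.elim0, fun i => i.elim0, fun i => i.elim0⟩,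
      fun i => i.elim0, by simp⟩
  | succ h ih =>
    intro Q U hU hd
    obtain ⟨S, hSU, hSne, hS⟩ := exists_dense_part hU hd
    obtain ⟨⟨a, b⟩, ha, hb, hab⟩ : {p : ι × ι | p.1 ∈ S ∧ p.2 ∈ S ∧ Q.Adj p.1 p.2 ∧ (p.1 ∈ S ∨ p.2 ∈ S)}.Nonempty := by
      rw [← Set.ncard_pos (Set.toFinite _)]
      refine lt_of_lt_of_le ?_ (hS S subset_rfl)
      have := (Set.ncard_pos (Set.toFinite _)).2 hSne
      rw [denseBound]
      positivity
    replace hab := hab.1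
    simp only at ha hb hab
    obtain ⟨i, hi, hi'⟩ := exists_slow_ball (Q := Q) ha hb hab.ne
    obtain ⟨j, hj, hjd⟩ := exists_dense_host ha hb hS hi'
    set E := eball Q S a b
    have hne : (E (j + 2) \ E j).Nonempty := by
      by_contra hne
      rw [Set.not_nonempty_iff_eq_empty] at hne
      simp [hne, dg] at hjd
    obtain ⟨B, hB, hB2, hBc⟩ := ih _ _ hne hjd.le
    have hES : ∀ i, E i ⊆ S := fun i => eball_subset ha hb i
    choose v hvB hvE using fun i => (hB.conn i).exists_mem_of_hostGraph (hB2 i)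
    choose P hPE hPc haP hPn u huP huv using fun i => exists_root_path hab j (v i) (hvE i)
    set A := {a, b} ∪ ⋃ i, P i with hA
    have hA0 : ({a, b} : Set ι) ⊆ E j := eball_mono (Nat.zero_le j)
    have hAE : A ⊆ E j := Set.union_subset hA0 (Set.iUnion_subset hPE)
    have hAB : ∀ i, Disjoint A (B i) := fun i => Set.disjoint_left.2 fun x hx hxB => (hB.subset i hxB).2 (hAE hx)
    have hAadj : ∀ i, ∃ x ∈ A, ∃ y ∈ B i, Q.Adj x y := fun i =>
      ⟨u i, Or.inr (Set.mem_iUnion_of_mem i (huP i)), v i, hvB i, huv i⟩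
    have hSc : S.ncard ≤ U.ncard := Set.ncard_le_ncard hSU (Set.toFinite _)
    have hAn : A.ncard ≤ 2 + h * (Nat.log 2 U.ncard + 1) := by
      have h1 : A.ncard ≤ _ := Set.ncard_union_le {a, b} (⋃ i, P i)
      have h2 : ({a, b} : Set ι).ncard ≤ 2 := (Set.ncard_insert_le _ _).trans (by simp)
      have h3 : (⋃ i, P i).ncard ≤ h * (Nat.log 2 U.ncard + 1) := by
        refine (Set.ncard_iUnion_le_of_fintype _).trans ((Finset.sum_le_card_nsmul _ _ _ fun i _ => (hPn i).trans ?_).trans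
          (by rw [Finset.card_univ, Fintype.card_fin, smul_eq_mul]))
        have := Nat.log_mono_right (b := 2) hSc
        omega
      omega
    refine ⟨Fin.cons A B, ⟨?_, ?_, ?_, ?_⟩, ?_, ?_⟩
    · refine Fin.cases ?_ fun i => ?_
      · exact hAE.trans ((hES _).trans hSU)
      · exact (hB.subset i).trans (Set.sdiff_subset.trans ((hES _).trans hSU))
    · refine Fin.cases ?_ fun i => ?_
      · exact (conn_pair hab).union_iUnion hPc fun i => Or.inl ⟨a, Or.inl rfl, haP i⟩
      · exact (hB.conn i).mono_le fun _ _ h => h.1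
    · refine Fin.cases (Fin.cases (by simp) fun i _ => hAB i) fun i => Fin.cases (fun _ => (hAB i).symm) fun i' hne => ?_
      exact hB.disj i i' fun h => hne (congrArg Fin.succ h)
    · refine Fin.cases (Fin.cases (by simp) fun i _ => hAadj i) fun i => Fin.cases (fun _ => ?_) fun i' hne => ?_
      · obtain ⟨x, hx, y, hy, hxy⟩ := hAadj i
        exact ⟨y, hy, x, hx, hxy.symm⟩
      · obtain ⟨x, hx, y, hy, hxy⟩ := hB.adj i i' fun h => hne (congrArg Fin.succ h)
        exact ⟨x, hx, y, hy, hxy.1⟩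
    · refine Fin.cases ?_ fun i => hB2 i
      refine (Set.ncard_pair hab.ne).symm.le.trans (Set.ncard_le_ncard Set.subset_union_left (Set.toFinite _))
    · have h1 : (⋃ i, (Fin.cons A B : Fin (h + 1) → Set ι) i) ⊆ A ∪ ⋃ i, B i := by
        refine Set.iUnion_subset (Fin.cases Set.subset_union_left fun i => ?_)
        exact (Set.subset_iUnion B i).trans Set.subset_union_right
      have h2 := (Set.ncard_le_ncard h1 (Set.toFinite _)).trans (Set.ncard_union_le _ _)
      have h3 : Nat.log 2 (E (j + 2) \ E j).ncard ≤ Nat.log 2 U.ncard :=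
        Nat.log_mono_right (Set.ncard_le_ncard (Set.sdiff_subset.trans ((hES _).trans hSU)) (Set.toFinite _))
      have h4 : h * h * (Nat.log 2 (E (j + 2) \ E j).ncard + 3) ≤ h * h * (Nat.log 2 U.ncard + 3) :=
        Nat.mul_le_mul_left _ (by omega)
      nlinarith

end SmallMinor

section Counting

/-- Disjoint sets meeting `X` are at most as many as the elements of `X`. -/
theorem ncard_le_of_disjoint_meet {ι κ : Type*} [Finite κ] {I : Set ι} {f : ι → Set κ} {X : Set κ}
    (hd : ∀ i ∈ I, ∀ j ∈ I, i ≠ j → Disjoint (f i) (f j))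
    (hm : ∀ i ∈ I, (f i ∩ X).Nonempty) : I.ncard ≤ X.ncard := by
  classical
  rcases isEmpty_or_nonempty κ with hκ | hκ
  · have : I = ∅ := Set.eq_empty_of_forall_notMem fun i hi => hκ.elim (hm i hi).some
    simp [this]
  choose! g hg using hm
  refine Set.ncard_le_ncard_of_injOn g (fun i hi => (hg i hi).2) (fun i hi j hj hij => ?_) (Set.toFinite _)
  by_contra hne
  exact Set.disjoint_left.1 (hd i hi j hj hne) (hg i hi).1 (hij ▸ (hg j hj).1)

variable {ι κ : Type*} [Finite ι] [Finite κ]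

theorem ncard_pairs (W : Set ι) [Fintype W] (R : ι → κ → Prop) :
    {p : ι × κ | p.1 ∈ W ∧ R p.1 p.2}.ncard = ∑ i ∈ W.toFinset, {k | R i k}.ncard := by
  classical
  have := Fintype.ofFinite ι
  have := Fintype.ofFinite κ
  rw [Set.ncard_eq_toFinset_card', Finset.card_eq_sum_card_fiberwise (f := Prod.fst) (t := W.toFinset)
    (fun p hp => by simp at hp ⊢; exact hp.1)]
  refine Finset.sum_congr rfl fun i hi => ?_
  rw [Set.ncard_eq_toFinset_card']
  refine Finset.card_bij (fun p _ => p.2) (fun p hp => ?_) (fun p hp p' hp' h => ?_) fun k hk => ⟨(i, k), ?_, rfl⟩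
  · simp at hp ⊢
    exact hp.2 ▸ hp.1.2
  · simp at hp hp'
    exact Prod.ext (hp.2.trans hp'.2.symm) h
  · simp at hi hk ⊢
    exact ⟨hi, hk⟩

theorem ncard_pairs_le {W : Set ι} {R : ι → κ → Prop} {c : ℕ} (h : ∀ i ∈ W, {k | R i k}.ncard ≤ c) :
    {p : ι × κ | p.1 ∈ W ∧ R p.1 p.2}.ncard ≤ c * W.ncard := by
  have := Fintype.ofFinite W
  rw [ncard_pairs, Set.ncard_eq_toFinset_card', mul_comm]
  exact Finset.sum_le_card_nsmul _ _ _ fun i hi => h i (Set.mem_toFinset.1 hi)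

theorem le_ncard_pairs {W : Set ι} {R : ι → κ → Prop} {c : ℕ} (h : ∀ i ∈ W, c ≤ {k | R i k}.ncard) :
    c * W.ncard ≤ {p : ι × κ | p.1 ∈ W ∧ R p.1 p.2}.ncard := by
  have := Fintype.ofFinite W
  rw [ncard_pairs, Set.ncard_eq_toFinset_card', mul_comm]
  exact Finset.card_nsmul_le_sum _ _ _ fun i hi => h i (Set.mem_toFinset.1 hi)

end Counting

section Fat

variable {V ι K : Type*} {G : SimpleGraph V} {Q : SimpleGraph ι} {U : Set ι} {H : SimpleGraph K}
  {node : ι → Set V} {link : Sym2 ι → Set V} {Pc : Set (Set V)}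

/-- The edges of `Q` on `U` are represented in `G` by connected sets for the vertices and pairwise disjoint (possibly empty)
connected sets for the edges. -/
structure IsFat (G : SimpleGraph V) (Pc : Set (Set V)) (Q : SimpleGraph ι) (U : Set ι) (node : ι → Set V)
    (link : Sym2 ι → Set V) : Prop where
  node_mem : ∀ i ∈ U, node i ∈ Pc
  node_disj : ∀ i ∈ U, ∀ j ∈ U, i ≠ j → Disjoint (node i) (node j)
  adj : ∀ i ∈ U, ∀ j ∈ U, Q.Adj i j → (link s(i, j) = ∅ ∧ ∃ a ∈ node i, ∃ b ∈ node j, G.Adj a b) ∨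
    (link s(i, j) ∈ Pc ∧ ∃ a ∈ node i, ∃ b ∈ link s(i, j), G.Adj a b)
  link_node : ∀ i ∈ U, ∀ j ∈ U, ∀ k ∈ U, Q.Adj i j → Disjoint (link s(i, j)) (node k)
  link_disj : ∀ i ∈ U, ∀ j ∈ U, ∀ k ∈ U, ∀ l ∈ U, Q.Adj i j → Q.Adj k l → s(i, j) ≠ s(k, l) →
    Disjoint (link s(i, j)) (link s(k, l))

/-- The part of `G` representing the subgraph of `Q` induced by `R`. -/
def fatSet (Q : SimpleGraph ι) (node : ι → Set V) (link : Sym2 ι → Set V) (R : Set ι) : Set V :=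
  (⋃ i ∈ R, node i) ∪ ⋃ i ∈ R, ⋃ j ∈ R, ⋃ _ : Q.Adj i j, link s(i, j)

theorem IsFat.mono {Q' : SimpleGraph ι} {U' : Set ι} (h : IsFat G Pc Q U node link) (hQ : Q' ≤ Q) (hU : U' ⊆ U) :
    IsFat G Pc Q' U' node link :=
  ⟨fun i hi => h.node_mem i (hU hi), fun i hi j hj => h.node_disj i (hU hi) j (hU hj),
    fun i hi j hj hij => h.adj i (hU hi) j (hU hj) (hQ hij),
    fun i hi j hj k hk hij => h.link_node i (hU hi) j (hU hj) k (hU hk) (hQ hij),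
    fun i hi j hj i' hi' j' hj' hij hij' => h.link_disj i (hU hi) j (hU hj) i' (hU hi') j' (hU hj') (hQ hij) (hQ hij')⟩

theorem IsFat.minorIn (hPc : ∀ P ∈ Pc, Conn G P) (h : IsFat G Pc Q U node link) (hH : MinorIn H Q U) :
    MinorIn H G (fatSet Q node link U) := by
  have hout : ∀ i j : ι, s(i, j).out.1 = i ∨ s(i, j).out.1 = j := fun i j => by
    simpa using Sym2.out_fst_mem s(i, j)
  let J : ι → Set ι := fun i => {j | j ∈ U ∧ Q.Adj i j ∧ s(i, j).out.1 = i ∧ link s(i, j) ≠ ∅}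
  let φ : ι → Set V := fun i => node i ∪ ⋃ j : J i, link s(i, j)
  refine hH.lift φ ?_ ?_ ?_ ?_
  · intro i hi
    refine Set.union_subset_union (Set.subset_biUnion_of_mem (u := node) hi) (Set.iUnion_subset fun j => ?_)
    exact fun x hx => by
      simp only [Set.mem_iUnion]
      exact ⟨i, hi, j, j.2.1, j.2.2.1, hx⟩
  · intro i hi
    refine (hPc _ (h.node_mem i hi)).union_iUnion (fun j => ?_) fun j => ?_
    · exact hPc _ ((h.adj i hi j j.2.1 j.2.2.1).resolve_left fun h => j.2.2.2.2 h.1).1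
    · exact Or.inr ((h.adj i hi j j.2.1 j.2.2.1).resolve_left fun h => j.2.2.2.2 h.1).2
  · intro i hi i' hi' hne
    rw [Set.disjoint_union_left]
    constructor
    · rw [Set.disjoint_union_right, Set.disjoint_iUnion_right]
      exact ⟨h.node_disj i hi i' hi' hne, fun j => (h.link_node i' hi' j j.2.1 i hi j.2.2.1).symm⟩
    · rw [Set.disjoint_iUnion_left]
      intro j
      rw [Set.disjoint_union_right, Set.disjoint_iUnion_right]
      refine ⟨h.link_node i hi j j.2.1 i' hi' j.2.2.1, fun j' => ?_⟩
      refine h.link_disj i hi j j.2.1 i' hi' j' j'.2.1 j.2.2.1 j'.2.2.1 fun heq => hne ?_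
      rw [← j.2.2.2.1, ← j'.2.2.2.1, heq]
  · have key : ∀ i ∈ U, ∀ j ∈ U, Q.Adj i j → s(i, j).out.1 = i → ∃ x ∈ φ i, ∃ y ∈ φ j, G.Adj x y := by
      intro i hi j hj hij ho
      rcases h.adj i hi j hj hij with ⟨-, a, ha, b, hb, hab⟩ | ⟨hm, -⟩
      · exact ⟨a, Or.inl ha, b, Or.inl hb, hab⟩
      · have hne := (hPc _ hm).nonempty.ne_empty
        rcases h.adj j hj i hi hij.symm with ⟨h0, -⟩ | ⟨-, a, ha, b, hb, hab⟩
        · rw [Sym2.eq_swap] at h0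
          exact absurd h0 hne
        · rw [Sym2.eq_swap] at hb
          exact ⟨b, Or.inr (Set.mem_iUnion.2 ⟨⟨j, hj, hij, ho, hne⟩, hb⟩), a, Or.inl ha, hab.symm⟩
    intro i hi j hj hij
    rcases hout i j with ho | ho
    · exact key i hi j hj hij ho
    · rw [Sym2.eq_swap] at ho
      obtain ⟨x, hx, y, hy, hxy⟩ := key j hj i hi hij.symm ho
      exact ⟨y, hy, x, hx, hxy.symm⟩

/-- A dense fat graph contains a dense part on few vertices, if few vertices meet all models of `H`. -/
theorem IsFat.exists_dense_small [Finite V] [Finite ι] [Finite K] {X : Set V} {F : ℕ} (hPc : ∀ P ∈ Pc, Conn G P)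
    (h : IsFat G Pc Q U node link) (hX : ¬ MinorIn H G Xᶜ) (hF : X.ncard ≤ F) (hU : U.Nonempty)
    (hd : (7 * denseBound (Nat.card K) + 2) * U.ncard ≤ dg Q U) :
    ∃ U' ⊆ U, U'.Nonempty ∧ U'.ncard ≤ 2 * F ∧ denseBound (Nat.card K) * U'.ncard ≤ dg Q U' := by
  set τ := denseBound (Nat.card K)
  have hUpos : 0 < U.ncard := (Set.ncard_pos (Set.toFinite _)).2 hU
  by_cases hUF : U.ncard ≤ 2 * F
  · exact ⟨U, subset_rfl, hU, hUF, le_trans (Nat.mul_le_mul_right _ (by omega)) hd⟩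
  set B : Set ι := {i | i ∈ U ∧ (node i ∩ X).Nonempty}
  have hB : B.ncard ≤ F :=
    (ncard_le_of_disjoint_meet (fun i hi j hj => h.node_disj i hi.1 j hj.1) fun i hi => hi.2).trans hF
  -- the edges whose link meets `X`
  have hL : {p : ι × ι | p.1 ∈ U ∧ p.2 ∈ U ∧ Q.Adj p.1 p.2 ∧ (link s(p.1, p.2) ∩ X).Nonempty}.ncard ≤ 2 * F := by
    set E : Set (Sym2 ι) := {e | ∃ i ∈ U, ∃ j ∈ U, e = s(i, j) ∧ Q.Adj i j ∧ (link e ∩ X).Nonempty}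
    have hE : E.ncard ≤ F := by
      refine (ncard_le_of_disjoint_meet (f := link) ?_ ?_).trans hF
      · rintro _ ⟨i, hi, j, hj, rfl, hij, -⟩ _ ⟨i', hi', j', hj', rfl, hij', -⟩ hne
        exact h.link_disj i hi j hj i' hi' j' hj' hij hij' hne
      · rintro _ ⟨i, hi, j, hj, rfl, hij, hne⟩
        exact hne
    have h1 : {p : ι × ι | p.1 ∈ U ∧ p.2 ∈ U ∧ Q.Adj p.1 p.2 ∧ (link s(p.1, p.2) ∩ X).Nonempty} ⊆
        ((fun e : Sym2 ι => e.out) '' E) ∪ ((fun e : Sym2 ι => e.out.swap) '' E) := by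
      rintro ⟨i, j⟩ ⟨hi, hj, hij, hne⟩
      have hmem : s(i, j) ∈ E := ⟨i, hi, j, hj, rfl, hij, hne⟩
      have h2 : s(s(i, j).out.1, s(i, j).out.2) = s(i, j) := Quot.out_eq _
      rcases Sym2.eq_iff.1 h2 with ⟨h3, h4⟩ | ⟨h3, h4⟩
      · exact Or.inl ⟨_, hmem, Prod.ext h3 h4⟩
      · exact Or.inr ⟨_, hmem, Prod.ext h4 h3⟩
    refine (Set.ncard_le_ncard h1 (Set.toFinite _)).trans ((Set.ncard_union_le _ _).trans ?_)
    have h3 := Set.ncard_image_le (f := fun e : Sym2 ι => e.out) (Set.toFinite E)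
    have h4 := Set.ncard_image_le (f := fun e : Sym2 ι => e.out.swap) (Set.toFinite E)
    omega
  -- the edges avoiding `X` are sparse
  let Q₀ : SimpleGraph ι :=
    { Adj := fun i j => Q.Adj i j ∧ Disjoint (link s(i, j)) X
      symm := ⟨fun i j hij => ⟨hij.1.symm, by rw [Sym2.eq_swap]; exact hij.2⟩⟩
      loopless := ⟨fun i hi => Q.loopless.irrefl _ hi.1⟩ }
  have hQ₀ : dg Q₀ (U \ B) ≤ τ * U.ncard := by
    by_contra! hlt
    have hne : (U \ B).Nonempty := by
      by_contra hne
      rw [Set.not_nonempty_iff_eq_empty] at hne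
      simp [hne, dg] at hlt
    obtain ⟨M, hM, -⟩ := exists_small_top (Nat.card K) Q₀ (U \ B) hne
      ((Nat.mul_le_mul_left _ (Set.ncard_le_ncard Set.sdiff_subset (Set.toFinite _))).trans hlt.le)
    refine hX (((h.mono (Q' := Q₀) (fun _ _ h => h.1) Set.sdiff_subset).minorIn hPc (MinorIn.of_top ⟨M, hM⟩)).mono ?_)
    rintro x (hx | hx) hxX
    · simp only [Set.mem_iUnion] at hx
      obtain ⟨i, hi, hx⟩ := hx
      exact hi.2 ⟨hi.1, x, hx, hxX⟩
    · simp only [Set.mem_iUnion] at hx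
      obtain ⟨i, hi, j, hj, hij, hx⟩ := hx
      exact Set.disjoint_left.1 hij.2 hx hxX
  -- hence many edges have an end in `B`
  set P : Set ι → ℕ := fun W => {p : ι × ι | p.1 ∈ W ∧ p.2 ∈ B ∧ Q.Adj p.1 p.2}.ncard with hP
  have hPU : (7 * τ + 2) * U.ncard ≤ τ * U.ncard + 2 * F + 2 * P U := by
    have h1 : {p : ι × ι | p.1 ∈ U ∧ p.2 ∈ U ∧ Q.Adj p.1 p.2} ⊆
        ({p : ι × ι | p.1 ∈ U \ B ∧ p.2 ∈ U \ B ∧ Q₀.Adj p.1 p.2} ∪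
          {p : ι × ι | p.1 ∈ U ∧ p.2 ∈ U ∧ Q.Adj p.1 p.2 ∧ (link s(p.1, p.2) ∩ X).Nonempty}) ∪
        ({p : ι × ι | p.1 ∈ U ∧ p.2 ∈ B ∧ Q.Adj p.1 p.2} ∪ Prod.swap '' {p : ι × ι | p.1 ∈ U ∧ p.2 ∈ B ∧ Q.Adj p.1 p.2}) := by
      rintro ⟨i, j⟩ ⟨hi, hj, hij⟩
      by_cases hjB : j ∈ B
      · exact Or.inr (Or.inl ⟨hi, hjB, hij⟩)
      by_cases hiB : i ∈ B
      · exact Or.inr (Or.inr ⟨(j, i), ⟨hj, hiB, hij.symm⟩, rfl⟩)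
      by_cases hne : (link s(i, j) ∩ X).Nonempty
      · exact Or.inl (Or.inr ⟨hi, hj, hij, hne⟩)
      · refine Or.inl (Or.inl ⟨⟨hi, hiB⟩, ⟨hj, hjB⟩, hij, ?_⟩)
        rwa [Set.not_nonempty_iff_eq_empty, ← Set.disjoint_iff_inter_eq_empty] at hne
    have h2 := (Set.ncard_le_ncard h1 (Set.toFinite _)).trans ((Set.ncard_union_le _ _).trans
      (Nat.add_le_add (Set.ncard_union_le _ _) (Set.ncard_union_le _ _)))
    have h3 := Set.ncard_image_le (f := Prod.swap) (Set.toFinite {p : ι × ι | p.1 ∈ U ∧ p.2 ∈ B ∧ Q.Adj p.1 p.2})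
    simp only [dg] at hd hQ₀
    simp only [hP]
    omega
  have hPW : ∀ W ⊆ U, P W ≤ dg Q (B ∪ W) := fun W hW =>
    Set.ncard_le_ncard (fun p hp => ⟨Or.inr hp.1, Or.inl hp.2.1, hp.2.2⟩) (Set.toFinite _)
  have hBne : B.Nonempty := by
    by_contra hne
    rw [Set.not_nonempty_iff_eq_empty] at hne
    have : P U = 0 := by simp [hP, hne]
    rw [this] at hPU
    nlinarith
  have hBU : B ⊆ U := fun _ h => h.1
  set T : Set ι := {i | i ∈ U ∧ 2 * τ ≤ {k | k ∈ B ∧ Q.Adj i k}.ncard}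
  have hTU : T ⊆ U := fun _ h => h.1
  by_cases hT : F ≤ T.ncard
  · obtain ⟨W, hWT, hW⟩ := Set.exists_subset_card_eq hT
    refine ⟨B ∪ W, Set.union_subset hBU (hWT.trans hTU), hBne.inl, (Set.ncard_union_le _ _).trans (by omega), ?_⟩
    refine le_trans ?_ (hPW W (hWT.trans hTU))
    have h1 : 2 * τ * W.ncard ≤ P W := le_ncard_pairs (R := fun i k => k ∈ B ∧ Q.Adj i k) fun i hi => (hWT hi).2
    have h2 := Nat.mul_le_mul_left τ (Set.ncard_union_le B W)
    have h3 : τ * B.ncard ≤ τ * F := Nat.mul_le_mul_left _ hB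
    rw [hW] at h1 h2
    nlinarith
  · refine ⟨B ∪ T, Set.union_subset hBU hTU, hBne.inl, (Set.ncard_union_le _ _).trans (by omega), ?_⟩
    refine le_trans ?_ (hPW T hTU)
    have h1 : P U ≤ P T + P (U \ T) := by
      refine (Set.ncard_le_ncard (fun p hp => ?_) (Set.toFinite _)).trans (Set.ncard_union_le _ _)
      by_cases hpT : p.1 ∈ T
      exacts [Or.inl ⟨hpT, hp.2⟩, Or.inr ⟨⟨hp.1, hpT⟩, hp.2⟩]
    have h2 : P (U \ T) ≤ 2 * τ * (U \ T).ncard := ncard_pairs_le (R := fun i k => k ∈ B ∧ Q.Adj i k) fun i hi => by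
      by_contra! hlt
      exact hi.2 ⟨hi.1, hlt.le⟩
    have h3 : (U \ T).ncard ≤ U.ncard := Set.ncard_le_ncard Set.sdiff_subset (Set.toFinite _)
    have h4 := Set.ncard_union_le B T
    have h5 : τ * (U \ T).ncard ≤ τ * U.ncard := Nat.mul_le_mul_left _ h3
    have h6 : τ * (B ∪ T).ncard ≤ τ * U.ncard := Nat.mul_le_mul_left _ (by omega)
    nlinarith

end Fat

section Traces

variable {ι : Type*} [Finite ι] {Q Γ : SimpleGraph ι} {A U : Set ι} {D : ℕ}

/-- The neighbours of `b` in `A`. -/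
def nb (Γ : SimpleGraph ι) (A : Set ι) (b : ι) : Set ι := {a | a ∈ A ∧ Γ.Adj b a}

theorem exists_nb_lt (h : dg Q U < D * U.ncard) : ∃ v ∈ U, (nb Q U v).ncard < D := by
  by_contra! hc
  exact absurd (le_ncard_pairs (R := fun i k => k ∈ U ∧ Q.Adj i k) hc) (not_le.2 h)

theorem ncard_cliques_le : ∀ (n : ℕ) (U : Set ι), U.ncard = n →
    (∀ U' ⊆ U, U'.Nonempty → dg Q U' < D * U'.ncard) →
    {S : Set ι | S ⊆ U ∧ S.Nonempty ∧ Q.IsClique S}.ncard ≤ 2 ^ D * n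
  | 0, U, hU, _ => by
    rw [Set.ncard_eq_zero (Set.toFinite _)] at hU
    subst hU
    have : {S : Set ι | S ⊆ ∅ ∧ S.Nonempty ∧ Q.IsClique S} = ∅ :=
      Set.eq_empty_of_forall_notMem fun S hS => hS.2.1.ne_empty (Set.subset_empty_iff.1 hS.1)
    rw [this]
    simp
  | n + 1, U, hU, hd => by
    obtain ⟨v, hv, hlt⟩ := exists_nb_lt (hd U subset_rfl ((Set.ncard_pos (Set.toFinite _)).1 (by omega)))
    have h1 := ncard_cliques_le n (U \ {v}) (by rw [Set.ncard_sdiff_singleton_of_mem hv]; omega)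
      fun U' hU' => hd U' (hU'.trans Set.sdiff_subset)
    have h2 : {S : Set ι | S ⊆ U ∧ S.Nonempty ∧ Q.IsClique S} ⊆
        {S : Set ι | S ⊆ U \ {v} ∧ S.Nonempty ∧ Q.IsClique S} ∪ (insert v) '' (nb Q U v).powerset := by
      rintro S ⟨hS, hne, hc⟩
      by_cases hvS : v ∈ S
      · refine Or.inr ⟨S \ {v}, fun x hx => ⟨hS hx.1, hc hvS hx.1 (Ne.symm hx.2)⟩, ?_⟩
        simp [hvS]
      · exact Or.inl ⟨fun x hx => ⟨hS hx, fun h => hvS (h ▸ hx)⟩, hne, hc⟩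
    have h3 := (Set.ncard_le_ncard h2 (Set.toFinite _)).trans (Set.ncard_union_le _ _)
    have h4 := Set.ncard_image_le (f := insert v) (Set.toFinite (nb Q U v).powerset)
    rw [Set.ncard_powerset _ (Set.toFinite _)] at h4
    have h5 : 2 ^ (nb Q U v).ncard ≤ 2 ^ D := Nat.pow_le_pow_right (by norm_num) hlt.le
    rw [mul_add]
    omega

/-- Greedily assigning the members of a family to pairs of their elements. -/
theorem exists_pairs (T : Set (Set ι)) : ∃ (Q : SimpleGraph ι) (f : Sym2 ι → Set ι),
    Set.InjOn f Q.edgeSet ∧ (∀ i j, Q.Adj i j → f s(i, j) ∈ T ∧ i ∈ f s(i, j)) ∧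
      ∀ S ∈ T, Q.IsClique S ∨ S ∈ f '' Q.edgeSet := by
  classical
  induction T, Set.toFinite T using Set.Finite.induction_on with
  | empty => exact ⟨⊥, fun _ => ∅, by simp, by simp, by simp⟩
  | @insert S T hST _ ih =>
    obtain ⟨Q, f, h1, h2, h3⟩ := ih
    by_cases hc : Q.IsClique S
    · refine ⟨Q, f, h1, fun i j hij => ⟨Or.inr (h2 i j hij).1, (h2 i j hij).2⟩, ?_⟩
      rintro S' (rfl | hS')
      exacts [Or.inl hc, h3 S' hS']
    · obtain ⟨i, hi, j, hj, hne, hij⟩ : ∃ i ∈ S, ∃ j ∈ S, i ≠ j ∧ ¬ Q.Adj i j := by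
        simpa [SimpleGraph.IsClique, Set.Pairwise] using hc
      have hE : (Q ⊔ edge i j).edgeSet = insert s(i, j) Q.edgeSet := by
        rw [edgeSet_sup, edgeSet_edge_of_ne hne, Set.union_singleton]
      have hf : ∀ e ∈ Q.edgeSet, Function.update f s(i, j) S e = f e := fun e he =>
        Function.update_of_ne (by rintro rfl; exact hij he) _ _
      have hfT : ∀ e ∈ Q.edgeSet, f e ∈ T := fun e => e.ind fun a b h => (h2 a b h).1
      refine ⟨Q ⊔ edge i j, Function.update f s(i, j) S, ?_, ?_, ?_⟩
      · rw [hE, Set.injOn_insert (show s(i, j) ∉ Q.edgeSet from hij)]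
        refine ⟨fun e he e' he' h => h1 he he' (by rwa [hf e he, hf e' he'] at h), ?_⟩
        rintro ⟨e, he, h⟩
        rw [hf e he, Function.update_self] at h
        exact hST (h ▸ hfT e he)
      · intro a b hab
        by_cases he : s(a, b) = s(i, j)
        · rw [he, Function.update_self]
          refine ⟨Or.inl rfl, ?_⟩
          rcases Sym2.eq_iff.1 he with ⟨rfl, -⟩ | ⟨rfl, -⟩
          exacts [hi, hj]
        · have hab' : s(a, b) ∈ (Q ⊔ edge i j).edgeSet := hab
          rw [hE] at hab'
          have := h2 a b (hab'.resolve_left he)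
          rw [Function.update_of_ne he]
          exact ⟨Or.inr this.1, this.2⟩
      · rintro S' (rfl | hS')
        · exact Or.inr ⟨s(i, j), by rw [hE]; exact Set.mem_insert _ _, Function.update_self ..⟩
        · rcases h3 S' hS' with h | ⟨e, he, rfl⟩
          · exact Or.inl (h.mono le_sup_left)
          · exact Or.inr ⟨e, by rw [hE]; exact Or.inr he, hf e he⟩

/-- `Γ` and the graphs obtained by contracting a matching of links of `Γ` have average degree less than `D`. -/
structure IsSparse (Γ : SimpleGraph ι) (D : ℕ) : Prop where
  dg_lt : ∀ U : Set ι, U.Nonempty → dg Γ U < D * U.ncard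
  dg_link_lt : ∀ (U : Set ι) (Q : SimpleGraph ι) (l : Sym2 ι → ι), U.Nonempty → Set.InjOn l Q.edgeSet →
    (∀ i j, Q.Adj i j → i ∈ U ∧ l s(i, j) ∉ U ∧ Γ.Adj i (l s(i, j))) → dg Q U < D * U.ncard

theorem IsSparse.ncard_traces_le (h : IsSparse Γ D) (U L : Set ι) (hUL : Disjoint U L) :
    (nb Γ U '' L \ {∅}).ncard ≤ (D + 2 ^ D) * U.ncard := by
  classical
  obtain ⟨Q, f, h1, h2, h3⟩ := exists_pairs (nb Γ U '' L \ {∅})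
  rcases U.eq_empty_or_nonempty with rfl | hU
  · have : nb Γ ∅ '' L \ {∅} = ∅ := Set.eq_empty_of_forall_notMem fun S hS => by
      obtain ⟨⟨b, -, rfl⟩, hne⟩ := hS
      exact hne (Set.eq_empty_of_forall_notMem fun x hx => hx.1)
    simp [this]
  have : Nonempty ι := hU.to_type
  have hinv : ∀ e ∈ Q.edgeSet, ∃ b ∈ L, nb Γ U b = f e := fun e => e.ind fun a b hab => (h2 a b hab).1.1
  choose! l hlL hl using hinv
  have hlinj : Set.InjOn l Q.edgeSet := fun e he e' he' hee => h1 he he' (by rw [← hl e he, ← hl e' he', hee])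
  have hadj : ∀ i j, Q.Adj i j → i ∈ U ∧ l s(i, j) ∉ U ∧ Γ.Adj i (l s(i, j)) := fun i j hij => by
    have h4 := (h2 i j hij).2
    rw [← hl _ hij] at h4
    exact ⟨h4.1, fun h => Set.disjoint_left.1 hUL h (hlL _ hij), h4.2.symm⟩
  have hd : ∀ U' ⊆ U, U'.Nonempty → dg Q U' < D * U'.ncard := fun U' hU' hne => by
    let Q' : SimpleGraph ι :=
      { Adj := fun i j => i ∈ U' ∧ j ∈ U' ∧ Q.Adj i j
        symm := ⟨fun i j h => ⟨h.2.1, h.1, h.2.2.symm⟩⟩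
        loopless := ⟨fun i h => Q.loopless.irrefl _ h.2.2⟩ }
    have hQ' : Q' ≤ Q := fun _ _ h => h.2.2
    refine lt_of_le_of_lt (Set.ncard_le_ncard ?_ (Set.toFinite _)) (h.dg_link_lt U' Q' l hne
      (hlinj.mono (edgeSet_mono hQ')) fun i j hij => ?_)
    · exact fun p hp => ⟨hp.1, hp.2.1, hp.1, hp.2.1, hp.2.2⟩
    · have := hadj i j hij.2.2
      exact ⟨hij.1, fun h => this.2.1 (hU' h), this.2.2⟩
  have hE : Q.edgeSet.ncard ≤ dg Q U := by
    refine Set.ncard_le_ncard_of_injOn (fun e => e.out) (fun e he => ?_) (fun e _ e' _ h => ?_) (Set.toFinite _)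
    · have h4 : s(e.out.1, e.out.2) = e := Quot.out_eq e
      have h5 : Q.Adj e.out.1 e.out.2 := by
        rw [← mem_edgeSet, h4]
        exact he
      exact ⟨(hadj _ _ h5).1, (hadj _ _ h5.symm).1, h5⟩
    · rw [← Quot.out_eq e, ← Quot.out_eq e']
      exact congrArg _ h
  have h4 : nb Γ U '' L \ {∅} ⊆ f '' Q.edgeSet ∪ {S : Set ι | S ⊆ U ∧ S.Nonempty ∧ Q.IsClique S} := by
    intro S hS
    rcases h3 S hS with hc | hf
    · refine Or.inr ⟨?_, Set.nonempty_iff_ne_empty.2 hS.2, hc⟩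
      obtain ⟨⟨b, -, rfl⟩, -⟩ := hS
      exact fun x hx => hx.1
    · exact Or.inl hf
  have h5 := (Set.ncard_le_ncard h4 (Set.toFinite _)).trans (Set.ncard_union_le _ _)
  have h6 := Set.ncard_image_le (f := f) (Set.toFinite Q.edgeSet)
  have h7 := ncard_cliques_le U.ncard U rfl hd
  have h8 := hd U subset_rfl hU
  rw [add_mul]
  omega

end Traces

section Hull

variable {ι κ : Type*} [Finite ι] [Finite κ] {Γ : SimpleGraph ι} {A A₀ Y R S : Set ι} {c s m w D : ℕ}

theorem ncard_exists_le {W : Set ι} {r : ι → κ → Prop} (h : ∀ i ∈ W, {k | r i k}.ncard ≤ c) :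
    {k | ∃ i ∈ W, r i k}.ncard ≤ c * W.ncard := by
  have h1 : {k | ∃ i ∈ W, r i k} ⊆ Prod.snd '' {p : ι × κ | p.1 ∈ W ∧ r p.1 p.2} :=
    fun k ⟨i, hi, hk⟩ => ⟨(i, k), ⟨hi, hk⟩, rfl⟩
  exact (Set.ncard_le_ncard h1 (Set.toFinite _)).trans
    ((Set.ncard_image_le (Set.toFinite _)).trans (ncard_pairs_le h))

/-- `A₀`, its neighbours in `A`, and the vertices of `A` joined to it by a path through one vertex outside `A`. -/
def nhull (Γ : SimpleGraph ι) (A A₀ : Set ι) : Set ι :=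
  A₀ ∪ ({x | x ∈ A ∧ ∃ a ∈ A₀, Γ.Adj a x} ∪ {x | x ∈ A ∧ ∃ a ∈ A₀, ∃ b ∉ A, Γ.Adj a b ∧ Γ.Adj b x})

theorem ncard_nhull_le (hs : ∀ b ∈ Y, (nb Γ A b).ncard ≤ s) (hm : ∀ b ∈ R \ Y, (nb Γ A b).ncard ≤ m)
    (hR : ∀ b ∉ A, (nb Γ A b).Nonempty → ∃ b' ∈ R, nb Γ A b' = nb Γ A b) (hA₀ : A₀ ⊆ A)
    (hc : ∀ a ∈ A₀, (nb Γ (A ∪ R) a).ncard ≤ c) (hS : ∀ a ∈ A₀, nb Γ Y a = S) :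
    (nhull Γ A A₀).ncard ≤ (1 + c + c * m) * A₀.ncard + s * S.ncard := by
  rcases A₀.eq_empty_or_nonempty with rfl | ⟨a₀, ha₀⟩
  · simp [nhull]
  have h1 : nhull Γ A A₀ ⊆ ({k | ∃ a ∈ A₀, k ∈ insert a (nb Γ (A ∪ R) a)} ∪
      {k | ∃ a ∈ A₀, ∃ b ∈ nb Γ (R \ Y) a, k ∈ nb Γ A b}) ∪ {k | ∃ b ∈ S, k ∈ nb Γ A b} := by
    rintro x (hx | ⟨hx, a, ha, hax⟩ | ⟨hx, a, ha, b, hb, hab, hbx⟩)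
    · exact Or.inl (Or.inl ⟨x, hx, Set.mem_insert _ _⟩)
    · exact Or.inl (Or.inl ⟨a, ha, Or.inr ⟨Or.inl hx, hax⟩⟩)
    · have hxb : x ∈ nb Γ A b := ⟨hx, hbx⟩
      have hab' : a ∈ nb Γ A b := ⟨hA₀ ha, hab.symm⟩
      obtain ⟨b', hb', hbb⟩ := hR b hb ⟨x, hxb⟩
      rw [← hbb] at hxb hab'
      by_cases hY : b' ∈ Y
      · exact Or.inr ⟨b', by rw [← hS a ha]; exact ⟨hY, hab'.2.symm⟩, hxb⟩
      · exact Or.inl (Or.inr ⟨a, ha, b', ⟨⟨hb', hY⟩, hab'.2.symm⟩, hxb⟩)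
  have h2 := (Set.ncard_le_ncard h1 (Set.toFinite _)).trans ((Set.ncard_union_le _ _).trans
    (Nat.add_le_add_right (Set.ncard_union_le _ _) _))
  have h3 : {k | ∃ a ∈ A₀, k ∈ insert a (nb Γ (A ∪ R) a)}.ncard ≤ (c + 1) * A₀.ncard :=
    ncard_exists_le fun a ha => (Set.ncard_insert_le _ _).trans (Nat.add_le_add_right (hc a ha) 1)
  have h4 : {k | ∃ a ∈ A₀, ∃ b ∈ nb Γ (R \ Y) a, k ∈ nb Γ A b}.ncard ≤ (m * c) * A₀.ncard := by
    refine ncard_exists_le fun a ha => ?_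
    refine (ncard_exists_le (c := m) (r := fun b k => k ∈ nb Γ A b) fun b hb => hm b hb.1).trans
      (Nat.mul_le_mul_left _ (le_trans (Set.ncard_le_ncard ?_ (Set.toFinite _)) (hc a ha)))
    exact fun b hb => ⟨Or.inr hb.1.1, hb.2⟩
  have h5 : {k | ∃ b ∈ S, k ∈ nb Γ A b}.ncard ≤ s * S.ncard := by
    refine ncard_exists_le fun b hb => hs b ?_
    rw [← hS a₀ ha₀] at hb
    exact hb.1
  nlinarith

/-- In a sparse bipartition with one side of bounded degree, some part of the other side has a small hull. -/
theorem IsSparse.exists_small_hull (hΓ : IsSparse Γ D) (hw : 1 ≤ w) (hA : A.Nonempty)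
    (hs : ∀ b ∉ A, (nb Γ A b).ncard ≤ s) {c₁ c₂ : ℕ} (hc₁ : c₁ = D + 2 ^ D) (hc₂ : c₂ = D * (1 + c₁))
    (hs₁ : 24 * w * (1 + 2 * c₂) ≤ s) (hs₂ : 48 * w * c₂ * (2 * c₁ * c₂ * (24 * w * c₂)) ≤ s) :
    ∃ A₀ ⊆ A, A₀.Nonempty ∧ (nhull Γ A A₀).ncard ≤ (1 + 2 * c₂ + 2 * c₂ * s) * (24 * w * c₂ + 1) + s * (2 * c₂) ∧
      (s < (nhull Γ A A₀).ncard → 6 * (w * (nhull Γ A A₀).ncard) < s * A₀.ncard) := by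
  by_contra! hcon
  have hN : 0 < A.ncard := (Set.ncard_pos (Set.toFinite _)).2 hA
  have hD : 0 < D := Nat.pos_of_ne_zero fun h => by
    have := hΓ.dg_lt A hA
    simp [h] at this
  have hc₂pos : 0 < c₂ := by rw [hc₂]; positivity
  set L := 48 * w * c₂ with hL
  have hLpos : 0 < L := by positivity
  set m := s / L with hm
  have hm₁ : L * m ≤ s := Nat.mul_div_le s L
  have hm₂ : s < L * (m + 1) := by
    rw [mul_add, mul_one]
    exact Nat.lt_mul_div_succ s hLpos
  have hms : m ≤ s := Nat.div_le_self _ _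
  -- representatives of the neighbourhoods
  obtain ⟨R, hRL, hRim, hRinj⟩ : ∃ R ⊆ {b | b ∉ A ∧ (nb Γ A b).Nonempty},
      nb Γ A '' R = nb Γ A '' {b | b ∉ A ∧ (nb Γ A b).Nonempty} ∧ Set.InjOn (nb Γ A) R := by
    obtain ⟨R, hR, hb⟩ := Set.exists_subset_bijOn {b | b ∉ A ∧ (nb Γ A b).Nonempty} (nb Γ A)
    exact ⟨R, hR, hb.image_eq, hb.injOn⟩
  have hR : ∀ b ∉ A, (nb Γ A b).Nonempty → ∃ b' ∈ R, nb Γ A b' = nb Γ A b := fun b hb hne => by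
    have h1 : nb Γ A b ∈ nb Γ A '' R := hRim ▸ ⟨b, ⟨hb, hne⟩, rfl⟩
    exact h1
  have hRcard : R.ncard ≤ c₁ * A.ncard := by
    rw [← hRinj.ncard_image, hc₁]
    refine (Set.ncard_le_ncard ?_ (Set.toFinite _)).trans (hΓ.ncard_traces_le A Aᶜ disjoint_compl_right)
    rintro _ ⟨b, hb, rfl⟩
    exact ⟨⟨b, (hRL hb).1, rfl⟩, (hRL hb).2.ne_empty⟩
  have hdg : dg Γ (A ∪ R) ≤ c₂ * A.ncard := by
    have h1 := hΓ.dg_lt (A ∪ R) hA.inl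
    have h2 := Nat.mul_le_mul_left D ((Set.ncard_union_le A R).trans (Nat.add_le_add_left hRcard _))
    rw [hc₂]
    calc _ ≤ _ := h1.le.trans h2
      _ = _ := by ring
  set low : Set ι := {a | a ∈ A ∧ (nb Γ (A ∪ R) a).ncard ≤ 2 * c₂} with hlow
  have hlowA : low ⊆ A := fun a h => h.1
  have hlowN : A.ncard ≤ 2 * low.ncard := by
    have h1 : (2 * c₂) * (A \ low).ncard ≤ {p : ι × ι | p.1 ∈ A \ low ∧ p.2 ∈ nb Γ (A ∪ R) p.1}.ncard :=
      le_ncard_pairs (R := fun a b => b ∈ nb Γ (A ∪ R) a) fun a ha => by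
        by_contra! h
        exact ha.2 ⟨ha.1, h.le⟩
    have h2 : {p : ι × ι | p.1 ∈ A \ low ∧ p.2 ∈ nb Γ (A ∪ R) p.1}.ncard ≤ dg Γ (A ∪ R) :=
      Set.ncard_le_ncard (fun p hp => ⟨Or.inl hp.1.1, hp.2.1, hp.2.2⟩) (Set.toFinite _)
    have h3 := Set.ncard_sdiff_add_ncard_of_subset hlowA (Set.toFinite _)
    have h4 : c₂ * (2 * (A \ low).ncard) ≤ c₂ * A.ncard := by
      rw [← mul_assoc, mul_comm c₂ 2]
      omega
    have := Nat.le_of_mul_le_mul_left h4 hc₂pos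
    omega
  set Y : Set ι := {b | b ∈ R ∧ m < (nb Γ A b).ncard} with hY
  have hYR : Y ⊆ R := fun b h => h.1
  have hYA : Disjoint Y A := Set.disjoint_left.2 fun b h => (hRL h.1).1
  have hYcard : (m + 1) * Y.ncard ≤ c₂ * A.ncard := by
    have h1 : (m + 1) * Y.ncard ≤ {p : ι × ι | p.1 ∈ Y ∧ p.2 ∈ nb Γ A p.1}.ncard :=
      le_ncard_pairs (R := fun a b => b ∈ nb Γ A a) fun a ha => ha.2
    have h2 : {p : ι × ι | p.1 ∈ Y ∧ p.2 ∈ nb Γ A p.1}.ncard ≤ dg Γ (A ∪ R) :=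
      Set.ncard_le_ncard (fun p hp => ⟨Or.inr hp.1.1, Or.inl hp.2.1, hp.2.2⟩) (Set.toFinite _)
    exact h1.trans (h2.trans hdg)
  have hull : ∀ A₀ ⊆ low, ∀ S, (∀ a ∈ A₀, nb Γ Y a = S) →
      (nhull Γ A A₀).ncard ≤ (1 + 2 * c₂ + 2 * c₂ * m) * A₀.ncard + s * S.ncard := fun A₀ hA₀ S hS =>
    ncard_nhull_le (fun b hb => hs b (hRL (hYR hb)).1)
      (fun b hb => by by_contra! h; exact hb.2 ⟨hb.1, h⟩) hR (hA₀.trans hlowA) (fun a ha => (hA₀ ha).2) hS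
  have hmul : 2 * c₂ * m ≤ 2 * c₂ * s := Nat.mul_le_mul_left _ hms
  -- every vertex of small degree has a neighbour of large degree
  have hne : ∀ a ∈ low, nb Γ Y a ≠ ∅ := by
    intro a ha h0
    have h1 := hull {a} (Set.singleton_subset_iff.2 ha) ∅ (by simpa using h0)
    simp only [Set.ncard_singleton, Set.ncard_empty, mul_one, mul_zero, add_zero] at h1
    have h2 : 4 * (c₂ * m) ≤ L * m := by
      rw [hL, ← mul_assoc]
      exact Nat.mul_le_mul_right _ (Nat.mul_le_mul_right _ (by omega))
    have h3 : 2 * (1 + 2 * c₂) ≤ 24 * w * (1 + 2 * c₂) := Nat.mul_le_mul_right _ (by omega)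
    have h4 : 2 * c₂ * m = 2 * (c₂ * m) := by ring
    have h5 := hcon {a} (Set.singleton_subset_iff.2 (hlowA ha)) (Set.singleton_nonempty a)
      (h1.trans (by nlinarith))
    omega
  -- few vertices of small degree have the same neighbours of large degree
  have hfib : ∀ S ∈ nb Γ Y '' low, {a | a ∈ low ∧ nb Γ Y a = S}.ncard ≤ 24 * w * c₂ := by
    rintro S ⟨a, ha, haS⟩
    by_contra! hlt
    obtain ⟨A₀, hA₀, hcard⟩ := Set.exists_subset_card_eq (Nat.succ_le_of_lt hlt)
    have hS : S.ncard ≤ 2 * c₂ := by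
      rw [← haS]
      have h1 : nb Γ Y a ⊆ nb Γ (A ∪ R) a := fun b hb => ⟨Or.inr (hYR hb.1), hb.2⟩
      exact (Set.ncard_le_ncard h1 (Set.toFinite _)).trans ha.2
    have h1 := hull A₀ (fun x hx => (hA₀ hx).1) S fun x hx => (hA₀ hx).2
    rw [hcard] at h1
    have h2 : s * S.ncard ≤ s * (2 * c₂) := Nat.mul_le_mul_left _ hS
    have h3 := hcon A₀ (fun x hx => hlowA (hA₀ hx).1)
      ((Set.ncard_pos (Set.toFinite _)).1 (by rw [hcard]; omega))
      (h1.trans (Nat.add_le_add (Nat.mul_le_mul_right _ (by omega)) h2))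
    obtain ⟨h4, h5⟩ := h3
    rw [hcard] at h5
    have h6 : 6 * w * (nhull Γ A A₀).ncard ≤ 6 * w * ((1 + 2 * c₂ + 2 * c₂ * m) * (24 * w * c₂).succ + s * (2 * c₂)) :=
      Nat.mul_le_mul_left _ (h1.trans (Nat.add_le_add_left h2 _))
    have h7 : 24 * w * (1 + 2 * c₂) * (24 * w * c₂).succ ≤ s * (24 * w * c₂).succ := Nat.mul_le_mul_right _ hs₁
    have h8 : L * m * (24 * w * c₂).succ ≤ s * (24 * w * c₂).succ := Nat.mul_le_mul_right _ hm₁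
    have h9 : 0 < s := lt_of_lt_of_le (by positivity) hs₁
    rw [hL] at h8
    simp only [Nat.succ_eq_add_one] at *
    nlinarith
  have hlowY : low.ncard ≤ 24 * w * c₂ * (c₁ * Y.ncard) := by
    have h1 : low ⊆ {a | ∃ S ∈ nb Γ Y '' low, a ∈ low ∧ nb Γ Y a = S} := fun a ha => ⟨_, ⟨a, ha, rfl⟩, ha, rfl⟩
    refine (Set.ncard_le_ncard h1 (Set.toFinite _)).trans ((ncard_exists_le hfib).trans (Nat.mul_le_mul_left _ ?_))
    rw [hc₁]
    refine (Set.ncard_le_ncard ?_ (Set.toFinite _)).trans (hΓ.ncard_traces_le Y A hYA)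
    rintro _ ⟨a, ha, rfl⟩
    exact ⟨⟨a, hlowA ha, rfl⟩, hne a ha⟩
  have hfin : (m + 1) * Y.ncard ≤ (2 * c₁ * c₂ * (24 * w * c₂)) * Y.ncard := by
    calc (m + 1) * Y.ncard ≤ c₂ * A.ncard := hYcard
      _ ≤ c₂ * (2 * (24 * w * c₂ * (c₁ * Y.ncard))) := Nat.mul_le_mul_left _ (by omega)
      _ = _ := by ring
  have hYpos : 0 < Y.ncard := Nat.pos_of_ne_zero fun h => by
    rw [h] at hlowY
    omega
  have h10 := Nat.mul_le_mul_left L (Nat.le_of_mul_le_mul_right hfin hYpos)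
  omega

end Hull

section Piece

variable {V : Type*} {K : Type*} {H : SimpleGraph K} {G : SimpleGraph V} {s q F n : ℕ} {Z P P' X : Set V}

/-- The vertices of `Z` and the components of `G - Z`, as sets. -/
def IsPiece (G : SimpleGraph V) (Z P : Set V) : Prop :=
  (∃ z ∈ Z, P = {z}) ∨ (Conn G P ∧ Disjoint P Z ∧ ∀ a ∈ P, ∀ b ∉ Z, G.Adj a b → b ∈ P)

theorem IsPiece.conn (h : IsPiece G Z P) : Conn G P := by
  rcases h with ⟨z, -, rfl⟩ | h
  exacts [.singleton z, h.1]

theorem IsPiece.eq_of_mem {x : V} (h : IsPiece G Z P) (h' : IsPiece G Z P') (hx : x ∈ P) (hx' : x ∈ P') : P = P' := by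
  have key : ∀ {P P' : Set V}, Conn G P → Disjoint P Z → (∀ a ∈ P', ∀ b ∉ Z, G.Adj a b → b ∈ P') → x ∈ P → x ∈ P' →
      P ⊆ P' := fun hP hd hcl hx hx' =>
    hP.2 _ ⟨x, hx, hx'⟩ fun a _ ha' b hb hab => hcl a ha' b (Set.disjoint_left.1 hd hb) hab
  rcases h with ⟨z, hz, rfl⟩ | ⟨h1, h2, h3⟩ <;> rcases h' with ⟨z', hz', rfl⟩ | ⟨h1', h2', h3'⟩
  · rw [← Set.mem_singleton_iff.1 hx, ← Set.mem_singleton_iff.1 hx']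
  · exact absurd (Set.mem_singleton_iff.1 hx ▸ hz) (Set.disjoint_left.1 h2' hx')
  · exact absurd (Set.mem_singleton_iff.1 hx' ▸ hz') (Set.disjoint_left.1 h2 hx)
  · exact (key h1 h2 h3' hx hx').antisymm (key h1' h2' h3 hx' hx)

theorem IsPiece.disjoint (h : IsPiece G Z P) (h' : IsPiece G Z P') (hne : P ≠ P') : Disjoint P P' :=
  Set.disjoint_left.2 fun _ hx hx' => hne (h.eq_of_mem h' hx hx')

theorem isPiece_compo {x : V} (hx : x ∉ Z) : IsPiece G Z (compo G Zᶜ x) :=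
  Or.inr ⟨conn_compo hx, Set.disjoint_left.2 fun _ h => compo_subset h, fun _ ha _ hb hab => mem_compo_of_adj ha hb hab⟩

theorem not_minorIn_sUnion [Finite V] (hH : Conn H Set.univ) (hZ : IsNice H G s Z) (hs : 1 ≤ s)
    (hq : ∀ S : Set V, S.ncard ≤ q → ¬ Isolates H G S) {T : Set (Set V)} (hT : ∀ P ∈ T, IsPiece G Z P)
    (hc : s * T.ncard ≤ q) : ¬ MinorIn H G (⋃₀ T) := by
  have h1 : ⋃₀ T ∩ Z ∪ att G Z (⋃₀ T \ Z) ⊆ {x | ∃ P ∈ T, x ∈ P ∩ Z ∪ att G Z (P \ Z)} := by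
    rintro x (⟨⟨P, hP, hx⟩, hxZ⟩ | ⟨hxZ, a, ⟨⟨P, hP, ha⟩, haZ⟩, hax⟩)
    · exact ⟨P, hP, Or.inl ⟨hx, hxZ⟩⟩
    · exact ⟨P, hP, Or.inr ⟨hxZ, a, ⟨ha, haZ⟩, hax⟩⟩
  have h2 : {x | ∃ P ∈ T, x ∈ P ∩ Z ∪ att G Z (P \ Z)}.ncard ≤ s * T.ncard := ncard_exists_le fun P hP => by
    rcases hT P hP with ⟨z, hz, rfl⟩ | ⟨h1, h2, -⟩
    · have : {x | x ∈ {z} ∩ Z ∪ att G Z ({z} \ Z)} ⊆ {z} := by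
        rintro x (hx | ⟨-, a, ha, -⟩)
        · exact hx.1
        · exact absurd (ha.1 ▸ hz) ha.2
      exact (Set.ncard_le_ncard this (Set.toFinite _)).trans (by simpa using hs)
    · rw [h2.inter_eq, h2.sdiff_eq_left, Set.empty_union]
      exact hZ.2 P h1 h2
  have h3 := not_minorIn_of_small (Z₀ := ⋃₀ T ∩ Z) (X := ⋃₀ T \ Z) hH hZ.1 hq Set.disjoint_sdiff_left
    (fun a ha b hb hab => by
      obtain ⟨⟨P, hP, haP⟩, haZ⟩ := ha
      refine ⟨⟨P, hP, ?_⟩, hb⟩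
      rcases hT P hP with ⟨z, hz, rfl⟩ | ⟨-, -, h⟩
      · exact absurd (Set.mem_singleton_iff.1 haP ▸ hz) haZ
      · exact h a haP b hb hab)
    ((Set.ncard_le_ncard h1 (Set.toFinite _)).trans (h2.trans hc))
  rwa [Set.inter_union_sdiff] at h3

theorem IsFat.dg_lt {ι : Type*} [Finite V] [Finite ι] [Finite K] {Q : SimpleGraph ι} {U : Set ι} {node : ι → Set V}
    {link : Sym2 ι → Set V} (hf : IsFat G {P | IsPiece G Z P} Q U node link) (hH : Conn H Set.univ) (hZ : IsNice H G s Z)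
    (hs : 1 ≤ s) (hq : ∀ S : Set V, S.ncard ≤ q → ¬ Isolates H G S) (hX : ¬ MinorIn H G Xᶜ) (hF : X.ncard ≤ F)
    (hn : Nat.card K * Nat.card K * (Nat.log 2 (2 * F) + 3) ≤ n) (hnq : s * (n + n * n) ≤ q) (hU : U.Nonempty) :
    dg Q U < (7 * denseBound (Nat.card K) + 2) * U.ncard := by
  by_contra! hlt
  obtain ⟨U', hU', hne, hcard, hd⟩ := hf.exists_dense_small (fun P hP => IsPiece.conn hP) hX hF hU hlt
  obtain ⟨B, hB, -, hBcard⟩ := exists_small_top (Nat.card K) Q U' hne hd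
  set R := ⋃ i, B i
  have hRU : R ⊆ U := (Set.iUnion_subset hB.subset).trans hU'
  have hR : R.ncard ≤ n :=
    hBcard.trans (le_trans (Nat.mul_le_mul_left _ (Nat.add_le_add_right (Nat.log_mono_right hcard) 3)) hn)
  have hm : MinorIn H G (fatSet Q node link R) := (hf.mono le_rfl hRU).minorIn (fun P hP => IsPiece.conn hP)
    (MinorIn.of_top ⟨B, fun i => Set.subset_iUnion B i, hB.conn, hB.disj, hB.adj⟩)
  set E : Set (ι × ι) := {p | p.1 ∈ R ∧ p.2 ∈ R ∧ Q.Adj p.1 p.2 ∧ (link s(p.1, p.2)).Nonempty}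
  set T : Set (Set V) := node '' R ∪ (fun p : ι × ι => link s(p.1, p.2)) '' E
  refine not_minorIn_sUnion hH hZ hs hq (T := T) ?_ ?_ (hm.mono ?_)
  · rintro _ (⟨i, hi, rfl⟩ | ⟨⟨i, j⟩, ⟨hi, hj, hij, hl⟩, rfl⟩)
    · exact hf.node_mem i (hRU hi)
    · exact ((hf.adj i (hRU hi) j (hRU hj) hij).resolve_left fun h => hl.ne_empty h.1).1
  · refine le_trans (Nat.mul_le_mul_left _ ?_) hnq
    refine (Set.ncard_union_le _ _).trans (Nat.add_le_add ((Set.ncard_image_le (Set.toFinite _)).trans hR) ?_)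
    refine (Set.ncard_image_le (Set.toFinite _)).trans ?_
    have h1 : E ⊆ R ×ˢ R := fun p hp => ⟨hp.1, hp.2.1⟩
    refine (Set.ncard_le_ncard h1 (Set.toFinite _)).trans ?_
    rw [Set.ncard_prod]
    exact Nat.mul_le_mul hR hR
  · rintro x (hx | hx)
    · simp only [Set.mem_iUnion] at hx
      obtain ⟨i, hi, hx⟩ := hx
      exact ⟨_, Or.inl ⟨i, hi, rfl⟩, hx⟩
    · simp only [Set.mem_iUnion] at hx
      obtain ⟨i, hi, j, hj, hij, hx⟩ := hx
      exact ⟨_, Or.inr ⟨(i, j), ⟨hi, hj, hij, x, hx⟩, rfl⟩, hx⟩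

/-- The graph of adjacencies between pieces. -/
def pieceGraph (G : SimpleGraph V) (Z : Set V) : SimpleGraph {P : Set V // IsPiece G Z P} where
  Adj P P' := P ≠ P' ∧ ∃ a ∈ P.1, ∃ b ∈ P'.1, G.Adj a b
  symm := ⟨fun _ _ ⟨hne, a, ha, b, hb, hab⟩ => ⟨hne.symm, b, hb, a, ha, hab.symm⟩⟩
  loopless := ⟨fun _ h => h.1 rfl⟩

theorem isSparse_pieceGraph [Finite V] [Finite K] (hH : Conn H Set.univ) (hZ : IsNice H G s Z)
    (hs : 1 ≤ s) (hq : ∀ S : Set V, S.ncard ≤ q → ¬ Isolates H G S) (hX : ¬ MinorIn H G Xᶜ) (hF : X.ncard ≤ F)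
    (hn : Nat.card K * Nat.card K * (Nat.log 2 (2 * F) + 3) ≤ n) (hnq : s * (n + n * n) ≤ q) :
    IsSparse (pieceGraph G Z) (7 * denseBound (Nat.card K) + 2) := by
  have hd : ∀ P P' : {P : Set V // IsPiece G Z P}, P ≠ P' → Disjoint P.1 P'.1 := fun P P' hne =>
    P.2.disjoint P'.2 fun h => hne (Subtype.ext h)
  refine ⟨fun U hU => ?_, fun U Q l hU hl hadj => ?_⟩
  · refine IsFat.dg_lt (node := Subtype.val) (link := fun _ => ∅) ⟨fun i _ => i.2, fun i _ j _ => hd i j,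
      fun i _ j _ hij => Or.inl ⟨rfl, hij.2⟩, fun _ _ _ _ _ _ _ => Set.empty_disjoint _,
      fun _ _ _ _ _ _ _ _ _ _ _ => Set.empty_disjoint _⟩ hH hZ hs hq hX hF hn hnq hU
  · refine IsFat.dg_lt (node := Subtype.val) (link := fun e => (l e).1) ⟨fun i _ => i.2, fun i _ j _ => hd i j,
      fun i _ j _ hij => Or.inr ⟨(l s(i, j)).2, (hadj i j hij).2.2.2⟩,
      fun i _ j _ k hk hij => hd _ _ fun h => (hadj i j hij).2.1 (h ▸ hk),
      fun i _ j _ i' _ j' _ hij hij' hne => hd _ _ fun h => hne (hl hij hij' h)⟩ hH hZ hs hq hX hF hn hnq hU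

theorem exists_minimal_isNice [Finite V] [Nonempty K] (H : SimpleGraph K) (G : SimpleGraph V) (s : ℕ) :
    ∃ Z, IsNice H G s Z ∧ ∀ Z', IsNice H G s Z' → Z.ncard ≤ Z'.ncard := by
  refine Set.exists_min_image {Z | IsNice H G s Z} Set.ncard (Set.toFinite _) ⟨Set.univ, ?_, fun C hC hd => ?_⟩
  · rintro ⟨B, hB⟩
    obtain ⟨u⟩ := ‹Nonempty K›
    obtain ⟨x, hx⟩ := (hB.conn u).nonempty
    exact hB.subset u hx trivial
  · obtain ⟨x, hx⟩ := hC.nonempty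
    exact absurd trivial (Set.disjoint_left.1 hd hx)

theorem hull_subset {A₀ : Set {P : Set V // IsPiece G Z P}} :
    hull G Z {x | ∃ P ∈ A₀, x ∈ P.1} ⊆ {x | ∃ P ∈ nhull (pieceGraph G Z) {P | ∃ z ∈ Z, P.1 = {z}} A₀, x ∈ P.1} := by
  rintro x (⟨P, hP, hx⟩ | ⟨hx, a, ⟨P, hP, ha⟩, hax⟩ | ⟨hx, y, ⟨C, hC, hCZ, hyC, c, hc, z, ⟨P, hP, hzP⟩, hcz⟩, hyx⟩)
  · exact ⟨P, Or.inl hP, hx⟩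
  · by_cases hxP : x ∈ P.1
    · exact ⟨P, Or.inl hP, hxP⟩
    · exact ⟨⟨{x}, Or.inl ⟨x, hx, rfl⟩⟩, Or.inr (Or.inl ⟨⟨x, hx, rfl⟩, P, hP,
        fun h => hxP (by rw [h]; rfl), a, ha, x, rfl, hax⟩), rfl⟩
  · have hyZ : y ∉ Z := Set.disjoint_left.1 hCZ hyC
    have hsub : C ⊆ compo G Zᶜ y :=
      hC.subset_compo (fun u hu => Set.disjoint_left.1 hCZ hu) ⟨y, hyC, mem_compo_self hyZ⟩
    have hxC : x ∉ compo G Zᶜ y := fun h => compo_subset h hx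
    by_cases hPy : P = ⟨compo G Zᶜ y, isPiece_compo hyZ⟩
    · subst hPy
      exact ⟨⟨{x}, Or.inl ⟨x, hx, rfl⟩⟩, Or.inr (Or.inl ⟨⟨x, hx, rfl⟩, _, hP,
        fun h => hxC ((Subtype.ext_iff.1 h).ge (Set.mem_singleton x)), y, mem_compo_self hyZ, x, rfl, hyx⟩), rfl⟩
    refine ⟨⟨{x}, Or.inl ⟨x, hx, rfl⟩⟩, Or.inr (Or.inr ⟨⟨x, hx, rfl⟩, P, hP, ⟨compo G Zᶜ y, isPiece_compo hyZ⟩, ?_,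
      ⟨hPy, z, hzP, c, hsub hc, hcz.symm⟩, fun h => hxC ((Subtype.ext_iff.1 h).ge (Set.mem_singleton x)), y, mem_compo_self hyZ, x, rfl, hyx⟩), rfl⟩
    rintro ⟨u, hu, h⟩
    exact compo_subset (h.ge (Set.mem_singleton u)) hu

/-- Some model of `H` is isolated by few vertices. -/
theorem exists_isolating {K : Type*} [Finite K] {H : SimpleGraph K} (hH : Conn H Set.univ) {N : ℕ}
    (hgr : MinorIn H gr {p | p.1 < N ∧ p.2 < N}) :
    ∃ s q₀ : ℕ, ∀ {V : Type*} [Finite V] {G : SimpleGraph V} {X : Set V} (q n F : ℕ), MinorIn H G Set.univ →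
      ¬ MinorIn H G Xᶜ → X.ncard ≤ F → Nat.card K * Nat.card K * (Nat.log 2 (2 * F) + 3) ≤ n → s * (n + n * n) ≤ q →
      q₀ ≤ q → ∃ S : Set V, S.ncard ≤ q ∧ Isolates H G S := by
  obtain ⟨w₀, hw₀⟩ := exists_balanced hgr
  have : Nonempty K := hH.nonempty.to_type
  set w := w₀ + 1
  set D := 7 * denseBound (Nat.card K) + 2
  obtain ⟨c₁, hc₁⟩ : ∃ c, c = D + 2 ^ D := ⟨_, rfl⟩
  obtain ⟨c₂, hc₂⟩ : ∃ c, c = D * (1 + c₁) := ⟨_, rfl⟩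
  obtain ⟨s, hs⟩ : ∃ s, s = 24 * w * (1 + 2 * c₂) + 48 * w * c₂ * (2 * c₁ * c₂ * (24 * w * c₂)) := ⟨_, rfl⟩
  refine ⟨s, (1 + 2 * c₂ + 2 * c₂ * s) * (24 * w * c₂ + 1) + s * (2 * c₂), fun {V _ G X} q n F hm hX hF hn hnq hq₀ => ?_⟩
  by_contra! hq
  have hw : 1 ≤ w := Nat.le_add_left ..
  have hs6 : 6 * w ≤ s := by
    have : 6 * w ≤ 24 * w * (1 + 2 * c₂) := by nlinarith
    omega
  have hsep : HasSep H G w := fun Y hY W hW => by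
    obtain ⟨S, A₁, A₂, h1, h2⟩ := hw₀ hY W hW
    exact ⟨S, A₁, A₂, h1.trans (Nat.le_succ _), h2⟩
  obtain ⟨Z, hZ, hmin⟩ := exists_minimal_isNice H G s
  have hZne : Z.Nonempty := by
    by_contra h
    rw [Set.not_nonempty_iff_eq_empty] at h
    exact hZ.1 (by rwa [h, Set.compl_empty])
  have hsp := isSparse_pieceGraph hH hZ (by omega) hq hX hF hn hnq
  have hsA : ∀ b ∉ {P : {P : Set V // IsPiece G Z P} | ∃ z ∈ Z, P.1 = {z}},
      (nb (pieceGraph G Z) {P | ∃ z ∈ Z, P.1 = {z}} b).ncard ≤ s := by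
    intro b hb
    have h1 := b.2.resolve_left hb
    refine le_trans ?_ (hZ.2 b.1 h1.1 h1.2.1)
    refine Set.ncard_le_ncard_of_injOn (fun P => P.2.conn.nonempty.some) ?_ ?_ (Set.toFinite _)
    · rintro P ⟨⟨z, hz, hPz⟩, -, a, ha, c, hc, hac⟩
      have h2 : P.2.conn.nonempty.some = z := hPz.le P.2.conn.nonempty.some_mem
      have h3 : c = z := hPz.le hc
      refine ⟨h2 ▸ hz, a, ha, ?_⟩
      rw [h2, ← h3]
      exact hac
    · rintro P - P' - hPP
      refine Subtype.ext (P.2.eq_of_mem P'.2 P.2.conn.nonempty.some_mem ?_)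
      simp only at hPP
      rw [hPP]
      exact P'.2.conn.nonempty.some_mem
  obtain ⟨z, hz⟩ := hZne
  obtain ⟨A₀, hA₀, hne, hcard, hlt⟩ := hsp.exists_small_hull
    (A := {P | ∃ z ∈ Z, P.1 = {z}}) hw ⟨⟨{z}, Or.inl ⟨z, hz, rfl⟩⟩, z, hz, rfl⟩ hsA hc₁ hc₂
    (by omega) (by omega)
  set Z₀ : Set V := {x | ∃ P ∈ A₀, x ∈ P.1} with hZ₀
  have hhull : (hull G Z Z₀).ncard ≤ (nhull (pieceGraph G Z) {P | ∃ z ∈ Z, P.1 = {z}} A₀).ncard := by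
    refine (Set.ncard_le_ncard hull_subset (Set.toFinite _)).trans ?_
    rw [← one_mul (nhull (pieceGraph G Z) {P | ∃ z ∈ Z, P.1 = {z}} A₀).ncard]
    refine ncard_exists_le fun P hP => ?_
    obtain ⟨z, -, hz⟩ : ∃ z ∈ Z, P.1 = {z} := by
      rcases hP with h | h | h
      exacts [hA₀ h, h.1, h.1]
    have : {k | k ∈ P.1} = {z} := hz
    simp [this]
  have hcard₀ : A₀.ncard ≤ Z₀.ncard := by
    refine ncard_le_of_disjoint_meet (f := Subtype.val)
      (fun P _ P' _ hne => P.2.disjoint P'.2 fun h => hne (Subtype.ext h)) fun P hP => ?_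
    obtain ⟨x, hx⟩ := P.2.conn.nonempty
    exact ⟨x, hx, P, hP, hx⟩
  have hZ₀Z : Z₀ ⊆ Z := by
    rintro x ⟨P, hP, hx⟩
    obtain ⟨z, hz, h⟩ := hA₀ hP
    rw [h] at hx
    exact Set.mem_singleton_iff.1 hx ▸ hz
  obtain ⟨P, hP⟩ := hne
  obtain ⟨x, hx⟩ := P.2.conn.nonempty
  obtain ⟨h1, h2⟩ := lt_ncard_hull hH hsep hw hs6 hq hZ hmin hZ₀Z ⟨x, P, hP, hx⟩ (hhull.trans (hcard.trans hq₀))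
  have h3 := hlt (h1.trans_le hhull)
  have h4 := Nat.mul_le_mul_left w hhull
  have h5 := Nat.mul_le_mul_left s hcard₀
  omega

end Piece

section Packing

variable {V : Type*} {K : Type*} {H : SimpleGraph K} {G : SimpleGraph V} {S : Set V} {p : ℕ}

theorem IsModelIn.image_val {X : Set V} {C : Set X} {B : K → Set X} (h : IsModelIn H (G.induce X) C B) :
    IsModelIn H G X fun u => Subtype.val '' B u :=
  ⟨fun _ => Subtype.coe_image_subset _ _, fun u => (h.conn u).image_val,
    fun u v huv => (Set.disjoint_image_iff Subtype.val_injective).2 (h.disj u v huv), fun u v huv => by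
      obtain ⟨a, ha, b, hb, hab⟩ := h.adj u v huv
      exact ⟨a, ⟨a, ha, rfl⟩, b, ⟨b, hb, rfl⟩, hab⟩⟩

theorem MinorIn.preimage_val {X Y : Set V} (h : MinorIn H G Y) (hYX : Y ⊆ X) :
    MinorIn H (G.induce X) (Subtype.val ⁻¹' Y) := by
  obtain ⟨B, hB⟩ := h
  refine ⟨fun u => Subtype.val ⁻¹' B u, fun u => Set.preimage_mono (hB.subset u),
    fun u => (hB.conn u).preimage_val ((hB.subset u).trans hYX), fun u v huv => (hB.disj u v huv).preimage _,
    fun u v huv => ?_⟩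
  obtain ⟨a, ha, b, hb, hab⟩ := hB.adj u v huv
  exact ⟨⟨a, hYX (hB.subset u ha)⟩, ha, ⟨b, hYX (hB.subset v hb)⟩, hb, hab⟩

theorem HasDisjointModels.succ (hS : Isolates H G S) (h : HasDisjointModels H (G.induce Sᶜ) p) :
    HasDisjointModels H G (p + 1) := by
  obtain ⟨B, hB, hd⟩ := hS
  obtain ⟨M, hM, hMd⟩ := h
  have hM' : ∀ i, IsModelIn H G Sᶜ fun u => Subtype.val '' M i u := fun i => (isMinorModel_iff.1 (hM i)).image_val
  refine ⟨Fin.cons B fun i u => Subtype.val '' M i u, Fin.cases (isMinorModel_iff.2 hB) fun i =>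
    isMinorModel_iff.2 ((hM' i).mono (Set.subset_univ _)), fun i j => ?_⟩
  refine Fin.cases ?_ (fun i => ?_) i <;> refine Fin.cases ?_ (fun j => ?_) j
  · exact fun h => absurd rfl h
  · exact fun _ => hd _ (hM' j)
  · exact fun _ => (hd _ (hM' i)).symm
  · intro hne
    simp only [Fin.cons_succ, ← Set.image_iUnion]
    exact (Set.disjoint_image_iff Subtype.val_injective).2 (hMd fun h => hne (by rw [h]))

theorem HasDisjointModels.le_card [Finite V] [Nonempty K] (h : HasDisjointModels H G p) : p ≤ Nat.card V := by
  obtain ⟨M, hM, hd⟩ := h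
  obtain ⟨u⟩ := ‹Nonempty K›
  choose x hx using fun i => (conn_iff.1 ((hM i).1 u)).nonempty
  have hinj : Function.Injective x := fun i j hij => by
    by_contra hne
    exact Set.disjoint_left.1 (hd hne) (Set.mem_iUnion_of_mem u (hx i)) (hij ▸ Set.mem_iUnion_of_mem u (hx j))
  simpa using Nat.card_le_card_of_injective x hinj

theorem not_hasDisjointModels_of_packNumber_lt [Finite V] [Nonempty K] (h : packNumber H G < p) :
    ¬ HasDisjointModels H G p := fun hp =>
  absurd (le_csSup ⟨Nat.card V, fun _ h => h.le_card⟩ hp) (not_le.2 h)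

theorem coverNumber_le (hS : ¬ MinorIn H G Sᶜ) : coverNumber H G ≤ S.ncard := by
  refine Nat.sInf_le ⟨S, fun B hB => ?_, rfl⟩
  by_contra! h
  have hB' := isMinorModel_iff.1 hB
  exact hS ⟨B, fun u x hx hxS => h x hxS u hx, hB'.conn, hB'.disj, hB'.adj⟩

theorem exists_min_hitting [Finite V] [Nonempty K] (H : SimpleGraph K) (G : SimpleGraph V) :
    ∃ X, ¬ MinorIn H G Xᶜ ∧ ∀ X', ¬ MinorIn H G X'ᶜ → X.ncard ≤ X'.ncard := by
  refine Set.exists_min_image {X | ¬ MinorIn H G Xᶜ} Set.ncard (Set.toFinite _) ⟨Set.univ, ?_⟩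
  rintro ⟨B, hB⟩
  obtain ⟨u⟩ := ‹Nonempty K›
  obtain ⟨x, hx⟩ := (hB.conn u).nonempty
  exact hB.subset u hx trivial

end Packing

theorem natLog_two_mul_le {η : ℝ} (hη : 0 < η) {F : ℕ} (hF : 1 ≤ F) :
    (Nat.log 2 (2 * F) : ℝ) ≤ 2 * 2 ^ η / η * (F : ℝ) ^ η := by
  have hF' : (1 : ℝ) ≤ F := by exact_mod_cast hF
  have h1 : ((2 : ℕ) ^ Nat.log 2 (2 * F) : ℝ) ≤ (2 * F : ℕ) := by
    exact_mod_cast Nat.pow_log_le_self 2 (by omega : 2 * F ≠ 0)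
  have h2 := Real.log_le_log (by positivity) h1
  rw [Real.log_pow] at h2
  have h3 := Real.log_le_rpow_div (x := (2 * F : ℕ)) (by positivity) hη
  have h4 : (1 : ℝ) / 2 ≤ Real.log (2 : ℕ) := by
    have := Real.log_two_gt_d9
    norm_num at this ⊢
    linarith
  push_cast at h2 h3 h4
  rw [Real.mul_rpow (by norm_num) (by positivity)] at h3
  have h5 : (Nat.log 2 (2 * F) : ℝ) * (1 / 2) ≤ Nat.log 2 (2 * F) * Real.log 2 := by gcongr
  have h6 : 2 * 2 ^ η / η * (F : ℝ) ^ η = 2 * (2 ^ η * (F : ℝ) ^ η / η) := by ring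
  rw [h6]
  linarith

theorem exists_polylog_le (h s q₀ : ℕ) {δ : ℝ} (hδ : 0 < δ) : ∃ A : ℝ, 0 ≤ A ∧ ∀ F n : ℕ, 1 ≤ F →
    n = h * h * (Nat.log 2 (2 * F) + 3) → ((q₀ + s * (n + n * n) : ℕ) : ℝ) ≤ A * (F : ℝ) ^ δ := by
  obtain ⟨c, hc⟩ : ∃ c : ℝ, c = h * h * (2 * 2 ^ (δ / 2) / (δ / 2) + 3) := ⟨_, rfl⟩
  have hc0 : 0 ≤ c := by rw [hc]; positivity
  refine ⟨q₀ + s * (c + c * c), by positivity, fun F n hF hn => ?_⟩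
  have hF' : (1 : ℝ) ≤ F := by exact_mod_cast hF
  obtain ⟨y, hy⟩ : ∃ y : ℝ, y = (F : ℝ) ^ (δ / 2) := ⟨_, rfl⟩
  have hy1 : 1 ≤ y := by rw [hy]; exact Real.one_le_rpow hF' (by positivity)
  have hyy : (F : ℝ) ^ δ = y * y := by
    rw [hy, ← Real.rpow_add (by linarith), add_halves]
  have hlog := natLog_two_mul_le (half_pos hδ) hF
  rw [← hy] at hlog
  have hn' : (n : ℝ) ≤ c * y := by
    rw [hn, hc]
    push_cast
    have h1 : (h : ℝ) * h * ((Nat.log 2 (2 * F) : ℝ) + 3) ≤ h * h * ((2 * 2 ^ (δ / 2) / (δ / 2) + 3) * y) :=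
      mul_le_mul_of_nonneg_left (by linarith) (mul_self_nonneg _)
    linarith
  rw [hyy]
  push_cast
  have h1 : (n : ℝ) * n ≤ (c * y) * (c * y) := mul_le_mul hn' hn' (by positivity) (by positivity)
  have h2 : c * y ≤ c * (y * y) := by
    refine mul_le_mul_of_nonneg_left ?_ hc0
    nlinarith
  have h3 : (q₀ : ℝ) ≤ q₀ * (y * y) := le_mul_of_one_le_right (Nat.cast_nonneg _) (by nlinarith)
  have h4 : (s : ℝ) * (n + n * n) ≤ s * (c * (y * y) + (c * y) * (c * y)) := by gcongr; linarith
  linarith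

theorem le_of_le_add_rpow {ε A F p : ℝ} (hε : 0 < ε) (hA : 0 ≤ A) (hp : 0 ≤ p)
    (h : F ≤ A * F ^ (ε / (1 + ε)) + (A + 1) ^ (1 + ε) * p ^ (1 + ε)) : F ≤ (A + 1) ^ (1 + ε) * (p + 1) ^ (1 + ε) := by
  by_contra! hlt
  have hb : 0 < A + 1 := by linarith
  have ht : 0 < p + 1 := by linarith
  have hε1 : 1 + ε ≠ 0 := by positivity
  set M := (A + 1) ^ (1 + ε) * (p + 1) ^ (1 + ε) with hM
  have hM0 : 0 < M := by positivity
  obtain ⟨r, hr⟩ : ∃ r, r = F / M := ⟨_, rfl⟩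
  have hF : F = r * M := by rw [hr]; field_simp
  have hr1 : 1 < r := by rw [hr]; exact (one_lt_div hM0).2 hlt
  have hδ : M ^ (ε / (1 + ε)) = (A + 1) ^ ε * (p + 1) ^ ε := by
    rw [hM, ← Real.mul_rpow hb.le ht.le, ← Real.mul_rpow hb.le ht.le, ← Real.rpow_mul (by positivity)]
    congr 1
    field_simp
  have h1 : F ^ (ε / (1 + ε)) ≤ r * ((A + 1) ^ ε * (p + 1) ^ ε) := by
    rw [hF, Real.mul_rpow (by linarith) hM0.le, hδ]
    refine mul_le_mul_of_nonneg_right ?_ (by positivity)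
    conv_rhs => rw [← Real.rpow_one r]
    exact Real.rpow_le_rpow_of_exponent_le hr1.le ((div_le_one (by positivity)).2 (by linarith))
  have h2 : (A + 1) ^ (1 + ε) = (A + 1) * (A + 1) ^ ε := by rw [Real.rpow_add hb, Real.rpow_one]
  have h3 : (p + 1) ^ (1 + ε) = (p + 1) * (p + 1) ^ ε := by rw [Real.rpow_add ht, Real.rpow_one]
  have h4 : p ^ (1 + ε) ≤ p * (p + 1) ^ ε := by
    rcases hp.eq_or_lt with rfl | hp'
    · rw [Real.zero_rpow hε1]
      simp
    · rw [Real.rpow_add hp', Real.rpow_one]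
      gcongr
      linarith
  have hc : 0 < (A + 1) ^ ε * (p + 1) ^ ε := by positivity
  have h5 : r * ((A + 1) * (p + 1)) * ((A + 1) ^ ε * (p + 1) ^ ε) ≤
      (A * r + (A + 1) * p) * ((A + 1) ^ ε * (p + 1) ^ ε) := by
    calc _ = F := by rw [hF, hM, h2, h3]; ring
      _ ≤ A * (r * ((A + 1) ^ ε * (p + 1) ^ ε)) + (A + 1) ^ (1 + ε) * (p * (p + 1) ^ ε) := by
        refine h.trans (add_le_add (mul_le_mul_of_nonneg_left h1 hA) (mul_le_mul_of_nonneg_left h4 (by positivity)))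
      _ = _ := by rw [h2]; ring
  have h6 := le_of_mul_le_mul_right h5 hc
  have h7 : 0 ≤ (r - 1) * ((A + 1) * p) := mul_nonneg (by linarith) (mul_nonneg hb.le hp)
  nlinarith

/-- The covering number is at most of order `p ^ (1 + ε)`, where `p` is the packing number. -/
theorem exists_hitting {K : Type*} [Finite K] {H : SimpleGraph K} (hH : Conn H Set.univ) {N : ℕ}
    (hgr : MinorIn H gr {p | p.1 < N ∧ p.2 < N}) {ε : ℝ} (hε : 0 < ε) :
    ∃ C : ℝ, 0 < C ∧ ∀ (p : ℕ) {V : Type*} [Finite V] {G : SimpleGraph V}, ¬ HasDisjointModels H G (p + 1) →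
      ∃ X, ¬ MinorIn H G Xᶜ ∧ (X.ncard : ℝ) ≤ C * (p : ℝ) ^ (1 + ε) := by
  obtain ⟨s, q₀, hsq⟩ := exists_isolating hH hgr
  have : Nonempty K := hH.nonempty.to_type
  obtain ⟨A, hA, hpoly⟩ := exists_polylog_le (Nat.card K) s q₀ (δ := ε / (1 + ε)) (by positivity)
  refine ⟨(A + 1) ^ (1 + ε), by positivity, fun p => ?_⟩
  induction p with
  | zero =>
    intro V _ G hG
    refine ⟨∅, fun h => hG ?_, by simp; positivity⟩
    rw [Set.compl_empty] at h
    obtain ⟨B, hB⟩ := h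
    exact ⟨fun _ => B, fun _ => isMinorModel_iff.2 hB, fun i j h => absurd (Subsingleton.elim (α := Fin 1) i j) h⟩
  | succ p ih =>
    intro V _ G hG
    obtain ⟨X, hX, hmin⟩ := exists_min_hitting H G
    refine ⟨X, hX, ?_⟩
    push_cast
    rcases Nat.eq_zero_or_pos X.ncard with h0 | hpos
    · rw [h0]
      simp only [Nat.cast_zero]
      positivity
    have hm : MinorIn H G Set.univ := by
      by_contra h
      have := hmin ∅ (by rwa [Set.compl_empty])
      rw [Set.ncard_empty] at this
      omega
    obtain ⟨n, hn⟩ : ∃ n, n = Nat.card K * Nat.card K * (Nat.log 2 (2 * X.ncard) + 3) := ⟨_, rfl⟩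
    obtain ⟨S, hS, hiso⟩ := hsq (q₀ + s * (n + n * n)) n X.ncard hm hX le_rfl hn.ge (Nat.le_add_left ..) (Nat.le_add_right ..)
    obtain ⟨X', hX', hcard⟩ := ih (G := G.induce Sᶜ) fun h => hG (h.succ hiso)
    have h1 : ¬ MinorIn H G (S ∪ Subtype.val '' X')ᶜ := fun h => by
      refine hX' ((h.preimage_val (X := Sᶜ) fun x hx hxS => hx (Or.inl hxS)).mono fun x hx hxX => ?_)
      exact hx (Or.inr ⟨x, hxX, rfl⟩)
    have h2 := (hmin _ h1).trans ((Set.ncard_union_le _ _).trans (Nat.add_le_add hS (Set.ncard_image_le (Set.toFinite _))))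
    have h3 : (X.ncard : ℝ) ≤ (q₀ + s * (n + n * n) : ℕ) + X'.ncard := by exact_mod_cast h2
    refine le_of_le_add_rpow hε hA (Nat.cast_nonneg p) (h3.trans (add_le_add (hpoly _ n hpos hn) hcard))

/-- Let `H` be a connected planar graph, `ε > 0`, and
`g : ℕ → ℕ` with `g(n) = Ω(n^{1+ε})`. Then there is a constant `C > 0` such that
for every `k > 0` and every graph `G` with `tw(G) < g(k)` and `pack_H(G) < k`,
we have `cover_H(G) ≤ C·g(k)`. -/
theorem sep_to_cover {β : Type} [Fintype β] (H : SimpleGraph β)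
    (hconn : H.Connected)
    (hK5 : ¬ IsMinor (completeGraph (Fin 5)) H)
    (hK33 : ¬ IsMinor (completeBipartiteGraph (Fin 3) (Fin 3)) H)
    (ε : ℝ) (hε : 0 < ε) (g : ℕ → ℕ)
    (hg : ∃ c : ℝ, 0 < c ∧ ∃ N : ℕ, ∀ n : ℕ, N ≤ n → c * (n : ℝ) ^ (1 + ε) ≤ (g n : ℝ)) :
    ∃ C : ℝ, 0 < C ∧
      ∀ (k : ℕ), 0 < k →
        ∀ (α : Type) [Fintype α], ∀ (G : SimpleGraph α),
          treewidth G < g k → packNumber H G < k →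
            (coverNumber H G : ℝ) ≤ C * (g k : ℝ) := by
  obtain ⟨N, hgr⟩ := exists_grid_minor hconn hK5 hK33
  have hH : Conn H Set.univ := conn_iff.1 ((SimpleGraph.induceUnivIso H).connected_iff.2 hconn)
  have : Nonempty β := hconn.nonempty
  obtain ⟨C, hC, h⟩ := exists_hitting hH hgr hε
  obtain ⟨c, hc, N₀, hN⟩ := hg
  refine ⟨C * (1 / c + (N₀ : ℝ) ^ (1 + ε)), by positivity, fun k hk α _ G htw hpack => ?_⟩
  obtain ⟨p, rfl⟩ : ∃ p, k = p + 1 := ⟨k - 1, by omega⟩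
  obtain ⟨X, hX, hcard⟩ := h p (not_hasDisjointModels_of_packNumber_lt hpack)
  have h1 : (coverNumber H G : ℝ) ≤ X.ncard := by exact_mod_cast coverNumber_le hX
  have h2 : (p : ℝ) ^ (1 + ε) ≤ ((p + 1 : ℕ) : ℝ) ^ (1 + ε) :=
    Real.rpow_le_rpow (Nat.cast_nonneg _) (by push_cast; linarith) (by linarith)
  have hg1 : (1 : ℝ) ≤ g (p + 1) := by exact_mod_cast (by omega : 1 ≤ g (p + 1))
  have hN0 : 0 ≤ (N₀ : ℝ) ^ (1 + ε) := by positivity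
  have h3 : ((p + 1 : ℕ) : ℝ) ^ (1 + ε) ≤ (1 / c + (N₀ : ℝ) ^ (1 + ε)) * g (p + 1) := by
    rw [add_mul]
    obtain hle | hlt := le_total N₀ (p + 1)
    · have h4 : ((p + 1 : ℕ) : ℝ) ^ (1 + ε) ≤ 1 / c * g (p + 1) := by
        rw [one_div_mul_eq_div, le_div_iff₀ hc, mul_comm]
        exact hN _ hle
      have h5 : 0 ≤ (N₀ : ℝ) ^ (1 + ε) * g (p + 1) := by positivity
      linarith
    · have h4 : ((p + 1 : ℕ) : ℝ) ^ (1 + ε) ≤ (N₀ : ℝ) ^ (1 + ε) :=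
        Real.rpow_le_rpow (Nat.cast_nonneg _) (by exact_mod_cast hlt) (by linarith)
      have h5 : 0 ≤ 1 / c * (g (p + 1) : ℝ) := by positivity
      have h6 := le_mul_of_one_le_right hN0 hg1
      linarith
  calc (coverNumber H G : ℝ) ≤ C * (p : ℝ) ^ (1 + ε) := h1.trans hcard
    _ ≤ C * ((1 / c + (N₀ : ℝ) ^ (1 + ε)) * g (p + 1)) := mul_le_mul_of_nonneg_left (h2.trans h3) hC.le
    _ = C * (1 / c + (N₀ : ℝ) ^ (1 + ε)) * g (p + 1) := by ring
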